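/- (Zhang, bounded gaps between primes) There exists a constant C such that for every N there exist primes p and p' with N < p < p' and p' − p ≤ C; in other words, there are infinitely many pairs of consecutive primes at distance at most C. -/

import Mathlib

namespace BoundedGaps

/-! ### Antitone sums in residue classes -/

theorem sum_range_mul_eq (f : ℕ → ℝ) (q N : ℕ) :
    ∑ n ∈ Finset.range (q * N), f n = ∑ r ∈ Finset.range q, ∑ j ∈ Finset.range N, f (r + q * j) := by
  induction N with
  | zero => simp
  | succ N ih =>
    rw [Nat.mul_succ, Finset.sum_range_add, ih, ← Finset.sum_add_distrib]
    refine Finset.sum_congr rfl fun r _ => ?_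
    rw [Finset.sum_range_succ, add_comm r]

theorem sum_filter_modEq_eq (f : ℕ → ℝ) {q : ℕ} (N : ℕ) {r : ℕ} (hr : r < q) :
    ∑ n ∈ Finset.range (q * N) with n % q = r, f n = ∑ j ∈ Finset.range N, f (r + q * j) := by
  have hq : 0 < q := by omega
  rw [Finset.sum_filter, sum_range_mul_eq, Finset.sum_eq_single r]
  · refine Finset.sum_congr rfl fun j _ => ?_
    simp [Nat.mod_eq_of_lt hr]
  · intro b hb hbr
    refine Finset.sum_eq_zero fun j _ => ?_
    simp [Nat.mod_eq_of_lt (Finset.mem_range.1 hb), hbr]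
  · intro h; simp [hr] at h

/-- An antitone weight is equidistributed in residue classes up to its largest value. -/
theorem abs_sum_modEq_sub_le {f : ℕ → ℝ} (hf : Antitone f) (h0 : ∀ n, 0 ≤ f n) {N : ℕ}
    (hN : ∀ n, N ≤ n → f n = 0) {q : ℕ} (hq : 0 < q) (a : ℕ) :
    |∑ n ∈ Finset.range N with n ≡ a [MOD q], f n - (∑ n ∈ Finset.range N, f n) / q| ≤ f 0 := by
  set S : ℕ → ℝ := fun r => ∑ j ∈ Finset.range N, f (r + q * j) with hS
  have hSanti : Antitone S := fun r s hrs =>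
    Finset.sum_le_sum fun j _ => hf (by omega)
  have hS0 : S 0 ≤ f 0 + S q := by
    simp only [hS]
    have h1 : ∑ j ∈ Finset.range (N + 1), f (0 + q * j) = f 0 + ∑ j ∈ Finset.range N, f (q + q * j) := by
      rw [Finset.sum_range_succ', add_comm]
      simp [Nat.mul_succ, add_comm]
    rw [← h1, Finset.sum_range_succ]
    have := h0 (0 + q * N)
    linarith
  have hext : ∀ (P : ℕ → Prop) [DecidablePred P],
      ∑ n ∈ Finset.range N with P n, f n = ∑ n ∈ Finset.range (q * N) with P n, f n := by
    intro P _
    rw [Finset.sum_filter, Finset.sum_filter]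
    refine Finset.sum_subset (Finset.range_mono (Nat.le_mul_of_pos_left N hq)) fun n _ hn => ?_
    simp [hN n (by simpa using hn)]
  have htot : ∑ n ∈ Finset.range N, f n = ∑ r ∈ Finset.range q, S r := by
    have := hext (fun _ => True)
    simp only [Finset.filter_true] at this
    rw [this, sum_range_mul_eq]
  have hcl : ∑ n ∈ Finset.range N with n ≡ a [MOD q], f n = S (a % q) := by
    rw [hext]
    exact sum_filter_modEq_eq f N (Nat.mod_lt a hq)
  have hqr : (0 : ℝ) < q := by exact_mod_cast hq
  have ha := Nat.mod_lt a hq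
  have hup : (∑ r ∈ Finset.range q, S r) ≤ q * S 0 := by
    have := Finset.sum_le_card_nsmul (Finset.range q) S (S 0) fun r _ => hSanti (Nat.zero_le r)
    simpa using this
  have hlo : q * S q ≤ ∑ r ∈ Finset.range q, S r := by
    have := Finset.card_nsmul_le_sum (Finset.range q) S (S q)
      fun r hr => hSanti (Finset.mem_range.1 hr).le
    simpa using this
  rw [htot, hcl, abs_le]
  have h1 := hSanti (Nat.zero_le (a % q))
  have h2 := hSanti ha.le
  have h3 : (∑ r ∈ Finset.range q, S r) / q ≤ S 0 := by rw [div_le_iff₀ hqr]; linarith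
  have h4 : S q ≤ (∑ r ∈ Finset.range q, S r) / q := by rw [le_div_iff₀ hqr]; linarith
  constructor <;> linarith

/-! ### The log-Gaussian weight -/

/-- The weight `exp (-(log n)² / (2 * L))`. -/
noncomputable def om (L : ℝ) (n : ℕ) : ℝ := Real.exp (-(Real.log n) ^ 2 / (2 * L))

theorem om_pos (L : ℝ) (n : ℕ) : 0 < om L n := Real.exp_pos _

theorem om_zero (L : ℝ) : om L 0 = 1 := by simp [om]

theorem log_natCast_mono {m n : ℕ} (h : m ≤ n) : Real.log m ≤ Real.log n := by
  rcases Nat.eq_zero_or_pos m with rfl | hm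
  · simpa using Real.log_natCast_nonneg n
  · exact Real.log_le_log (by exact_mod_cast hm) (by exact_mod_cast h)

theorem om_antitone {L : ℝ} (hL : 0 < L) : Antitone (om L) := by
  intro m n h
  unfold om
  have h1 := log_natCast_mono h
  have h2 := Real.log_natCast_nonneg m
  gcongr

theorem om_le_one {L : ℝ} (hL : 0 < L) (n : ℕ) : om L n ≤ 1 :=
  (om_antitone hL (Nat.zero_le n)).trans_eq (om_zero L)

theorem om_le_rpow {L : ℝ} (hL : 0 < L) (a : ℝ) {n : ℕ} (hn : 0 < n) :
    om L n ≤ Real.exp (L * a ^ 2 / 2) * (n : ℝ) ^ (-a) := by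
  have hn' : (0 : ℝ) < n := by exact_mod_cast hn
  rw [om, Real.rpow_def_of_pos hn', ← Real.exp_add]
  refine Real.exp_le_exp.2 ?_
  have : L * a ^ 2 / 2 + Real.log n * -a - -(Real.log n) ^ 2 / (2 * L)
      = (L * a - Real.log n) ^ 2 / (2 * L) := by
    field_simp; ring
  have h2 : 0 ≤ (L * a - Real.log n) ^ 2 / (2 * L) := by positivity
  linarith

/-! ### Bounds for Dirichlet L-functions near `s = 1` -/

theorem norm_ofReal_cpow_neg_sub_le {a b : ℝ} (ha : 0 < a) (hab : a ≤ b) {s : ℂ} (hs : 0 < s.re) :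
    ‖(b : ℂ) ^ (-s) - (a : ℂ) ^ (-s)‖ ≤ ‖s‖ * a ^ (-s.re - 1) * (b - a) := by
  have hs0 : s ≠ 0 := by rintro rfl; simp at hs
  have hd : ∀ x ∈ Set.Icc a b, HasDerivWithinAt (fun x : ℝ => (x : ℂ) ^ (-s))
      (-s * (x : ℂ) ^ (-s - 1)) (Set.Icc a b) x := by
    intro x hx
    have hx0 : 0 < x := ha.trans_le hx.1
    exact (hasDerivAt_ofReal_cpow_const hx0.ne' (neg_ne_zero.2 hs0)).hasDerivWithinAt
  refine norm_image_sub_le_of_norm_deriv_le_segment' hd (fun x hx => ?_) b (Set.right_mem_Icc.2 hab)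
  have hx0 : 0 < x := ha.trans_le hx.1
  rw [norm_mul, norm_neg, Complex.norm_cpow_eq_rpow_re_of_pos hx0]
  simp only [Complex.sub_re, Complex.neg_re, Complex.one_re]
  refine mul_le_mul_of_nonneg_left ?_ (norm_nonneg _)
  exact Real.rpow_le_rpow_of_nonpos ha hx.1 (by linarith)

/-- The contribution of `n ∈ [jq, (j+1)q)` to the Dirichlet series of `χ`. -/
noncomputable def blockSum {q : ℕ} (χ : DirichletCharacter ℂ q) (j : ℕ) (s : ℂ) : ℂ :=
  ∑ r ∈ Finset.range q, χ r * ((j * q + r : ℕ) : ℂ) ^ (-s)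

theorem sum_range_char_eq_zero {q : ℕ} [NeZero q] {χ : DirichletCharacter ℂ q} (hχ : χ ≠ 1) :
    ∑ r ∈ Finset.range q, χ (r : ZMod q) = 0 := by
  have h := MulChar.sum_eq_zero_of_ne_one hχ
  rw [← h]
  refine Finset.sum_bij (fun r _ => (r : ZMod q)) (fun _ _ => Finset.mem_univ _) ?_ ?_ fun _ _ => rfl
  · intro a ha b hb hab
    rw [ZMod.natCast_eq_natCast_iff] at hab
    exact Nat.ModEq.eq_of_lt_of_lt hab (Finset.mem_range.1 ha) (Finset.mem_range.1 hb)
  · intro b _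
    exact ⟨b.val, Finset.mem_range.2 (ZMod.val_lt b), ZMod.natCast_zmod_val b⟩

theorem norm_blockSum_le {q : ℕ} [NeZero q] {χ : DirichletCharacter ℂ q} (hχ : χ ≠ 1) {j : ℕ}
    (hj : 0 < j) {s : ℂ} (hs : 0 < s.re) :
    ‖blockSum χ j s‖ ≤ (q : ℝ) ^ 2 * ‖s‖ * ((j * q : ℕ) : ℝ) ^ (-s.re - 1) := by
  have hq : 0 < q := Nat.pos_of_ne_zero (NeZero.ne q)
  have hjq : (0 : ℝ) < ((j * q : ℕ) : ℝ) := by exact_mod_cast Nat.mul_pos hj hq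
  have h : blockSum χ j s = ∑ r ∈ Finset.range q,
      χ r * (((j * q + r : ℕ) : ℂ) ^ (-s) - ((j * q : ℕ) : ℂ) ^ (-s)) := by
    simp only [mul_sub, Finset.sum_sub_distrib, ← Finset.sum_mul, sum_range_char_eq_zero hχ,
      zero_mul, sub_zero, blockSum]
  rw [h]
  refine (norm_sum_le _ _).trans ?_
  have : ∀ r ∈ Finset.range q,
      ‖χ r * (((j * q + r : ℕ) : ℂ) ^ (-s) - ((j * q : ℕ) : ℂ) ^ (-s))‖
        ≤ q * ‖s‖ * ((j * q : ℕ) : ℝ) ^ (-s.re - 1) := by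
    intro r hr
    rw [norm_mul]
    have h1 := norm_ofReal_cpow_neg_sub_le (b := ((j * q + r : ℕ) : ℝ)) hjq
      (by exact_mod_cast Nat.le_add_right _ _) hs
    have h2 := χ.norm_le_one r
    have h3 : ((j * q + r : ℕ) : ℝ) - ((j * q : ℕ) : ℝ) ≤ q := by
      push_cast
      have : (r : ℝ) ≤ q := by exact_mod_cast (Finset.mem_range.1 hr).le
      linarith
    simp only [Complex.ofReal_natCast] at h1
    calc _ ≤ 1 * (‖s‖ * ((j * q : ℕ) : ℝ) ^ (-s.re - 1) * q) := by
          gcongr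
          exact h1.trans (by gcongr)
      _ = _ := by ring
  refine (Finset.sum_le_card_nsmul _ _ _ this).trans_eq ?_
  simp; ring

theorem sum_blockSum {q : ℕ} (χ : DirichletCharacter ℂ q) (J : ℕ) (s : ℂ) :
    ∑ j ∈ Finset.range J, blockSum χ j s = ∑ n ∈ Finset.range (q * J), χ n * (n : ℂ) ^ (-s) := by
  induction J with
  | zero => simp
  | succ J ih =>
    rw [Finset.sum_range_succ, ih, Nat.mul_succ, Finset.sum_range_add, blockSum]
    congr 1
    refine Finset.sum_congr rfl fun r _ => ?_
    simp [mul_comm q J]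

theorem summable_blockSum {q : ℕ} [NeZero q] {χ : DirichletCharacter ℂ q} (hχ : χ ≠ 1)
    {s : ℂ} (hs : 0 < s.re) : Summable fun j => blockSum χ (j + 1) s := by
  have hq : 0 < q := Nat.pos_of_ne_zero (NeZero.ne q)
  have h1 : Summable fun j : ℕ => ((j + 1 : ℕ) : ℝ) ^ (-s.re - 1) :=
    (summable_nat_add_iff 1).2 (Real.summable_nat_rpow.2 (by linarith : -s.re - 1 < -1))
  refine Summable.of_norm_bounded
    (h1.mul_left ((q : ℝ) ^ 2 * ‖s‖ * (q : ℝ) ^ (-s.re - 1))) fun j => ?_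
  refine (norm_blockSum_le hχ j.succ_pos hs).trans_eq ?_
  rw [Nat.cast_mul, Real.mul_rpow (by positivity) (by positivity)]
  ring

theorem LFunction_eq_tsum_blockSum_of_one_lt_re {q : ℕ} [NeZero q] {χ : DirichletCharacter ℂ q}
    (hχ : χ ≠ 1) {s : ℂ} (hs : 1 < s.re) :
    χ.LFunction s = blockSum χ 0 s + ∑' j, blockSum χ (j + 1) s := by
  have hq : 0 < q := Nat.pos_of_ne_zero (NeZero.ne q)
  have hsum := DirichletCharacter.LSeriesSummable_of_one_lt_re χ hs
  have hs0 : s ≠ 0 := by rintro rfl; simp at hs; linarith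
  rw [DirichletCharacter.LFunction_eq_LSeries χ hs]
  have h1 := hsum.LSeriesHasSum.tendsto_sum_nat
  have h2 : Filter.Tendsto (fun J : ℕ => q * J) Filter.atTop Filter.atTop :=
    Filter.tendsto_id.const_mul_atTop' hq
  have h3 := h1.comp h2
  have h4 := ((summable_blockSum hχ (by linarith : 0 < s.re)).hasSum.tendsto_sum_nat).const_add
    (blockSum χ 0 s)
  refine tendsto_nhds_unique (h3.comp (Filter.tendsto_add_atTop_nat 1)) (h4.congr fun J => ?_)
  have h5 := sum_blockSum χ (J + 1) s
  rw [Finset.sum_range_succ', add_comm] at h5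
  rw [h5]
  refine Finset.sum_congr rfl fun n _ => ?_
  rw [LSeries.term_def]
  split_ifs with h
  · subst h; simp [hs0]
  · rw [Complex.cpow_neg, div_eq_mul_inv]

theorem LFunction_eq_tsum_blockSum {q : ℕ} [NeZero q] {χ : DirichletCharacter ℂ q}
    (hχ : χ ≠ 1) {s : ℂ} (hs : 0 < s.re) :
    χ.LFunction s = blockSum χ 0 s + ∑' j, blockSum χ (j + 1) s := by
  have hq : 0 < q := Nat.pos_of_ne_zero (NeZero.ne q)
  have hq1 : q ≠ 1 := by
    rintro rfl
    exact hχ (DirichletCharacter.level_one χ)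
  set U : Set ℂ := {z | 0 < z.re} with hU
  have hUo : IsOpen U := isOpen_lt continuous_const Complex.continuous_re
  have hUc : Convex ℝ U := convex_halfSpace_re_gt 0
  have hblock : ∀ j, Differentiable ℂ (blockSum χ j) ∨ j = 0 := by
    intro j
    rcases Nat.eq_zero_or_pos j with h | h
    · exact Or.inr h
    left
    unfold blockSum
    refine Differentiable.fun_sum fun r _ => ?_
    refine Differentiable.const_mul (fun z => ?_) _
    refine DifferentiableAt.const_cpow differentiableAt_id.neg (Or.inl ?_)
    have : 0 < j * q := Nat.mul_pos h hq
    exact_mod_cast (by omega : j * q + r ≠ 0)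
  have hblock0 : DifferentiableOn ℂ (blockSum χ 0) U := by
    unfold blockSum
    refine DifferentiableOn.fun_sum fun r _ => ?_
    refine DifferentiableOn.const_mul (fun z hz => ?_) _
    refine (DifferentiableAt.const_cpow differentiableAt_id.neg (Or.inr ?_)).differentiableWithinAt
    intro h
    have hz0 : z = 0 := by simpa using h
    simp [hU, hz0] at hz
  have htsum : DifferentiableOn ℂ (fun z => ∑' j, blockSum χ (j + 1) z) U := by
    intro z hz
    set δ := z.re / 2
    have hδ : 0 < δ := half_pos hz
    set V : Set ℂ := {w | δ < w.re} ∩ Metric.ball 0 (‖z‖ + 1)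
    have hVo : IsOpen V := (isOpen_lt continuous_const Complex.continuous_re).inter Metric.isOpen_ball
    have hzV : z ∈ V := ⟨half_lt_self (show 0 < z.re from hz), by simp⟩
    have h1 : Summable fun j : ℕ => ((j + 1 : ℕ) : ℝ) ^ (-δ - 1) :=
      (summable_nat_add_iff 1).2 (Real.summable_nat_rpow.2 (by linarith : -δ - 1 < -1))
    have := Complex.differentiableOn_tsum_of_summable_norm
      (h1.mul_left ((q : ℝ) ^ 2 * (‖z‖ + 1))) (F := fun j w => blockSum χ (j + 1) w) (U := V)
      (fun j => ((hblock (j + 1)).resolve_right (by omega)).differentiableOn) hVo ?_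
    · exact (this.differentiableAt (hVo.mem_nhds hzV)).differentiableWithinAt
    intro j w hw
    have hw1 : δ < w.re := hw.1
    have hw2 : ‖w‖ < ‖z‖ + 1 := by simpa using hw.2
    refine (norm_blockSum_le hχ j.succ_pos (hδ.trans hw1)).trans ?_
    have h3 : (((j + 1) * q : ℕ) : ℝ) ^ (-w.re - 1) ≤ ((j + 1 : ℕ) : ℝ) ^ (-δ - 1) := by
      calc (((j + 1) * q : ℕ) : ℝ) ^ (-w.re - 1) ≤ ((j + 1 : ℕ) : ℝ) ^ (-w.re - 1) := by
            refine Real.rpow_le_rpow_of_nonpos (by positivity) ?_ (by linarith)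
            exact_mod_cast Nat.le_mul_of_pos_right _ hq
        _ ≤ _ := Real.rpow_le_rpow_of_exponent_le (by push_cast; linarith [j.cast_nonneg (α := ℝ)])
            (by linarith)
    gcongr
  have hL : DifferentiableOn ℂ χ.LFunction U :=
    (DirichletCharacter.differentiable_LFunction hχ).differentiableOn
  have key := (hL.analyticOnNhd hUo).eqOn_of_preconnected_of_eventuallyEq
    ((hblock0.add htsum).analyticOnNhd hUo) hUc.isPreconnected (z₀ := 2) (by simp [hU]) ?_
  · exact key hs
  · have hV : {z : ℂ | 1 < z.re} ∈ nhds (2 : ℂ) :=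
      (isOpen_lt continuous_const Complex.continuous_re).mem_nhds (by simp)
    filter_upwards [hV] with w hw
    exact LFunction_eq_tsum_blockSum_of_one_lt_re hχ hw

theorem sum_range_inv_le (N : ℕ) : ∑ n ∈ Finset.range N, (n : ℝ)⁻¹ ≤ 1 + Real.log N := by
  have h := harmonic_le_one_add_log N
  refine le_trans ?_ h
  have h1 : ((harmonic N : ℚ) : ℝ) = ∑ n ∈ Finset.range (N + 1), (n : ℝ)⁻¹ := by
    rw [Finset.sum_range_succ', harmonic]
    push_cast
    simp
  rw [h1, Finset.sum_range_succ]
  have : (0 : ℝ) ≤ (N : ℝ)⁻¹ := by positivity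
  linarith

theorem norm_blockSum_zero_le {q : ℕ} [NeZero q] (χ : DirichletCharacter ℂ q) {l : ℝ}
    (hl : 1 ≤ l) (hq : Real.log q ≤ l) {s : ℂ} (hs : ‖s - 1‖ ≤ 1 / (2 * l)) :
    ‖blockSum χ 0 s‖ ≤ 2 * Real.exp 1 * l := by
  have hre : |s.re - 1| ≤ 1 / (2 * l) := by
    have := Complex.abs_re_le_norm (s - 1)
    simp only [Complex.sub_re, Complex.one_re] at this
    exact this.trans hs
  have hlo := (abs_le.1 hre).1
  have h2l : 1 / (2 * l) ≤ 1 / 2 := by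
    apply one_div_le_one_div_of_le <;> linarith
  have hs0 : s ≠ 0 := by
    rintro rfl
    norm_num at hre
    norm_num at h2l
    linarith
  have hterm : ∀ r ∈ Finset.range q, ‖χ r * ((0 * q + r : ℕ) : ℂ) ^ (-s)‖ ≤ Real.exp 1 * (r : ℝ)⁻¹ := by
    intro r hr
    rcases Nat.eq_zero_or_pos r with rfl | hr0
    · simp [hs0]
    have hr0' : (0 : ℝ) < r := by exact_mod_cast hr0
    rw [norm_mul, zero_mul, zero_add, Complex.norm_natCast_cpow_of_pos hr0]
    have h1 : (r : ℝ) ^ (-s).re = (r : ℝ) ^ (1 - s.re) * (r : ℝ)⁻¹ := by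
      rw [← Real.rpow_neg_one, ← Real.rpow_add hr0']
      congr 1; rw [Complex.neg_re]; ring
    have h2 : (r : ℝ) ^ (1 - s.re) ≤ Real.exp 1 := by
      rw [Real.rpow_def_of_pos hr0']
      apply Real.exp_le_exp.2
      have h3 : Real.log r ≤ l := (log_natCast_mono (Finset.mem_range.1 hr).le).trans hq
      have h4 : 0 ≤ Real.log r := Real.log_natCast_nonneg r
      calc Real.log r * (1 - s.re) ≤ Real.log r * (1 / (2 * l)) := by gcongr; linarith
        _ ≤ l * (1 / (2 * l)) := by gcongr
        _ ≤ 1 := by field_simp; norm_num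
    rw [h1]
    calc _ ≤ 1 * (Real.exp 1 * (r : ℝ)⁻¹) := by
          gcongr
          exact χ.norm_le_one r
      _ = _ := one_mul _
  refine (norm_sum_le_of_le _ hterm).trans ?_
  rw [← Finset.mul_sum]
  have := sum_range_inv_le q
  have he := Real.exp_pos 1
  nlinarith

theorem exists_norm_LFunction_le : ∃ C : ℝ, 1 ≤ C ∧ ∀ (q : ℕ) [NeZero q]
    (χ : DirichletCharacter ℂ q), χ ≠ 1 → ∀ l : ℝ, 1 ≤ l → Real.log q ≤ l → ∀ s : ℂ,
      ‖s - 1‖ ≤ 1 / (2 * l) → ‖χ.LFunction s‖ ≤ C * l := by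
  have hZ : Summable fun j : ℕ => ((j + 1 : ℕ) : ℝ) ^ (-3 / 2 : ℝ) :=
    (summable_nat_add_iff 1).2 (Real.summable_nat_rpow.2 (by norm_num))
  set Z := ∑' j : ℕ, ((j + 1 : ℕ) : ℝ) ^ (-3 / 2 : ℝ) with hZdef
  have hZ0 : 0 ≤ Z := tsum_nonneg fun j => by positivity
  refine ⟨2 * Real.exp 1 + Real.exp 1 * 2 * Z, ?_, ?_⟩
  · have := Real.add_one_le_exp 1
    have : 0 ≤ Real.exp 1 * 2 * Z := by positivity
    linarith
  intro q _ χ hχ l hl hql s hs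
  have hq : 0 < q := Nat.pos_of_ne_zero (NeZero.ne q)
  have hqr : (0 : ℝ) < q := by exact_mod_cast hq
  have hre : |s.re - 1| ≤ 1 / (2 * l) := by
    have := Complex.abs_re_le_norm (s - 1)
    simp only [Complex.sub_re, Complex.one_re] at this
    exact this.trans hs
  have hlo := (abs_le.1 hre).1
  have h2l : 1 / (2 * l) ≤ 1 / 2 := by
    apply one_div_le_one_div_of_le <;> linarith
  have hs0 : 0 < s.re := by linarith
  have hns : ‖s‖ ≤ 2 := by
    calc ‖s‖ = ‖(s - 1) + 1‖ := by ring_nf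
      _ ≤ ‖s - 1‖ + ‖(1 : ℂ)‖ := norm_add_le _ _
      _ ≤ 2 := by simp; linarith
  rw [LFunction_eq_tsum_blockSum hχ hs0]
  have hb : ∀ j : ℕ, ‖blockSum χ (j + 1) s‖ ≤ Real.exp 1 * 2 * ((j + 1 : ℕ) : ℝ) ^ (-3 / 2 : ℝ) := by
    intro j
    refine (norm_blockSum_le hχ j.succ_pos hs0).trans ?_
    rw [Nat.cast_mul, Real.mul_rpow (by positivity) (by positivity)]
    have h1 : (q : ℝ) ^ 2 * (q : ℝ) ^ (-s.re - 1) ≤ Real.exp 1 := by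
      rw [← Real.rpow_natCast, ← Real.rpow_add hqr, Real.rpow_def_of_pos hqr]
      apply Real.exp_le_exp.2
      have h4 : 0 ≤ Real.log q := Real.log_natCast_nonneg q
      push_cast
      calc Real.log q * (2 + (-s.re - 1)) ≤ Real.log q * (1 / (2 * l)) := by gcongr; linarith
        _ ≤ l * (1 / (2 * l)) := by gcongr
        _ ≤ 1 := by field_simp; norm_num
    have h2 : ((j + 1 : ℕ) : ℝ) ^ (-s.re - 1) ≤ ((j + 1 : ℕ) : ℝ) ^ (-3 / 2 : ℝ) :=
      Real.rpow_le_rpow_of_exponent_le (by push_cast; linarith [j.cast_nonneg (α := ℝ)])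
        (by linarith)
    calc _ = ((q : ℝ) ^ 2 * (q : ℝ) ^ (-s.re - 1)) * ‖s‖ * ((j + 1 : ℕ) : ℝ) ^ (-s.re - 1) := by
          ring
      _ ≤ _ := by gcongr
  have htail : ‖∑' j, blockSum χ (j + 1) s‖ ≤ Real.exp 1 * 2 * Z :=
    tsum_of_norm_bounded (hZ.hasSum.mul_left _) hb
  refine (norm_add_le _ _).trans ?_
  have h5 := norm_blockSum_zero_le χ hl hql hs
  have : 0 ≤ Real.exp 1 * 2 * Z := by positivity
  nlinarith

theorem exists_norm_deriv_LFunction_le : ∃ C : ℝ, 1 ≤ C ∧ ∀ (q : ℕ) [NeZero q]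
    (χ : DirichletCharacter ℂ q), χ ≠ 1 → ∀ l : ℝ, 1 ≤ l → Real.log q ≤ l → ∀ s : ℂ,
      ‖s - 1‖ ≤ 1 / (4 * l) →
        ‖χ.LFunction s‖ ≤ C * l ∧ ‖deriv χ.LFunction s‖ ≤ C * l ^ 2 := by
  obtain ⟨C, hC1, hC⟩ := exists_norm_LFunction_le
  refine ⟨4 * C, by linarith, fun q _ χ hχ l hl hql s hs => ?_⟩
  have h42 : 1 / (4 * l) + 1 / (4 * l) = 1 / (2 * l) := by field_simp; norm_num
  have hpos : 0 < 1 / (4 * l) := by positivity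
  constructor
  · refine (hC q χ hχ l hl hql s (by linarith)).trans ?_
    nlinarith
  · have := Complex.norm_deriv_le_of_forall_mem_sphere_norm_le (c := s) (R := 1 / (4 * l))
      (C := C * l) (f := χ.LFunction) hpos
      (DirichletCharacter.differentiable_LFunction hχ).diffContOnCl fun z hz => ?_
    · refine this.trans_eq ?_
      field_simp
    · refine hC q χ hχ l hl hql z ?_
      have hz' : ‖z - s‖ = 1 / (4 * l) := by simpa [dist_eq_norm] using hz
      calc ‖z - 1‖ = ‖(z - s) + (s - 1)‖ := by ring_nf
        _ ≤ ‖z - s‖ + ‖s - 1‖ := norm_add_le _ _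
        _ ≤ _ := by linarith

open Complex in
/-- The character `χ₁ χ̄₂` to the modulus `q₁ q₂`. -/
noncomputable def twist {q₁ q₂ : ℕ} (χ₁ : DirichletCharacter ℂ q₁) (χ₂ : DirichletCharacter ℂ q₂) :
    DirichletCharacter ℂ (q₁ * q₂) :=
  DirichletCharacter.changeLevel (Nat.dvd_mul_right q₁ q₂) χ₁ *
    (DirichletCharacter.changeLevel (Nat.dvd_mul_left q₂ q₁) χ₂)⁻¹

theorem inv_char_eq_conj {q : ℕ} [NeZero q] (χ : DirichletCharacter ℂ q) (a : ZMod q) :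
    χ⁻¹ a = (starRingEnd ℂ) (χ a) := by
  rw [MulChar.inv_apply_eq_inv']
  by_cases h : IsUnit a
  · exact Complex.inv_eq_conj (χ.unit_norm_eq_one h.unit)
  · simp [MulChar.map_nonunit χ h]

theorem changeLevel_apply_natCast {d q : ℕ} (h : d ∣ q) (χ : DirichletCharacter ℂ d) {n : ℕ}
    (hn : n.Coprime q) : DirichletCharacter.changeLevel h χ (n : ZMod q) = χ n := by
  have := DirichletCharacter.changeLevel_eq_cast_of_dvd' χ h (a := (n : ℤ))
    (Nat.isCoprime_iff_coprime.2 hn)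
  exact_mod_cast this

theorem char_apply_eq_zero {q n : ℕ} (χ : DirichletCharacter ℂ q) (h : ¬ n.Coprime q) :
    χ (n : ZMod q) = 0 :=
  MulChar.map_nonunit χ fun hu => h ((ZMod.isUnit_iff_coprime n q).1 hu)

theorem twist_apply {q₁ q₂ : ℕ} [NeZero q₁] [NeZero q₂] (χ₁ : DirichletCharacter ℂ q₁)
    (χ₂ : DirichletCharacter ℂ q₂) (n : ℕ) :
    twist χ₁ χ₂ (n : ZMod (q₁ * q₂)) = χ₁ n * (starRingEnd ℂ) (χ₂ n) := by
  have : NeZero (q₁ * q₂) := ⟨mul_ne_zero (NeZero.ne _) (NeZero.ne _)⟩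
  by_cases h : n.Coprime (q₁ * q₂)
  · rw [twist, MulChar.mul_apply, inv_char_eq_conj, changeLevel_apply_natCast _ _ h,
      changeLevel_apply_natCast _ _ h]
  · rw [char_apply_eq_zero _ h]
    rw [Nat.coprime_mul_iff_right, not_and_or] at h
    rcases h with h | h
    · rw [char_apply_eq_zero _ h, zero_mul]
    · rw [char_apply_eq_zero _ h, map_zero, mul_zero]

theorem twist_ne_one {q₁ q₂ : ℕ} [NeZero q₁] [NeZero q₂] {χ₁ : DirichletCharacter ℂ q₁}
    {χ₂ : DirichletCharacter ℂ q₂} (h₁ : χ₁.IsPrimitive) (h₂ : χ₂.IsPrimitive)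
    (hne : (⟨q₁, χ₁⟩ : Σ q, DirichletCharacter ℂ q) ≠ ⟨q₂, χ₂⟩) : twist χ₁ χ₂ ≠ 1 := by
  have : NeZero (q₁ * q₂) := ⟨mul_ne_zero (NeZero.ne _) (NeZero.ne _)⟩
  intro h
  rw [twist, mul_inv_eq_one] at h
  have hq : q₁ = q₂ := by
    have := congrArg DirichletCharacter.conductor h
    rwa [DirichletCharacter.conductor_changeLevel, DirichletCharacter.conductor_changeLevel,
      (DirichletCharacter.isPrimitive_def _).1 h₁,
      (DirichletCharacter.isPrimitive_def _).1 h₂] at this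
  subst hq
  exact hne (by rw [DirichletCharacter.changeLevel_injective _ h])

theorem re_add_re_nonneg {A B : ℂ} (hA : ‖A‖ ≤ 1) (hB : ‖B‖ ≤ 1) :
    0 ≤ 3 + 2 * A.re + 2 * B.re + 2 * (A * (starRingEnd ℂ) B).re := by
  have h1 : A.re ^ 2 + A.im ^ 2 ≤ 1 := by
    have := Complex.sq_norm A
    rw [Complex.normSq_apply] at this
    nlinarith [norm_nonneg A]
  have h2 : B.re ^ 2 + B.im ^ 2 ≤ 1 := by
    have := Complex.sq_norm B
    rw [Complex.normSq_apply] at this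
    nlinarith [norm_nonneg B]
  simp only [Complex.mul_re, Complex.conj_re, Complex.conj_im]
  nlinarith [sq_nonneg (1 + A.re + B.re), sq_nonneg (A.im + B.im)]

open Complex in
theorem re_log_triple_nonneg {x : ℝ} (hx₀ : 0 ≤ x) (hx₁ : x < 1) {a b : ℂ} (ha : ‖a‖ ≤ 1)
    (hb : ‖b‖ ≤ 1) :
    0 ≤ 3 * (-log (1 - x)).re + 2 * (-log (1 - a * x)).re + 2 * (-log (1 - b * x)).re
      + 2 * (-log (1 - a * (starRingEnd ℂ) b * x)).re := by
  have hn : ‖(x : ℂ)‖ < 1 := by simpa [abs_of_nonneg hx₀] using hx₁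
  have hmul : ∀ c : ℂ, ‖c‖ ≤ 1 → ‖c * x‖ < 1 := fun c hc => by
    rw [norm_mul]
    exact (mul_le_of_le_one_left (norm_nonneg _) hc).trans_lt hn
  have hab : ‖a * (starRingEnd ℂ) b‖ ≤ 1 := by
    rw [norm_mul, RCLike.norm_conj]
    exact mul_le_one₀ ha (norm_nonneg _) hb
  rw [← (((hasSum_re <| hasSum_taylorSeries_neg_log hn).mul_left 3).add
    ((hasSum_re <| hasSum_taylorSeries_neg_log (hmul a ha)).mul_left 2) |>.add
    ((hasSum_re <| hasSum_taylorSeries_neg_log (hmul b hb)).mul_left 2) |>.add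
    ((hasSum_re <| hasSum_taylorSeries_neg_log (hmul _ hab)).mul_left 2)).tsum_eq]
  refine tsum_nonneg fun n => ?_
  have h := re_add_re_nonneg (A := a ^ n) (B := b ^ n) (by rw [norm_pow]; exact pow_le_one₀ (norm_nonneg _) ha)
    (by rw [norm_pow]; exact pow_le_one₀ (norm_nonneg _) hb)
  have key : ∀ c : ℂ, ((c * x) ^ n / (n : ℂ)).re = c.re * 0 + (c ^ n).re * (x ^ n / n) := by
    intro c
    rw [mul_pow, div_natCast_re, ← ofReal_pow, re_mul_ofReal]
    ring
  have key1 : ((x : ℂ) ^ n / (n : ℂ)).re = x ^ n / n := by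
    rw [div_natCast_re, ← ofReal_pow, ofReal_re]
  rw [key, key, key, key1, mul_pow, ← map_pow]
  have h3 : 0 ≤ x ^ n / n := by positivity
  nlinarith [mul_nonneg h h3]

open Complex in
/-- A lower bound for a product of `L`-functions, from positivity of `|1 + χ₁ + χ₂|²`. -/
theorem one_le_norm_LFunction_product {q₁ q₂ : ℕ} [NeZero q₁] [NeZero q₂]
    (χ₁ : DirichletCharacter ℂ q₁) (χ₂ : DirichletCharacter ℂ q₂) {σ : ℝ} (hσ : 1 < σ) :
    1 ≤ ‖riemannZeta σ‖ ^ 3 * ‖χ₁.LFunction σ‖ ^ 2 * ‖χ₂.LFunction σ‖ ^ 2 *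
      ‖(haveI : NeZero (q₁ * q₂) := ⟨mul_ne_zero (NeZero.ne _) (NeZero.ne _)⟩;
        (twist χ₁ χ₂).LFunction σ)‖ ^ 2 := by
  have : NeZero (q₁ * q₂) := ⟨mul_ne_zero (NeZero.ne _) (NeZero.ne _)⟩
  have hs : 1 < (σ : ℂ).re := by simpa using hσ
  have hz : riemannZeta σ = (1 : DirichletCharacter ℂ 1).LFunction σ := by
    rw [DirichletCharacter.LFunction_modOne_eq]
  rw [hz]
  have H₀ := DirichletCharacter.summable_neg_log_one_sub_mul_prime_cpow
    (1 : DirichletCharacter ℂ 1) hs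
  have H₁ := DirichletCharacter.summable_neg_log_one_sub_mul_prime_cpow χ₁ hs
  have H₂ := DirichletCharacter.summable_neg_log_one_sub_mul_prime_cpow χ₂ hs
  have H₃ := DirichletCharacter.summable_neg_log_one_sub_mul_prime_cpow (twist χ₁ χ₂) hs
  have hsum₀ := (hasSum_re H₀.hasSum).summable.mul_left 3
  have hsum₁ := (hasSum_re H₁.hasSum).summable.mul_left 2
  have hsum₂ := (hasSum_re H₂.hasSum).summable.mul_left 2
  have hsum₃ := (hasSum_re H₃.hasSum).summable.mul_left 2
  have hE : ∀ {N : ℕ} [NeZero N] (χ : DirichletCharacter ℂ N), ‖χ.LFunction σ‖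
      = Real.exp (∑' p : Nat.Primes, -log (1 - χ p * (p : ℂ) ^ (-(σ : ℂ)))).re := by
    intro N _ χ
    rw [DirichletCharacter.LFunction_eq_LSeries χ hs,
      ← DirichletCharacter.LSeries_eulerProduct_exp_log χ hs, norm_exp]
  rw [hE, hE, hE, hE]
  simp only [← Real.exp_nat_mul, ← Real.exp_add, Real.one_le_exp_iff, Nat.cast_ofNat]
  rw [re_tsum H₀, re_tsum H₁, re_tsum H₂, re_tsum H₃, ← tsum_mul_left, ← tsum_mul_left,
    ← tsum_mul_left, ← tsum_mul_left, ← hsum₀.tsum_add hsum₁,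
    ← (hsum₀.add hsum₁).tsum_add hsum₂, ← ((hsum₀.add hsum₁).add hsum₂).tsum_add hsum₃]
  refine tsum_nonneg fun p => ?_
  have hp : 2 ≤ (p : ℕ) := p.prop.two_le
  have hx : ((p : ℕ) : ℂ) ^ (-(σ : ℂ)) = (((p : ℕ) : ℝ) ^ (-σ) : ℝ) := by
    rw [ofReal_cpow (Nat.cast_nonneg _)]; simp
  have hx1 : ((p : ℕ) : ℝ) ^ (-σ) < 1 :=
    Real.rpow_lt_one_of_one_lt_of_neg (by exact_mod_cast (by omega : 1 < (p : ℕ))) (by linarith)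
  have := re_log_triple_nonneg (by positivity) hx1 (χ₁.norm_le_one (p : ℕ)) (χ₂.norm_le_one (p : ℕ))
  rw [twist_apply, hx]
  have h1 : (1 : DirichletCharacter ℂ 1) ((p : ℕ) : ZMod 1) = 1 :=
    MulChar.one_apply (isUnit_of_subsingleton _)
  rw [h1, one_mul]
  exact this

theorem tsum_rpow_neg_le {δ : ℝ} (h0 : 0 < δ) (h1 : δ ≤ 1) :
    ∑' n : ℕ, (n : ℝ) ^ (-(1 + δ)) ≤ 2 / δ := by
  have hstep : ∀ n : ℕ, 0 < n → ((n + 1 : ℕ) : ℝ) ^ (-(1 + δ))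
      ≤ ((n : ℝ) ^ (-δ) - ((n + 1 : ℕ) : ℝ) ^ (-δ)) / δ := by
    intro n hn
    have hn' : (0 : ℝ) < n := by exact_mod_cast hn
    have hn1 : (0 : ℝ) < ((n + 1 : ℕ) : ℝ) := by positivity
    rw [le_div_iff₀ h0]
    have e1 : (n : ℝ) ^ (-δ) = ((n + 1 : ℕ) : ℝ) ^ (-δ) * (((n + 1 : ℕ) : ℝ) / n) ^ δ := by
      rw [Real.div_rpow hn1.le hn'.le, Real.rpow_neg hn'.le, Real.rpow_neg hn1.le]
      field_simp
    have e2 : ((n + 1 : ℕ) : ℝ) ^ (-(1 + δ)) = ((n + 1 : ℕ) : ℝ) ^ (-δ) * ((n + 1 : ℕ) : ℝ)⁻¹ := by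
      rw [← Real.rpow_neg_one, ← Real.rpow_add hn1]; ring_nf
    have e3 : 1 + δ * ((n + 1 : ℕ) : ℝ)⁻¹ ≤ (((n + 1 : ℕ) : ℝ) / n) ^ δ := by
      rw [Real.rpow_def_of_pos (by positivity)]
      have hl := Real.one_sub_inv_le_log_of_pos (show 0 < ((n + 1 : ℕ) : ℝ) / n by positivity)
      have hl2 : 1 - (((n + 1 : ℕ) : ℝ) / n)⁻¹ = ((n + 1 : ℕ) : ℝ)⁻¹ := by
        push_cast; field_simp; ring
      rw [hl2] at hl
      have := Real.add_one_le_exp (Real.log (((n + 1 : ℕ) : ℝ) / n) * δ)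
      nlinarith
    rw [e1, e2]
    have h5 : (0 : ℝ) < ((n + 1 : ℕ) : ℝ) ^ (-δ) := by positivity
    nlinarith
  have hpart : ∀ N : ℕ, ∑ n ∈ Finset.range (N + 2), (n : ℝ) ^ (-(1 + δ))
      ≤ 1 + (1 - ((N + 1 : ℕ) : ℝ) ^ (-δ)) / δ := by
    intro N
    induction N with
    | zero => simp [Finset.sum_range_succ, Real.zero_rpow (by linarith : -δ + -1 < 0).ne]
    | succ N ih =>
      rw [Finset.sum_range_succ]
      have := hstep (N + 1) N.succ_pos
      have e : 1 + (1 - ((N + 1 + 1 : ℕ) : ℝ) ^ (-δ)) / δ = 1 + (1 - ((N + 1 : ℕ) : ℝ) ^ (-δ)) / δ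
        + (((N + 1 : ℕ) : ℝ) ^ (-δ) - ((N + 1 + 1 : ℕ) : ℝ) ^ (-δ)) / δ := by ring
      rw [e]
      exact add_le_add ih this
  refine Real.tsum_le_of_sum_range_le (fun n => by positivity) fun n => ?_
  have hmono : ∑ i ∈ Finset.range n, (i : ℝ) ^ (-(1 + δ))
      ≤ ∑ i ∈ Finset.range (n + 2), (i : ℝ) ^ (-(1 + δ)) :=
    Finset.sum_le_sum_of_subset_of_nonneg (Finset.range_mono (by omega))
      fun i _ _ => by positivity
  refine hmono.trans ((hpart n).trans ?_)
  have h6 : (0 : ℝ) < ((n + 1 : ℕ) : ℝ) ^ (-δ) := by positivity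
  rw [le_div_iff₀ h0, add_mul, div_mul_cancel₀ _ h0.ne']
  linarith

theorem summable_rpow_neg {δ : ℝ} (h0 : 0 < δ) : Summable fun n : ℕ => (n : ℝ) ^ (-(1 + δ)) :=
  Real.summable_nat_rpow.2 (by linarith)

theorem norm_riemannZeta_le {δ : ℝ} (h0 : 0 < δ) (h1 : δ ≤ 1) :
    ‖riemannZeta ((1 + δ : ℝ) : ℂ)‖ ≤ 2 / δ := by
  rw [zeta_eq_tsum_one_div_nat_cpow (by simp [h0])]
  refine (tsum_of_norm_bounded (summable_rpow_neg h0).hasSum fun n => ?_).trans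
    (tsum_rpow_neg_le h0 h1)
  rw [norm_div, norm_one, Real.rpow_neg (Nat.cast_nonneg n), one_div]
  rcases Nat.eq_zero_or_pos n with rfl | hn
  · rw [Nat.cast_zero, Complex.zero_cpow, Nat.cast_zero, Real.zero_rpow (by linarith)]
    · simp
    · intro h
      have := congrArg Complex.re h
      simp at this; linarith
  · rw [Complex.norm_natCast_cpow_of_pos hn]
    simp

end BoundedGaps

namespace BoundedGaps

open Filter

/-- Two distinct primitive characters cannot both have very small values `L(1, χ)`. -/
theorem exists_repulsion : ∃ C : ℝ, 1 ≤ C ∧ ∀ (q₁ q₂ : ℕ) [NeZero q₁] [NeZero q₂]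
    (χ₁ : DirichletCharacter ℂ q₁) (χ₂ : DirichletCharacter ℂ q₂),
    χ₁.IsPrimitive → χ₂.IsPrimitive → χ₁ ≠ 1 → χ₂ ≠ 1 →
    (⟨q₁, χ₁⟩ : Σ q, DirichletCharacter ℂ q) ≠ ⟨q₂, χ₂⟩ →
    ∀ l ε : ℝ, 1 ≤ l → Real.log (q₁ * q₂ : ℕ) ≤ l → 0 < ε → ε ≤ 1 / (4 * l) →
      ‖χ₁.LFunction 1‖ ≤ ε → ‖χ₂.LFunction 1‖ ≤ ε → 1 ≤ C * l ^ 10 * ε := by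
  obtain ⟨C, hC1, hC⟩ := exists_norm_deriv_LFunction_le
  refine ⟨128 * C ^ 6, by nlinarith [one_le_pow₀ hC1 (n := 6)], ?_⟩
  intro q₁ q₂ _ _ χ₁ χ₂ hp₁ hp₂ hχ₁ hχ₂ hne l ε hl hq hε hεl hL₁ hL₂
  have : NeZero (q₁ * q₂) := ⟨mul_ne_zero (NeZero.ne _) (NeZero.ne _)⟩
  have hσn : ‖(((1 + ε : ℝ) : ℂ)) - 1‖ ≤ 1 / (4 * l) := by
    push_cast
    simpa [abs_of_pos hε] using hεl
  have hε1 : ε ≤ 1 := hεl.trans (by rw [div_le_one (by positivity)]; linarith)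
  have hLσ : ∀ (q : ℕ) [NeZero q] (χ : DirichletCharacter ℂ q), χ ≠ 1 → Real.log q ≤ l →
      ‖χ.LFunction 1‖ ≤ ε → ‖χ.LFunction ((1 + ε : ℝ) : ℂ)‖ ≤ 2 * C * l ^ 2 * ε := by
    intro q _ χ hχ hql hL
    have h := (convex_closedBall (1 : ℂ) (1 / (4 * l))).norm_image_sub_le_of_norm_deriv_le
      (f := χ.LFunction) (C := C * l ^ 2) (x := 1) (y := ((1 + ε : ℝ) : ℂ))
      (fun z _ => (DirichletCharacter.differentiable_LFunction hχ).differentiableAt)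
      (fun z hz => (hC q χ hχ l hl hql z (by simpa [dist_eq_norm] using hz)).2)
      (by simp; linarith) (by simpa [dist_eq_norm] using hσn)
    have h2 : ‖(((1 + ε : ℝ) : ℂ)) - 1‖ = ε := by
      push_cast; simp [abs_of_pos hε]
    rw [h2] at h
    have h3 := norm_add_le (χ.LFunction ((1 + ε : ℝ) : ℂ) - χ.LFunction 1) (χ.LFunction 1)
    rw [sub_add_cancel] at h3
    have h4 : 1 ≤ C * l ^ 2 := by nlinarith [one_le_pow₀ hl (n := 2)]
    nlinarith
  have hq₁ : Real.log q₁ ≤ l := (log_natCast_mono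
    (Nat.le_mul_of_pos_right _ (Nat.pos_of_ne_zero (NeZero.ne q₂)))).trans hq
  have hq₂ : Real.log q₂ ≤ l := (log_natCast_mono
    (Nat.le_mul_of_pos_left _ (Nat.pos_of_ne_zero (NeZero.ne q₁)))).trans hq
  have h1 := one_le_norm_LFunction_product χ₁ χ₂ (show 1 < 1 + ε by linarith)
  have h2 := norm_riemannZeta_le hε hε1
  have h3 := hLσ q₁ χ₁ hχ₁ hq₁ hL₁
  have h4 := hLσ q₂ χ₂ hχ₂ hq₂ hL₂
  have h5 := (hC (q₁ * q₂) (twist χ₁ χ₂) (twist_ne_one hp₁ hp₂ hne) l hl hq _ hσn).1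
  calc 1 ≤ _ := h1
    _ ≤ (2 / ε) ^ 3 * (2 * C * l ^ 2 * ε) ^ 2 * (2 * C * l ^ 2 * ε) ^ 2 * (C * l) ^ 2 := by
        gcongr
    _ = 128 * C ^ 6 * l ^ 10 * ε := by
        field_simp; ring

/-- `L` is a scale at which no primitive character of conductor at most `L ^ B` has an
exceptionally small value `L(1, χ)`. -/
def GoodScale (B L : ℝ) : Prop := ∀ (q : ℕ) [NeZero q] (χ : DirichletCharacter ℂ q),
  χ.IsPrimitive → χ ≠ 1 → (q : ℝ) ≤ L ^ B → L ^ (-(1 / 5 : ℝ)) ≤ ‖χ.LFunction 1‖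

theorem exists_goodScale {B : ℝ} (hB : 1 ≤ B) (L₀ : ℝ) : ∃ L, L₀ ≤ L ∧ GoodScale B L := by
  obtain ⟨C, hC1, hC⟩ := exists_repulsion
  have hlim : ∀ᶠ L : ℝ in atTop, L₀ ≤ L ∧ Real.exp 1 ≤ L ∧
      L ^ (-(1 / 5 : ℝ)) ≤ 1 / (4 * (2 * B * Real.log L)) ∧
      C * (2 * B * Real.log L) ^ 10 * L ^ (-(1 / 5 : ℝ)) < 1 := by
    have h1 : Tendsto (fun L : ℝ => C * (2 * B) ^ 10 * (Real.log L ^ (10 : ℝ) / L ^ (1 / 5 : ℝ)))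
        atTop (nhds (C * (2 * B) ^ 10 * 0)) :=
      ((isLittleO_log_rpow_rpow_atTop 10 (by norm_num : (0 : ℝ) < 1 / 5)).tendsto_div_nhds_zero).const_mul _
    have h2 : Tendsto (fun L : ℝ => 8 * B * (Real.log L ^ (1 : ℝ) / L ^ (1 / 5 : ℝ)))
        atTop (nhds (8 * B * 0)) :=
      ((isLittleO_log_rpow_rpow_atTop 1 (by norm_num : (0 : ℝ) < 1 / 5)).tendsto_div_nhds_zero).const_mul _
    rw [mul_zero] at h1 h2
    filter_upwards [h1.eventually_lt_const one_pos, h2.eventually_lt_const one_pos,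
      eventually_ge_atTop L₀, eventually_ge_atTop (Real.exp 1)] with L a1 a2 a3 a4
    have hL : 0 < L := (Real.exp_pos 1).trans_le a4
    have hlog : 1 ≤ Real.log L := by rwa [Real.le_log_iff_exp_le hL]
    refine ⟨a3, a4, ?_, ?_⟩
    · rw [Real.rpow_neg hL.le, ← one_div]
      apply one_div_le_one_div_of_le (by positivity)
      rw [Real.rpow_one, ← mul_div_assoc, div_lt_one (by positivity)] at a2
      linarith
    · rw [Real.rpow_neg hL.le]
      have : Real.log L ^ (10 : ℝ) = Real.log L ^ (10 : ℕ) := by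
        rw [← Real.rpow_natCast]; norm_num
      rw [this] at a1
      calc _ = C * (2 * B) ^ 10 * (Real.log L ^ 10 / L ^ (1 / 5 : ℝ)) := by
            rw [div_eq_mul_inv]; ring
        _ < 1 := a1
  obtain ⟨L₁, hL₁⟩ := eventually_atTop.1 hlim
  set M := max L₁ (Real.exp 1) with hM
  by_cases hg : GoodScale B M
  · exact ⟨M, (hL₁ M (le_max_left _ _)).1, hg⟩
  unfold GoodScale at hg
  push Not at hg
  obtain ⟨q₁, _, χ₁, hp₁, hχ₁, hq₁, hsmall⟩ := hg
  have hM0 : 0 < M := (Real.exp_pos 1).trans_le (le_max_right _ _)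
  set η := ‖χ₁.LFunction 1‖ with hη
  have hη0 : 0 < η := norm_pos_iff.2 (DirichletCharacter.LFunction_apply_one_ne_zero hχ₁)
  set L := η ^ (-5 : ℝ) with hLdef
  have hLη : L ^ (-(1 / 5 : ℝ)) = η := by
    rw [hLdef, ← Real.rpow_mul hη0.le]; norm_num
  have hML : M ≤ L := by
    have h1 : M = (M ^ (-(1 / 5 : ℝ))) ^ (-5 : ℝ) := by
      rw [← Real.rpow_mul hM0.le]; norm_num
    rw [h1, hLdef]
    exact Real.rpow_le_rpow_of_nonpos hη0 hsmall.le (by norm_num)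
  obtain ⟨b1, b2, b3, b4⟩ := hL₁ L ((le_max_left _ _).trans hML)
  have hL0 : 0 < L := hM0.trans_le hML
  have hlog : 1 ≤ Real.log L := by rwa [Real.le_log_iff_exp_le hL0]
  refine ⟨L, b1, fun q _ χ hp hχ hq => ?_⟩
  rw [hLη]
  by_contra hlt
  push Not at hlt
  have hne : (⟨q₁, χ₁⟩ : Σ q, DirichletCharacter ℂ q) ≠ ⟨q, χ⟩ := by
    intro h
    rw [Sigma.mk.injEq] at h
    obtain ⟨rfl, h⟩ := h
    rw [← eq_of_heq h] at hlt
    exact lt_irrefl _ hlt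
  have hq₁' : (q₁ : ℝ) ≤ L ^ B := hq₁.trans (Real.rpow_le_rpow hM0.le hML (by linarith))
  have hqpos : (0 : ℝ) < q := by exact_mod_cast Nat.pos_of_ne_zero (NeZero.ne q)
  have hqpos₁ : (0 : ℝ) < q₁ := by exact_mod_cast Nat.pos_of_ne_zero (NeZero.ne q₁)
  have hlogq : Real.log (q₁ * q : ℕ) ≤ 2 * B * Real.log L := by
    push_cast
    rw [Real.log_mul hqpos₁.ne' hqpos.ne']
    have e1 := Real.log_le_log hqpos hq
    have e2 := Real.log_le_log hqpos₁ hq₁'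
    rw [Real.log_rpow hL0] at e1 e2
    linarith
  have := hC q₁ q χ₁ χ hp₁ hp hχ₁ hχ hne (2 * B * Real.log L) η (by nlinarith) hlogq hη0
    (hLη ▸ b3) le_rfl hlt.le
  rw [hLη] at b4
  linarith

end BoundedGaps

namespace BoundedGaps

open Complex MeasureTheory

theorem gaussian_mul_cpow_eq (L σ t : ℝ) {n : ℕ} (hn : 0 < n) :
    cexp (L * (σ + t * I) ^ 2 / 2) * (n : ℂ) ^ (-(σ + t * I)) =
      cexp ((-(L / 2) : ℝ) * (t : ℂ) ^ 2 + (((L * σ - Real.log n : ℝ) : ℂ) * I) * t +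
        ((L * σ ^ 2 / 2 - σ * Real.log n : ℝ) : ℂ)) := by
  have hn0 : (n : ℂ) ≠ 0 := by exact_mod_cast hn.ne'
  rw [Complex.cpow_def_of_ne_zero hn0, ← Complex.exp_add, ← Complex.natCast_log]
  congr 1
  push_cast
  linear_combination ((L : ℂ) * t ^ 2 / 2) * Complex.I_sq

theorem integrable_gaussian_mul_cpow {L : ℝ} (hL : 0 < L) (σ : ℝ) {n : ℕ} (hn : 0 < n) :
    Integrable fun t : ℝ => cexp (L * (σ + t * I) ^ 2 / 2) * (n : ℂ) ^ (-(σ + t * I)) := by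
  simp only [gaussian_mul_cpow_eq L σ _ hn]
  exact integrable_cexp_quadratic' (by rw [ofReal_re]; linarith) _ _

/-- The weight `om` as a Mellin integral along the line `re s = σ`. -/
theorem om_eq_integral {L : ℝ} (hL : 0 < L) (σ : ℝ) {n : ℕ} (hn : 0 < n) :
    (om L n : ℂ) = (√(L / (2 * Real.pi)) : ℝ) *
      ∫ t : ℝ, cexp (L * (σ + t * I) ^ 2 / 2) * (n : ℂ) ^ (-(σ + t * I)) := by
  simp only [gaussian_mul_cpow_eq L σ _ hn]
  rw [integral_cexp_quadratic (by rw [ofReal_re]; linarith)]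
  have h1 : ((Real.pi : ℂ) / -((-(L / 2) : ℝ) : ℂ)) ^ (1 / 2 : ℂ) = (√(2 * Real.pi / L) : ℝ) := by
    rw [Real.sqrt_eq_rpow, ofReal_cpow (by positivity)]
    congr 1
    · push_cast; field_simp
    · norm_num
  rw [h1, ← mul_assoc, ← ofReal_mul, ← Real.sqrt_mul (by positivity)]
  have h2 : L / (2 * Real.pi) * (2 * Real.pi / L) = 1 := by
    have := Real.pi_pos; field_simp
  rw [h2, Real.sqrt_one, ofReal_one, one_mul, om, ofReal_exp]
  congr 1
  have hL' : (L : ℂ) ≠ 0 := by exact_mod_cast hL.ne'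
  push_cast
  rw [mul_pow, I_sq]
  field_simp
  ring

theorem norm_cexp_gaussian (L σ t : ℝ) :
    ‖cexp (L * (σ + t * I) ^ 2 / 2)‖ = Real.exp (L * (σ ^ 2 - t ^ 2) / 2) := by
  rw [Complex.norm_exp]
  congr 1
  have : (L * (σ + t * I) ^ 2 / 2 : ℂ) = ((L * (σ ^ 2 - t ^ 2) / 2 : ℝ) : ℂ) + ((L * σ * t : ℝ) : ℂ) * I := by
    push_cast
    linear_combination ((L : ℂ) * t ^ 2 / 2) * Complex.I_sq
  rw [this, add_re, ofReal_re, re_ofReal_mul, I_re, mul_zero, add_zero]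

theorem norm_natCast_cpow_neg {n : ℕ} (hn : 0 < n) (σ t : ℝ) :
    ‖(n : ℂ) ^ (-(σ + t * I))‖ = (n : ℝ) ^ (-σ) := by
  rw [Complex.norm_natCast_cpow_of_pos hn]
  simp

/-- Moving the vertical segment of integration. -/
theorem norm_integral_vertical_le {f : ℂ → ℂ} {σ₁ σ₂ T M₁ M₂ : ℝ} (hσ : σ₁ ≤ σ₂) (hT : 0 ≤ T)
    (hf : ∀ x y : ℝ, x ∈ Set.Icc σ₁ σ₂ → y ∈ Set.Icc (-T) T → DifferentiableAt ℂ f (x + y * I))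
    (h₁ : ∀ y : ℝ, y ∈ Set.Icc (-T) T → ‖f (σ₁ + y * I)‖ ≤ M₁)
    (h₂ : ∀ x y : ℝ, x ∈ Set.Icc σ₁ σ₂ → |y| = T → ‖f (x + y * I)‖ ≤ M₂) :
    ‖∫ y : ℝ in (-T)..T, f (σ₂ + y * I)‖ ≤ 2 * T * M₁ + 2 * (σ₂ - σ₁) * M₂ := by
  have hTT : -T ≤ T := by linarith
  have key := integral_boundary_rect_eq_zero_of_differentiableOn f ⟨σ₁, -T⟩ ⟨σ₂, T⟩ (by
    intro s hs
    rw [mem_reProdIm, Set.uIcc_of_le hσ, Set.uIcc_of_le hTT] at hs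
    have := hf s.re s.im hs.1 hs.2
    rw [re_add_im] at this
    exact this.differentiableWithinAt)
  simp only at key
  set a := ∫ x : ℝ in σ₁..σ₂, f (x + (-T : ℝ) * I)
  set b := ∫ x : ℝ in σ₁..σ₂, f (x + T * I)
  set c := ∫ y : ℝ in (-T)..T, f (σ₂ + y * I)
  set d := ∫ y : ℝ in (-T)..T, f (σ₁ + y * I)
  have e : c = d + I * (a - b) := by
    rw [smul_eq_mul, smul_eq_mul] at key
    linear_combination (-I) * key + (c - d) * I_sq
  have ha : ‖a‖ ≤ M₂ * (σ₂ - σ₁) := by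
    have := intervalIntegral.norm_integral_le_of_norm_le_const (a := σ₁) (b := σ₂) (C := M₂)
      (f := fun x : ℝ => f (x + (-T : ℝ) * I)) fun x hx => by
        rw [Set.uIoc_of_le hσ] at hx
        exact h₂ x (-T) ⟨hx.1.le, hx.2⟩ (by rw [abs_neg, abs_of_nonneg hT])
    rwa [abs_of_nonneg (by linarith)] at this
  have hb : ‖b‖ ≤ M₂ * (σ₂ - σ₁) := by
    have := intervalIntegral.norm_integral_le_of_norm_le_const (a := σ₁) (b := σ₂) (C := M₂)
      (f := fun x : ℝ => f (x + T * I)) fun x hx => by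
        rw [Set.uIoc_of_le hσ] at hx
        exact h₂ x T ⟨hx.1.le, hx.2⟩ (abs_of_nonneg hT)
    rwa [abs_of_nonneg (by linarith)] at this
  have hd : ‖d‖ ≤ M₁ * (2 * T) := by
    have := intervalIntegral.norm_integral_le_of_norm_le_const (a := -T) (b := T) (C := M₁)
      (f := fun y : ℝ => f (σ₁ + y * I)) fun y hy => by
        rw [Set.uIoc_of_le hTT] at hy
        exact h₁ y ⟨hy.1.le, hy.2⟩
    rwa [abs_of_nonneg (by linarith), sub_neg_eq_add, ← two_mul] at this
  rw [e]
  calc ‖d + I * (a - b)‖ ≤ ‖d‖ + ‖I * (a - b)‖ := norm_add_le _ _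
    _ ≤ ‖d‖ + (‖a‖ + ‖b‖) := by
        rw [norm_mul, norm_I, one_mul]
        gcongr
        exact norm_sub_le _ _
    _ ≤ _ := by linarith

open ArithmeticFunction in
theorem vonMangoldt_mul_rpow_le {c : ℝ} (hc : 0 < c) (n : ℕ) :
    vonMangoldt n * (n : ℝ) ^ (-(1 + c)) ≤ 2 / c * (n : ℝ) ^ (-(1 + c / 2)) := by
  rcases Nat.eq_zero_or_pos n with rfl | hn
  · simp only [ArithmeticFunction.map_zero, zero_mul]
    positivity
  have hn' : (0 : ℝ) < n := by exact_mod_cast hn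
  have h1 : vonMangoldt n ≤ (n : ℝ) ^ (c / 2) / (c / 2) :=
    vonMangoldt_le_log.trans (Real.log_le_rpow_div hn'.le (half_pos hc))
  calc vonMangoldt n * (n : ℝ) ^ (-(1 + c)) ≤ (n : ℝ) ^ (c / 2) / (c / 2) * (n : ℝ) ^ (-(1 + c)) := by
        gcongr
    _ = 2 / c * ((n : ℝ) ^ (c / 2) * (n : ℝ) ^ (-(1 + c))) := by field_simp
    _ = _ := by rw [← Real.rpow_add hn']; ring_nf

open ArithmeticFunction in
theorem summable_vonMangoldt_rpow {c : ℝ} (hc : 0 < c) :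
    Summable fun n : ℕ => vonMangoldt n * (n : ℝ) ^ (-(1 + c)) :=
  Summable.of_nonneg_of_le (fun n => mul_nonneg vonMangoldt_nonneg (by positivity))
    (vonMangoldt_mul_rpow_le hc) ((summable_rpow_neg (half_pos hc)).mul_left (2 / c))

open ArithmeticFunction in
theorem tsum_vonMangoldt_rpow_le {c : ℝ} (hc : 0 < c) (hc1 : c ≤ 1) :
    ∑' n : ℕ, vonMangoldt n * (n : ℝ) ^ (-(1 + c)) ≤ 8 / c ^ 2 := by
  refine ((summable_vonMangoldt_rpow hc).tsum_le_tsum (vonMangoldt_mul_rpow_le hc)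
    ((summable_rpow_neg (half_pos hc)).mul_left (2 / c))).trans ?_
  rw [tsum_mul_left]
  calc 2 / c * _ ≤ 2 / c * (2 / (c / 2)) := by
        gcongr
        exact tsum_rpow_neg_le (half_pos hc) (by linarith)
    _ = 8 / c ^ 2 := by field_simp; norm_num

end BoundedGaps

namespace BoundedGaps

open Complex MeasureTheory ArithmeticFunction

/-- The length of the smoothed sums at scale `L`. -/
noncomputable def cut (L : ℝ) : ℕ := ⌊Real.exp (5 * L)⌋₊

/-- The smoothed Chebyshev function twisted by a character. -/
noncomputable def psi {q : ℕ} (L : ℝ) (χ : DirichletCharacter ℂ q) : ℂ :=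
  ∑ n ∈ Finset.Icc 1 (cut L), (vonMangoldt n : ℂ) * χ n * (om L n : ℂ)

/-- The Dirichlet polynomial of `Λ χ` of length `cut L`. -/
noncomputable def dirPoly {q : ℕ} (L : ℝ) (χ : DirichletCharacter ℂ q) (s : ℂ) : ℂ :=
  ∑ n ∈ Finset.Icc 1 (cut L), (vonMangoldt n : ℂ) * χ n * (n : ℂ) ^ (-s)

theorem integrable_gaussian_mul_dirPoly {q : ℕ} {L : ℝ} (hL : 0 < L) (χ : DirichletCharacter ℂ q)
    (σ : ℝ) : Integrable fun t : ℝ => cexp (L * (σ + t * I) ^ 2 / 2) * dirPoly L χ (σ + t * I) := by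
  simp only [dirPoly, Finset.mul_sum]
  refine integrable_finsetSum _ fun n hn => ?_
  have := (integrable_gaussian_mul_cpow hL σ (Finset.mem_Icc.1 hn).1).const_mul
    ((vonMangoldt n : ℂ) * χ n)
  refine this.congr (Filter.Eventually.of_forall fun t => ?_)
  simp only
  ring

theorem psi_eq_integral {q : ℕ} {L : ℝ} (hL : 0 < L) (χ : DirichletCharacter ℂ q) (σ : ℝ) :
    psi L χ = (√(L / (2 * Real.pi)) : ℝ) *
      ∫ t : ℝ, cexp (L * (σ + t * I) ^ 2 / 2) * dirPoly L χ (σ + t * I) := by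
  simp only [dirPoly, Finset.mul_sum, psi]
  rw [integral_finsetSum, Finset.mul_sum]
  · refine Finset.sum_congr rfl fun n hn => ?_
    rw [om_eq_integral hL σ (Finset.mem_Icc.1 hn).1, ← mul_assoc, mul_comm _ (((√_ : ℝ)) : ℂ),
      mul_assoc, ← integral_const_mul]
    congr 1
    refine integral_congr_ae (Filter.Eventually.of_forall fun t => ?_)
    simp only
    ring
  · intro n hn
    have := (integrable_gaussian_mul_cpow hL σ (Finset.mem_Icc.1 hn).1).const_mul
      ((vonMangoldt n : ℂ) * χ n)
    refine this.congr (Filter.Eventually.of_forall fun t => ?_)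
    simp only
    ring

theorem norm_vonMangoldt_char_cpow_le {q n : ℕ} (χ : DirichletCharacter ℂ q) (hn : 0 < n) (σ t : ℝ) :
    ‖(vonMangoldt n : ℂ) * χ n * (n : ℂ) ^ (-(σ + t * I))‖ ≤ vonMangoldt n * (n : ℝ) ^ (-σ) := by
  rw [norm_mul, norm_mul, norm_natCast_cpow_neg hn, norm_real, Real.norm_of_nonneg vonMangoldt_nonneg]
  have := χ.norm_le_one n
  have h2 := vonMangoldt_nonneg (n := n)
  calc _ ≤ vonMangoldt n * 1 * (n : ℝ) ^ (-σ) := by gcongr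
    _ = _ := by ring

theorem norm_dirPoly_le {q : ℕ} (L : ℝ) (χ : DirichletCharacter ℂ q) {c : ℝ} (hc : 0 < c)
    (hc1 : c ≤ 1) (t : ℝ) : ‖dirPoly L χ ((1 + c : ℝ) + t * I)‖ ≤ 8 / c ^ 2 := by
  refine le_trans ?_ (tsum_vonMangoldt_rpow_le hc hc1)
  refine (norm_sum_le_of_le _ fun n hn =>
    norm_vonMangoldt_char_cpow_le χ (Finset.mem_Icc.1 hn).1 (1 + c) t).trans ?_
  exact (summable_vonMangoldt_rpow hc).sum_le_tsum _ fun n _ =>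
    mul_nonneg vonMangoldt_nonneg (by positivity)

theorem norm_logDeriv_add_dirPoly_le {q : ℕ} [NeZero q] (L : ℝ) (χ : DirichletCharacter ℂ q) {c : ℝ}
    (hc : 0 < c) (hc1 : c ≤ 1) (t : ℝ) :
    ‖deriv χ.LFunction ((1 + c : ℝ) + t * I) / χ.LFunction ((1 + c : ℝ) + t * I)
      + dirPoly L χ ((1 + c : ℝ) + t * I)‖ ≤ 32 / c ^ 2 * Real.exp (-(5 * L * c / 2)) := by
  set s : ℂ := (1 + c : ℝ) + t * I with hs
  have hs1 : 1 < s.re := by simp [hs, hc]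
  have h1 := DirichletCharacter.LSeries_twist_vonMangoldt_eq χ hs1
  have h2 := (DirichletCharacter.LSeriesSummable_twist_vonMangoldt χ hs1)
  rw [DirichletCharacter.deriv_LFunction_eq_deriv_LSeries χ hs1,
    DirichletCharacter.LFunction_eq_LSeries χ hs1]
  have h3 : deriv (LSeries (χ ·)) s / LSeries (χ ·) s = -LSeries ((fun n : ℕ => χ n) *
      (fun n : ℕ => (vonMangoldt n : ℂ))) s := by
    rw [h1, neg_div, neg_neg]
  rw [h3]
  set F : ℕ → ℂ := fun n => if n ∈ Finset.Icc 1 (cut L) then 0 else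
    (vonMangoldt n : ℂ) * χ n * (n : ℂ) ^ (-s) with hF
  have hterm : ∀ n, LSeries.term ((fun n : ℕ => χ n) * (fun n : ℕ => (vonMangoldt n : ℂ))) s n
      = (vonMangoldt n : ℂ) * χ n * (n : ℂ) ^ (-s) := by
    intro n
    rw [LSeries.term_def]
    split_ifs with h
    · subst h; simp
    · rw [cpow_neg, Pi.mul_apply, div_eq_mul_inv, mul_comm (χ n)]
  have hsumF : HasSum F (LSeries ((fun n : ℕ => χ n) * (fun n : ℕ => (vonMangoldt n : ℂ))) s
      - dirPoly L χ s) := by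
    have e1 := h2.LSeriesHasSum
    unfold LSeriesHasSum at e1
    have e2 : HasSum (fun n => if n ∈ Finset.Icc 1 (cut L) then
        (vonMangoldt n : ℂ) * χ n * (n : ℂ) ^ (-s) else 0) (dirPoly L χ s) := by
      have := hasSum_sum_of_ne_finset_zero (L := SummationFilter.unconditional ℕ) (f := fun n => if n ∈ Finset.Icc 1 (cut L) then
        (vonMangoldt n : ℂ) * χ n * (n : ℂ) ^ (-s) else 0) (s := Finset.Icc 1 (cut L))
        (fun n hn => by simp only [if_neg hn])
      rwa [Finset.sum_ite_mem, Finset.inter_self] at this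
    have hFe : F = fun n => LSeries.term ((fun n : ℕ => χ n) * (fun n : ℕ => (vonMangoldt n : ℂ))) s n
        - (if n ∈ Finset.Icc 1 (cut L) then (vonMangoldt n : ℂ) * χ n * (n : ℂ) ^ (-s) else 0) := by
      funext n
      simp only [hF, hterm]
      split_ifs <;> simp
    rw [hFe]
    exact e1.sub e2
  rw [neg_add_eq_sub, norm_sub_rev, ← hsumF.tsum_eq]
  have hbound : ∀ n, ‖F n‖ ≤ Real.exp (-(5 * L * c / 2)) *
      (vonMangoldt n * (n : ℝ) ^ (-(1 + c / 2))) := by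
    intro n
    simp only [hF]
    have hΛ := vonMangoldt_nonneg (n := n)
    split_ifs with h
    · rw [norm_zero]; positivity
    rcases Nat.eq_zero_or_pos n with rfl | hn
    · simp
    have hX : Real.exp (5 * L) < n := by
      rw [Finset.mem_Icc, not_and, not_le] at h
      exact Nat.lt_of_floor_lt (h hn)
    have hn' : (0 : ℝ) < n := by exact_mod_cast hn
    refine (norm_vonMangoldt_char_cpow_le χ hn (1 + c) t).trans ?_
    have e1 : (n : ℝ) ^ (-(1 + c)) = (n : ℝ) ^ (-(c / 2)) * (n : ℝ) ^ (-(1 + c / 2)) := by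
      rw [← Real.rpow_add hn']; ring_nf
    have e2 : (n : ℝ) ^ (-(c / 2)) ≤ Real.exp (-(5 * L * c / 2)) := by
      calc (n : ℝ) ^ (-(c / 2)) ≤ (Real.exp (5 * L)) ^ (-(c / 2)) :=
            Real.rpow_le_rpow_of_nonpos (Real.exp_pos _) hX.le (by linarith)
        _ = _ := by rw [← Real.exp_mul]; ring_nf
    rw [e1]
    calc _ = (n : ℝ) ^ (-(c / 2)) * (vonMangoldt n * (n : ℝ) ^ (-(1 + c / 2))) := by ring
      _ ≤ _ := by gcongr
  refine (tsum_of_norm_bounded ((summable_vonMangoldt_rpow (half_pos hc)).hasSum.mul_left _) hbound).trans ?_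
  have := tsum_vonMangoldt_rpow_le (half_pos hc) (by linarith)
  calc _ ≤ Real.exp (-(5 * L * c / 2)) * (8 / (c / 2) ^ 2) := by gcongr
    _ = _ := by field_simp; norm_num

end BoundedGaps

namespace BoundedGaps

open Complex MeasureTheory ArithmeticFunction

theorem norm_integral_outside_le {g : ℝ → ℂ} (hg : Integrable g) {a M T : ℝ} (ha : 0 < a)
    (hM : 0 ≤ M) (hT : 0 ≤ T)
    (h : ∀ t, ‖g t‖ ≤ M * Real.exp (-a * t ^ 2)) :
    ‖∫ t, g t‖ ≤ ‖∫ t in (-T)..T, g t‖ + M * Real.exp (-(a * T ^ 2 / 2)) * √(2 * Real.pi / a) := by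
  have hI : Integrable fun t : ℝ => M * Real.exp (-(a * T ^ 2 / 2)) * Real.exp (-(a / 2) * t ^ 2) :=
    (integrable_exp_neg_mul_sq (half_pos ha)).const_mul _
  have hsplit : ∫ t, g t = (∫ t in (-T)..T, g t) + ∫ t in (Set.Ioc (-T) T)ᶜ, g t := by
    rw [intervalIntegral.integral_of_le (by linarith), integral_add_compl measurableSet_Ioc hg]
  have hout : ‖∫ t in (Set.Ioc (-T) T)ᶜ, g t‖ ≤
      ∫ t, M * Real.exp (-(a * T ^ 2 / 2)) * Real.exp (-(a / 2) * t ^ 2) := by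
    refine (norm_integral_le_integral_norm _).trans ?_
    refine le_trans (setIntegral_mono_on hg.norm.integrableOn hI.integrableOn
      measurableSet_Ioc.compl fun t ht => ?_)
      (setIntegral_le_integral hI (Filter.Eventually.of_forall fun t => by positivity))
    refine (h t).trans ?_
    rw [mul_assoc, ← Real.exp_add]
    refine mul_le_mul_of_nonneg_left (Real.exp_le_exp.2 ?_) hM
    have : T ^ 2 ≤ t ^ 2 := by
      rw [Set.mem_compl_iff, Set.mem_Ioc, not_and_or, not_lt, not_le] at ht
      rcases ht with ht | ht <;> nlinarith
    nlinarith
  rw [hsplit]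
  refine (norm_add_le _ _).trans (add_le_add le_rfl (hout.trans_eq ?_))
  rw [integral_const_mul, integral_gaussian]
  congr 2
  field_simp

/-- The explicit bound for `psi` given by a zero-free rectangle. -/
theorem norm_psi_le_of_zeroFree {q : ℕ} [NeZero q] {χ : DirichletCharacter ℂ q} (hχ : χ ≠ 1)
    {L b c T A : ℝ} (hL : 0 < L) (hb : 0 < b) (hb1 : b ≤ 1) (hc : 0 < c) (hc1 : c ≤ 1) (hT : 0 < T)
    (hA : ∀ x y : ℝ, x ∈ Set.Icc (1 - b) (1 + c) → y ∈ Set.Icc (-T) T →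
      χ.LFunction (x + y * I) ≠ 0 ∧
      ‖deriv χ.LFunction (x + y * I) / χ.LFunction (x + y * I)‖ ≤ A) :
    ‖psi L χ‖ ≤ √(L / (2 * Real.pi)) * (
      (2 * T * (A * Real.exp (L * (1 - b) ^ 2 / 2))
        + 2 * (b + c) * (A * Real.exp (L * ((1 + c) ^ 2 - T ^ 2) / 2)))
      + 2 * T * (32 / c ^ 2 * Real.exp (-(5 * L * c / 2)) * Real.exp (L * (1 + c) ^ 2 / 2))
      + 8 / c ^ 2 * Real.exp (L * (1 + c) ^ 2 / 2) * Real.exp (-(L * T ^ 2 / 4))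
        * √(4 * Real.pi / L)) := by
  rw [psi_eq_integral hL χ (1 + c), norm_mul, norm_real, Real.norm_of_nonneg (Real.sqrt_nonneg _)]
  refine mul_le_mul_of_nonneg_left ?_ (Real.sqrt_nonneg _)
  have hA0 : 0 ≤ A := (norm_nonneg _).trans
    (hA 1 0 ⟨by linarith, by linarith⟩ ⟨by linarith, by linarith⟩).2
  have hexp : ∀ σ t : ℝ, 0 ≤ σ → σ ≤ 1 + c → ‖cexp (L * (σ + t * I) ^ 2 / 2)‖
      ≤ Real.exp (L * ((1 + c) ^ 2 - t ^ 2) / 2) := by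
    intro σ t h0 h1
    rw [norm_cexp_gaussian]
    gcongr
  have hexp' : ∀ t : ℝ, Real.exp (L * ((1 + c) ^ 2 - t ^ 2) / 2)
      = Real.exp (L * (1 + c) ^ 2 / 2) * Real.exp (-(L / 2) * t ^ 2) := by
    intro t; rw [← Real.exp_add]; ring_nf
  have h1 := norm_integral_outside_le (integrable_gaussian_mul_dirPoly hL χ (1 + c))
    (a := L / 2) (M := 8 / c ^ 2 * Real.exp (L * (1 + c) ^ 2 / 2)) (T := T) (by linarith)
    (by positivity) hT.le (fun t => by
      rw [norm_mul, mul_comm]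
      have e1 := norm_dirPoly_le L χ hc hc1 t
      have e2 := hexp (1 + c) t (by linarith) le_rfl
      rw [hexp'] at e2
      calc _ ≤ (8 / c ^ 2) * (Real.exp (L * (1 + c) ^ 2 / 2) * Real.exp (-(L / 2) * t ^ 2)) :=
            mul_le_mul e1 e2 (norm_nonneg _) (by positivity)
        _ = _ := by ring)
  have e3 : L / 2 * T ^ 2 / 2 = L * T ^ 2 / 4 := by ring
  have e4 : 2 * Real.pi / (L / 2) = 4 * Real.pi / L := by field_simp; norm_num
  rw [e3, e4] at h1
  refine h1.trans (add_le_add ?_ le_rfl)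
  set f : ℂ → ℂ := fun s => cexp (L * s ^ 2 / 2) * (deriv χ.LFunction s / χ.LFunction s) with hf
  set g : ℝ → ℂ := fun t => cexp (L * ((1 + c : ℝ) + t * I) ^ 2 / 2) *
      dirPoly L χ ((1 + c : ℝ) + t * I) with hg
  have hLd := DirichletCharacter.differentiable_LFunction hχ
  have hdiff : ∀ x y : ℝ, x ∈ Set.Icc (1 - b) (1 + c) → y ∈ Set.Icc (-T) T →
      DifferentiableAt ℂ f (x + y * I) := by
    intro x y hx hy
    have hd : Differentiable ℂ (deriv χ.LFunction) := fun z =>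
      (hLd.analyticAt z).deriv.differentiableAt
    refine DifferentiableAt.mul (by fun_prop) ?_
    exact (hd _).div (hLd _) (hA x y hx hy).1
  have hvert := norm_integral_vertical_le (f := f) (σ₁ := 1 - b) (σ₂ := 1 + c) (T := T)
    (M₁ := A * Real.exp (L * (1 - b) ^ 2 / 2))
    (M₂ := A * Real.exp (L * ((1 + c) ^ 2 - T ^ 2) / 2)) (by linarith) hT.le hdiff
    (fun y hy => by
      simp only [hf]
      rw [norm_mul, mul_comm, norm_cexp_gaussian]
      refine mul_le_mul (hA _ y ⟨le_rfl, by linarith⟩ hy).2 (Real.exp_le_exp.2 ?_)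
        (Real.exp_nonneg _) hA0
      have : 0 ≤ L * y ^ 2 := by positivity
      linarith)
    (fun x y hx hy => by
      simp only [hf]
      rw [norm_mul, mul_comm]
      have e5 := hexp x y (by linarith [hx.1]) hx.2
      rw [← sq_abs y, hy] at e5
      exact mul_le_mul (hA x y hx (abs_le.1 hy.le)).2 e5 (norm_nonneg _) hA0)
  have hcf : ContinuousOn (fun t : ℝ => f ((1 + c : ℝ) + t * I)) (Set.uIcc (-T) T) := by
    intro t ht
    rw [Set.uIcc_of_le (by linarith)] at ht
    refine ContinuousAt.continuousWithinAt ?_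
    exact (hdiff (1 + c) t ⟨by linarith, le_rfl⟩ ht).continuousAt.comp
      (f := fun t : ℝ => (((1 + c : ℝ) : ℂ) + t * I)) (by fun_prop)
  have hgi : IntervalIntegrable g volume (-T) T :=
    (integrable_gaussian_mul_dirPoly hL χ (1 + c)).intervalIntegrable
  have hsum : ∫ t in (-T)..T, g t = (∫ t in (-T)..T, (g t + f ((1 + c : ℝ) + t * I)))
      - ∫ t in (-T)..T, f ((1 + c : ℝ) + t * I) := by
    rw [← intervalIntegral.integral_sub (hgi.add hcf.intervalIntegrable) hcf.intervalIntegrable]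
    simp
  have hdiffint : ‖∫ t in (-T)..T, (g t + f ((1 + c : ℝ) + t * I))‖ ≤
      (32 / c ^ 2 * Real.exp (-(5 * L * c / 2)) * Real.exp (L * (1 + c) ^ 2 / 2)) * |T - -T| := by
    refine intervalIntegral.norm_integral_le_of_norm_le_const fun t _ => ?_
    simp only [hg, hf]
    rw [← mul_add, norm_mul, mul_comm, add_comm]
    refine mul_le_mul (norm_logDeriv_add_dirPoly_le L χ hc hc1 t) ?_ (norm_nonneg _) (by positivity)
    rw [norm_cexp_gaussian]
    apply Real.exp_le_exp.2
    have : 0 ≤ L * t ^ 2 := by positivity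
    linarith
  rw [abs_of_nonneg (by linarith), sub_neg_eq_add, ← two_mul] at hdiffint
  rw [hsum]
  refine (norm_sub_le _ _).trans ?_
  have e6 : 1 + c - (1 - b) = b + c := by ring
  rw [e6] at hvert
  linarith

end BoundedGaps

namespace BoundedGaps

open Complex Filter

theorem contour_estimate {L x : ℝ} (hL : 0 < L) (a4 : 2 ≤ x) (hxL : L = x ^ 4)
    (hsq : √L = x ^ 2) (a3 : 600 * (x ^ 6 * Real.exp (-x)) < 1) :
    √(L / (2 * Real.pi)) * (
      (2 * (4 / x) * (x ^ 4 * Real.exp (L * (1 - 1 / x) ^ 2 / 2))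
        + 2 * (1 / x + 1 / x ^ 2) *
          (x ^ 4 * Real.exp (L * ((1 + 1 / x ^ 2) ^ 2 - (4 / x) ^ 2) / 2)))
      + 2 * (4 / x) * (32 / (1 / x ^ 2) ^ 2 * Real.exp (-(5 * L * (1 / x ^ 2) / 2)) *
          Real.exp (L * (1 + 1 / x ^ 2) ^ 2 / 2))
      + 8 / (1 / x ^ 2) ^ 2 * Real.exp (L * (1 + 1 / x ^ 2) ^ 2 / 2) *
          Real.exp (-(L * (4 / x) ^ 2 / 4)) * √(4 * Real.pi / L)) ≤
      Real.exp (L / 2 - √L / 4) := by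
  have hx0 : 0 < x := by linarith
  set E := Real.exp (x ^ 4 / 2 - 3 / 2 * x ^ 2 + 1 / 2) with hE
  have hE0 : 0 < E := Real.exp_pos _
  have e1 : Real.exp (L * (1 - 1 / x) ^ 2 / 2) ≤ E := by
    apply Real.exp_le_exp.2
    rw [hxL]
    have : x ^ 4 * (1 - 1 / x) ^ 2 / 2 = x ^ 4 / 2 - x ^ 3 + x ^ 2 / 2 := by field_simp; ring
    rw [this]
    have : 2 * x ^ 2 ≤ x ^ 3 := by rw [pow_succ x 2, mul_comm]; gcongr
    linarith
  have e2 : Real.exp (L * ((1 + 1 / x ^ 2) ^ 2 - (4 / x) ^ 2) / 2) ≤ E := by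
    apply Real.exp_le_exp.2
    rw [hxL]
    have : x ^ 4 * ((1 + 1 / x ^ 2) ^ 2 - (4 / x) ^ 2) / 2 = x ^ 4 / 2 - 7 * x ^ 2 + 1 / 2 := by
      field_simp; ring
    rw [this]; nlinarith [sq_nonneg x]
  have e0 : L * (1 + 1 / x ^ 2) ^ 2 / 2 = x ^ 4 / 2 + x ^ 2 + 1 / 2 := by
    rw [hxL]; field_simp; ring
  have e3 : Real.exp (-(5 * L * (1 / x ^ 2) / 2)) * Real.exp (L * (1 + 1 / x ^ 2) ^ 2 / 2) ≤ E := by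
    rw [← Real.exp_add, e0]
    apply Real.exp_le_exp.2
    rw [hxL]
    have : 5 * x ^ 4 * (1 / x ^ 2) / 2 = 5 / 2 * x ^ 2 := by field_simp
    rw [this]; linarith
  have e4 : Real.exp (L * (1 + 1 / x ^ 2) ^ 2 / 2) * Real.exp (-(L * (4 / x) ^ 2 / 4)) ≤ E := by
    rw [← Real.exp_add, e0]
    apply Real.exp_le_exp.2
    rw [hxL]
    have : x ^ 4 * (4 / x) ^ 2 / 4 = 4 * x ^ 2 := by field_simp
    rw [this]; nlinarith [sq_nonneg x]
  have hpi := Real.pi_gt_three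
  have hpi4 := Real.pi_le_four
  have s1 : √(L / (2 * Real.pi)) ≤ x ^ 2 := by
    rw [← hsq]
    apply Real.sqrt_le_sqrt
    rw [div_le_iff₀ (by positivity)]; nlinarith
  have s2 : √(4 * Real.pi / L) ≤ 4 := by
    rw [Real.sqrt_le_left (by norm_num), div_le_iff₀ hL, hxL]
    have : 1 ≤ x ^ 4 := one_le_pow₀ (by linarith)
    linarith
  have hxinv : 1 / x ≤ 1 := by rw [div_le_one hx0]; linarith
  have hxinv2 : 1 / x ^ 2 ≤ 1 := by rw [div_le_one (by positivity)]; nlinarith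
  have hfour : 4 / x ≤ 4 := by rw [div_le_iff₀ hx0]; linarith
  have hc2 : 1 / (1 / x ^ 2) ^ 2 = x ^ 4 := by field_simp
  have t3 : 32 / (1 / x ^ 2) ^ 2 * Real.exp (-(5 * L * (1 / x ^ 2) / 2)) *
      Real.exp (L * (1 + 1 / x ^ 2) ^ 2 / 2) ≤ 32 * x ^ 4 * E := by
    calc _ = 32 * (1 / (1 / x ^ 2) ^ 2) * (Real.exp (-(5 * L * (1 / x ^ 2) / 2)) *
      Real.exp (L * (1 + 1 / x ^ 2) ^ 2 / 2)) := by ring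
      _ ≤ _ := by rw [hc2]; gcongr
  have t4 : 8 / (1 / x ^ 2) ^ 2 * Real.exp (L * (1 + 1 / x ^ 2) ^ 2 / 2) *
      Real.exp (-(L * (4 / x) ^ 2 / 4)) ≤ 8 * x ^ 4 * E := by
    calc _ = 8 * (1 / (1 / x ^ 2) ^ 2) * (Real.exp (L * (1 + 1 / x ^ 2) ^ 2 / 2) *
      Real.exp (-(L * (4 / x) ^ 2 / 4))) := by ring
      _ ≤ _ := by rw [hc2]; gcongr
  calc _ ≤ x ^ 2 * ((2 * 4 * (x ^ 4 * E) + 2 * (1 + 1) * (x ^ 4 * E)) + 2 * 4 * (32 * x ^ 4 * E)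
        + 8 * x ^ 4 * E * 4) := by gcongr
    _ = 300 * x ^ 6 * E := by ring
    _ ≤ Real.exp (L / 2 - √L / 4) := by
        have f1 : 600 * x ^ 6 ≤ Real.exp x := by
          rw [Real.exp_neg, ← div_eq_mul_inv, ← mul_div_assoc, div_lt_one (Real.exp_pos _)] at a3
          exact a3.le
        calc 300 * x ^ 6 * E ≤ Real.exp x * E := by gcongr; linarith [pow_pos hx0 6]
          _ = Real.exp (x + (x ^ 4 / 2 - 3 / 2 * x ^ 2 + 1 / 2)) := by rw [hE, ← Real.exp_add]
          _ ≤ _ := by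
            apply Real.exp_le_exp.2
            rw [hsq, hxL]
            nlinarith

/-- A Siegel–Walfisz type bound for characters whose `L(1, χ)` is not exceptionally small. -/
theorem eventually_norm_psi_le {B : ℝ} (hB : 1 ≤ B) : ∀ᶠ L : ℝ in atTop, ∀ (q : ℕ) [NeZero q]
    (χ : DirichletCharacter ℂ q), χ ≠ 1 → (q : ℝ) ≤ L ^ B → L ^ (-(1 / 5 : ℝ)) ≤ ‖χ.LFunction 1‖ →
      ‖psi L χ‖ ≤ Real.exp (L / 2 - √L / 4) := by
  obtain ⟨C, hC1, hC⟩ := exists_norm_deriv_LFunction_le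
  have hx4 : Tendsto (fun L : ℝ => L ^ (1 / 4 : ℝ)) atTop atTop :=
    tendsto_rpow_atTop (by norm_num)
  have h1 : Tendsto (fun L : ℝ => 10 * C * B ^ 2 * (Real.log L ^ (2 : ℝ) / L ^ (1 / 20 : ℝ)))
      atTop (nhds (10 * C * B ^ 2 * 0)) :=
    ((isLittleO_log_rpow_rpow_atTop 2 (by norm_num : (0 : ℝ) < 1 / 20)).tendsto_div_nhds_zero).const_mul _
  have h2 : Tendsto (fun L : ℝ => 20 * B * (Real.log L ^ (1 : ℝ) / L ^ (1 / 4 : ℝ)))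
      atTop (nhds (20 * B * 0)) :=
    ((isLittleO_log_rpow_rpow_atTop 1 (by norm_num : (0 : ℝ) < 1 / 4)).tendsto_div_nhds_zero).const_mul _
  have h3 : Tendsto (fun L : ℝ => 600 * ((L ^ (1 / 4 : ℝ)) ^ 6 * Real.exp (-(L ^ (1 / 4 : ℝ)))))
      atTop (nhds (600 * 0)) :=
    ((Real.tendsto_pow_mul_exp_neg_atTop_nhds_zero 6).comp hx4).const_mul _
  rw [mul_zero] at h1 h2 h3
  filter_upwards [h1.eventually_lt_const one_pos, h2.eventually_lt_const one_pos,
    h3.eventually_lt_const one_pos, hx4.eventually_ge_atTop 2, eventually_ge_atTop (Real.exp 1)]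
    with L a1 a2 a3 a4 a5
  intro q _ χ hχ hq hL1
  have hL : 0 < L := (Real.exp_pos 1).trans_le a5
  have hlog : 1 ≤ Real.log L := by rwa [Real.le_log_iff_exp_le hL]
  set x := L ^ (1 / 4 : ℝ) with hx
  have hx0 : 0 < x := by linarith
  have hxL : L = x ^ 4 := by
    rw [hx, ← Real.rpow_natCast, ← Real.rpow_mul hL.le]; norm_num
  have hsq : √L = x ^ 2 := by
    rw [hxL, show x ^ 4 = (x ^ 2) ^ 2 by ring, Real.sqrt_sq (by positivity)]
  set l := B * Real.log L with hl
  have hl1 : 1 ≤ l := by nlinarith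
  have hqpos : (0 : ℝ) < q := by exact_mod_cast Nat.pos_of_ne_zero (NeZero.ne q)
  have hql : Real.log q ≤ l := by
    have := Real.log_le_log hqpos hq
    rwa [Real.log_rpow hL] at this
  have hxl : 20 * l ≤ x := by
    rw [Real.rpow_one, ← mul_div_assoc, div_lt_one hx0] at a2
    linarith
  have hl2 : 10 * C * l ^ 2 * L ^ (1 / 5 : ℝ) ≤ x := by
    have e1 : x = L ^ (1 / 20 : ℝ) * L ^ (1 / 5 : ℝ) := by
      rw [hx, ← Real.rpow_add hL]; norm_num
    rw [e1]
    gcongr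
    rw [← mul_div_assoc, div_lt_one (by positivity)] at a1
    have e2 : Real.log L ^ (2 : ℝ) = Real.log L ^ (2 : ℕ) := by
      rw [← Real.rpow_natCast]; norm_num
    rw [e2] at a1
    rw [hl, mul_pow]
    linarith
  have h5x : 5 / x ≤ 1 / (4 * l) := by
    rw [div_le_div_iff₀ hx0 (by linarith)]; linarith
  have hL5 : 0 < L ^ (1 / 5 : ℝ) := by positivity
  have hA : ∀ u v : ℝ, u ∈ Set.Icc (1 - 1 / x) (1 + 1 / x ^ 2) → v ∈ Set.Icc (-(4 / x)) (4 / x) →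
      χ.LFunction (u + v * I) ≠ 0 ∧
      ‖deriv χ.LFunction (u + v * I) / χ.LFunction (u + v * I)‖ ≤ x ^ 4 := by
    intro u v hu hv
    have hx2 : 1 / x ^ 2 ≤ 1 / x := by
      apply one_div_le_one_div_of_le hx0; nlinarith
    have hn : ‖(u + v * I : ℂ) - 1‖ ≤ 5 / x := by
      have e : (u + v * I : ℂ) - 1 = ((u - 1 : ℝ) : ℂ) + (v : ℂ) * I := by push_cast; ring
      rw [e]
      refine (norm_add_le _ _).trans ?_
      rw [norm_mul, norm_I, mul_one, norm_real, norm_real, Real.norm_eq_abs, Real.norm_eq_abs]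
      have e1 : |u - 1| ≤ 1 / x := abs_le.2 ⟨by linarith [hu.1], by linarith [hu.2]⟩
      have e2 : |v| ≤ 4 / x := abs_le.2 hv
      have e3 : 5 / x = 1 / x + 4 / x := by ring
      linarith
    obtain ⟨-, hd⟩ := hC q χ hχ l hl1 hql _ (hn.trans h5x)
    have hmv := (convex_closedBall (1 : ℂ) (5 / x)).norm_image_sub_le_of_norm_deriv_le
      (f := χ.LFunction) (C := C * l ^ 2) (x := 1) (y := (u + v * I : ℂ))
      (fun z _ => (DirichletCharacter.differentiable_LFunction hχ).differentiableAt)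
      (fun z hz => (hC q χ hχ l hl1 hql z
        (by rw [Metric.mem_closedBall, dist_eq_norm] at hz; exact hz.trans h5x)).2)
      (by simp; positivity) (by simpa [dist_eq_norm] using hn)
    have hsmall : C * l ^ 2 * (5 / x) ≤ L ^ (-(1 / 5 : ℝ)) / 2 := by
      rw [Real.rpow_neg hL.le]
      field_simp
      linarith
    have hlow : L ^ (-(1 / 5 : ℝ)) / 2 ≤ ‖χ.LFunction (u + v * I)‖ := by
      have e4 := norm_sub_norm_le (χ.LFunction 1) (χ.LFunction (u + v * I))
      rw [norm_sub_rev] at e4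
      have e5 : C * l ^ 2 * ‖(u + v * I : ℂ) - 1‖ ≤ C * l ^ 2 * (5 / x) := by gcongr
      linarith
    have hpos : 0 < L ^ (-(1 / 5 : ℝ)) / 2 := by positivity
    refine ⟨norm_pos_iff.1 (hpos.trans_le hlow), ?_⟩
    rw [norm_div, div_le_iff₀ (hpos.trans_le hlow)]
    calc _ ≤ C * l ^ 2 := hd
      _ ≤ x ^ 4 * (L ^ (-(1 / 5 : ℝ)) / 2) := by
          rw [Real.rpow_neg hL.le]
          have hx3 : 1 ≤ x ^ 3 := one_le_pow₀ (by linarith)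
          have : 2 * (C * l ^ 2 * L ^ (1 / 5 : ℝ)) ≤ x ^ 4 := by
            have e6 : x ≤ x ^ 4 := by nlinarith
            have e7 : 0 ≤ C * l ^ 2 * L ^ (1 / 5 : ℝ) := by positivity
            linarith
          field_simp
          linarith
      _ ≤ _ := by gcongr
  have hmain := norm_psi_le_of_zeroFree hχ (b := 1 / x) (c := 1 / x ^ 2) (T := 4 / x) (A := x ^ 4) hL
    (by positivity) (by rw [div_le_one hx0]; linarith) (by positivity)
    (by rw [div_le_one (by positivity)]; nlinarith) (by positivity) hA
  exact hmain.trans (contour_estimate hL a4 hxL hsq a3)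

end BoundedGaps

namespace BoundedGaps

open Complex ComplexConjugate

/-- A duality form of the large sieve inequality. -/
theorem sum_norm_sq_le_of_almost_orthogonal {κ : Type*} [DecidableEq κ] (s : Finset κ)
    (N : Finset ℕ) (e : κ → ℕ → ℂ) (a : ℕ → ℂ) {H δ : ℝ}
    (hH : 0 ≤ H) (hδ : 0 ≤ δ) (hdiag : ∀ x ∈ s, ∑ n ∈ N, ‖e x n‖ ^ 2 ≤ H)
    (hoff : ∀ x ∈ s, ∀ y ∈ s, x ≠ y → ‖∑ n ∈ N, e x n * conj (e y n)‖ ≤ δ) :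
    ∑ x ∈ s, ‖∑ n ∈ N, a n * e x n‖ ^ 2 ≤ (H + s.card * δ) * ∑ n ∈ N, ‖a n‖ ^ 2 := by
  set S : κ → ℂ := fun x => ∑ n ∈ N, a n * e x n with hS
  set T := ∑ x ∈ s, ‖S x‖ ^ 2 with hT
  have hT0 : 0 ≤ T := Finset.sum_nonneg fun _ _ => by positivity
  set D : ℕ → ℂ := fun n => ∑ x ∈ s, conj (S x) * e x n with hD
  have h1 : (T : ℂ) = ∑ n ∈ N, a n * D n := by
    simp only [hT, hD, Finset.mul_sum]
    rw [Finset.sum_comm]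
    push_cast
    refine Finset.sum_congr rfl fun x _ => ?_
    rw [← Complex.conj_mul' (S x)]
    conv_lhs => rw [hS]
    simp only [Finset.mul_sum]
    refine Finset.sum_congr rfl fun n _ => ?_
    simp only [hS]
    ring
  have h2 : T ^ 2 ≤ (∑ n ∈ N, ‖a n‖ ^ 2) * ∑ n ∈ N, ‖D n‖ ^ 2 := by
    have : T ≤ ∑ n ∈ N, ‖a n‖ * ‖D n‖ := by
      have e1 : T = ‖(T : ℂ)‖ := by rw [norm_real, Real.norm_of_nonneg hT0]
      rw [e1, h1]
      exact (norm_sum_le _ _).trans (Finset.sum_le_sum fun n _ => (norm_mul _ _).le)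
    calc T ^ 2 ≤ (∑ n ∈ N, ‖a n‖ * ‖D n‖) ^ 2 := by gcongr
      _ ≤ _ := Finset.sum_mul_sq_le_sq_mul_sq _ _ _
  have h3 : ∑ n ∈ N, ‖D n‖ ^ 2 ≤ (H + s.card * δ) * T := by
    have e1 : ((∑ n ∈ N, ‖D n‖ ^ 2 : ℝ) : ℂ) =
        ∑ x ∈ s, ∑ y ∈ s, conj (S x) * S y * ∑ n ∈ N, e x n * conj (e y n) := by
      push_cast
      simp only [Finset.mul_sum]
      rw [Finset.sum_congr rfl fun x _ => Finset.sum_comm, Finset.sum_comm]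
      refine Finset.sum_congr rfl fun n _ => ?_
      rw [← Complex.mul_conj' (D n)]
      simp only [hD, map_sum, Finset.sum_mul_sum, map_mul, Complex.conj_conj]
      refine Finset.sum_congr rfl fun x _ => Finset.sum_congr rfl fun y _ => ?_
      ring
    have e2 : ∑ n ∈ N, ‖D n‖ ^ 2 = ‖((∑ n ∈ N, ‖D n‖ ^ 2 : ℝ) : ℂ)‖ := by
      rw [norm_real, Real.norm_of_nonneg (Finset.sum_nonneg fun _ _ => by positivity)]
    rw [e2, e1]
    have e3 : ∀ x ∈ s, ‖∑ y ∈ s, conj (S x) * S y * ∑ n ∈ N, e x n * conj (e y n)‖ ≤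
        H * ‖S x‖ ^ 2 + ∑ y ∈ s, δ * ((‖S x‖ ^ 2 + ‖S y‖ ^ 2) / 2) := by
      intro x hx
      have e4 : ∀ y ∈ s, ‖conj (S x) * S y * ∑ n ∈ N, e x n * conj (e y n)‖ ≤
          (if y = x then H * ‖S x‖ ^ 2 else 0) + δ * ((‖S x‖ ^ 2 + ‖S y‖ ^ 2) / 2) := by
        intro y hy
        rw [norm_mul, norm_mul, RCLike.norm_conj]
        split_ifs with hxy
        · subst hxy
          have : ‖∑ n ∈ N, e y n * conj (e y n)‖ ≤ H := by
            refine le_trans (norm_sum_le_of_le _ fun n _ => ?_) (hdiag y hy)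
            rw [norm_mul, RCLike.norm_conj, sq]
          have h0 : 0 ≤ δ * ((‖S y‖ ^ 2 + ‖S y‖ ^ 2) / 2) := by positivity
          have := mul_le_mul_of_nonneg_left this (mul_nonneg (norm_nonneg (S y)) (norm_nonneg (S y)))
          nlinarith
        · have := hoff x hx y hy (Ne.symm hxy)
          have h5 : ‖S x‖ * ‖S y‖ ≤ (‖S x‖ ^ 2 + ‖S y‖ ^ 2) / 2 := by
            nlinarith [sq_nonneg (‖S x‖ - ‖S y‖)]
          rw [zero_add, mul_comm δ]
          gcongr
      refine (norm_sum_le_of_le _ e4).trans (le_of_eq ?_)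
      rw [Finset.sum_add_distrib, Finset.sum_ite_eq' s x, if_pos hx]
    refine (norm_sum_le_of_le _ e3).trans (le_of_eq ?_)
    simp only [Finset.sum_add_distrib, ← Finset.mul_sum, ← Finset.sum_div, Finset.sum_const,
      nsmul_eq_mul, ← hT]
    ring
  by_cases hTz : T = 0
  · rw [hTz]
    positivity
  · have hTp : 0 < T := lt_of_le_of_ne hT0 (Ne.symm hTz)
    have h5 : 0 ≤ ∑ n ∈ N, ‖a n‖ ^ 2 := Finset.sum_nonneg fun _ _ => by positivity
    have : T * T ≤ ((H + s.card * δ) * ∑ n ∈ N, ‖a n‖ ^ 2) * T := by nlinarith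
    exact le_of_mul_le_mul_right this hTp

/-- Nonprincipal character sums weighted by an antitone function. -/
theorem norm_sum_char_mul_antitone_le {q : ℕ} [NeZero q] {χ : DirichletCharacter ℂ q} (hχ : χ ≠ 1)
    {f : ℕ → ℝ} (hf : Antitone f) (h0 : ∀ n, 0 ≤ f n) {N : ℕ} (hN : ∀ n, N ≤ n → f n = 0) :
    ‖∑ n ∈ Finset.range N, χ n * (f n : ℂ)‖ ≤ q * f 0 := by
  have hq : 0 < q := Nat.pos_of_ne_zero (NeZero.ne q)
  set M := (∑ n ∈ Finset.range N, f n) / q with hM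
  have h1 : ∑ n ∈ Finset.range N, χ n * (f n : ℂ) = ∑ a ∈ Finset.range q,
      χ a * ((∑ n ∈ Finset.range N with n ≡ a [MOD q], f n : ℝ) : ℂ) := by
    rw [← Finset.sum_fiberwise_of_maps_to (g := fun n => n % q) (t := Finset.range q)
      fun n _ => Finset.mem_range.2 (Nat.mod_lt n hq)]
    refine Finset.sum_congr rfl fun a ha => ?_
    push_cast
    rw [Finset.mul_sum]
    have haq := Nat.mod_eq_of_lt (Finset.mem_range.1 ha)
    refine Finset.sum_congr (Finset.filter_congr fun n _ => by rw [Nat.ModEq, haq]) fun n hn => ?_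
    rw [(ZMod.natCast_eq_natCast_iff n a q).2 (Finset.mem_filter.1 hn).2]
  have h2 : ∑ n ∈ Finset.range N, χ n * (f n : ℂ) = ∑ a ∈ Finset.range q,
      χ a * ((∑ n ∈ Finset.range N with n ≡ a [MOD q], f n - M : ℝ) : ℂ) := by
    rw [h1]
    simp only [ofReal_sub, mul_sub, Finset.sum_sub_distrib, ← Finset.sum_mul,
      sum_range_char_eq_zero hχ, zero_mul, sub_zero]
  rw [h2]
  refine (norm_sum_le_of_le (f := _) (n := fun _ => f 0) _ fun a _ => ?_).trans (by simp)
  rw [norm_mul, norm_real, Real.norm_eq_abs]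
  have e1 := χ.norm_le_one a
  have e2 := abs_sum_modEq_sub_le hf h0 hN hq a
  have := h0 0
  calc _ ≤ 1 * f 0 := by gcongr
    _ = _ := one_mul _

end BoundedGaps

namespace BoundedGaps

open Complex ArithmeticFunction

/-- The sum of `f χ` against the smooth weight. -/
noncomputable def charSum {q : ℕ} (L : ℝ) (χ : DirichletCharacter ℂ q)
    (f : ArithmeticFunction ℝ) : ℂ :=
  ∑ n ∈ Finset.Icc 1 (cut L), (f n : ℂ) * χ n * (om L n : ℂ)

theorem sum_conv_mul_eq (f g : ArithmeticFunction ℝ) (F : ℕ → ℂ) (N : ℕ) :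
    ∑ n ∈ Finset.Icc 1 N, (((f * g) n : ℝ) : ℂ) * F n =
      ∑ x ∈ Finset.Icc 1 N ×ˢ Finset.Icc 1 N with x.1 * x.2 ≤ N,
        (f x.1 : ℂ) * (g x.2 : ℂ) * F (x.1 * x.2) := by
  rw [← Finset.sum_fiberwise_of_maps_to (g := fun x : ℕ × ℕ => x.1 * x.2) (t := Finset.Icc 1 N)]
  · refine Finset.sum_congr rfl fun n hn => ?_
    obtain ⟨h1, h2⟩ := Finset.mem_Icc.1 hn
    rw [ArithmeticFunction.mul_apply]
    push_cast
    rw [Finset.sum_mul]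
    have hset : n.divisorsAntidiagonal = {x ∈ {x ∈ Finset.Icc 1 N ×ˢ Finset.Icc 1 N | x.1 * x.2 ≤ N} |
        x.1 * x.2 = n} := by
      ext ⟨a, b⟩
      simp only [Nat.mem_divisorsAntidiagonal, Finset.mem_filter, Finset.mem_product,
        Finset.mem_Icc]
      constructor
      · rintro ⟨rfl, h⟩
        have ha : 0 < a := Nat.pos_of_ne_zero (by rintro rfl; simp at h)
        have hb : 0 < b := Nat.pos_of_ne_zero (by rintro rfl; simp at h)
        exact ⟨⟨⟨⟨ha, by nlinarith⟩, hb, by nlinarith⟩, h2⟩, rfl⟩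
      · rintro ⟨-, h⟩
        exact ⟨h, by omega⟩
    rw [hset]
    refine Finset.sum_congr rfl fun x hx => ?_
    rw [(Finset.mem_filter.1 hx).2]
  · intro x hx
    obtain ⟨hx1, hx2⟩ := Finset.mem_filter.1 hx
    obtain ⟨h1, h2⟩ := Finset.mem_product.1 hx1
    exact Finset.mem_Icc.2 ⟨Nat.mul_pos (Finset.mem_Icc.1 h1).1 (Finset.mem_Icc.1 h2).1, hx2⟩

theorem sum_hyperbola_eq {M : Type*} [AddCommMonoid M] (F : ℕ × ℕ → M) (N : ℕ) :
    ∑ x ∈ Finset.Icc 1 N ×ˢ Finset.Icc 1 N with x.1 * x.2 ≤ N, F x =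
      ∑ d ∈ Finset.Icc 1 N, ∑ k ∈ Finset.Icc 1 (N / d), F (d, k) := by
  rw [Finset.sum_filter, Finset.sum_product]
  refine Finset.sum_congr rfl fun d hd => ?_
  rw [← Finset.sum_filter]
  refine Finset.sum_congr ?_ fun _ _ => rfl
  have hd1 := (Finset.mem_Icc.1 hd).1
  ext k
  simp only [Finset.mem_filter, Finset.mem_Icc, Nat.le_div_iff_mul_le hd1]
  constructor
  · rintro ⟨⟨h1, -⟩, h3⟩; exact ⟨h1, by rwa [mul_comm]⟩
  · rintro ⟨h1, h3⟩; exact ⟨⟨h1, by nlinarith⟩, by rwa [mul_comm]⟩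

theorem norm_charSum_conv_le {q : ℕ} {L : ℝ} {χ : DirichletCharacter ℂ q}
    (c g : ArithmeticFunction ℝ) {G : ℝ} (hG : ∀ d, 1 ≤ d →
      ‖∑ k ∈ Finset.Icc 1 (cut L / d), χ k * ((g k * om L (d * k) : ℝ) : ℂ)‖ ≤ G) :
    ‖charSum L χ (c * g)‖ ≤ (∑ d ∈ Finset.Icc 1 (cut L), |c d|) * G := by
  have h := sum_conv_mul_eq c g (fun n => χ n * (om L n : ℂ)) (cut L)
  simp only [← mul_assoc] at h
  rw [charSum, h, sum_hyperbola_eq, Finset.sum_mul]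
  refine norm_sum_le_of_le _ fun d hd => ?_
  have : ∑ k ∈ Finset.Icc 1 (cut L / d), (c d : ℂ) * (g k : ℂ) * χ ((d * k : ℕ) : ZMod q) *
      (om L (d * k) : ℂ) = (c d : ℂ) * χ d * ∑ k ∈ Finset.Icc 1 (cut L / d),
        χ k * ((g k * om L (d * k) : ℝ) : ℂ) := by
    rw [Finset.mul_sum]
    refine Finset.sum_congr rfl fun k _ => ?_
    push_cast
    rw [map_mul]
    ring
  rw [this, norm_mul, norm_mul, norm_real, Real.norm_eq_abs]
  have h1 := χ.norm_le_one d
  have h2 := hG d (Finset.mem_Icc.1 hd).1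
  have h3 := abs_nonneg (c d)
  have h4 : 0 ≤ G := (norm_nonneg _).trans h2
  calc _ ≤ |c d| * 1 * G := by gcongr
    _ = _ := by ring

theorem norm_sum_char_Icc_le {q : ℕ} [NeZero q] {χ : DirichletCharacter ℂ q} (hχ : χ ≠ 1)
    {f : ℕ → ℝ} {N : ℕ} (hf : ∀ m n, m ≤ n → n ≤ N → f n ≤ f m) (h0 : ∀ n ≤ N, 0 ≤ f n) :
    ‖∑ k ∈ Finset.Icc 1 N, χ k * (f k : ℂ)‖ ≤ q * f 0 := by
  have hq1 : q ≠ 1 := by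
    rintro rfl; exact hχ (Subsingleton.elim _ _)
  have := norm_sum_char_mul_antitone_le hχ (f := fun n => if n ≤ N then f n else 0) (N := N + 1)
    (by
      intro m n hmn
      dsimp only
      split_ifs with h1 h2 h2
      · exact hf m n hmn h1
      · omega
      · exact h0 m h2
      · exact le_rfl)
    (by intro n; split_ifs with h; exacts [h0 n h, le_rfl])
    (by intro n hn; simp; omega)
  simp only [zero_le, if_true] at this
  refine le_of_eq_of_le ?_ this
  congr 1
  have hne : ((0 : ℕ) : ZMod q) = 0 := by simp
  have hnt : Nontrivial (ZMod q) := ZMod.nontrivial_iff.2 hq1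
  rw [Finset.range_eq_Ico, Finset.sum_eq_sum_Ico_succ_bot (by omega), hne, χ.map_zero, zero_mul,
    zero_add]
  refine Finset.sum_congr (by ext; simp) fun k hk => ?_
  rw [if_pos (by simp at hk; omega)]

theorem log_cut_le {L : ℝ} (hL : 0 ≤ L) : Real.log (cut L) ≤ 5 * L := by
  rcases Nat.eq_zero_or_pos (cut L) with h | h
  · simp [h]; linarith
  · rw [Real.log_le_iff_le_exp (by exact_mod_cast h)]
    exact Nat.floor_le (Real.exp_pos _).le

theorem norm_charSum_conv_zeta_le {q : ℕ} [NeZero q] {L : ℝ} (hL : 0 < L)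
    {χ : DirichletCharacter ℂ q} (hχ : χ ≠ 1) (c : ArithmeticFunction ℝ) :
    ‖charSum L χ (c * (zeta : ArithmeticFunction ℝ))‖ ≤
      (∑ d ∈ Finset.Icc 1 (cut L), |c d|) * q := by
  refine norm_charSum_conv_le _ _ fun d hd => ?_
  have := norm_sum_char_Icc_le hχ (f := fun k => om L (d * k)) (N := cut L / d)
    (fun m n hmn _ => om_antitone hL (Nat.mul_le_mul_left d hmn)) fun n _ => (om_pos _ _).le
  simp only [mul_zero, om_zero, mul_one] at this
  refine le_of_eq_of_le ?_ this
  congr 1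
  refine Finset.sum_congr rfl fun k hk => ?_
  have : k ≠ 0 := by have := (Finset.mem_Icc.1 hk).1; omega
  simp [natCoe_apply, zeta_apply, this]

theorem norm_charSum_conv_log_le {q : ℕ} [NeZero q] {L : ℝ} (hL : 0 < L)
    {χ : DirichletCharacter ℂ q} (hχ : χ ≠ 1) (c : ArithmeticFunction ℝ) :
    ‖charSum L χ (c * ArithmeticFunction.log)‖ ≤ (∑ d ∈ Finset.Icc 1 (cut L), |c d|) * (10 * L * q) := by
  refine norm_charSum_conv_le _ _ fun d hd => ?_
  have hle : ∀ n ≤ cut L / d, Real.log n ≤ 5 * L := fun n hn =>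
    (log_natCast_mono (hn.trans (Nat.div_le_self _ _))).trans (log_cut_le hL.le)
  have h1 := norm_sum_char_Icc_le hχ (f := fun k => 5 * L * om L (d * k)) (N := cut L / d)
    (fun m n hmn _ => mul_le_mul_of_nonneg_left (om_antitone hL (Nat.mul_le_mul_left d hmn))
      (by positivity)) fun n _ => mul_nonneg (by positivity) (om_pos _ _).le
  have h2 := norm_sum_char_Icc_le hχ (f := fun k => (5 * L - Real.log k) * om L (d * k))
    (N := cut L / d)
    (fun m n hmn hn => mul_le_mul (by linarith [log_natCast_mono hmn])
      (om_antitone hL (Nat.mul_le_mul_left d hmn)) (om_pos _ _).le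
      (by linarith [hle m (hmn.trans hn)]))
    fun n hn => mul_nonneg (by linarith [hle n hn]) (om_pos _ _).le
  simp only [mul_zero, om_zero, mul_one, Nat.cast_zero, Real.log_zero, sub_zero] at h1 h2
  have e : ∑ k ∈ Finset.Icc 1 (cut L / d), χ k * ((ArithmeticFunction.log k * om L (d * k) : ℝ) : ℂ) =
      ∑ k ∈ Finset.Icc 1 (cut L / d), χ k * ((5 * L * om L (d * k) : ℝ) : ℂ) -
      ∑ k ∈ Finset.Icc 1 (cut L / d), χ k * (((5 * L - Real.log k) * om L (d * k) : ℝ) : ℂ) := by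
    rw [← Finset.sum_sub_distrib]
    refine Finset.sum_congr rfl fun k _ => ?_
    rw [log_apply]
    push_cast
    ring
  rw [e]
  refine (norm_sub_le _ _).trans ?_
  linarith

end BoundedGaps

namespace BoundedGaps

open Complex ArithmeticFunction ComplexConjugate MeasureTheory

/-- A Dirichlet polynomial of length `cut L` on the line `Re s = 1`. -/
noncomputable def linePoly {q : ℕ} (L : ℝ) (χ : DirichletCharacter ℂ q) (f : ArithmeticFunction ℝ)
    (t : ℝ) : ℂ :=
  ∑ n ∈ Finset.Icc 1 (cut L), (f n : ℂ) * χ n * (n : ℂ) ^ (-((1 : ℝ) + t * I : ℂ))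

theorem sum_inv_cut_le {L : ℝ} (hL : 0 ≤ L) :
    ∑ n ∈ Finset.Icc 1 (cut L), (n : ℝ)⁻¹ ≤ 1 + 5 * L := by
  have h := harmonic_le_one_add_log (cut L)
  rw [harmonic_eq_sum_Icc] at h
  push_cast at h
  linarith [log_cut_le hL]

theorem norm_sum_twist_inv_le {q₁ q₂ : ℕ} [NeZero q₁] [NeZero q₂] {χ₁ : DirichletCharacter ℂ q₁}
    {χ₂ : DirichletCharacter ℂ q₂} (h : twist χ₁ χ₂ ≠ 1) {U : ℕ} (hU : 0 < U) (N : ℕ) :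
    ‖∑ n ∈ Finset.Ioc U N, χ₁ n * conj (χ₂ n) * ((n : ℝ)⁻¹ : ℝ)‖ ≤ 2 * (q₁ * q₂) / U := by
  rcases le_or_gt N U with hNU | hNU
  · rw [Finset.Ioc_eq_empty (by omega)]
    simp; positivity
  have hU' : (0 : ℝ) < U := by exact_mod_cast hU
  have h1 := norm_sum_char_Icc_le h (f := fun n => ((max n U : ℕ) : ℝ)⁻¹) (N := N)
    (fun m n hmn _ => inv_anti₀ (by exact_mod_cast (hU.trans_le (le_max_right _ _)))
      (by exact_mod_cast max_le_max hmn le_rfl)) fun n _ => by positivity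
  have h2 := norm_sum_char_Icc_le h (f := fun n => (U : ℝ)⁻¹) (N := U)
    (fun m n hmn _ => le_rfl) fun n _ => by positivity
  simp only [zero_le, max_eq_right] at h1
  have e : ∑ n ∈ Finset.Ioc U N, χ₁ n * conj (χ₂ n) * ((n : ℝ)⁻¹ : ℝ) =
      ∑ n ∈ Finset.Icc 1 N, twist χ₁ χ₂ n * ((((max n U : ℕ) : ℝ)⁻¹ : ℝ) : ℂ) -
      ∑ n ∈ Finset.Icc 1 U, twist χ₁ χ₂ n * (((U : ℝ)⁻¹ : ℝ) : ℂ) := by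
    have hd : Disjoint (Finset.Icc 1 U) (Finset.Ioc U N) := by
      rw [Finset.disjoint_left]; intro a; simp; omega
    have hun : Finset.Icc 1 N = Finset.Icc 1 U ∪ Finset.Ioc U N := by
      ext a; simp; omega
    rw [hun, Finset.sum_union hd]
    have e1 : ∑ n ∈ Finset.Icc 1 U, twist χ₁ χ₂ n * ((((max n U : ℕ) : ℝ)⁻¹ : ℝ) : ℂ) =
        ∑ n ∈ Finset.Icc 1 U, twist χ₁ χ₂ n * (((U : ℝ)⁻¹ : ℝ) : ℂ) :=
      Finset.sum_congr rfl fun n hn => by rw [max_eq_right (Finset.mem_Icc.1 hn).2]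
    rw [e1, add_sub_cancel_left]
    refine Finset.sum_congr rfl fun n hn => ?_
    rw [max_eq_left (Finset.mem_Ioc.1 hn).1.le, twist_apply]
  rw [e]
  refine (norm_sub_le _ _).trans ((add_le_add h1 h2).trans (le_of_eq ?_))
  push_cast
  field_simp
  ring

theorem sum_norm_linePoly_sq_le {L : ℝ} (hL : 0 ≤ L) {Q U : ℕ} (hU : 0 < U)
    (s : Finset (Σ q, DirichletCharacter ℂ q))
    (hs : ∀ c ∈ s, 1 ≤ c.1 ∧ c.1 ≤ Q ∧ c.2.IsPrimitive) {f : ArithmeticFunction ℝ}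
    (hf : ∀ n ≤ U, f n = 0) (t : ℝ) :
    ∑ c ∈ s, ‖linePoly L c.2 f t‖ ^ 2 ≤ (1 + 5 * L + s.card * (2 * (Q * Q) / U)) *
      ∑ n ∈ Finset.Icc 1 (cut L), f n ^ 2 / n := by
  classical
  have hsub : Finset.Ioc U (cut L) ⊆ Finset.Icc 1 (cut L) := fun n hn => by
    simp at hn ⊢; omega
  set e : (Σ q, DirichletCharacter ℂ q) → ℕ → ℂ := fun c n => c.2 n * ((√(n : ℝ))⁻¹ : ℝ) with he
  set a : ℕ → ℂ := fun n => (f n : ℂ) * (((√(n : ℝ))⁻¹ : ℝ) * (n : ℂ) ^ (-(t * I : ℂ))) with ha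
  have hline : ∀ c ∈ s, linePoly L c.2 f t = ∑ n ∈ Finset.Ioc U (cut L), a n * e c n := by
    intro c _
    rw [linePoly, ← Finset.sum_subset hsub]
    · refine Finset.sum_congr rfl fun n hn => ?_
      have hn0 : 0 < n := by simp at hn; omega
      have hn0' : (n : ℂ) ≠ 0 := by exact_mod_cast hn0.ne'
      rw [neg_add, Complex.cpow_add _ _ hn0', ofReal_one, Complex.cpow_neg_one]
      have : (n : ℂ)⁻¹ = ((√(n : ℝ))⁻¹ : ℝ) * ((√(n : ℝ))⁻¹ : ℝ) := by
        rw [← ofReal_mul, ← mul_inv, Real.mul_self_sqrt (by positivity)]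
        push_cast; rfl
      rw [this]
      simp only [ha, he]
      ring
    · intro n hn hn2
      have : n ≤ U := by
        by_contra h
        exact hn2 (Finset.mem_Ioc.2 ⟨by omega, (Finset.mem_Icc.1 hn).2⟩)
      simp [hf n this]
  rw [Finset.sum_congr rfl fun c hc => by rw [hline c hc]]
  have hsq : ∀ n : ℕ, ((√(n : ℝ))⁻¹) ^ 2 = (n : ℝ)⁻¹ := fun n => by
    rw [inv_pow, Real.sq_sqrt (by positivity)]
  refine (sum_norm_sq_le_of_almost_orthogonal s _ e a (H := 1 + 5 * L) (δ := 2 * (Q * Q) / U)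
    (by positivity) (by positivity) ?_ ?_).trans ?_
  · intro c _
    refine le_trans ?_ (sum_inv_cut_le hL)
    refine (Finset.sum_le_sum fun n _ => ?_).trans
      (Finset.sum_le_sum_of_subset_of_nonneg hsub fun n _ _ => by positivity)
    simp only [he]
    rw [norm_mul, mul_pow, norm_real, Real.norm_of_nonneg (by positivity), hsq]
    have := c.2.norm_le_one n
    have h2 : ‖c.2 (n : ZMod c.1)‖ ^ 2 ≤ 1 := pow_le_one₀ (norm_nonneg _) this
    have h3 : (0 : ℝ) ≤ (n : ℝ)⁻¹ := by positivity
    nlinarith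
  · rintro ⟨q₁, χ₁⟩ hx ⟨q₂, χ₂⟩ hy hxy
    obtain ⟨a1, a2, a3⟩ := hs _ hx
    obtain ⟨b1, b2, b3⟩ := hs _ hy
    dsimp only at a1 a2 a3 b1 b2 b3
    have : NeZero q₁ := ⟨by omega⟩
    have : NeZero q₂ := ⟨by omega⟩
    have h := norm_sum_twist_inv_le (twist_ne_one a3 b3 hxy) hU (cut L)
    have e1 : ∑ n ∈ Finset.Ioc U (cut L), e ⟨q₁, χ₁⟩ n * conj (e ⟨q₂, χ₂⟩ n) =
        ∑ n ∈ Finset.Ioc U (cut L), χ₁ n * conj (χ₂ n) * ((n : ℝ)⁻¹ : ℝ) := by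
      refine Finset.sum_congr rfl fun n _ => ?_
      simp only [he, map_mul, conj_ofReal]
      rw [← hsq n]
      push_cast
      ring
    rw [e1]
    refine h.trans ?_
    have a2' : (q₁ : ℝ) ≤ Q := by exact_mod_cast a2
    have b2' : (q₂ : ℝ) ≤ Q := by exact_mod_cast b2
    gcongr
  · refine mul_le_mul_of_nonneg_left ?_ (by positivity)
    refine (Finset.sum_le_sum fun n hn => ?_).trans
      (Finset.sum_le_sum_of_subset_of_nonneg hsub fun n _ _ => by positivity)
    have hn0 : 0 < n := by simp at hn; omega
    simp only [ha]
    rw [norm_mul, norm_mul, norm_real, norm_real, Real.norm_eq_abs, Real.norm_eq_abs, mul_pow,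
      mul_pow, sq_abs, sq_abs, hsq]
    have : ‖(n : ℂ) ^ (-(t * I : ℂ))‖ = 1 := by
      rw [Complex.norm_natCast_cpow_of_pos hn0]; simp
    rw [this]
    simp [div_eq_mul_inv]

end BoundedGaps

namespace BoundedGaps

open Complex ArithmeticFunction MeasureTheory

/-- The bilinear form obtained from `charSum` of a convolution by dropping the condition
`m * l ≤ cut L`. -/
noncomputable def boxSum {q : ℕ} (L : ℝ) (χ : DirichletCharacter ℂ q) (f g : ArithmeticFunction ℝ) :
    ℂ :=
  ∑ x ∈ Finset.Icc 1 (cut L) ×ˢ Finset.Icc 1 (cut L),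
    (f x.1 : ℂ) * (g x.2 : ℂ) * (χ (x.1 * x.2 : ℕ) * (om L (x.1 * x.2) : ℂ))

theorem om_le_of_cut_lt {L : ℝ} (hL : 0 < L) {n : ℕ} (hn : cut L < n) :
    om L n ≤ (n : ℝ) ^ (-(5 / 2 : ℝ)) := by
  have hn0 : (0 : ℝ) < n := by exact_mod_cast (Nat.zero_le _).trans_lt hn
  have h1 : 5 * L ≤ Real.log n := by
    rw [Real.le_log_iff_exp_le hn0]
    exact (Nat.lt_of_floor_lt hn).le
  rw [om, Real.rpow_def_of_pos hn0]
  apply Real.exp_le_exp.2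
  rw [neg_div, mul_neg, neg_le_neg_iff, le_div_iff₀ (by positivity)]
  nlinarith

theorem norm_charSum_sub_boxSum_le {q : ℕ} {L : ℝ} (hL : 0 < L) (χ : DirichletCharacter ℂ q)
    {f g : ArithmeticFunction ℝ} (hf : ∀ n, |f n| ≤ n) (hg : ∀ n, |g n| ≤ n) :
    ‖charSum L χ (f * g) - boxSum L χ f g‖ ≤ 16 := by
  have h := sum_conv_mul_eq f g (fun n => χ n * (om L n : ℂ)) (cut L)
  rw [charSum, boxSum]
  simp only [mul_assoc] at h ⊢
  rw [h, ← Finset.sum_filter_add_sum_filter_not (Finset.Icc 1 (cut L) ×ˢ Finset.Icc 1 (cut L))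
    (fun x => x.1 * x.2 ≤ cut L), sub_add_cancel_left, norm_neg]
  have hpt : ∀ x ∈ Finset.filter (fun x : ℕ × ℕ => ¬ x.1 * x.2 ≤ cut L)
      (Finset.Icc 1 (cut L) ×ˢ Finset.Icc 1 (cut L)),
      ‖(f x.1 : ℂ) * ((g x.2 : ℂ) * (χ (x.1 * x.2 : ℕ) * (om L (x.1 * x.2) : ℂ)))‖ ≤
        (x.1 : ℝ) ^ (-(1 + 1 / 2 : ℝ)) * (x.2 : ℝ) ^ (-(1 + 1 / 2 : ℝ)) := by
    intro x hx
    obtain ⟨hx1, hx2⟩ := Finset.mem_filter.1 hx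
    obtain ⟨ha, hb⟩ := Finset.mem_product.1 hx1
    have ha0 : (0 : ℝ) < x.1 := by exact_mod_cast (Finset.mem_Icc.1 ha).1
    have hb0 : (0 : ℝ) < x.2 := by exact_mod_cast (Finset.mem_Icc.1 hb).1
    have hom := om_le_of_cut_lt hL (not_le.1 hx2)
    rw [norm_mul, norm_mul, norm_mul, norm_real, norm_real, norm_real, Real.norm_eq_abs,
      Real.norm_eq_abs, Real.norm_of_nonneg (om_pos _ _).le]
    have h1 := χ.norm_le_one (x.1 * x.2 : ℕ)
    have e1 : ∀ y : ℝ, 0 < y → y ^ (-(1 + 1 / 2 : ℝ)) = y * y ^ (-(5 / 2 : ℝ)) := fun y hy => by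
      rw [← Real.rpow_one_add' hy.le (by norm_num)]; norm_num
    have h0 := (om_pos L (x.1 * x.2)).le
    calc _ ≤ (x.1 : ℝ) * (x.2 * (1 * ((x.1 * x.2 : ℕ) : ℝ) ^ (-(5 / 2 : ℝ)))) := by
          gcongr
          exacts [hf _, hg _]
      _ = _ := by
          push_cast
          rw [Real.mul_rpow ha0.le hb0.le, e1 _ ha0, e1 _ hb0]
          ring
  refine (norm_sum_le_of_le _ hpt).trans ?_
  refine (Finset.sum_le_sum_of_subset_of_nonneg (Finset.filter_subset _ _)
    fun _ _ _ => by positivity).trans ?_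
  rw [Finset.sum_product]
  dsimp only
  rw [← Finset.sum_mul_sum]
  have hs : ∑ n ∈ Finset.Icc 1 (cut L), (n : ℝ) ^ (-(1 + 1 / 2 : ℝ)) ≤ 4 := by
    refine ((summable_rpow_neg (by norm_num)).sum_le_tsum _ fun n _ => by positivity).trans
      ((tsum_rpow_neg_le (by norm_num) (by norm_num)).trans (by norm_num))
  have hs0 : 0 ≤ ∑ n ∈ Finset.Icc 1 (cut L), (n : ℝ) ^ (-(1 + 1 / 2 : ℝ)) :=
    Finset.sum_nonneg fun _ _ => by positivity
  nlinarith

theorem gaussian_mul_linePoly_eq {q : ℕ} (L : ℝ) (χ : DirichletCharacter ℂ q)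
    (f g : ArithmeticFunction ℝ) (t : ℝ) :
    cexp (L * ((1 : ℝ) + t * I) ^ 2 / 2) * (linePoly L χ f t * linePoly L χ g t) =
      ∑ x ∈ Finset.Icc 1 (cut L) ×ˢ Finset.Icc 1 (cut L),
        (f x.1 : ℂ) * (g x.2 : ℂ) * χ (x.1 * x.2 : ℕ) *
          (cexp (L * ((1 : ℝ) + t * I) ^ 2 / 2) *
            ((x.1 * x.2 : ℕ) : ℂ) ^ (-((1 : ℝ) + t * I : ℂ))) := by
  rw [linePoly, linePoly, Finset.sum_mul_sum, ← Finset.sum_product', Finset.mul_sum]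
  refine Finset.sum_congr rfl fun x _ => ?_
  push_cast
  rw [Complex.natCast_mul_natCast_cpow, map_mul]
  ring

theorem integrable_gaussian_mul_linePoly {q : ℕ} {L : ℝ} (hL : 0 < L) (χ : DirichletCharacter ℂ q)
    (f g : ArithmeticFunction ℝ) : Integrable fun t : ℝ =>
      cexp (L * ((1 : ℝ) + t * I) ^ 2 / 2) * (linePoly L χ f t * linePoly L χ g t) := by
  simp only [gaussian_mul_linePoly_eq]
  refine integrable_finsetSum _ fun x hx => ?_
  obtain ⟨ha, hb⟩ := Finset.mem_product.1 hx
  exact (integrable_gaussian_mul_cpow hL 1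
    (Nat.mul_pos (Finset.mem_Icc.1 ha).1 (Finset.mem_Icc.1 hb).1)).const_mul _

theorem boxSum_eq_integral {q : ℕ} {L : ℝ} (hL : 0 < L) (χ : DirichletCharacter ℂ q)
    (f g : ArithmeticFunction ℝ) : boxSum L χ f g = (√(L / (2 * Real.pi)) : ℝ) * ∫ t : ℝ,
      cexp (L * ((1 : ℝ) + t * I) ^ 2 / 2) * (linePoly L χ f t * linePoly L χ g t) := by
  simp only [gaussian_mul_linePoly_eq, boxSum]
  have hpos : ∀ x ∈ Finset.Icc 1 (cut L) ×ˢ Finset.Icc 1 (cut L), 0 < x.1 * x.2 := fun x hx => by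
    obtain ⟨ha, hb⟩ := Finset.mem_product.1 hx
    exact Nat.mul_pos (Finset.mem_Icc.1 ha).1 (Finset.mem_Icc.1 hb).1
  rw [integral_finsetSum _ fun x hx =>
    (integrable_gaussian_mul_cpow hL 1 (hpos x hx)).const_mul _, Finset.mul_sum]
  refine Finset.sum_congr rfl fun x hx => ?_
  rw [integral_const_mul, om_eq_integral hL 1 (hpos x hx)]
  ring

theorem sum_norm_boxSum_le {L : ℝ} (hL : 0 < L) (s : Finset (Σ q, DirichletCharacter ℂ q))
    (f g : ArithmeticFunction ℝ) {D : ℝ}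
    (hD : ∀ t, ∑ c ∈ s, ‖linePoly L c.2 f t‖ * ‖linePoly L c.2 g t‖ ≤ D) :
    ∑ c ∈ s, ‖boxSum L c.2 f g‖ ≤ Real.exp (L / 2) * D := by
  set F : (Σ q, DirichletCharacter ℂ q) → ℝ → ℂ := fun c t =>
    cexp (L * ((1 : ℝ) + t * I) ^ 2 / 2) * (linePoly L c.2 f t * linePoly L c.2 g t) with hF
  have hFi : ∀ c ∈ s, Integrable fun t => ‖F c t‖ := fun c _ =>
    (integrable_gaussian_mul_linePoly hL c.2 f g).norm
  have h1 : ∑ c ∈ s, ‖boxSum L c.2 f g‖ ≤ √(L / (2 * Real.pi)) * ∫ t, ∑ c ∈ s, ‖F c t‖ := by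
    rw [integral_finsetSum _ hFi, Finset.mul_sum]
    refine Finset.sum_le_sum fun c _ => ?_
    rw [boxSum_eq_integral hL, norm_mul, norm_real, Real.norm_of_nonneg (Real.sqrt_nonneg _)]
    exact mul_le_mul_of_nonneg_left (norm_integral_le_integral_norm _) (Real.sqrt_nonneg _)
  have h2 : ∫ t, ∑ c ∈ s, ‖F c t‖ ≤
      ∫ t : ℝ, Real.exp (L / 2) * D * Real.exp (-(L / 2) * t ^ 2) := by
    refine integral_mono (integrable_finsetSum _ hFi)
      ((integrable_exp_neg_mul_sq (half_pos hL)).const_mul _) fun t => ?_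
    have e : Real.exp (L * ((1 : ℝ) ^ 2 - t ^ 2) / 2) =
        Real.exp (L / 2) * Real.exp (-(L / 2) * t ^ 2) := by
      rw [← Real.exp_add]; congr 1; ring
    simp only [hF, norm_mul, norm_cexp_gaussian, e]
    rw [← Finset.mul_sum]
    have := hD t
    calc _ ≤ Real.exp (L / 2) * Real.exp (-(L / 2) * t ^ 2) * D := by gcongr
      _ = _ := by ring
  rw [integral_const_mul, integral_gaussian] at h2
  refine h1.trans ((mul_le_mul_of_nonneg_left h2 (Real.sqrt_nonneg _)).trans (le_of_eq ?_))
  have h3 : √(L / (2 * Real.pi)) * √(Real.pi / (L / 2)) = 1 := by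
    rw [← Real.sqrt_mul (by positivity)]
    have := Real.pi_pos.ne'
    rw [show L / (2 * Real.pi) * (Real.pi / (L / 2)) = 1 by field_simp, Real.sqrt_one]
  linear_combination Real.exp (L / 2) * D * h3

theorem sum_norm_charSum_bilinear_le {L : ℝ} (hL : 0 < L) {Q U : ℕ} (hU : 0 < U)
    (s : Finset (Σ q, DirichletCharacter ℂ q))
    (hs : ∀ c ∈ s, 1 ≤ c.1 ∧ c.1 ≤ Q ∧ c.2.IsPrimitive) {f g : ArithmeticFunction ℝ}
    (hf : ∀ n ≤ U, f n = 0) (hg : ∀ n ≤ U, g n = 0) (hfn : ∀ n, |f n| ≤ n) (hgn : ∀ n, |g n| ≤ n)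
    {A B : ℝ} (hA : 0 ≤ A) (hB : 0 ≤ B)
    (hfA : ∑ n ∈ Finset.Icc 1 (cut L), f n ^ 2 / n ≤ A ^ 2)
    (hgB : ∑ n ∈ Finset.Icc 1 (cut L), g n ^ 2 / n ≤ B ^ 2) :
    ∑ c ∈ s, ‖charSum L c.2 (f * g)‖ ≤
      Real.exp (L / 2) * ((1 + 5 * L + s.card * (2 * (Q * Q) / U)) * (A * B)) + s.card * 16 := by
  set G : ℝ := 1 + 5 * L + s.card * (2 * (Q * Q) / U) with hG
  have hG0 : 0 ≤ G := by positivity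
  have hbox := sum_norm_boxSum_le hL s f g (D := G * (A * B)) fun t => by
    have h1 := sum_norm_linePoly_sq_le hL.le hU s hs hf t
    have h2 := sum_norm_linePoly_sq_le hL.le hU s hs hg t
    have h3 := Finset.sum_mul_sq_le_sq_mul_sq s (fun c => ‖linePoly L c.2 f t‖)
      (fun c => ‖linePoly L c.2 g t‖)
    refine abs_le_of_sq_le_sq' ?_ (by positivity) |>.2
    calc _ ≤ _ := h3
      _ ≤ (G * A ^ 2) * (G * B ^ 2) := by
          refine mul_le_mul (h1.trans ?_) (h2.trans ?_) (Finset.sum_nonneg fun _ _ => by positivity)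
            (by positivity)
          · gcongr
          · gcongr
      _ = _ := by ring
  have : ∑ c ∈ s, ‖charSum L c.2 (f * g)‖ ≤ ∑ c ∈ s, (‖boxSum L c.2 f g‖ + 16) :=
    Finset.sum_le_sum fun c _ => by
      have := norm_charSum_sub_boxSum_le hL c.2 hfn hgn
      have h2 := norm_sub_norm_le (charSum L c.2 (f * g)) (boxSum L c.2 f g)
      linarith
  refine this.trans ?_
  rw [Finset.sum_add_distrib, Finset.sum_const, nsmul_eq_mul]
  gcongr

end BoundedGaps

namespace BoundedGaps

open Complex ArithmeticFunction
open scoped ArithmeticFunction.zeta ArithmeticFunction.Moebius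

theorem sum_conv_le {f g : ArithmeticFunction ℝ} (hf : ∀ n, 0 ≤ f n) (hg : ∀ n, 0 ≤ g n) {F : ℕ → ℝ}
    (hF : ∀ n, 0 ≤ F n) (hmul : ∀ m n, F (m * n) = F m * F n) (N : ℕ) :
    ∑ n ∈ Finset.Icc 1 N, (f * g) n * F n ≤
      (∑ n ∈ Finset.Icc 1 N, f n * F n) * ∑ n ∈ Finset.Icc 1 N, g n * F n := by
  have h : ∑ n ∈ Finset.Icc 1 N, (f * g) n * F n =
      ∑ x ∈ Finset.Icc 1 N ×ˢ Finset.Icc 1 N with x.1 * x.2 ≤ N,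
        f x.1 * g x.2 * F (x.1 * x.2) := by
    exact_mod_cast sum_conv_mul_eq f g (fun n => (F n : ℂ)) N
  rw [h, Finset.sum_mul_sum, ← Finset.sum_product']
  refine (Finset.sum_le_sum_of_subset_of_nonneg (Finset.filter_subset _ _) fun x _ _ =>
    mul_nonneg (mul_nonneg (hf _) (hg _)) (hF _)).trans (Finset.sum_le_sum fun x _ => ?_)
  rw [hmul]
  exact le_of_eq (by ring)

/-- The absolute value of an arithmetic function. -/
noncomputable def absFun (f : ArithmeticFunction ℝ) : ArithmeticFunction ℝ :=
  ⟨fun n => |f n|, by simp⟩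

theorem absFun_apply (f : ArithmeticFunction ℝ) (n : ℕ) : absFun f n = |f n| := rfl

theorem sum_abs_conv_le (f g : ArithmeticFunction ℝ) (N : ℕ) :
    ∑ n ∈ Finset.Icc 1 N, |(f * g) n| ≤
      (∑ n ∈ Finset.Icc 1 N, |f n|) * ∑ n ∈ Finset.Icc 1 N, |g n| := by
  have h := sum_conv_le (f := absFun f) (g := absFun g) (F := fun _ => 1)
    (fun n => abs_nonneg _) (fun n => abs_nonneg _) (fun _ => zero_le_one) (by simp) N
  simp only [mul_one, absFun_apply] at h
  refine (Finset.sum_le_sum fun n _ => ?_).trans h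
  rw [mul_apply, mul_apply]
  refine (Finset.abs_sum_le_sum_abs _ _).trans (Finset.sum_le_sum fun x _ => ?_)
  rw [abs_mul]
  rfl

/-- The restriction of an arithmetic function to `n ≤ U`. -/
noncomputable def low (U : ℕ) (f : ArithmeticFunction ℝ) : ArithmeticFunction ℝ :=
  ⟨fun n => if n ≤ U then f n else 0, by simp⟩

theorem low_apply (U : ℕ) (f : ArithmeticFunction ℝ) (n : ℕ) :
    low U f n = if n ≤ U then f n else 0 := rfl

theorem arith_sub_apply (f g : ArithmeticFunction ℝ) (n : ℕ) : (f - g) n = f n - g n := by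
  have h : (f - g + g) n = f n := by rw [sub_add_cancel]
  rw [ArithmeticFunction.add_apply] at h
  linarith

theorem sub_low_apply (U : ℕ) (f : ArithmeticFunction ℝ) (n : ℕ) :
    (f - low U f) n = if n ≤ U then 0 else f n := by
  rw [arith_sub_apply, low_apply]
  split_ifs <;> simp

theorem sum_abs_low_le {U N : ℕ} {f : ArithmeticFunction ℝ} {B : ℝ} (hB : 0 ≤ B)
    (hf : ∀ n ∈ Finset.Icc 1 N, |f n| ≤ B) : ∑ n ∈ Finset.Icc 1 N, |low U f n| ≤ U * B := by
  have h1 : ∀ n ∈ Finset.Icc 1 N, |low U f n| ≤ if n ∈ Finset.Icc 1 U then B else 0 := by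
    intro n hn
    rw [low_apply]
    have := hf n hn
    have h2 := (Finset.mem_Icc.1 hn).1
    split_ifs with h3 h4 h4
    · exact this
    · exact absurd (Finset.mem_Icc.2 ⟨h2, h3⟩) h4
    · simpa using hB
    · simp
  refine (Finset.sum_le_sum h1).trans ?_
  rw [← Finset.sum_filter]
  refine (Finset.sum_le_sum_of_subset_of_nonneg (t := Finset.Icc 1 U)
    (fun n hn => (Finset.mem_filter.1 hn).2) fun _ _ _ => hB).trans ?_
  simp

/-- Vaughan's identity. -/
theorem vonMangoldt_eq_vaughan (U : ℕ) : (Λ : ArithmeticFunction ℝ) =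
    low U Λ + low U (μ : ArithmeticFunction ℝ) * ArithmeticFunction.log
      - low U Λ * low U (μ : ArithmeticFunction ℝ) * (ζ : ArithmeticFunction ℝ)
      + (Λ - low U Λ) * ((ζ : ArithmeticFunction ℝ) *
        ((μ : ArithmeticFunction ℝ) - low U (μ : ArithmeticFunction ℝ))) := by
  have h1 : (Λ : ArithmeticFunction ℝ) * (ζ : ArithmeticFunction ℝ) = ArithmeticFunction.log :=
    vonMangoldt_mul_zeta
  have h2 : (ζ : ArithmeticFunction ℝ) * (μ : ArithmeticFunction ℝ) = 1 := coe_zeta_mul_coe_moebius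
  rw [← h1]
  linear_combination (low U Λ - Λ) * h2

theorem charSum_add {q : ℕ} (L : ℝ) (χ : DirichletCharacter ℂ q) (f g : ArithmeticFunction ℝ) :
    charSum L χ (f + g) = charSum L χ f + charSum L χ g := by
  simp only [charSum, ← Finset.sum_add_distrib, ArithmeticFunction.add_apply]
  refine Finset.sum_congr rfl fun n _ => ?_
  push_cast; ring

theorem charSum_sub {q : ℕ} (L : ℝ) (χ : DirichletCharacter ℂ q) (f g : ArithmeticFunction ℝ) :
    charSum L χ (f - g) = charSum L χ f - charSum L χ g := by
  simp only [charSum, ← Finset.sum_sub_distrib, arith_sub_apply]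
  refine Finset.sum_congr rfl fun n _ => ?_
  push_cast; ring

theorem norm_charSum_le {q : ℕ} {L : ℝ} (hL : 0 < L) (χ : DirichletCharacter ℂ q)
    (f : ArithmeticFunction ℝ) : ‖charSum L χ f‖ ≤ ∑ n ∈ Finset.Icc 1 (cut L), |f n| := by
  refine norm_sum_le_of_le _ fun n _ => ?_
  rw [norm_mul, norm_mul, norm_real, norm_real, Real.norm_eq_abs, Real.norm_of_nonneg (om_pos _ _).le]
  have h1 := χ.norm_le_one n
  have h2 := om_le_one hL n
  have h3 := (om_pos L n).le
  calc _ ≤ |f n| * 1 * 1 := by gcongr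
    _ = _ := by ring

theorem abs_zeta_mul_le (U n : ℕ) :
    |((ζ : ArithmeticFunction ℝ) *
      ((μ : ArithmeticFunction ℝ) - low U (μ : ArithmeticFunction ℝ))) n| ≤ n.divisors.card := by
  rw [mul_comm, coe_mul_zeta_apply]
  refine (Finset.abs_sum_le_sum_abs _ _).trans ((Finset.sum_le_card_nsmul _ _ 1 fun d _ => ?_).trans
    (by simp))
  rw [sub_low_apply]
  split_ifs
  · simp
  · rw [intCoe_apply]
    exact_mod_cast abs_moebius_le_one

theorem card_divisors_sq_le (n : ℕ) : ((n.divisors.card : ℝ)) ^ 2 ≤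
    (((ζ : ArithmeticFunction ℝ) * ζ) * ((ζ : ArithmeticFunction ℝ) * ζ)) n := by
  have htau : ∀ d, ((ζ : ArithmeticFunction ℝ) * (ζ : ArithmeticFunction ℝ)) d = d.divisors.card := by
    intro d
    rw [coe_mul_zeta_apply]
    rw [Finset.sum_congr rfl fun i hi => by
      rw [natCoe_apply, zeta_apply, if_neg (Nat.pos_of_mem_divisors hi).ne']]
    simp
  rw [mul_apply]
  simp only [htau]
  have h1 : ∀ x ∈ n.divisorsAntidiagonal,
      (n.divisors.card : ℝ) ≤ x.1.divisors.card * x.2.divisors.card := by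
    intro x hx
    rw [← (Nat.mem_divisorsAntidiagonal.1 hx).1, Nat.divisors_mul]
    exact_mod_cast Finset.card_mul_le
  refine le_trans ?_ (Finset.sum_le_sum h1)
  rw [Finset.sum_const, nsmul_eq_mul, sq]
  have : n.divisorsAntidiagonal.card = n.divisors.card := by
    rw [← Nat.map_div_right_divisors, Finset.card_map]
  rw [this]

theorem sum_card_divisors_sq_div_le {L : ℝ} (hL : 0 ≤ L) :
    ∑ n ∈ Finset.Icc 1 (cut L), ((n.divisors.card : ℝ)) ^ 2 / n ≤ ((1 + 5 * L) ^ 2) ^ 2 := by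
  have hz : ∀ n, 0 ≤ (ζ : ArithmeticFunction ℝ) n := fun n => by
    rw [natCoe_apply]; positivity
  have hzz : ∀ n, 0 ≤ ((ζ : ArithmeticFunction ℝ) * (ζ : ArithmeticFunction ℝ)) n := fun n => by
    rw [mul_apply]; exact Finset.sum_nonneg fun x _ => mul_nonneg (hz _) (hz _)
  have hF : ∀ n : ℕ, 0 ≤ (n : ℝ)⁻¹ := fun n => by positivity
  have hm : ∀ m n : ℕ, ((m * n : ℕ) : ℝ)⁻¹ = (m : ℝ)⁻¹ * (n : ℝ)⁻¹ := fun m n => by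
    push_cast; rw [mul_inv]
  have h1 := sum_conv_le hz hz hF hm (cut L)
  have h2 := sum_conv_le hzz hzz hF hm (cut L)
  have h0 : ∑ n ∈ Finset.Icc 1 (cut L), (ζ : ArithmeticFunction ℝ) n * (n : ℝ)⁻¹ ≤ 1 + 5 * L := by
    refine (Finset.sum_le_sum fun n _ => ?_).trans (sum_inv_cut_le hL)
    have : (ζ : ArithmeticFunction ℝ) n ≤ 1 := by
      rw [natCoe_apply, zeta_apply]; split_ifs <;> simp
    have h3 : (0 : ℝ) ≤ (n : ℝ)⁻¹ := by positivity
    nlinarith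
  have h00 : 0 ≤ ∑ n ∈ Finset.Icc 1 (cut L), (ζ : ArithmeticFunction ℝ) n * (n : ℝ)⁻¹ :=
    Finset.sum_nonneg fun n _ => mul_nonneg (hz n) (hF n)
  have h01 : 0 ≤ ∑ n ∈ Finset.Icc 1 (cut L),
      ((ζ : ArithmeticFunction ℝ) * (ζ : ArithmeticFunction ℝ)) n * (n : ℝ)⁻¹ :=
    Finset.sum_nonneg fun n _ => mul_nonneg (hzz n) (hF n)
  have h11 : ∑ n ∈ Finset.Icc 1 (cut L),
      ((ζ : ArithmeticFunction ℝ) * (ζ : ArithmeticFunction ℝ)) n * (n : ℝ)⁻¹ ≤ (1 + 5 * L) ^ 2 :=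
    h1.trans (by rw [sq]; gcongr)
  refine le_trans (Finset.sum_le_sum fun n _ => ?_) (h2.trans (by rw [sq (_ ^ 2)]; gcongr))
  rw [div_eq_mul_inv]
  exact mul_le_mul_of_nonneg_right (card_divisors_sq_le n) (hF n)

theorem sum_vonMangoldt_sq_div_le {L : ℝ} (hL : 0 ≤ L) :
    ∑ n ∈ Finset.Icc 1 (cut L), Λ n ^ 2 / n ≤ ((1 + 5 * L) ^ 2) ^ 2 := by
  have h1 : ∀ n ∈ Finset.Icc 1 (cut L), Λ n ^ 2 / n ≤ (5 * L) ^ 2 * (n : ℝ)⁻¹ := by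
    intro n hn
    rw [div_eq_mul_inv]
    have h2 : Λ n ≤ 5 * L := vonMangoldt_le_log.trans
      ((log_natCast_mono (Finset.mem_Icc.1 hn).2).trans (log_cut_le hL))
    have h3 := vonMangoldt_nonneg (n := n)
    gcongr
  refine (Finset.sum_le_sum h1).trans ?_
  rw [← Finset.mul_sum]
  calc _ ≤ (5 * L) ^ 2 * (1 + 5 * L) := by gcongr; exact sum_inv_cut_le hL
    _ ≤ (1 + 5 * L) ^ 3 * (1 + 5 * L) := by
        gcongr
        nlinarith [pow_nonneg hL 3, pow_nonneg hL 2]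
    _ = _ := by ring

theorem sum_norm_psi_le_vaughan {L : ℝ} (hL : 0 < L) {Q U : ℕ} (hU : 0 < U)
    (s : Finset (Σ q, DirichletCharacter ℂ q))
    (hs : ∀ c ∈ s, 1 ≤ c.1 ∧ c.1 ≤ Q ∧ c.2.IsPrimitive ∧ c.2 ≠ 1) :
    ∑ c ∈ s, ‖psi L c.2‖ ≤
      s.card * (U * (5 * L) + U * (10 * L * Q) + U * (5 * L) * U * Q + 16)
      + Real.exp (L / 2) * ((1 + 5 * L + s.card * (2 * (Q * Q) / U)) * (1 + 5 * L) ^ 4) := by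
  set b : ArithmeticFunction ℝ := (ζ : ArithmeticFunction ℝ) *
    ((μ : ArithmeticFunction ℝ) - low U (μ : ArithmeticFunction ℝ)) with hb
  have hΛ : ∀ n ∈ Finset.Icc 1 (cut L), |Λ n| ≤ 5 * L := fun n hn => by
    rw [abs_of_nonneg vonMangoldt_nonneg]
    exact vonMangoldt_le_log.trans
      ((log_natCast_mono (Finset.mem_Icc.1 hn).2).trans (log_cut_le hL.le))
  have hS1 : ∑ n ∈ Finset.Icc 1 (cut L), |low U Λ n| ≤ U * (5 * L) :=
    sum_abs_low_le (by positivity) hΛ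
  have hS2 : ∑ n ∈ Finset.Icc 1 (cut L), |low U (μ : ArithmeticFunction ℝ) n| ≤ U := by
    refine (sum_abs_low_le zero_le_one fun n _ => ?_).trans (mul_one _).le
    rw [intCoe_apply]
    exact_mod_cast abs_moebius_le_one
  have hdecomp : ∀ c ∈ s, ‖psi L c.2‖ ≤
      (U * (5 * L) + U * (10 * L * Q) + U * (5 * L) * U * Q) +
        ‖charSum L c.2 ((Λ - low U Λ) * b)‖ := by
    rintro ⟨q, χ⟩ hc
    obtain ⟨h1, h2, -, h4⟩ := hs _ hc
    dsimp only at h1 h2 h4 ⊢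
    have : NeZero q := ⟨by omega⟩
    have hqQ : (q : ℝ) ≤ Q := by exact_mod_cast h2
    have e : psi L χ = charSum L χ Λ := rfl
    rw [e, vonMangoldt_eq_vaughan U, charSum_add, charSum_sub, charSum_add,
      ← vonMangoldt_eq_vaughan U]
    have n0 := (norm_charSum_le hL χ (low U Λ)).trans hS1
    have n1 : ‖charSum L χ (low U (μ : ArithmeticFunction ℝ) * ArithmeticFunction.log)‖ ≤
        U * (10 * L * Q) := by
      refine (norm_charSum_conv_log_le hL h4 _).trans ?_
      gcongr
    have n2 : ‖charSum L χ (low U Λ * low U (μ : ArithmeticFunction ℝ) *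
        (ζ : ArithmeticFunction ℝ))‖ ≤ U * (5 * L) * U * Q := by
      refine (norm_charSum_conv_zeta_le hL h4 _).trans ?_
      have := sum_abs_conv_le (low U Λ) (low U (μ : ArithmeticFunction ℝ)) (cut L)
      gcongr
      refine this.trans ?_
      gcongr
    refine (norm_add_le _ _).trans (add_le_add ?_ le_rfl)
    refine (norm_sub_le _ _).trans (add_le_add ?_ n2)
    exact (norm_add_le _ _).trans (add_le_add n0 n1)
  have hA : ∑ n ∈ Finset.Icc 1 (cut L), (Λ - low U Λ) n ^ 2 / n ≤ ((1 + 5 * L) ^ 2) ^ 2 := by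
    refine (Finset.sum_le_sum fun n _ => ?_).trans (sum_vonMangoldt_sq_div_le hL.le)
    refine div_le_div_of_nonneg_right ?_ (Nat.cast_nonneg n)
    rw [sub_low_apply]
    split_ifs
    · simp
    · exact le_rfl
  have hB : ∑ n ∈ Finset.Icc 1 (cut L), b n ^ 2 / n ≤ ((1 + 5 * L) ^ 2) ^ 2 := by
    refine (Finset.sum_le_sum fun n _ => ?_).trans (sum_card_divisors_sq_div_le hL.le)
    refine div_le_div_of_nonneg_right ?_ (Nat.cast_nonneg n)
    rw [← sq_abs]
    exact pow_le_pow_left₀ (abs_nonneg _) (abs_zeta_mul_le U n) 2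
  have hbil := sum_norm_charSum_bilinear_le hL hU s (fun c hc => ⟨(hs c hc).1, (hs c hc).2.1,
    (hs c hc).2.2.1⟩) (f := Λ - low U Λ) (g := b) (A := (1 + 5 * L) ^ 2) (B := (1 + 5 * L) ^ 2)
    (fun n hn => by rw [sub_low_apply, if_pos hn])
    (fun n hn => by
      rw [hb, mul_comm, coe_mul_zeta_apply]
      refine Finset.sum_eq_zero fun d hd => ?_
      rw [sub_low_apply, if_pos ((Nat.divisor_le hd).trans hn)])
    (fun n => by
      rw [sub_low_apply]
      split_ifs
      · simp
      · rw [abs_of_nonneg vonMangoldt_nonneg]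
        exact vonMangoldt_le_log.trans (Real.log_le_self (by positivity)))
    (fun n => (abs_zeta_mul_le U n).trans (by exact_mod_cast Nat.card_divisors_le_self n))
    (by positivity) (by positivity)
    hA hB
  refine (Finset.sum_le_sum hdecomp).trans ?_
  rw [Finset.sum_add_distrib, Finset.sum_const, nsmul_eq_mul]
  have e4 : (1 + 5 * L) ^ 2 * (1 + 5 * L) ^ 2 = (1 + 5 * L) ^ 4 := by ring
  rw [e4] at hbil
  linarith

/-- The average of `psi` over primitive characters of small conductor. -/
theorem sum_norm_psi_le {L : ℝ} (hL : 0 < L) {Q : ℕ} (hQ : (Q : ℝ) ≤ Real.exp (L / 40))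
    (s : Finset (Σ q, DirichletCharacter ℂ q))
    (hs : ∀ c ∈ s, 1 ≤ c.1 ∧ c.1 ≤ Q ∧ c.2.IsPrimitive ∧ c.2 ≠ 1) (hcard : s.card ≤ Q ^ 2) :
    ∑ c ∈ s, ‖psi L c.2‖ ≤ 21 * (1 + 5 * L) ^ 5 * Real.exp (L / 2) := by
  set E := Real.exp (L / 40) with hE
  have hE1 : 1 ≤ E := Real.one_le_exp (by positivity)
  have hE4 : E ^ 4 = Real.exp (L / 10) := by rw [hE, ← Real.exp_nat_mul]; congr 1; push_cast; ring
  have hE20 : E ^ 20 = Real.exp (L / 2) := by rw [hE, ← Real.exp_nat_mul]; congr 1; push_cast; ring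
  set U := ⌊E ^ 4⌋₊ with hU
  have hE41 : 1 ≤ E ^ 4 := one_le_pow₀ hE1
  have hU0 : 0 < U := Nat.floor_pos.2 hE41
  have hUle : (U : ℝ) ≤ E ^ 4 := Nat.floor_le (by positivity)
  have hU1 : (1 : ℝ) ≤ U := by exact_mod_cast hU0
  have hUge : E ^ 4 ≤ 2 * U := by
    have := Nat.lt_floor_add_one (E ^ 4)
    linarith
  have h := sum_norm_psi_le_vaughan hL hU0 s hs
  have hc : (s.card : ℝ) ≤ E ^ 2 := by
    calc (s.card : ℝ) ≤ (Q : ℝ) ^ 2 := by exact_mod_cast hcard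
      _ ≤ _ := by gcongr
  have hcQ : s.card * (2 * (Q * Q) / U) ≤ (4 : ℝ) := by
    calc s.card * (2 * (Q * Q) / U) ≤ E ^ 2 * (2 * (E * E) / (E ^ 4 / 2)) := by
          gcongr
          linarith
      _ = 4 := by field_simp; norm_num
  have h1 : s.card * (U * (5 * L) + U * (10 * L * Q) + U * (5 * L) * U * Q + 16) ≤
      E ^ 20 * (16 + 20 * L) := by
    calc _ ≤ E ^ 2 * (E ^ 4 * (5 * L) + E ^ 4 * (10 * L * E) + E ^ 4 * (5 * L) * E ^ 4 * E + 16) := by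
          gcongr
      _ = E ^ 6 * (5 * L) + E ^ 7 * (10 * L) + E ^ 11 * (5 * L) + E ^ 2 * 16 := by ring
      _ ≤ E ^ 20 * (5 * L) + E ^ 20 * (10 * L) + E ^ 20 * (5 * L) + E ^ 20 * 16 := by
          gcongr <;> first | exact hE1 | norm_num
      _ = _ := by ring
  have hL1 : 1 ≤ (1 + 5 * L) ^ 4 := one_le_pow₀ (by linarith)
  rw [← hE20] at h ⊢
  refine h.trans ?_
  calc _ ≤ E ^ 20 * (16 + 20 * L) + E ^ 20 * ((1 + 5 * L + 4) * (1 + 5 * L) ^ 4) := by gcongr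
    _ ≤ E ^ 20 * ((16 * (1 + 5 * L)) * (1 + 5 * L) ^ 4) +
        E ^ 20 * ((5 * (1 + 5 * L)) * (1 + 5 * L) ^ 4) := by
        gcongr
        · nlinarith
        · linarith
    _ = _ := by ring

end BoundedGaps

namespace BoundedGaps

open ArithmeticFunction

theorem sum_le_sum_of_injOn {ι κ : Type*} [DecidableEq κ] {s : Finset ι} {t : Finset κ} {f : ι → ℝ}
    {g : κ → ℝ} (e : ι → κ) (hg : ∀ x ∈ t, 0 ≤ g x) (hmem : ∀ x ∈ s, e x ∈ t)
    (hinj : Set.InjOn e s) (hle : ∀ x ∈ s, f x ≤ g (e x)) : ∑ x ∈ s, f x ≤ ∑ x ∈ t, g x := by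
  calc ∑ x ∈ s, f x ≤ ∑ x ∈ s, g (e x) := Finset.sum_le_sum hle
    _ = ∑ x ∈ s.image e, g x := (Finset.sum_image hinj).symm
    _ ≤ ∑ x ∈ t, g x := Finset.sum_le_sum_of_subset_of_nonneg
        (Finset.image_subset_iff.2 hmem) fun x hx _ ↦ hg x hx

/-- The von Mangoldt weight restricted to primes exceeding `Q`. -/
noncomputable def primeWeight (Q n : ℕ) : ℝ := if n.Prime ∧ Q < n then Real.log n else 0

theorem primeWeight_nonneg (Q n : ℕ) : 0 ≤ primeWeight Q n := by
  unfold primeWeight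
  split_ifs
  · exact Real.log_natCast_nonneg n
  · exact le_rfl

theorem primeWeight_le_vonMangoldt (Q n : ℕ) : primeWeight Q n ≤ Λ n := by
  unfold primeWeight
  split_ifs with h
  · rw [vonMangoldt_apply_prime h.1]
  · exact vonMangoldt_nonneg

/-- The analogue of `psi` for primes exceeding `Q`. -/
noncomputable def primeSum {q : ℕ} (L : ℝ) (Q : ℕ) (χ : DirichletCharacter ℂ q) : ℂ :=
  ∑ n ∈ Finset.Icc 1 (cut L), (primeWeight Q n : ℂ) * χ n * (om L n : ℂ)

theorem sum_vonMangoldt_not_prime_le {L : ℝ} (hL : 0 < L) :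
    ∑ n ∈ Finset.Icc 1 (cut L) with ¬ n.Prime, Λ n * om L n ≤
      Real.exp (L / 8) * (20 * L * (1 + 5 * L)) := by
  set N := cut L with hN
  have step1 : ∑ n ∈ Finset.Icc 1 N with ¬ n.Prime, Λ n * om L n ≤
      ∑ x ∈ ((Finset.Icc 1 N).filter Nat.Prime) ×ˢ Finset.Icc 2 N,
        Real.exp (L / 8) * (Real.log x.1 * (√(x.1 : ℝ))⁻¹ ^ x.2) := by
    have hnn : ∀ x ∈ ((Finset.Icc 1 N).filter Nat.Prime) ×ˢ Finset.Icc 2 N,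
        0 ≤ Real.exp (L / 8) * (Real.log x.1 * (√(x.1 : ℝ))⁻¹ ^ x.2) := fun x _ ↦
      mul_nonneg (Real.exp_pos _).le (mul_nonneg (Real.log_natCast_nonneg _) (by positivity))
    have h0 : ∑ n ∈ Finset.Icc 1 N with ¬ n.Prime, Λ n * om L n =
        ∑ n ∈ (Finset.Icc 1 N).filter (fun n ↦ ¬ n.Prime ∧ IsPrimePow n), Λ n * om L n := by
      rw [← Finset.filter_filter]
      refine (Finset.sum_filter_of_ne fun n _ hn ↦ ?_).symm
      exact vonMangoldt_ne_zero_iff.mp (left_ne_zero_of_mul hn)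
    rw [h0]
    refine sum_le_sum_of_injOn (fun n ↦ (n.minFac, n.factorization n.minFac)) hnn ?_ ?_ ?_
    · intro n hn
      simp only [Finset.mem_filter, Finset.mem_Icc] at hn
      obtain ⟨⟨h1, h2⟩, hnp, hpp⟩ := hn
      have hn1 : n ≠ 1 := hpp.ne_one
      have hp : n.minFac.Prime := Nat.minFac_prime hn1
      have he : n.minFac ^ n.factorization n.minFac = n := hpp.minFac_pow_factorization_eq
      have hlt : n.factorization n.minFac < n := Nat.factorization_lt _ (by omega)
      simp only [Finset.mem_product, Finset.mem_filter, Finset.mem_Icc]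
      refine ⟨⟨⟨hp.one_lt.le, (Nat.minFac_le h1).trans h2⟩, hp⟩, ?_, by omega⟩
      by_contra hc
      have : n.factorization n.minFac = 0 ∨ n.factorization n.minFac = 1 := by omega
      rcases this with h | h
      · rw [h, pow_zero] at he; exact hn1 he.symm
      · rw [h, pow_one] at he; exact hnp (he ▸ hp)
    · intro m hm n hn hmn
      simp only [Finset.coe_filter, Set.mem_ofPred_eq] at hm hn
      have h1 := hm.2.2.minFac_pow_factorization_eq
      have h2 := hn.2.2.minFac_pow_factorization_eq
      simp only [Prod.mk.injEq] at hmn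
      rw [← h1, ← h2, hmn.1, ← hmn.2, hmn.1]
    · intro n hn
      simp only [Finset.mem_filter, Finset.mem_Icc] at hn
      obtain ⟨⟨h1, h2⟩, hnp, hpp⟩ := hn
      have hp : n.minFac.Prime := Nat.minFac_prime hpp.ne_one
      have he : n.minFac ^ n.factorization n.minFac = n := hpp.minFac_pow_factorization_eq
      have hom := om_le_rpow hL (1 / 2) h1
      have hΛ : Λ n = Real.log n.minFac := by
        rw [vonMangoldt_apply, if_pos hpp]
      have e1 : (n : ℝ) ^ (-(1 / 2 : ℝ)) = (√(n.minFac : ℝ))⁻¹ ^ n.factorization n.minFac := by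
        conv_lhs => rw [← he]
        rw [Real.rpow_neg (by positivity), ← Real.sqrt_eq_rpow, inv_pow]
        push_cast
        congr 1
        rw [Real.sqrt_eq_iff_mul_self_eq (by positivity) (by positivity), ← mul_pow,
          Real.mul_self_sqrt (by positivity)]
      rw [hΛ, ← e1]
      calc Real.log n.minFac * om L n
          ≤ Real.log n.minFac * (Real.exp (L * (1 / 2) ^ 2 / 2) * (n : ℝ) ^ (-(1 / 2 : ℝ))) :=
            mul_le_mul_of_nonneg_left hom (Real.log_natCast_nonneg _)
        _ = _ := by
            rw [show L * (1 / 2) ^ 2 / 2 = L / 8 by ring]; ring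
  refine step1.trans ?_
  rw [← Finset.mul_sum, Finset.sum_product]
  refine mul_le_mul_of_nonneg_left ?_ (Real.exp_pos _).le
  have hH := sum_inv_cut_le hL.le
  calc ∑ p ∈ (Finset.Icc 1 N).filter Nat.Prime, ∑ j ∈ Finset.Icc 2 N,
        Real.log p * (√(p : ℝ))⁻¹ ^ j
      ≤ ∑ p ∈ (Finset.Icc 1 N).filter Nat.Prime, (20 * L) * (p : ℝ)⁻¹ := by
        refine Finset.sum_le_sum fun p hp ↦ ?_
        simp only [Finset.mem_filter, Finset.mem_Icc] at hp
        have hlog : Real.log p ≤ 5 * L := (log_natCast_mono hp.1.2).trans (log_cut_le hL.le)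
        have hp2 : (2 : ℝ) ≤ p := by exact_mod_cast hp.2.two_le
        have hx1 : (√(p : ℝ))⁻¹ ≤ 3 / 4 := by
          rw [inv_le_comm₀ (by positivity) (by norm_num)]
          refine Real.le_sqrt_of_sq_le ?_
          norm_num
          linarith
        set x := (√(p : ℝ))⁻¹ with hx
        have hx0 : 0 ≤ x := by positivity
        have hx2 : x ^ 2 = (p : ℝ)⁻¹ := by
          rw [hx, inv_pow, Real.sq_sqrt (by positivity)]
        have hgeo : ∑ j ∈ Finset.Icc 2 N, x ^ j ≤ 4 * x ^ 2 := by
          have : Finset.Icc 2 N = Finset.Ico 2 (N + 1) := by ext; simp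
          rw [this]
          refine (geom_sum_Ico_le_of_lt_one hx0 (by linarith)).trans ?_
          rw [div_le_iff₀ (by linarith)]
          nlinarith [sq_nonneg x]
        rw [← Finset.mul_sum]
        calc Real.log p * ∑ j ∈ Finset.Icc 2 N, x ^ j ≤ (5 * L) * (4 * x ^ 2) :=
              mul_le_mul hlog hgeo (Finset.sum_nonneg fun _ _ ↦ by positivity) (by positivity)
          _ = _ := by rw [hx2]; ring
    _ ≤ 20 * L * (1 + 5 * L) := by
        rw [← Finset.mul_sum]
        refine mul_le_mul_of_nonneg_left (le_trans ?_ hH) (by positivity)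
        exact Finset.sum_le_sum_of_subset_of_nonneg (Finset.filter_subset _ _)
          fun _ _ _ ↦ by positivity

theorem norm_primeSum_sub_psi_le {L : ℝ} (hL : 0 < L) {Q : ℕ}
    (hQ : (Q : ℝ) ≤ Real.exp (L / 40)) {q : ℕ} (χ : DirichletCharacter ℂ q) :
    ‖primeSum L Q χ - psi L χ‖ ≤ Real.exp (L / 8) * (25 * L * (1 + 5 * L)) := by
  have h1 : ‖primeSum L Q χ - psi L χ‖ ≤
      ∑ n ∈ Finset.Icc 1 (cut L), (Λ n - primeWeight Q n) * om L n := by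
    rw [primeSum, psi, ← Finset.sum_sub_distrib]
    refine (norm_sum_le _ _).trans (Finset.sum_le_sum fun n _ ↦ ?_)
    have e : (primeWeight Q n : ℂ) * χ n * (om L n : ℂ) - (Λ n : ℂ) * χ n * (om L n : ℂ) =
        ((-((Λ n - primeWeight Q n) * om L n) : ℝ) : ℂ) * χ n := by push_cast; ring
    rw [e, norm_mul, Complex.norm_real, Real.norm_eq_abs, abs_neg, abs_of_nonneg
      (mul_nonneg (sub_nonneg.2 (primeWeight_le_vonMangoldt Q n)) (om_pos L n).le)]
    exact mul_le_of_le_one_right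
      (mul_nonneg (sub_nonneg.2 (primeWeight_le_vonMangoldt Q n)) (om_pos L n).le)
      (DirichletCharacter.norm_le_one χ _)
  refine h1.trans ?_
  rw [← Finset.sum_filter_add_sum_filter_not _ Nat.Prime]
  have h2 : ∑ n ∈ Finset.Icc 1 (cut L) with n.Prime, (Λ n - primeWeight Q n) * om L n ≤
      Real.exp (L / 8) * (5 * L) := by
    calc ∑ n ∈ Finset.Icc 1 (cut L) with n.Prime, (Λ n - primeWeight Q n) * om L n
        ≤ ∑ n ∈ Finset.Icc 1 (cut L) with n.Prime, (if n ∈ Finset.Icc 1 Q then 5 * L else 0) := by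
          refine Finset.sum_le_sum fun n hn ↦ ?_
          simp only [Finset.mem_filter, Finset.mem_Icc] at hn
          rw [vonMangoldt_apply_prime hn.2, primeWeight]
          simp only [Finset.mem_Icc]
          by_cases hnQ : Q < n
          · rw [if_pos ⟨hn.2, hnQ⟩, if_neg (by omega)]; simp
          · rw [if_neg (by tauto), if_pos (by omega), sub_zero]
            have hlog : Real.log n ≤ 5 * L := (log_natCast_mono hn.1.2).trans (log_cut_le hL.le)
            exact (mul_le_of_le_one_right (Real.log_natCast_nonneg n) (om_le_one hL n)).trans hlog
      _ ≤ ∑ n ∈ Finset.Icc 1 Q, (5 * L) := by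
          rw [← Finset.sum_filter]
          refine Finset.sum_le_sum_of_subset_of_nonneg (fun n hn ↦ ?_) fun _ _ _ ↦ by positivity
          exact (Finset.mem_filter.1 hn).2
      _ ≤ _ := by
          rw [Finset.sum_const, Nat.card_Icc, nsmul_eq_mul]
          refine mul_le_mul_of_nonneg_right ?_ (by positivity)
          simp only [add_tsub_cancel_right]
          exact hQ.trans (Real.exp_le_exp.2 (by linarith))
  have h3 : ∑ n ∈ Finset.Icc 1 (cut L) with ¬ n.Prime, (Λ n - primeWeight Q n) * om L n ≤
      Real.exp (L / 8) * (20 * L * (1 + 5 * L)) := by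
    refine le_trans (Finset.sum_le_sum fun n _ ↦ ?_) (sum_vonMangoldt_not_prime_le hL)
    exact mul_le_mul_of_nonneg_right (sub_le_self _ (primeWeight_nonneg Q n)) (om_pos L n).le
  refine (add_le_add h2 h3).trans ?_
  rw [← mul_add]
  refine mul_le_mul_of_nonneg_left ?_ (Real.exp_pos _).le
  nlinarith

/-- Primitive reduction. -/
theorem primeSum_primitiveCharacter {L : ℝ} {Q q : ℕ} [NeZero q] (hq : q ≤ Q)
    (χ : DirichletCharacter ℂ q) : primeSum L Q χ.primitiveCharacter = primeSum L Q χ := by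
  refine Finset.sum_congr rfl fun n _ ↦ ?_
  unfold primeWeight
  split_ifs with h
  · have hc : n.Coprime q := by
      rw [Nat.coprime_comm]
      refine (h.1.coprime_iff_not_dvd.2 fun hd ↦ ?_).symm
      have := Nat.le_of_dvd (NeZero.pos q) hd
      omega
    congr 2
    conv_rhs => rw [← χ.changeLevel_primitiveCharacter]
    exact (changeLevel_apply_natCast χ.conductor_dvd_level _ hc).symm
  · simp

end BoundedGaps

namespace BoundedGaps

open ArithmeticFunction
open scoped ArithmeticFunction.zeta

/-- `c ^ ω(n)` on squarefree `n`. -/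
noncomputable def sqfreePow (c : ℕ) : ArithmeticFunction ℝ :=
  ⟨fun n ↦ if Squarefree n then (c : ℝ) ^ n.primeFactors.card else 0, by simp⟩

theorem sqfreePow_apply (c n : ℕ) :
    sqfreePow c n = if Squarefree n then (c : ℝ) ^ n.primeFactors.card else 0 := rfl

theorem sqfreePow_nonneg (c n : ℕ) : 0 ≤ sqfreePow c n := by
  rw [sqfreePow_apply]; split_ifs <;> positivity

theorem isMultiplicative_sqfreePow (c : ℕ) : (sqfreePow c).IsMultiplicative := by
  refine ⟨by simp [sqfreePow_apply], fun {m n} h ↦ ?_⟩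
  simp only [sqfreePow_apply, Nat.squarefree_mul h]
  by_cases hm : Squarefree m <;> by_cases hn : Squarefree n <;> simp [hm, hn]
  rw [h.primeFactors_mul, Finset.card_union_of_disjoint h.disjoint_primeFactors, pow_add]

theorem sqfreePow_succ_le (c n : ℕ) : sqfreePow (c + 1) n ≤ (sqfreePow c * (ζ : ArithmeticFunction ℝ)) n := by
  rw [coe_mul_zeta_apply]
  by_cases hn : Squarefree n
  · rw [← (isMultiplicative_sqfreePow c).prodPrimeFactors_one_add_of_squarefree hn,
      sqfreePow_apply, if_pos hn, ← Finset.prod_const]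
    refine le_of_eq (Finset.prod_congr rfl fun p hp ↦ ?_)
    have hp' := Nat.prime_of_mem_primeFactors hp
    rw [sqfreePow_apply, if_pos hp'.squarefree]
    simp [hp'.primeFactors, add_comm]
  · rw [sqfreePow_apply, if_neg hn]
    exact Finset.sum_nonneg fun _ _ ↦ sqfreePow_nonneg _ _

theorem sum_sqfreePow_div_le (c N : ℕ) :
    ∑ n ∈ Finset.Icc 1 N, sqfreePow c n * (n : ℝ)⁻¹ ≤ (∑ n ∈ Finset.Icc 1 N, (n : ℝ)⁻¹) ^ c := by
  induction c with
  | zero =>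
    rw [pow_zero]
    have : ∀ n ∈ Finset.Icc 1 N, sqfreePow 0 n * (n : ℝ)⁻¹ ≤ if n = 1 then 1 else 0 := by
      intro n hn
      have hn1 := (Finset.mem_Icc.1 hn).1
      split_ifs with h
      · simp [h, sqfreePow_apply]
      · have : n.primeFactors.card ≠ 0 := by
          rw [Finset.card_ne_zero, Nat.nonempty_primeFactors]; omega
        simp [sqfreePow_apply, this]
    refine (Finset.sum_le_sum this).trans ?_
    rw [Finset.sum_ite_eq']
    split_ifs <;> norm_num
  | succ c ih =>
    calc ∑ n ∈ Finset.Icc 1 N, sqfreePow (c + 1) n * (n : ℝ)⁻¹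
        ≤ ∑ n ∈ Finset.Icc 1 N, (sqfreePow c * (ζ : ArithmeticFunction ℝ)) n * (n : ℝ)⁻¹ :=
          Finset.sum_le_sum fun n _ ↦
            mul_le_mul_of_nonneg_right (sqfreePow_succ_le c n) (by positivity)
      _ ≤ (∑ n ∈ Finset.Icc 1 N, sqfreePow c n * (n : ℝ)⁻¹) *
          ∑ n ∈ Finset.Icc 1 N, (ζ : ArithmeticFunction ℝ) n * (n : ℝ)⁻¹ := by
          refine sum_conv_le (F := fun n ↦ (n : ℝ)⁻¹) (sqfreePow_nonneg c) (fun n ↦ ?_)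
            (fun n ↦ by positivity) (fun m n ↦ by push_cast; rw [mul_inv]) N
          rw [natCoe_apply]; positivity
      _ ≤ _ := by
          rw [pow_succ]
          refine mul_le_mul ih (Finset.sum_le_sum fun n hn ↦ ?_)
            (Finset.sum_nonneg fun n _ ↦ ?_) (by positivity)
          · rw [natCoe_apply, zeta_apply_ne (by have := (Finset.mem_Icc.1 hn).1; omega)]; simp
          · rw [natCoe_apply]; positivity

theorem inv_totient_le {q : ℕ} (hq : Squarefree q) :
    ((q.totient : ℝ))⁻¹ ≤ 2 ^ q.primeFactors.card * (q : ℝ)⁻¹ := by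
  have hq0 : 0 < q := Nat.pos_of_ne_zero hq.ne_zero
  have h1 : (q : ℝ) ≤ 2 ^ q.primeFactors.card * q.totient := by
    have h := Nat.totient_mul_prod_primeFactors q
    rw [Nat.prod_primeFactors_of_squarefree hq, mul_comm] at h
    have h2 := Nat.eq_of_mul_eq_mul_left hq0 h
    have : q ≤ 2 ^ q.primeFactors.card * q.totient := by
      rw [h2, ← Finset.prod_const, ← Finset.prod_mul_distrib]
      conv_lhs => rw [← Nat.prod_primeFactors_of_squarefree hq]
      refine Finset.prod_le_prod' fun p hp ↦ ?_
      have := (Nat.prime_of_mem_primeFactors hp).two_le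
      omega
    exact_mod_cast this
  have hφ : (0 : ℝ) < q.totient := by exact_mod_cast Nat.totient_pos.2 hq0
  rw [inv_le_iff_one_le_mul₀ hφ]
  have : (0 : ℝ) < q := by exact_mod_cast hq0
  rw [mul_right_comm, ← div_eq_mul_inv, one_le_div this]
  exact h1

/-- The weight `K ^ ω(q) / φ(q)` on squarefree `q`. -/
noncomputable def modWeight (K q : ℕ) : ℝ := sqfreePow K q * (q.totient : ℝ)⁻¹

theorem modWeight_nonneg (K q : ℕ) : 0 ≤ modWeight K q :=
  mul_nonneg (sqfreePow_nonneg K q) (by positivity)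

theorem modWeight_le (K q : ℕ) : modWeight K q ≤ sqfreePow (2 * K) q * (q : ℝ)⁻¹ := by
  unfold modWeight
  rw [sqfreePow_apply, sqfreePow_apply]
  split_ifs with h
  · calc (K : ℝ) ^ q.primeFactors.card * (q.totient : ℝ)⁻¹
        ≤ (K : ℝ) ^ q.primeFactors.card * (2 ^ q.primeFactors.card * (q : ℝ)⁻¹) :=
          mul_le_mul_of_nonneg_left (inv_totient_le h) (by positivity)
      _ = _ := by push_cast; rw [mul_pow]; ring
  · simp

theorem modWeight_mul_le (K f m : ℕ) : modWeight K (f * m) ≤ modWeight K f * modWeight K m := by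
  by_cases h : Squarefree (f * m)
  · have hc := Nat.coprime_of_squarefree_mul h
    unfold modWeight
    rw [(isMultiplicative_sqfreePow K).map_mul_of_coprime hc, Nat.totient_mul hc]
    push_cast
    rw [mul_inv]
    exact le_of_eq (by ring)
  · have : modWeight K (f * m) = 0 := by rw [modWeight, sqfreePow_apply, if_neg h, zero_mul]
    rw [this]
    exact mul_nonneg (modWeight_nonneg _ _) (modWeight_nonneg _ _)

theorem sum_modWeight_multiples_le (K f Q : ℕ) (hf : 0 < f) :
    ∑ q ∈ Finset.Icc 1 Q with f ∣ q, modWeight K q ≤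
      modWeight K f * (∑ n ∈ Finset.Icc 1 Q, (n : ℝ)⁻¹) ^ (2 * K) := by
  calc ∑ q ∈ Finset.Icc 1 Q with f ∣ q, modWeight K q
      ≤ ∑ m ∈ Finset.Icc 1 Q, modWeight K f * modWeight K m := by
        refine sum_le_sum_of_injOn (fun q ↦ q / f)
          (fun m _ ↦ mul_nonneg (modWeight_nonneg _ _) (modWeight_nonneg _ _)) ?_ ?_ ?_
        · intro q hq
          simp only [Finset.mem_filter, Finset.mem_Icc] at hq ⊢
          exact ⟨Nat.div_pos (Nat.le_of_dvd hq.1.1 hq.2) hf, (Nat.div_le_self _ _).trans hq.1.2⟩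
        · intro a ha b hb hab
          simp only [Finset.coe_filter, Set.mem_ofPred_eq] at ha hb
          rw [← Nat.mul_div_cancel' ha.2, ← Nat.mul_div_cancel' hb.2]
          exact congrArg _ hab
        · intro q hq
          simp only [Finset.mem_filter, Finset.mem_Icc] at hq
          have := modWeight_mul_le K f (q / f)
          rwa [Nat.mul_div_cancel' hq.2] at this
    _ ≤ _ := by
        rw [← Finset.mul_sum]
        refine mul_le_mul_of_nonneg_left ?_ (modWeight_nonneg _ _)
        exact (Finset.sum_le_sum fun m _ ↦ modWeight_le K m).trans (sum_sqfreePow_div_le _ _)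

theorem modWeight_le_rpow (K q : ℕ) (hK : 1 ≤ K) (hq : 0 < q) :
    modWeight K q ≤ (2 * K : ℝ) ^ (4 * K ^ 2) * (√(q : ℝ))⁻¹ := by
  refine (modWeight_le K q).trans ?_
  have hq' : (0 : ℝ) < q := by exact_mod_cast hq
  rw [sqfreePow_apply]
  split_ifs with h
  swap
  · rw [zero_mul]; positivity
  have hK' : (1 : ℝ) ≤ K := by exact_mod_cast hK
  have hsq : √(q : ℝ) = ∏ p ∈ q.primeFactors, √(p : ℝ) := by
    conv_lhs => rw [← Nat.prod_primeFactors_of_squarefree h]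
    push_cast
    rw [Real.sqrt_eq_iff_mul_self_eq (by positivity) (by positivity), ← Finset.prod_mul_distrib]
    exact Finset.prod_congr rfl fun p _ ↦ (Real.mul_self_sqrt (by positivity)).symm
  have key : ((2 * K : ℕ) : ℝ) ^ q.primeFactors.card ≤ (2 * K : ℝ) ^ (4 * K ^ 2) * √(q : ℝ) := by
    rw [hsq, ← Finset.prod_const]
    calc ∏ _p ∈ q.primeFactors, ((2 * K : ℕ) : ℝ)
        ≤ ∏ p ∈ q.primeFactors, ((if p ≤ 4 * K ^ 2 then (2 * K : ℝ) else 1) * √(p : ℝ)) := by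
          refine Finset.prod_le_prod (fun _ _ ↦ by positivity) fun p hp ↦ ?_
          have hp2 := (Nat.prime_of_mem_primeFactors hp).two_le
          push_cast
          split_ifs with hc
          · refine le_mul_of_one_le_right (by positivity) (Real.one_le_sqrt.2 ?_)
            exact_mod_cast (by omega)
          · rw [one_mul]
            refine Real.le_sqrt_of_sq_le ?_
            have : 4 * K ^ 2 ≤ p := by omega
            have : (4 * K ^ 2 : ℝ) ≤ p := by exact_mod_cast this
            nlinarith
      _ = (2 * K : ℝ) ^ (q.primeFactors.filter (· ≤ 4 * K ^ 2)).card *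
          ∏ p ∈ q.primeFactors, √(p : ℝ) := by
          rw [Finset.prod_mul_distrib, ← Finset.prod_filter, Finset.prod_const]
      _ ≤ _ := by
          refine mul_le_mul_of_nonneg_right ?_ (by positivity)
          refine pow_le_pow_right₀ (by linarith) ?_
          calc (q.primeFactors.filter (· ≤ 4 * K ^ 2)).card ≤ (Finset.Icc 1 (4 * K ^ 2)).card := by
                refine Finset.card_le_card fun p hp ↦ ?_
                simp only [Finset.mem_filter, Finset.mem_Icc] at hp ⊢
                exact ⟨(Nat.prime_of_mem_primeFactors hp.1).one_lt.le, hp.2⟩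
            _ = _ := by simp
  calc ((2 * K : ℕ) : ℝ) ^ q.primeFactors.card * (q : ℝ)⁻¹
      ≤ ((2 * K : ℝ) ^ (4 * K ^ 2) * √(q : ℝ)) * (q : ℝ)⁻¹ :=
        mul_le_mul_of_nonneg_right key (by positivity)
    _ = _ := by
        have : (q : ℝ)⁻¹ = (√(q : ℝ))⁻¹ * (√(q : ℝ))⁻¹ := by
          rw [← mul_inv, Real.mul_self_sqrt hq'.le]
        have h0 : √(q : ℝ) ≠ 0 := (Real.sqrt_pos.2 hq').ne'
        rw [this]
        field_simp

end BoundedGaps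

namespace BoundedGaps

open Filter Topology

open Classical in
/-- The nonprincipal Dirichlet characters modulo `q` (none when `q = 0`). -/
noncomputable def nonprincipal (q : ℕ) : Finset (DirichletCharacter ℂ q) :=
  if h : q = 0 then ∅ else
    have : NeZero q := ⟨h⟩
    Finset.univ.filter (· ≠ 1)

theorem mem_nonprincipal {q : ℕ} [NeZero q] {χ : DirichletCharacter ℂ q} :
    χ ∈ nonprincipal q ↔ χ ≠ 1 := by
  unfold nonprincipal
  rw [dif_neg (NeZero.ne q)]
  simp

theorem card_nonprincipal_le (q : ℕ) : (nonprincipal q).card ≤ q := by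
  rcases Nat.eq_zero_or_pos q with rfl | hq
  · simp [nonprincipal]
  · have : NeZero q := ⟨hq.ne'⟩
    have h1 : (nonprincipal q).card ≤ Fintype.card (DirichletCharacter ℂ q) :=
      Finset.card_le_univ _
    rw [← Nat.card_eq_fintype_card, DirichletCharacter.card_eq_totient_of_hasEnoughRootsOfUnity] at h1
    exact h1.trans (Nat.totient_le q)

open Classical in
/-- The primitive nonprincipal characters of conductor at most `Q`. -/
noncomputable def primitives (Q : ℕ) : Finset (Σ q, DirichletCharacter ℂ q) :=
  ((Finset.Icc 1 Q).sigma nonprincipal).filter fun c ↦ c.2.IsPrimitive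

theorem mem_primitives {Q : ℕ} {c : Σ q, DirichletCharacter ℂ q} :
    c ∈ primitives Q ↔ 1 ≤ c.1 ∧ c.1 ≤ Q ∧ c.2.IsPrimitive ∧ c.2 ≠ 1 := by
  simp only [primitives, Finset.mem_filter, Finset.mem_sigma, Finset.mem_Icc]
  constructor
  · rintro ⟨⟨⟨h1, h2⟩, h3⟩, h4⟩
    have : NeZero c.1 := ⟨by omega⟩
    exact ⟨h1, h2, h4, mem_nonprincipal.1 h3⟩
  · rintro ⟨h1, h2, h3, h4⟩
    have : NeZero c.1 := ⟨by omega⟩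
    exact ⟨⟨⟨h1, h2⟩, mem_nonprincipal.2 h4⟩, h3⟩

theorem card_primitives_le (Q : ℕ) : (primitives Q).card ≤ Q ^ 2 := by
  classical
  refine (Finset.card_filter_le _ _).trans ?_
  rw [Finset.card_sigma]
  calc ∑ q ∈ Finset.Icc 1 Q, (nonprincipal q).card ≤ ∑ q ∈ Finset.Icc 1 Q, Q :=
        Finset.sum_le_sum fun q hq ↦ (card_nonprincipal_le q).trans (Finset.mem_Icc.1 hq).2
    _ = Q ^ 2 := by simp [sq]

theorem eq_of_sigma_primitive_eq {q : ℕ} {χ χ' : DirichletCharacter ℂ q}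
    (h : (⟨_, χ.primitiveCharacter⟩ : Σ q, DirichletCharacter ℂ q) = ⟨_, χ'.primitiveCharacter⟩) :
    χ = χ' := by
  have aux : ∀ (c c' : Σ q, DirichletCharacter ℂ q) (hc : c.1 ∣ q) (hc' : c'.1 ∣ q), c = c' →
      DirichletCharacter.changeLevel hc c.2 = DirichletCharacter.changeLevel hc' c'.2 := by
    rintro c c' hc hc' rfl
    rfl
  have := aux ⟨_, χ.primitiveCharacter⟩ ⟨_, χ'.primitiveCharacter⟩ χ.conductor_dvd_level
    χ'.conductor_dvd_level h
  rwa [χ.changeLevel_primitiveCharacter, χ'.changeLevel_primitiveCharacter] at this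

theorem sum_nonprincipal_le {L : ℝ} {Q q : ℕ} (hq0 : 0 < q) (hq : q ≤ Q) :
    ∑ χ ∈ nonprincipal q, ‖primeSum L Q χ‖ ≤
      ∑ c ∈ primitives Q with c.1 ∣ q, ‖primeSum L Q c.2‖ := by
  classical
  have : NeZero q := ⟨hq0.ne'⟩
  refine sum_le_sum_of_injOn (fun χ ↦ (⟨_, χ.primitiveCharacter⟩ : Σ q, DirichletCharacter ℂ q))
    (fun _ _ ↦ norm_nonneg _) ?_ ?_ ?_
  · intro χ hχ
    have hχ1 := mem_nonprincipal.1 hχ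
    have hd := χ.conductor_dvd_level
    have hpos : 0 < χ.conductor := Nat.pos_of_dvd_of_pos hd hq0
    simp only [Finset.mem_filter, mem_primitives]
    refine ⟨⟨hpos, (Nat.le_of_dvd hq0 hd).trans hq, χ.primitiveCharacter_isPrimitive, ?_⟩, hd⟩
    intro h
    apply hχ1
    rw [← χ.changeLevel_primitiveCharacter, h, DirichletCharacter.changeLevel_one]
  · intro χ _ χ' _ h
    exact eq_of_sigma_primitive_eq h
  · intro χ _
    rw [← primeSum_primitiveCharacter hq χ]

/-- The total weighted error for primes in residue classes. -/
noncomputable def bvSum (K : ℕ) (L : ℝ) (Q : ℕ) : ℝ :=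
  ∑ q ∈ Finset.Icc 1 Q, modWeight K q * ∑ χ ∈ nonprincipal q, ‖primeSum L Q χ‖

theorem bvSum_le (K : ℕ) (L : ℝ) (Q : ℕ) : bvSum K L Q ≤
    (∑ n ∈ Finset.Icc 1 Q, (n : ℝ)⁻¹) ^ (2 * K) *
      ∑ c ∈ primitives Q, modWeight K c.1 * ‖primeSum L Q c.2‖ := by
  unfold bvSum
  calc ∑ q ∈ Finset.Icc 1 Q, modWeight K q * ∑ χ ∈ nonprincipal q, ‖primeSum L Q χ‖
      ≤ ∑ q ∈ Finset.Icc 1 Q, modWeight K q *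
          ∑ c ∈ primitives Q, if c.1 ∣ q then ‖primeSum L Q c.2‖ else 0 := by
        refine Finset.sum_le_sum fun q hq ↦ ?_
        rw [Finset.mem_Icc] at hq
        rw [← Finset.sum_filter]
        exact mul_le_mul_of_nonneg_left (sum_nonprincipal_le hq.1 hq.2) (modWeight_nonneg _ _)
    _ = ∑ c ∈ primitives Q, (∑ q ∈ Finset.Icc 1 Q with c.1 ∣ q, modWeight K q) *
          ‖primeSum L Q c.2‖ := by
        simp_rw [Finset.mul_sum]
        rw [Finset.sum_comm]
        refine Finset.sum_congr rfl fun c _ ↦ ?_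
        rw [Finset.sum_filter, Finset.sum_mul]
        refine Finset.sum_congr rfl fun q _ ↦ ?_
        split_ifs <;> simp
    _ ≤ ∑ c ∈ primitives Q, (modWeight K c.1 * (∑ n ∈ Finset.Icc 1 Q, (n : ℝ)⁻¹) ^ (2 * K)) *
          ‖primeSum L Q c.2‖ := by
        refine Finset.sum_le_sum fun c hc ↦ mul_le_mul_of_nonneg_right ?_ (norm_nonneg _)
        exact sum_modWeight_multiples_le K c.1 Q (mem_primitives.1 hc).1
    _ = _ := by
        rw [Finset.mul_sum]
        exact Finset.sum_congr rfl fun c _ ↦ by ring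

theorem sum_primitives_le {K : ℕ} (hK : 1 ≤ K) {L B : ℝ} (hL : 1 ≤ L) {Q : ℕ}
    (hQ : (Q : ℝ) ≤ Real.exp (L / 40)) {A : ℝ} (hA0 : 0 ≤ A)
    (hA : ∀ c ∈ primitives Q, (c.1 : ℝ) ≤ L ^ B → ‖psi L c.2‖ ≤ A) :
    ∑ c ∈ primitives Q, modWeight K c.1 * ‖primeSum L Q c.2‖ ≤
      (2 * K : ℝ) ^ (4 * K ^ 2) * (L ^ (2 * B) * A + L ^ (-(B / 2)) * (21 * (1 + 5 * L) ^ 5 *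
        Real.exp (L / 2)) + Real.exp (7 * L / 40) * (25 * L * (1 + 5 * L))) := by
  classical
  have hL0 : 0 < L := by linarith
  set C : ℝ := (2 * K : ℝ) ^ (4 * K ^ 2) with hC
  have hC0 : 0 ≤ C := by positivity
  set ξ : ℝ := Real.exp (L / 8) * (25 * L * (1 + 5 * L)) with hξ
  have hξ0 : 0 ≤ ξ := by positivity
  have hw : ∀ c ∈ primitives Q, modWeight K c.1 ≤ C := by
    intro c hc
    refine (modWeight_le_rpow K c.1 hK (mem_primitives.1 hc).1).trans ?_
    refine mul_le_of_le_one_right hC0 (inv_le_one_of_one_le₀ (Real.one_le_sqrt.2 ?_))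
    exact_mod_cast (mem_primitives.1 hc).1
  have h1 : ∑ c ∈ primitives Q, modWeight K c.1 * ‖primeSum L Q c.2‖ ≤
      ∑ c ∈ primitives Q, modWeight K c.1 * ‖psi L c.2‖ + ∑ c ∈ primitives Q, C * ξ := by
    rw [← Finset.sum_add_distrib]
    refine Finset.sum_le_sum fun c hc ↦ ?_
    have h2 : ‖primeSum L Q c.2‖ ≤ ‖psi L c.2‖ + ξ := by
      have := norm_add_le (primeSum L Q c.2 - psi L c.2) (psi L c.2)
      rw [sub_add_cancel] at this
      linarith [norm_primeSum_sub_psi_le hL0 hQ c.2]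
    calc modWeight K c.1 * ‖primeSum L Q c.2‖ ≤ modWeight K c.1 * (‖psi L c.2‖ + ξ) :=
          mul_le_mul_of_nonneg_left h2 (modWeight_nonneg _ _)
      _ ≤ _ := by
          rw [mul_add]
          linarith [mul_le_mul_of_nonneg_right (hw c hc) hξ0]
  have h3 : ∑ c ∈ primitives Q, C * ξ ≤ C * (Real.exp (7 * L / 40) * (25 * L * (1 + 5 * L))) := by
    rw [Finset.sum_const, nsmul_eq_mul, mul_left_comm]
    refine mul_le_mul_of_nonneg_left ?_ hC0
    have hcard : ((primitives Q).card : ℝ) ≤ Real.exp (L / 20) := by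
      calc ((primitives Q).card : ℝ) ≤ (Q : ℝ) ^ 2 := by exact_mod_cast card_primitives_le Q
        _ ≤ Real.exp (L / 40) ^ 2 := pow_le_pow_left₀ (by positivity) hQ 2
        _ = Real.exp (L / 20) := by rw [← Real.exp_nat_mul]; congr 1; push_cast; ring
    calc ((primitives Q).card : ℝ) * ξ ≤ Real.exp (L / 20) * ξ :=
          mul_le_mul_of_nonneg_right hcard hξ0
      _ = _ := by
          rw [hξ, ← mul_assoc, ← Real.exp_add]; congr 2; ring
  have h4 : ∑ c ∈ primitives Q with (c.1 : ℝ) ≤ L ^ B, modWeight K c.1 * ‖psi L c.2‖ ≤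
      C * (L ^ (2 * B) * A) := by
    calc ∑ c ∈ primitives Q with (c.1 : ℝ) ≤ L ^ B, modWeight K c.1 * ‖psi L c.2‖
        ≤ ∑ c ∈ primitives Q with (c.1 : ℝ) ≤ L ^ B, C * A := by
          refine Finset.sum_le_sum fun c hc ↦ ?_
          rw [Finset.mem_filter] at hc
          exact mul_le_mul (hw c hc.1) (hA c hc.1 hc.2) (norm_nonneg _) hC0
      _ ≤ _ := by
          rw [Finset.sum_const, nsmul_eq_mul, mul_left_comm]
          refine mul_le_mul_of_nonneg_left (mul_le_mul_of_nonneg_right ?_ hA0) hC0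
          have hsub : (primitives Q).filter (fun c ↦ (c.1 : ℝ) ≤ L ^ B) ⊆ primitives ⌊L ^ B⌋₊ := by
            intro c hc
            rw [Finset.mem_filter, mem_primitives] at hc
            rw [mem_primitives]
            exact ⟨hc.1.1, Nat.le_floor hc.2, hc.1.2.2⟩
          calc (((primitives Q).filter fun c ↦ (c.1 : ℝ) ≤ L ^ B).card : ℝ)
              ≤ (⌊L ^ B⌋₊ : ℝ) ^ 2 := by
                exact_mod_cast (Finset.card_le_card hsub).trans (card_primitives_le _)
            _ ≤ (L ^ B) ^ 2 :=
                pow_le_pow_left₀ (by positivity) (Nat.floor_le (by positivity)) 2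
            _ = L ^ (2 * B) := by
                rw [← Real.rpow_natCast, ← Real.rpow_mul hL0.le]; congr 1; push_cast; ring
  have h5 : ∑ c ∈ primitives Q with ¬ (c.1 : ℝ) ≤ L ^ B, modWeight K c.1 * ‖psi L c.2‖ ≤
      C * (L ^ (-(B / 2)) * (21 * (1 + 5 * L) ^ 5 * Real.exp (L / 2))) := by
    calc ∑ c ∈ primitives Q with ¬ (c.1 : ℝ) ≤ L ^ B, modWeight K c.1 * ‖psi L c.2‖
        ≤ ∑ c ∈ primitives Q with ¬ (c.1 : ℝ) ≤ L ^ B, (C * L ^ (-(B / 2))) * ‖psi L c.2‖ := by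
          refine Finset.sum_le_sum fun c hc ↦ mul_le_mul_of_nonneg_right ?_ (norm_nonneg _)
          rw [Finset.mem_filter] at hc
          refine (modWeight_le_rpow K c.1 hK (mem_primitives.1 hc.1).1).trans
            (mul_le_mul_of_nonneg_left ?_ hC0)
          rw [Real.rpow_neg hL0.le]
          refine inv_anti₀ (by positivity) (Real.le_sqrt_of_sq_le ?_)
          rw [← Real.rpow_natCast, ← Real.rpow_mul hL0.le]
          push Not at hc
          refine le_trans (le_of_eq ?_) hc.2.le
          congr 1; push_cast; ring
      _ ≤ _ := by
          rw [← Finset.mul_sum, mul_assoc]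
          refine mul_le_mul_of_nonneg_left (mul_le_mul_of_nonneg_left ?_ (by positivity)) hC0
          refine sum_norm_psi_le hL0 hQ _ (fun c hc ↦ mem_primitives.1 (Finset.mem_filter.1 hc).1) ?_
          exact (Finset.card_filter_le _ _).trans (card_primitives_le Q)
  have h6 := Finset.sum_filter_add_sum_filter_not (primitives Q) (fun c ↦ (c.1 : ℝ) ≤ L ^ B)
    (fun c ↦ modWeight K c.1 * ‖psi L c.2‖)
  rw [mul_add, mul_add]
  linarith

theorem eventually_const_mul_rpow_mul_exp_le (C s : ℝ) {b ε : ℝ} (hb : 0 < b) (hε : 0 < ε) :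
    ∀ᶠ x : ℝ in atTop, C * (x ^ s * Real.exp (-b * x)) ≤ ε := by
  have h := (tendsto_rpow_mul_exp_neg_mul_atTop_nhds_zero s b hb).const_mul C
  rw [mul_zero] at h
  exact h.eventually (eventually_le_nhds hε)

theorem exists_eventually_bvSum_le {K : ℕ} (hK : 1 ≤ K) : ∃ B : ℝ, 1 ≤ B ∧ ∀ᶠ L : ℝ in atTop,
    GoodScale B L → ∀ Q : ℕ, (Q : ℝ) ≤ Real.exp (L / 40) → bvSum K L Q ≤ Real.exp (L / 2) := by
  set B : ℝ := 4 * K + 12 with hBdef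
  have hB : 1 ≤ B := by
    have : (0 : ℝ) ≤ K := by positivity
    linarith
  refine ⟨B, hB, ?_⟩
  set C : ℝ := 6 ^ (2 * K) * (2 * K : ℝ) ^ (4 * K ^ 2) with hC
  have hC0 : 0 ≤ C := by positivity
  have e1 := Real.tendsto_sqrt_atTop.eventually (eventually_const_mul_rpow_mul_exp_le C
    (2 * (2 * K + 2 * B)) (b := 1 / 4) (ε := 1 / 3) (by norm_num) (by norm_num))
  have e2 := eventually_ge_atTop (3 * (C * (21 * 6 ^ 5)))
  have e3 := eventually_const_mul_rpow_mul_exp_le (C * 150)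
    (2 * K + 2) (b := 13 / 40) (ε := 1 / 3) (by norm_num) (by norm_num)
  filter_upwards [e1, e2, e3, eventually_ge_atTop 1, eventually_norm_psi_le hB] with
    L h1 h2 h3 hL hpsi hgood Q hQ
  have hL0 : 0 < L := by linarith
  have hH : ∑ n ∈ Finset.Icc 1 Q, (n : ℝ)⁻¹ ≤ 6 * L := by
    have hQc : Q ≤ cut L := Nat.le_floor (hQ.trans (Real.exp_le_exp.2 (by linarith)))
    calc ∑ n ∈ Finset.Icc 1 Q, (n : ℝ)⁻¹ ≤ ∑ n ∈ Finset.Icc 1 (cut L), (n : ℝ)⁻¹ :=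
          Finset.sum_le_sum_of_subset_of_nonneg (Finset.Icc_subset_Icc_right hQc)
            fun _ _ _ ↦ by positivity
      _ ≤ 1 + 5 * L := sum_inv_cut_le hL0.le
      _ ≤ 6 * L := by linarith
  have hA : ∀ c ∈ primitives Q, (c.1 : ℝ) ≤ L ^ B →
      ‖psi L c.2‖ ≤ Real.exp (L / 2 - √L / 4) := by
    intro c hc hcL
    obtain ⟨hc1, -, hprim, hne⟩ := mem_primitives.1 hc
    have : NeZero c.1 := ⟨by omega⟩
    exact hpsi c.1 c.2 hne hcL (hgood c.1 c.2 hprim hne hcL)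
  have hmain := sum_primitives_le hK hL hQ (Real.exp_pos _).le hA
  have hnn : 0 ≤ ∑ c ∈ primitives Q, modWeight K c.1 * ‖primeSum L Q c.2‖ :=
    Finset.sum_nonneg fun c _ ↦ mul_nonneg (modWeight_nonneg _ _) (norm_nonneg _)
  have h5L : 1 + 5 * L ≤ 6 * L := by linarith
  calc bvSum K L Q ≤ (6 * L) ^ (2 * K) * _ :=
        (bvSum_le K L Q).trans (mul_le_mul (pow_le_pow_left₀ (Finset.sum_nonneg fun _ _ ↦ by positivity)
          hH _) hmain hnn (by positivity))
    _ ≤ (6 * L) ^ (2 * K) * ((2 * K : ℝ) ^ (4 * K ^ 2) * (L ^ (2 * B) * Real.exp (L / 2 - √L / 4) +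
        L ^ (-(B / 2)) * (21 * (6 * L) ^ 5 * Real.exp (L / 2)) +
        Real.exp (7 * L / 40) * (25 * L * (6 * L)))) := by gcongr
    _ = (C * (L ^ (2 * K) * L ^ (2 * B) * Real.exp (-(1 / 4) * √L)) +
          C * (21 * 6 ^ 5) * (L ^ (2 * K) * L ^ (-(B / 2)) * L ^ 5) +
          C * 150 * (L ^ (2 * K) * L ^ 2 * Real.exp (-(13 / 40) * L))) * Real.exp (L / 2) := by
        have x1 : Real.exp (L / 2 - √L / 4) = Real.exp (-(1 / 4) * √L) * Real.exp (L / 2) := by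
          rw [← Real.exp_add]; congr 1; ring
        have x2 : Real.exp (7 * L / 40) = Real.exp (-(13 / 40) * L) * Real.exp (L / 2) := by
          rw [← Real.exp_add]; congr 1; ring
        rw [x1, x2, hC, mul_pow]
        ring
    _ ≤ (1 / 3 + 1 / 3 + 1 / 3) * Real.exp (L / 2) := by
        refine mul_le_mul_of_nonneg_right (add_le_add (add_le_add ?_ ?_) ?_) (Real.exp_pos _).le
        · refine le_trans (le_of_eq ?_) h1
          congr 2
          rw [← Real.rpow_natCast, ← Real.rpow_add hL0, Real.sqrt_eq_rpow, ← Real.rpow_mul hL0.le]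
          congr 1; push_cast; ring
        · have : L ^ (2 * K) * L ^ (-(B / 2)) * L ^ 5 = L⁻¹ := by
            rw [← Real.rpow_natCast, ← Real.rpow_natCast, ← Real.rpow_add hL0, ← Real.rpow_add hL0,
              ← Real.rpow_neg_one]
            congr 1; push_cast; rw [hBdef]; ring
          rw [this, ← div_eq_mul_inv, div_le_iff₀ hL0]
          linarith
        · refine le_trans (le_of_eq ?_) h3
          congr 2
          rw [← Real.rpow_natCast, ← Real.rpow_natCast, ← Real.rpow_add hL0]
          congr 1; push_cast; ring
    _ = Real.exp (L / 2) := by norm_num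

end BoundedGaps

namespace BoundedGaps

/-! ### Tensor products of quadratic forms -/

section Tensor

variable {O X : Type*} [Fintype O] [Fintype X]

/-- The quadratic form attached to a product of weighted Gram systems. -/
noncomputable def gramForm {ι : Type*} [Fintype ι] [DecidableEq ι] (u : ι → X → ℝ) (φ : ι → O → X → ℝ)
    (c : (ι → O) → ℝ) : ℝ :=
  ∑ x : ι → X, (∏ i, u i (x i)) * (∑ l : ι → O, c l * ∏ i, φ i (l i) (x i)) ^ 2

theorem sum_fin_succ {M : Type*} [AddCommMonoid M] {n : ℕ} (F : (Fin (n + 1) → X) → M) :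
    ∑ x, F x = ∑ a : X, ∑ x : Fin n → X, F (Fin.cons a x) := by
  rw [← (Fin.consEquiv fun _ ↦ X).sum_comp, Fintype.sum_prod_type]
  rfl

theorem gramForm_succ {n : ℕ} (u : Fin (n + 1) → X → ℝ) (φ : Fin (n + 1) → O → X → ℝ)
    (c : (Fin (n + 1) → O) → ℝ) : gramForm u φ c =
      ∑ x₀, u 0 x₀ * gramForm (fun i ↦ u i.succ) (fun i ↦ φ i.succ)
        (fun l ↦ ∑ a, c (Fin.cons a l) * φ 0 a x₀) := by
  unfold gramForm
  rw [sum_fin_succ]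
  refine Finset.sum_congr rfl fun x₀ _ ↦ ?_
  rw [Finset.mul_sum]
  refine Finset.sum_congr rfl fun x _ ↦ ?_
  rw [Fin.prod_univ_succ, mul_assoc, sum_fin_succ, Finset.sum_comm]
  simp only [Fin.cons_zero, Fin.cons_succ, Fin.prod_univ_succ, Finset.sum_mul]
  congr 3
  refine Finset.sum_congr rfl fun l _ ↦ Finset.sum_congr rfl fun a _ ↦ by ring

theorem gramForm_fin_mono {n : ℕ} {u : Fin n → X → ℝ} {φ : Fin n → O → X → ℝ}
    {t : Fin n → X → ℝ} {T : Fin n → O → X → ℝ} (hu : ∀ i x, 0 ≤ u i x) (ht : ∀ i y, 0 ≤ t i y)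
    (h : ∀ i (v : O → ℝ), ∑ x, u i x * (∑ a, v a * φ i a x) ^ 2 ≤
      ∑ y, t i y * (∑ a, v a * T i a y) ^ 2) (c : (Fin n → O) → ℝ) :
    gramForm u φ c ≤ gramForm t T c := by
  induction n with
  | zero => simp [gramForm]
  | succ n ih =>
    calc gramForm u φ c ≤ ∑ y, t 0 y * gramForm (fun i ↦ u i.succ) (fun i ↦ φ i.succ)
          (fun l ↦ ∑ a, c (Fin.cons a l) * T 0 a y) := by
          have e : ∀ (s : X → ℝ) (f : O → X → ℝ),
              ∑ z, s z * gramForm (fun i ↦ u i.succ) (fun i ↦ φ i.succ)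
                (fun l ↦ ∑ a, c (Fin.cons a l) * f a z) =
              ∑ x : Fin n → X, (∏ i, u i.succ (x i)) * ∑ z, s z * (∑ a,
                (∑ l : Fin n → O, c (Fin.cons a l) * ∏ i, φ i.succ (l i) (x i)) * f a z) ^ 2 := by
            intro s f
            simp only [gramForm, Finset.mul_sum]
            rw [Finset.sum_comm]
            refine Finset.sum_congr rfl fun x _ ↦ Finset.sum_congr rfl fun z _ ↦ ?_
            rw [mul_left_comm]
            congr 3
            simp only [Finset.sum_mul]
            rw [Finset.sum_comm]
            exact Finset.sum_congr rfl fun a _ ↦ Finset.sum_congr rfl fun l _ ↦ by ring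
          rw [gramForm_succ, e (u 0) (φ 0), e (t 0) (T 0)]
          refine Finset.sum_le_sum fun x _ ↦ mul_le_mul_of_nonneg_left (h 0 _)
            (Finset.prod_nonneg fun i _ ↦ hu _ _)
      _ ≤ ∑ y, t 0 y * gramForm (fun i ↦ t i.succ) (fun i ↦ T i.succ)
          (fun l ↦ ∑ a, c (Fin.cons a l) * T 0 a y) :=
          Finset.sum_le_sum fun y _ ↦ mul_le_mul_of_nonneg_left
            (ih (fun i ↦ hu _) (fun i ↦ ht _) (fun i ↦ h _) _) (ht 0 y)
      _ = gramForm t T c := (gramForm_succ t T c).symm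

theorem gramForm_reindex {ι κ : Type*} [Fintype ι] [DecidableEq ι] [Fintype κ] [DecidableEq κ]
    (e : ι ≃ κ) (u : ι → X → ℝ) (φ : ι → O → X → ℝ) (c : (ι → O) → ℝ) :
    gramForm u φ c = gramForm (fun i ↦ u (e.symm i)) (fun i ↦ φ (e.symm i))
      (fun l ↦ c (l ∘ e)) := by
  unfold gramForm
  refine Fintype.sum_equiv (e.arrowCongr (Equiv.refl X)) _ _ fun x ↦ ?_
  congr 1
  · exact Fintype.prod_equiv e _ _ fun i ↦ by simp
  · congr 1
    refine Fintype.sum_equiv (e.arrowCongr (Equiv.refl O)) _ _ fun l ↦ ?_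
    congr 1
    · congr 1; ext i; simp
    · exact Fintype.prod_equiv e _ _ fun i ↦ by simp

/-- Local inequalities between Gram forms tensorise. -/
theorem gramForm_mono {ι : Type*} [Fintype ι] [DecidableEq ι] {u : ι → X → ℝ} {φ : ι → O → X → ℝ}
    {t : ι → X → ℝ} {T : ι → O → X → ℝ} (hu : ∀ i x, 0 ≤ u i x) (ht : ∀ i y, 0 ≤ t i y)
    (h : ∀ i (v : O → ℝ), ∑ x, u i x * (∑ a, v a * φ i a x) ^ 2 ≤
      ∑ y, t i y * (∑ a, v a * T i a y) ^ 2) (c : (ι → O) → ℝ) :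
    gramForm u φ c ≤ gramForm t T c := by
  rw [gramForm_reindex (Fintype.equivFin ι) u, gramForm_reindex (Fintype.equivFin ι) t]
  exact gramForm_fin_mono (fun _ ↦ hu _) (fun _ ↦ ht _) (fun _ ↦ h _) _

end Tensor

/-! ### Local forms of the sieve -/

section Local

variable {k : ℕ}

/-- The local sieve functions: `e` stands for `1 / (p - 1)`. -/
noncomputable def sieveFn (e : ℝ) (a x : Option (Fin k)) : ℝ :=
  a.elim 1 fun i ↦ e - if x = some i then 1 else 0

/-- Indicator basis: the constant function, and the indicators of the points `some i`. -/
noncomputable def pointFn (o x : Option (Fin k)) : ℝ :=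
  o.elim 1 fun i ↦ if x = some i then 1 else 0

/-- Coordinates in the basis `pointFn`. -/
noncomputable def pointCoeff (F : Option (Fin k) → ℝ) (o : Option (Fin k)) : ℝ :=
  o.elim (F none) fun i ↦ F (some i) - F none

theorem sum_pointCoeff (F : Option (Fin k) → ℝ) (x : Option (Fin k)) :
    F x = ∑ o, pointCoeff F o * pointFn o x := by
  rw [Fintype.sum_option]
  cases x with
  | none => simp [pointCoeff, pointFn]
  | some i => simp [pointCoeff, pointFn]

/-- The probability weights on `Option (Fin k)` with prescribed masses `m i` at `some i`. -/
noncomputable def pointMass (m : Fin k → ℝ) (x : Option (Fin k)) : ℝ :=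
  x.elim (1 - ∑ i, m i) m

theorem sum_pointCoeff_mul_mass (F : Option (Fin k) → ℝ) (m : Fin k → ℝ) :
    ∑ o, pointCoeff F o * o.elim 1 m = ∑ x, pointMass m x * F x := by
  simp only [Fintype.sum_option, pointCoeff, pointMass, Option.elim]
  simp only [sub_mul, Finset.sum_sub_distrib, Finset.sum_mul, mul_one, one_mul,
    mul_comm (F _) (m _)]
  ring

theorem sum_abs_pointCoeff_le {e : ℝ} (he : 0 < e) (he1 : e ≤ 1) (a b : Option (Fin k))
    (hab : ¬ (a = none ∧ b = none)) :
    ∑ o, |pointCoeff (fun x ↦ sieveFn e a x * sieveFn e b x) o| * o.elim e⁻¹ (fun _ ↦ 1) ≤ 4 := by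
  rw [Fintype.sum_option]
  have aux : ∀ i : Fin k, e * e⁻¹ + ∑ j, (if j = i then (1 : ℝ) else 0) ≤ 4 := by
    intro i
    rw [mul_inv_cancel₀ he.ne']
    simp; norm_num
  cases a with
  | none =>
    cases b with
    | none => exact absurd ⟨rfl, rfl⟩ hab
    | some i =>
      refine le_trans (le_of_eq ?_) (aux i)
      simp only [pointCoeff, sieveFn, Option.elim]
      congr 1
      · simp [abs_of_pos he]
      · refine Finset.sum_congr rfl fun j _ ↦ ?_
        by_cases h : j = i <;> simp [h]
  | some i =>
    cases b with
    | none =>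
      refine le_trans (le_of_eq ?_) (aux i)
      simp only [pointCoeff, sieveFn, Option.elim]
      congr 1
      · simp [abs_of_pos he]
      · refine Finset.sum_congr rfl fun j _ ↦ ?_
        by_cases h : j = i <;> simp [h]
    | some l =>
      have h1 : ∑ j : Fin k, |pointCoeff (fun x ↦ sieveFn e (some i) x * sieveFn e (some l) x) (some j)| *
          (some j).elim e⁻¹ (fun _ ↦ (1 : ℝ)) ≤
          ∑ j : Fin k, ((if j = i then (1 : ℝ) else 0) + (if j = l then 2 else 0)) := by
        refine Finset.sum_le_sum fun j _ ↦ ?_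
        simp only [pointCoeff, sieveFn, Option.elim, Option.some.injEq, mul_one]
        by_cases h : j = i <;> by_cases h' : j = l <;> simp [h, h'] <;> rw [abs_le] <;>
          constructor <;> split_ifs <;> nlinarith
      have h2 : |pointCoeff (fun x ↦ sieveFn e (some i) x * sieveFn e (some l) x) none| *
          (none : Option (Fin k)).elim e⁻¹ (fun _ ↦ (1 : ℝ)) ≤ 1 := by
        simp [pointCoeff, sieveFn, Option.elim, abs_mul, abs_of_pos he]
        field_simp
        linarith
      have h3 : ∑ j : Fin k, ((if j = i then (1 : ℝ) else 0) + (if j = l then 2 else 0)) = 3 := by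
        rw [Finset.sum_add_distrib]; simp; norm_num
      linarith

/-- Upper bound for the local form with respect to the uniform distribution modulo `p`. -/
theorem local_upper {p : ℝ} (hp : 2 ≤ p) (v : Option (Fin k) → ℝ) :
    ∑ x, pointMass (fun _ ↦ p⁻¹) x * (∑ a, v a * sieveFn (p - 1)⁻¹ a x) ^ 2 ≤
      ∑ y : Option (Fin k), y.elim (1 + (p ^ 2)⁻¹) (fun _ ↦ p⁻¹ + 8 * k / p ^ 2) *
        (∑ a, v a * (if a = y then 1 else 0)) ^ 2 := by
  set e := (p - 1)⁻¹ with he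
  set s := ∑ i : Fin k, v (some i) with hs
  set V := ∑ i : Fin k, v (some i) ^ 2 with hV
  have hsV : s ^ 2 ≤ k * V := by
    have := sq_sum_le_card_mul_sum_sq (s := Finset.univ) (f := fun i : Fin k ↦ v (some i))
    simpa using this
  have hR : ∑ y : Option (Fin k), y.elim (1 + (p ^ 2)⁻¹) (fun _ ↦ p⁻¹ + 8 * k / p ^ 2) *
        (∑ a, v a * (if a = y then 1 else 0)) ^ 2 =
      (1 + (p ^ 2)⁻¹) * v none ^ 2 + (p⁻¹ + 8 * k / p ^ 2) * V := by
    rw [Fintype.sum_option, hV, Finset.mul_sum]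
    simp
  have hx : ∀ x, ∑ a, v a * sieveFn e a x = v none + e * s - ∑ i, if x = some i then v (some i) else 0 := by
    intro x
    rw [Fintype.sum_option, hs, Finset.mul_sum, add_sub_assoc, ← Finset.sum_sub_distrib]
    simp only [sieveFn, Option.elim, mul_one]
    congr 1
    refine Finset.sum_congr rfl fun i _ ↦ ?_
    split_ifs <;> ring
  have hL : ∑ x, pointMass (fun _ : Fin k ↦ p⁻¹) x * (∑ a, v a * sieveFn e a x) ^ 2 =
      (v none + e * s) ^ 2 - 2 * p⁻¹ * (v none + e * s) * s + p⁻¹ * V := by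
    simp only [hx]
    rw [Fintype.sum_option]
    simp only [pointMass, Option.elim]
    have : ∀ i : Fin k, p⁻¹ * (v none + e * s - ∑ i', if some i = some i' then v (some i') else 0) ^ 2 =
        p⁻¹ * (v none + e * s) ^ 2 - 2 * p⁻¹ * (v none + e * s) * v (some i) + p⁻¹ * v (some i) ^ 2 := by
      intro i; simp; ring
    rw [Finset.sum_congr rfl fun i _ ↦ this i, Finset.sum_add_distrib, Finset.sum_sub_distrib,
      ← Finset.mul_sum, ← Finset.mul_sum, ← Finset.mul_sum, ← hs, ← hV]
    simp
    ring
  rw [hR, hL]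
  have hV0 : 0 ≤ V := Finset.sum_nonneg fun _ _ ↦ sq_nonneg _
  have hp0 : 0 < p := by linarith
  have hp1 : 0 < p - 1 := by linarith
  have hep : e - p⁻¹ = e * p⁻¹ := by rw [he]; field_simp; ring
  have he0 : 0 < e := inv_pos.2 hp1
  have he2 : e ≤ 2 * p⁻¹ := by
    rw [he, ← div_eq_mul_inv, inv_le_comm₀ hp1 (by positivity), inv_div]; linarith
  have hpi : 0 < p⁻¹ := inv_pos.2 hp0
  have e1 : 8 * (k : ℝ) / p ^ 2 = 8 * k * (p⁻¹ * p⁻¹) := by rw [div_eq_mul_inv, sq, mul_inv]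
  have e2 : (p ^ 2)⁻¹ = p⁻¹ * p⁻¹ := by rw [sq, mul_inv]
  rw [e1, e2]
  have h1 : (v none + e * s) ^ 2 - 2 * p⁻¹ * (v none + e * s) * s =
      v none ^ 2 + 2 * (e - p⁻¹) * v none * s + (e ^ 2 - 2 * p⁻¹ * e) * s ^ 2 := by ring
  rw [h1, hep]
  have h2 : 2 * (e * p⁻¹) * v none * s ≤ p⁻¹ * p⁻¹ * v none ^ 2 + e ^ 2 * s ^ 2 := by
    nlinarith [sq_nonneg (p⁻¹ * v none - e * s)]
  have h3 : e ^ 2 * s ^ 2 ≤ 4 * (p⁻¹ * p⁻¹) * (k * V) := by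
    have : e ^ 2 ≤ 4 * (p⁻¹ * p⁻¹) := by nlinarith
    exact mul_le_mul this hsV (sq_nonneg _) (by positivity)
  have h4 : 0 ≤ p⁻¹ * e * s ^ 2 := by positivity
  nlinarith

/-- Lower bound for the local form with respect to residues avoiding the class of `m`. -/
theorem local_lower {p : ℝ} (hp : 2 ≤ p) (m : Fin k) (v : Option (Fin k) → ℝ) :
    ∑ y : Option (Fin k), y.elim 1 (fun i ↦ if i = m then 0 else (p - 1)⁻¹ * (1 - k * (p - 1)⁻¹)) *
        (∑ a, v a * (if a = y then 1 else if a = some m ∧ y = none then (p - 1)⁻¹ else 0)) ^ 2 ≤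
      ∑ x, pointMass (fun i ↦ if i = m then 0 else (p - 1)⁻¹) x *
        (∑ a, v a * sieveFn (p - 1)⁻¹ a x) ^ 2 := by
  set e := (p - 1)⁻¹ with he
  have hp1 : 0 < p - 1 := by linarith
  have he0 : 0 < e := inv_pos.2 hp1
  set s := ∑ i : Fin k, (if i = m then 0 else v (some i)) with hs
  set V := ∑ i : Fin k, (if i = m then 0 else v (some i) ^ 2) with hV
  have hsV : s ^ 2 ≤ k * V := by
    have := sq_sum_le_card_mul_sum_sq (s := Finset.univ) (f := fun i : Fin k ↦ if i = m then 0 else v (some i))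
    simpa [ite_pow] using this
  have hsum : ∑ i : Fin k, v (some i) = v (some m) + s := by
    have h := Finset.add_sum_erase Finset.univ (fun i : Fin k ↦ v (some i)) (Finset.mem_univ m)
    have h' := Finset.add_sum_erase Finset.univ (fun i : Fin k ↦ if i = m then 0 else v (some i)) (Finset.mem_univ m)
    simp only [if_true, zero_add] at h'
    rw [← h, hs, ← h']
    congr 1
    exact Finset.sum_congr rfl fun i hi ↦ by rw [if_neg (Finset.ne_of_mem_erase hi)]
  set w := v none + e * v (some m) with hw
  have hLft : ∑ y : Option (Fin k), y.elim 1 (fun i ↦ if i = m then 0 else e * (1 - k * e)) *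
        (∑ a, v a * (if a = y then 1 else if a = some m ∧ y = none then e else 0)) ^ 2 =
      w ^ 2 + e * (1 - k * e) * V := by
    rw [Fintype.sum_option, hV, Finset.mul_sum]
    congr 1
    · rw [Fintype.sum_option]
      simp [hw, mul_comm]
    · refine Finset.sum_congr rfl fun i _ ↦ ?_
      simp only [Option.elim]
      split_ifs with h
      · simp
      · simp
  have hx : ∀ x, ∑ a, v a * sieveFn e a x = w + e * s - ∑ i, if x = some i then v (some i) else 0 := by
    intro x
    have : w + e * s = v none + e * ∑ i : Fin k, v (some i) := by rw [hsum, hw]; ring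
    rw [this, Fintype.sum_option, Finset.mul_sum, add_sub_assoc, ← Finset.sum_sub_distrib]
    simp only [sieveFn, Option.elim, mul_one]
    congr 1
    refine Finset.sum_congr rfl fun i _ ↦ ?_
    split_ifs <;> ring
  have hR : ∑ x, pointMass (fun i : Fin k ↦ if i = m then 0 else e) x * (∑ a, v a * sieveFn e a x) ^ 2 =
      (w + e * s) ^ 2 - 2 * e * (w + e * s) * s + e * V := by
    simp only [hx]
    rw [Fintype.sum_option]
    simp only [pointMass, Option.elim]
    have : ∀ i : Fin k, (if i = m then 0 else e) *
        (w + e * s - ∑ i', if some i = some i' then v (some i') else 0) ^ 2 =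
        (if i = m then 0 else e) * (w + e * s) ^ 2 - 2 * e * (w + e * s) * (if i = m then 0 else v (some i)) +
        e * (if i = m then 0 else v (some i) ^ 2) := by
      intro i
      split_ifs
      · simp
      · simp; ring
    rw [Finset.sum_congr rfl fun i _ ↦ this i, Finset.sum_add_distrib, Finset.sum_sub_distrib,
      ← Finset.mul_sum, ← Finset.mul_sum, ← Finset.sum_mul]
    simp
    ring
  rw [hLft, hR]
  nlinarith [mul_le_mul_of_nonneg_left hsV (sq_nonneg e)]

end Local

/-! ### Sieve sums over equidistributed sequences -/

section Equidistribution

variable {k : ℕ} {ι : Type*} [Fintype ι]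

/-- The support of an assignment. -/
def optSupp (τ : ι → Option (Fin k)) : Finset ι :=
  Finset.univ.filter fun p ↦ τ p ≠ none

theorem mem_optSupp {τ : ι → Option (Fin k)} {p : ι} : p ∈ optSupp τ ↔ τ p ≠ none := by
  simp [optSupp]

variable [DecidableEq ι]

theorem card_optSupp_subset_le (S : Finset ι) :
    (Finset.univ.filter fun τ : ι → Option (Fin k) ↦ optSupp τ ⊆ S).card ≤ (k + 1) ^ S.card := by
  have : (Finset.univ.filter fun τ : ι → Option (Fin k) ↦ optSupp τ ⊆ S) ⊆
      Fintype.piFinset fun p ↦ if p ∈ S then Finset.univ else {none} := by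
    intro τ hτ
    rw [Finset.mem_filter] at hτ
    rw [Fintype.mem_piFinset]
    intro p
    split_ifs with h
    · simp
    · by_contra h'
      exact h (hτ.2 (mem_optSupp.2 (by simpa using h')))
  refine (Finset.card_le_card this).trans ?_
  rw [Fintype.card_piFinset]
  have h : ∀ p, (if p ∈ S then (Finset.univ : Finset (Option (Fin k))) else {none}).card =
      if p ∈ S then k + 1 else 1 := by
    intro p; split_ifs <;> simp
  rw [Finset.prod_congr rfl fun p _ ↦ h p, Finset.prod_ite_mem]
  simp

theorem sum_pairs_le (G : Finset (Finset ι)) (f : Finset ι → ℝ) (hf : ∀ S ∈ G, 0 ≤ f S) :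
    ∑ x : (ι → Option (Fin k)) × (ι → Option (Fin k)),
      (if optSupp x.1 ∪ optSupp x.2 ∈ G then f (optSupp x.1 ∪ optSupp x.2) else 0) ≤
    ∑ S ∈ G, (((k : ℝ) + 1) ^ 2) ^ S.card * f S := by
  rw [← Finset.sum_filter, ← Finset.sum_fiberwise_of_maps_to
    (s := Finset.univ.filter fun x : (ι → Option (Fin k)) × (ι → Option (Fin k)) ↦
      optSupp x.1 ∪ optSupp x.2 ∈ G) (t := G) (g := fun x ↦ optSupp x.1 ∪ optSupp x.2)
    (fun x hx ↦ (Finset.mem_filter.1 hx).2)]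
  refine Finset.sum_le_sum fun S hS ↦ ?_
  rw [Finset.sum_congr rfl (g := fun _ ↦ f S) (fun x hx ↦ by rw [(Finset.mem_filter.1 hx).2]),
    Finset.sum_const, nsmul_eq_mul]
  refine mul_le_mul_of_nonneg_right ?_ (hf S hS)
  set B := Finset.univ.filter fun τ : ι → Option (Fin k) ↦ optSupp τ ⊆ S
  have h1 : ((Finset.univ.filter fun x : (ι → Option (Fin k)) × (ι → Option (Fin k)) ↦
      optSupp x.1 ∪ optSupp x.2 ∈ G).filter fun x ↦ optSupp x.1 ∪ optSupp x.2 = S) ⊆ B ×ˢ B := by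
    intro x hx
    have := (Finset.mem_filter.1 hx).2
    simp only [B, Finset.mem_product, Finset.mem_filter, Finset.mem_univ, true_and, ← this]
    exact ⟨Finset.subset_union_left, Finset.subset_union_right⟩
  have h2 := (Finset.card_le_card h1).trans_eq (Finset.card_product _ _)
  have h3 := h2.trans (Nat.mul_le_mul (card_optSupp_subset_le (k := k) S)
    (card_optSupp_subset_le (k := k) S))
  refine (Nat.cast_le.2 h3).trans (le_of_eq ?_)
  push_cast
  rw [← pow_mul, mul_comm 2, pow_mul, sq]

/-- Expanding the product of two sieve functions in the basis `pointFn`. -/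
theorem prod_sieveFn_mul (e : ι → ℝ) (l l' x : ι → Option (Fin k)) :
    (∏ p, sieveFn (e p) (l p) (x p)) * ∏ p, sieveFn (e p) (l' p) (x p) =
      ∑ τ : ι → Option (Fin k),
        (∏ p, pointCoeff (fun x ↦ sieveFn (e p) (l p) x * sieveFn (e p) (l' p) x) (τ p)) *
          ∏ p, pointFn (τ p) (x p) := by
  rw [← Finset.prod_mul_distrib]
  have : ∀ p, sieveFn (e p) (l p) (x p) * sieveFn (e p) (l' p) (x p) = ∑ o,
      pointCoeff (fun x ↦ sieveFn (e p) (l p) x * sieveFn (e p) (l' p) x) o * pointFn o (x p) :=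
    fun p ↦ sum_pointCoeff (fun x ↦ sieveFn (e p) (l p) x * sieveFn (e p) (l' p) x) (x p)
  rw [Finset.prod_congr rfl fun p _ ↦ this p, Finset.prod_univ_sum]
  simp only [Fintype.piFinset_univ, Finset.prod_mul_distrib]

theorem sum_abs_prod_pointCoeff_le {e : ι → ℝ} (he : ∀ p, 0 < e p) (he1 : ∀ p, e p ≤ 1)
    (l l' : ι → Option (Fin k)) {S : Finset ι} (hS : optSupp l ∪ optSupp l' = S)
    (δ : (ι → Option (Fin k)) → ℝ) {E : ℝ} (hE : 0 ≤ E)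
    (hδ : ∀ τ, optSupp τ ⊆ S → |δ τ| ≤ (∏ p ∈ S \ optSupp τ, (e p)⁻¹) * E) :
    |∑ τ : ι → Option (Fin k),
        (∏ p, pointCoeff (fun x ↦ sieveFn (e p) (l p) x * sieveFn (e p) (l' p) x) (τ p)) * δ τ| ≤
      4 ^ S.card * E := by
  have hnone : ∀ p, p ∉ S → l p = none ∧ l' p = none := by
    intro p hp
    rw [← hS, Finset.mem_union, not_or, mem_optSupp, mem_optSupp, not_not, not_not] at hp
    exact hp
  refine (Finset.abs_sum_le_sum_abs _ _).trans ?_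
  have h1 : ∀ τ : ι → Option (Fin k),
      |(∏ p, pointCoeff (fun x ↦ sieveFn (e p) (l p) x * sieveFn (e p) (l' p) x) (τ p)) * δ τ| ≤
      (∏ p, |pointCoeff (fun x ↦ sieveFn (e p) (l p) x * sieveFn (e p) (l' p) x) (τ p)| *
        (if p ∈ S then (τ p).elim (e p)⁻¹ (fun _ ↦ 1) else 1)) * E := by
    intro τ
    rw [abs_mul, Finset.abs_prod]
    by_cases hτ : optSupp τ ⊆ S
    · rw [Finset.prod_mul_distrib, mul_assoc]
      refine mul_le_mul_of_nonneg_left ((hδ τ hτ).trans (le_of_eq ?_))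
        (Finset.prod_nonneg fun _ _ ↦ abs_nonneg _)
      congr 1
      rw [Finset.prod_ite_mem, Finset.univ_inter, ← Finset.prod_sdiff hτ]
      have h3 : ∏ p ∈ optSupp τ, (τ p).elim (e p)⁻¹ (fun _ ↦ (1 : ℝ)) = 1 := by
        refine Finset.prod_eq_one fun p hp ↦ ?_
        rw [mem_optSupp] at hp
        cases h : τ p with
        | none => exact absurd h hp
        | some i => rfl
      rw [h3, mul_one]
      refine Finset.prod_congr rfl fun p hp ↦ ?_
      have : τ p = none := by
        by_contra h
        exact (Finset.mem_sdiff.1 hp).2 (mem_optSupp.2 h)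
      rw [this]; rfl
    · obtain ⟨p, hp, hpS⟩ := Finset.not_subset.1 hτ
      have : pointCoeff (fun x ↦ sieveFn (e p) (l p) x * sieveFn (e p) (l' p) x) (τ p) = 0 := by
        rw [mem_optSupp] at hp
        obtain ⟨h1, h2⟩ := hnone p hpS
        cases h : τ p with
        | none => exact absurd h hp
        | some i => simp [pointCoeff, sieveFn, h1, h2]
      rw [Finset.prod_eq_zero (Finset.mem_univ p) (by rw [this, abs_zero]), zero_mul]
      refine mul_nonneg (Finset.prod_nonneg fun p _ ↦ mul_nonneg (abs_nonneg _) ?_) hE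
      split_ifs
      · cases τ p
        · exact (inv_pos.2 (he p)).le
        · exact zero_le_one
      · exact zero_le_one
  refine (Finset.sum_le_sum fun τ _ ↦ h1 τ).trans ?_
  rw [← Finset.sum_mul]
  refine mul_le_mul_of_nonneg_right ?_ hE
  have h2 := Finset.prod_univ_sum (fun _ : ι ↦ (Finset.univ : Finset (Option (Fin k))))
    (fun p o ↦ |pointCoeff (fun x ↦ sieveFn (e p) (l p) x * sieveFn (e p) (l' p) x) o| *
        (if p ∈ S then o.elim (e p)⁻¹ (fun _ ↦ 1) else 1))
  rw [Fintype.piFinset_univ] at h2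
  rw [← h2]
  have h3 : (4 : ℝ) ^ S.card = ∏ p, if p ∈ S then 4 else 1 := by
    rw [Finset.prod_ite_mem]; simp
  rw [h3]
  refine Finset.prod_le_prod (fun p _ ↦ Finset.sum_nonneg fun o _ ↦ mul_nonneg (abs_nonneg _) ?_)
    fun p _ ↦ ?_
  · split_ifs
    · cases o
      · exact (inv_pos.2 (he p)).le
      · exact zero_le_one
    · exact zero_le_one
  · by_cases hp : p ∈ S
    · simp only [if_pos hp]
      refine sum_abs_pointCoeff_le (he p) (he1 p) (l p) (l' p) fun h ↦ ?_
      rw [← hS, Finset.mem_union, mem_optSupp, mem_optSupp] at hp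
      tauto
    · simp only [if_neg hp]
      obtain ⟨h1, h2⟩ := hnone p hp
      rw [Fintype.sum_option]
      simp [pointCoeff, sieveFn, h1, h2]

/-- If `a` is equidistributed with densities `m` among the cells given by `x`, then the sieve sum is
close to the corresponding quadratic form. -/
theorem abs_sum_sieve_sub_gramForm_le {e : ι → ℝ} (he : ∀ p, 0 < e p) (he1 : ∀ p, e p ≤ 1)
    (s : Finset ℕ) (a : ℕ → ℝ) (x : ℕ → ι → Option (Fin k)) (M : ℝ) (m : ι → Fin k → ℝ)
    (c : (ι → Option (Fin k)) → ℝ) {b : ℝ} (hb : ∀ l, |c l| ≤ b)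
    (G : Finset (Finset ι)) (hG : ∀ l l', c l ≠ 0 → c l' ≠ 0 → optSupp l ∪ optSupp l' ∈ G)
    (E : Finset ι → ℝ) (hE : ∀ S ∈ G, 0 ≤ E S)
    (hA : ∀ S ∈ G, ∀ τ : ι → Option (Fin k), optSupp τ ⊆ S →
      |∑ n ∈ s, a n * ∏ p, pointFn (τ p) (x n p) - M * ∏ p, (τ p).elim 1 (m p)| ≤
        (∏ p ∈ S \ optSupp τ, (e p)⁻¹) * E S) :
    |∑ n ∈ s, a n * (∑ l, c l * ∏ p, sieveFn (e p) (l p) (x n p)) ^ 2 -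
      M * gramForm (fun p ↦ pointMass (m p)) (fun p ↦ sieveFn (e p)) c| ≤
    b ^ 2 * ∑ S ∈ G, (4 * ((k : ℝ) + 1) ^ 2) ^ S.card * E S := by
  set A : (ι → Option (Fin k)) → ℝ := fun τ ↦ ∑ n ∈ s, a n * ∏ p, pointFn (τ p) (x n p)
  set co : (ι → Option (Fin k)) → (ι → Option (Fin k)) → (ι → Option (Fin k)) → ℝ := fun l l' τ ↦
    ∏ p, pointCoeff (fun x ↦ sieveFn (e p) (l p) x * sieveFn (e p) (l' p) x) (τ p)
  have h1 : ∑ n ∈ s, a n * (∑ l, c l * ∏ p, sieveFn (e p) (l p) (x n p)) ^ 2 =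
      ∑ y : (ι → Option (Fin k)) × (ι → Option (Fin k)),
        c y.1 * c y.2 * ∑ τ, co y.1 y.2 τ * A τ := by
    have h : ∀ n, a n * (∑ l, c l * ∏ p, sieveFn (e p) (l p) (x n p)) ^ 2 =
        ∑ y : (ι → Option (Fin k)) × (ι → Option (Fin k)), c y.1 * c y.2 *
          ∑ τ, co y.1 y.2 τ * (a n * ∏ p, pointFn (τ p) (x n p)) := by
      intro n
      rw [sq, Fintype.sum_mul_sum, ← Fintype.sum_prod_type', Finset.mul_sum]
      refine Finset.sum_congr rfl fun y _ ↦ ?_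
      have h' := prod_sieveFn_mul e y.1 y.2 (x n)
      calc _ = c y.1 * c y.2 * (a n * ((∏ p, sieveFn (e p) (y.1 p) (x n p)) *
            ∏ p, sieveFn (e p) (y.2 p) (x n p))) := by ring
        _ = _ := by
          rw [h', Finset.mul_sum]
          congr 1
          exact Finset.sum_congr rfl fun τ _ ↦ by simp only [co]; ring
    rw [Finset.sum_congr rfl fun n _ ↦ h n, Finset.sum_comm]
    refine Finset.sum_congr rfl fun y _ ↦ ?_
    rw [← Finset.mul_sum, Finset.sum_comm]
    simp only [A, Finset.mul_sum]
  have h2 : M * gramForm (fun p ↦ pointMass (m p)) (fun p ↦ sieveFn (e p)) c =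
      ∑ y : (ι → Option (Fin k)) × (ι → Option (Fin k)),
        c y.1 * c y.2 * ∑ τ, co y.1 y.2 τ * (M * ∏ p, (τ p).elim 1 (m p)) := by
    have h : ∀ l l', ∑ τ, co l l' τ * (M * ∏ p, (τ p).elim 1 (m p)) =
        M * ∑ z : ι → Option (Fin k), (∏ p, pointMass (m p) (z p)) *
          ((∏ p, sieveFn (e p) (l p) (z p)) * ∏ p, sieveFn (e p) (l' p) (z p)) := by
      intro l l'
      have e1 : ∀ τ, co l l' τ * (M * ∏ p, (τ p).elim 1 (m p)) = M * ∏ p,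
          pointCoeff (fun x ↦ sieveFn (e p) (l p) x * sieveFn (e p) (l' p) x) (τ p) *
            (τ p).elim 1 (m p) := by
        intro τ; rw [Finset.prod_mul_distrib]; simp only [co]; ring
      have e2 := Finset.prod_univ_sum (fun _ : ι ↦ (Finset.univ : Finset (Option (Fin k))))
        (fun p o ↦ pointCoeff (fun x ↦ sieveFn (e p) (l p) x * sieveFn (e p) (l' p) x) o *
            o.elim 1 (m p))
      have e3 := Finset.prod_univ_sum (fun _ : ι ↦ (Finset.univ : Finset (Option (Fin k))))
        (fun p z ↦ pointMass (m p) z * (sieveFn (e p) (l p) z * sieveFn (e p) (l' p) z))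
      rw [Fintype.piFinset_univ] at e2 e3
      rw [Finset.sum_congr rfl fun τ _ ↦ e1 τ, ← Finset.mul_sum, ← e2]
      congr 1
      simp only [sum_pointCoeff_mul_mass]
      rw [e3]
      simp only [Finset.prod_mul_distrib]
    simp only [h, gramForm]
    have h3 : ∀ z : ι → Option (Fin k), (∏ p, pointMass (m p) (z p)) *
        (∑ l : ι → Option (Fin k), c l * ∏ p, sieveFn (e p) (l p) (z p)) ^ 2 =
        ∑ y : (ι → Option (Fin k)) × (ι → Option (Fin k)), c y.1 * c y.2 *
          ((∏ p, pointMass (m p) (z p)) *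
          ((∏ p, sieveFn (e p) (y.1 p) (z p)) * ∏ p, sieveFn (e p) (y.2 p) (z p))) := by
      intro z
      rw [sq, Fintype.sum_mul_sum, ← Fintype.sum_prod_type', Finset.mul_sum]
      exact Finset.sum_congr rfl fun y _ ↦ by ring
    rw [Finset.sum_congr rfl fun z _ ↦ h3 z, Finset.sum_comm, Finset.mul_sum]
    refine Finset.sum_congr rfl fun y _ ↦ ?_
    rw [← Finset.mul_sum]
    ring
  rw [h1, h2, ← Finset.sum_sub_distrib]
  have h4 : ∀ y : (ι → Option (Fin k)) × (ι → Option (Fin k)),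
      |c y.1 * c y.2 * ∑ τ, co y.1 y.2 τ * A τ -
        c y.1 * c y.2 * ∑ τ, co y.1 y.2 τ * (M * ∏ p, (τ p).elim 1 (m p))| ≤
      if optSupp y.1 ∪ optSupp y.2 ∈ G then b ^ 2 * (4 ^ (optSupp y.1 ∪ optSupp y.2).card *
        E (optSupp y.1 ∪ optSupp y.2)) else 0 := by
    intro y
    rw [← mul_sub, ← Finset.sum_sub_distrib, abs_mul]
    simp only [← mul_sub]
    split_ifs with hy
    · have hb0 : 0 ≤ b := (abs_nonneg _).trans (hb y.1)
      refine mul_le_mul ?_ ?_ (abs_nonneg _) (sq_nonneg _)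
      · rw [abs_mul, sq]
        exact mul_le_mul (hb _) (hb _) (abs_nonneg _) hb0
      · exact sum_abs_prod_pointCoeff_le he he1 y.1 y.2 rfl _ (hE _ hy) (hA _ hy)
    · have : c y.1 * c y.2 = 0 := by
        by_contra h
        exact hy (hG _ _ (left_ne_zero_of_mul h) (right_ne_zero_of_mul h))
      rw [this]; simp
  refine (Finset.abs_sum_le_sum_abs _ _).trans ((Finset.sum_le_sum fun y _ ↦ h4 y).trans ?_)
  refine (sum_pairs_le G (fun S ↦ b ^ 2 * (4 ^ S.card * E S)) fun S hS ↦ ?_).trans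
    (le_of_eq ?_)
  · exact mul_nonneg (sq_nonneg _) (mul_nonneg (by positivity) (hE S hS))
  · rw [Finset.mul_sum]
    refine Finset.sum_congr rfl fun S _ ↦ ?_
    rw [mul_pow]; ring

end Equidistribution

/-! ### The upper bound for the sieve form -/

section Upper

variable {k : ℕ} {ι : Type*} [Fintype ι]

/-- The set of indices to which `l` assigns `i`. -/
def fiberSet (l : ι → Option (Fin k)) (i : Fin k) : Finset ι :=
  Finset.univ.filter fun p ↦ l p = some i

theorem mem_fiberSet {l : ι → Option (Fin k)} {i : Fin k} {p : ι} :
    p ∈ fiberSet l i ↔ l p = some i := by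
  simp [fiberSet]

theorem fiberSet_injective :
    Function.Injective (fiberSet : (ι → Option (Fin k)) → Fin k → Finset ι) := by
  intro l l' h
  have h' : ∀ p i, l p = some i ↔ l' p = some i := fun p i ↦ by
    rw [← mem_fiberSet, ← mem_fiberSet, h]
  funext p
  exact Option.ext fun i ↦ h' p i

theorem prod_elim_eq_prod_fiberSet (l : ι → Option (Fin k)) (f : ι → Fin k → ℝ) :
    ∏ p, (l p).elim 1 (f p) = ∏ i, ∏ p ∈ fiberSet l i, f p i := by
  simp only [fiberSet, Finset.prod_filter]
  rw [Finset.prod_comm]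
  refine Finset.prod_congr rfl fun p _ ↦ ?_
  cases h : l p with
  | none => simp
  | some j =>
    rw [Finset.prod_eq_single j]
    · simp
    · intro i _ hi
      rw [if_neg]
      simpa using Ne.symm hi
    · simp

theorem sum_optSupp_eq_sum_fiberSet (l : ι → Option (Fin k)) (f : ι → ℝ) :
    ∑ p ∈ optSupp l, f p = ∑ i, ∑ p ∈ fiberSet l i, f p := by
  simp only [fiberSet, optSupp, Finset.sum_filter]
  rw [Finset.sum_comm]
  refine Finset.sum_congr rfl fun p _ ↦ ?_
  cases h : l p with
  | none => simp
  | some j => simp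

/-- The sieve coefficients, supported on `∑ lg ≤ D` and of product form there. -/
noncomputable def sieveCoeff (lg : ι → ℝ) (D : ℝ) (g : Finset ι → ℝ) (l : ι → Option (Fin k)) : ℝ :=
  if ∑ p ∈ optSupp l, lg p ≤ D then ∏ i, g (fiberSet l i) else 0

theorem sum_prod_eq_pow (G : Finset ι → ℝ) :
    ∑ x : Fin k → Finset ι, ∏ i, G (x i) = (∑ S, G S) ^ k := by
  have := Finset.prod_univ_sum (fun _ : Fin k ↦ (Finset.univ : Finset (Finset ι))) fun _ S ↦ G S
  rw [Fintype.piFinset_univ] at this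
  rw [← this]
  simp

theorem sieveCoeff_nonneg {lg : ι → ℝ} {D : ℝ} {g : Finset ι → ℝ} (hg : ∀ S, 0 ≤ g S)
    (l : ι → Option (Fin k)) : 0 ≤ sieveCoeff lg D g l := by
  rw [sieveCoeff]
  split_ifs
  · exact Finset.prod_nonneg fun _ _ ↦ hg _
  · exact le_rfl

theorem sieveCoeff_le {lg : ι → ℝ} {D : ℝ} {g : Finset ι → ℝ} (hg : ∀ S, 0 ≤ g S) {b : ℝ}
    (hgb : ∀ S, g S ≤ b) (l : ι → Option (Fin k)) : sieveCoeff lg D g l ≤ b ^ k := by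
  have hb : 0 ≤ b := (hg ∅).trans (hgb ∅)
  rw [sieveCoeff]
  split_ifs
  · exact (Finset.prod_le_prod (fun _ _ ↦ hg _) fun _ _ ↦ hgb _).trans_eq (by simp)
  · positivity

variable [DecidableEq ι]

theorem gramForm_upper {P : ι → ℝ} (hP : ∀ p, 2 ≤ P p) (hk : ∀ p, k ≤ P p) (lg : ι → ℝ) (D : ℝ) (g : Finset ι → ℝ) :
    gramForm (fun p ↦ pointMass (fun _ : Fin k ↦ (P p)⁻¹)) (fun p ↦ sieveFn (P p - 1)⁻¹)
        (sieveCoeff lg D g) ≤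
      (∏ p, (1 + (P p ^ 2)⁻¹)) *
        (∑ S, (∏ p ∈ S, ((P p)⁻¹ + 8 * k / P p ^ 2)) * g S ^ 2) ^ k := by
  have hP0 : ∀ p, 0 < P p := fun p ↦ by linarith [hP p]
  have hρ : ∀ p, 0 ≤ (P p)⁻¹ + 8 * k / P p ^ 2 := fun p ↦ by have := hP0 p; positivity
  refine (gramForm_mono (t := fun p y ↦ y.elim (1 + (P p ^ 2)⁻¹)
      (fun _ ↦ (P p)⁻¹ + 8 * k / P p ^ 2)) (T := fun _ a y ↦ if a = y then 1 else 0)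
      ?_ ?_ (fun p v ↦ local_upper (hP p) v) _).trans ?_
  · intro p x
    cases x with
    | none =>
      have : (k : ℝ) * (P p)⁻¹ ≤ 1 := by
        rw [← div_eq_mul_inv, div_le_one (hP0 p)]; exact hk p
      simpa [pointMass] using this
    | some i => exact (inv_pos.2 (hP0 p)).le
  · intro p y
    cases y
    · have := hP0 p; simp only [Option.elim]; positivity
    · exact hρ p
  have hT : ∀ y : ι → Option (Fin k), ∑ l : ι → Option (Fin k), sieveCoeff lg D g l *
      ∏ p, (if l p = y p then (1 : ℝ) else 0) = sieveCoeff lg D g y := by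
    intro y
    rw [Finset.sum_eq_single y]
    · simp
    · intro l _ hl
      obtain ⟨p, hp⟩ := Function.ne_iff.1 hl
      rw [Finset.prod_eq_zero (Finset.mem_univ p) (if_neg hp), mul_zero]
    · simp
  simp only [gramForm, hT]
  rw [← sum_prod_eq_pow, Finset.mul_sum]
  refine sum_le_sum_of_injOn (fun l ↦ fiberSet l) (fun x _ ↦ ?_) (fun _ _ ↦ Finset.mem_univ _)
    fiberSet_injective.injOn fun l _ ↦ ?_
  · exact mul_nonneg (Finset.prod_nonneg fun p _ ↦ by positivity) (Finset.prod_nonneg fun i _ ↦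
      mul_nonneg (Finset.prod_nonneg fun p _ ↦ hρ p) (sq_nonneg _))
  · have h1 : ∏ p, (l p).elim (1 + (P p ^ 2)⁻¹) (fun _ ↦ (P p)⁻¹ + 8 * k / P p ^ 2) ≤
        (∏ p, (1 + (P p ^ 2)⁻¹)) * ∏ p, (l p).elim 1 (fun _ ↦ (P p)⁻¹ + 8 * k / P p ^ 2) := by
      rw [← Finset.prod_mul_distrib]
      have h0 : ∀ p, 0 ≤ (P p ^ 2)⁻¹ := fun p ↦ by have := hP0 p; positivity
      refine Finset.prod_le_prod (fun p _ ↦ ?_) fun p _ ↦ ?_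
      · cases l p
        · have := h0 p; simp only [Option.elim]; positivity
        · exact hρ p
      · cases l p
        · simp
        · simp only [Option.elim]
          nlinarith [h0 p, hρ p]
    have h2 : sieveCoeff lg D g l ^ 2 ≤ ∏ i, g (fiberSet l i) ^ 2 := by
      rw [Finset.prod_pow, sieveCoeff]
      split_ifs
      · exact le_rfl
      · rw [zero_pow two_ne_zero]; positivity
    refine (mul_le_mul h1 h2 (sq_nonneg _) ?_).trans (le_of_eq ?_)
    · refine mul_nonneg (Finset.prod_nonneg fun p _ ↦ by positivity) (Finset.prod_nonneg fun p _ ↦ ?_)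
      cases l p
      · exact zero_le_one
      · exact hρ p
    · rw [prod_elim_eq_prod_fiberSet, Finset.prod_mul_distrib, mul_assoc]

end Upper

section Tuples

variable {k : ℕ} {X : Type*} [Fintype X]

theorem sum_prod_mul_prod_le {w H : Fin k → X → ℝ} (hw : ∀ i x, 0 ≤ w i x)
    (hH : ∀ i x, 0 ≤ H i x) {ν : Fin k → ℝ}
    (h : ∀ i, ∑ x, w i x * H i x ≤ ν i * ∑ x, w i x) :
    ∑ x : Fin k → X, (∏ i, w i (x i)) * ∏ i, H i (x i) ≤ (∏ i, ν i) * ∏ i, ∑ x, w i x := by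
  classical
  have h1 := Finset.prod_univ_sum (fun _ : Fin k ↦ (Finset.univ : Finset X))
    fun i x ↦ w i x * H i x
  rw [Fintype.piFinset_univ] at h1
  simp only [← Finset.prod_mul_distrib]
  rw [← h1]
  exact Finset.prod_le_prod (fun i _ ↦ Finset.sum_nonneg fun x _ ↦ mul_nonneg (hw i x) (hH i x))
    fun i _ ↦ h i

theorem sum_prod_mul_le {w : Fin k → X → ℝ} (hw : ∀ i x, 0 ≤ w i x) (j : Fin k) {h : X → ℝ}
    (hh : ∀ x, 0 ≤ h x) {ν : ℝ} (hν : ∑ x, w j x * h x ≤ ν * ∑ x, w j x) :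
    ∑ x : Fin k → X, (∏ i, w i (x i)) * h (x j) ≤ ν * ∏ i, ∑ x, w i x := by
  have := sum_prod_mul_prod_le hw (H := fun i x ↦ if i = j then h x else 1)
    (ν := fun i ↦ if i = j then ν else 1) ?_ ?_
  · simpa using this
  · intro i x; split_ifs
    · exact hh x
    · exact zero_le_one
  · intro i; split_ifs with hi
    · rw [hi]; exact hν
    · simp

theorem sum_prod_mul_mul_le {w : Fin k → X → ℝ} (hw : ∀ i x, 0 ≤ w i x) {j j' : Fin k}
    (hj : j ≠ j') {h : X → ℝ} (hh : ∀ x, 0 ≤ h x) {ν : ℝ}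
    (hν : ∀ i, ∑ x, w i x * h x ≤ ν * ∑ x, w i x) :
    ∑ x : Fin k → X, (∏ i, w i (x i)) * (h (x j) * h (x j')) ≤ ν ^ 2 * ∏ i, ∑ x, w i x := by
  have key : ∀ f : Fin k → ℝ, ∏ i, (if i = j ∨ i = j' then f i else 1) = f j * f j' := by
    intro f
    have : ∀ i, (if i = j ∨ i = j' then f i else 1) =
        (if i = j then f i else 1) * (if i = j' then f i else 1) := by
      intro i
      by_cases h1 : i = j
      · subst h1; simp [hj]
      · simp [h1]
    rw [Finset.prod_congr rfl fun i _ ↦ this i, Finset.prod_mul_distrib]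
    simp
  have := sum_prod_mul_prod_le hw (H := fun i x ↦ if i = j ∨ i = j' then h x else 1)
    (ν := fun i ↦ if i = j ∨ i = j' then ν else 1) ?_ ?_
  · simpa only [key fun _ ↦ ν, fun x : Fin k → X ↦ key fun i ↦ h (x i), ← sq] using this
  · intro i x; split_ifs
    · exact hh x
    · exact zero_le_one
  · intro i; split_ifs with hi
    · exact hν i
    · simp

end Tuples

/-! ### The lower bound for the sieve form -/

section Lower

theorem one_sub_sum_le_prod_one_sub {ι : Type*} {r : ι → ℝ} (T : Finset ι) (h0 : ∀ p ∈ T, 0 ≤ r p)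
    (h1 : ∀ p ∈ T, r p ≤ 1) : 1 - ∑ p ∈ T, r p ≤ ∏ p ∈ T, (1 - r p) := by
  classical
  induction T using Finset.induction_on with
  | empty => simp
  | insert a s ha ih =>
    rw [Finset.sum_insert ha, Finset.prod_insert ha]
    have h2 := ih (fun p hp ↦ h0 p (Finset.mem_insert_of_mem hp))
      fun p hp ↦ h1 p (Finset.mem_insert_of_mem hp)
    have h3 := h0 a (Finset.mem_insert_self a s)
    have h4 := h1 a (Finset.mem_insert_self a s)
    have h5 : 0 ≤ ∑ p ∈ s, r p := Finset.sum_nonneg fun p hp ↦ h0 p (Finset.mem_insert_of_mem hp)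
    nlinarith [mul_le_mul_of_nonneg_left h2 (sub_nonneg.2 h4), mul_nonneg h3 h5]

variable {k : ℕ} {ι : Type*} [Fintype ι] [DecidableEq ι]

theorem sum_mem_le {r : ι → ℝ} (hr : ∀ p, 0 ≤ r p) {v : Finset ι → ℝ} (hv : ∀ S, 0 ≤ v S)
    (hanti : Antitone v) (p : ι) :
    ∑ S, (∏ q ∈ S, r q) * v S * (if p ∈ S then 1 else 0) ≤ r p * ∑ S, (∏ q ∈ S, r q) * v S := by
  simp only [mul_ite, mul_one, mul_zero]
  rw [← Finset.sum_filter, Finset.mul_sum]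
  refine sum_le_sum_of_injOn (fun S ↦ S.erase p) (fun S _ ↦ ?_) (fun _ _ ↦ Finset.mem_univ _) ?_
    fun S hS ↦ ?_
  · exact mul_nonneg (hr p) (mul_nonneg (Finset.prod_nonneg fun q _ ↦ hr q) (hv S))
  · intro S hS S' hS' h
    simp only [Finset.coe_filter, Finset.mem_univ, true_and, Set.mem_ofPred_eq] at hS hS'
    rw [← Finset.insert_erase hS, ← Finset.insert_erase hS']
    exact congrArg (insert p) h
  · have hp : p ∈ S := (Finset.mem_filter.1 hS).2
    rw [← Finset.mul_prod_erase S r hp, mul_assoc]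
    refine mul_le_mul_of_nonneg_left ?_ (hr p)
    exact mul_le_mul_of_nonneg_left (hanti (Finset.erase_subset p S))
      (Finset.prod_nonneg fun q _ ↦ hr q)

theorem sum_disjoint_ge {r : ι → ℝ} (hr : ∀ p, 0 ≤ r p) {v : Finset ι → ℝ} (hv : ∀ S, 0 ≤ v S)
    (hanti : Antitone v) (T : Finset ι) :
    (∑ S, (∏ q ∈ S, r q) * v S) * (1 - ∑ p ∈ T, r p) ≤
      ∑ S with Disjoint S T, (∏ q ∈ S, r q) * v S := by
  have h1 : ∑ S, (∏ q ∈ S, r q) * v S * (∑ p ∈ T, if p ∈ S then (1 : ℝ) else 0) ≤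
      (∑ S, (∏ q ∈ S, r q) * v S) * ∑ p ∈ T, r p := by
    simp only [Finset.mul_sum (s := T)]
    rw [Finset.sum_comm]
    refine Finset.sum_le_sum fun p _ ↦ ?_
    rw [mul_comm _ (r p)]
    exact sum_mem_le hr hv hanti p
  have h2 : ∑ S, (∏ q ∈ S, r q) * v S ≤ ∑ S with Disjoint S T, (∏ q ∈ S, r q) * v S +
      ∑ S, (∏ q ∈ S, r q) * v S * (∑ p ∈ T, if p ∈ S then (1 : ℝ) else 0) := by
    rw [Finset.sum_filter, ← Finset.sum_add_distrib]
    refine Finset.sum_le_sum fun S _ ↦ ?_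
    have h0 : 0 ≤ (∏ q ∈ S, r q) * v S := mul_nonneg (Finset.prod_nonneg fun q _ ↦ hr q) (hv S)
    have h3 : ∀ p, (0 : ℝ) ≤ if p ∈ S then 1 else 0 := fun p ↦ by split_ifs <;> norm_num
    split_ifs with h
    · have : 0 ≤ ∑ p ∈ T, if p ∈ S then (1 : ℝ) else 0 := Finset.sum_nonneg fun p _ ↦ h3 p
      nlinarith [mul_nonneg h0 this]
    · obtain ⟨p, hp, hpT⟩ := Finset.not_disjoint_iff.1 h
      have : (1 : ℝ) ≤ ∑ p ∈ T, if p ∈ S then (1 : ℝ) else 0 := by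
        refine le_trans ?_ (Finset.single_le_sum (fun q _ ↦ h3 q) hpT)
        rw [if_pos hp]
      nlinarith
  linarith

/-- The assignment `y` changed to `m` on `A`. -/
def extend (y : ι → Option (Fin k)) (m : Fin k) (A : Finset ι) (p : ι) : Option (Fin k) :=
  if p ∈ A then some m else y p

/-- The inner sum of the quadratic form at an assignment avoiding `m`. -/
theorem inner_sum_ge {P : ι → ℝ} (hP : ∀ p, 2 ≤ P p) (lg : ι → ℝ) {D : ℝ} {g : Finset ι → ℝ}
    (hg : ∀ S, 0 ≤ g S) (hanti : Antitone g)
    (hsupp : ∀ S, g S ≠ 0 → ∑ p ∈ S, lg p ≤ D / 2) (m : Fin k) (y : ι → Option (Fin k))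
    (hy : fiberSet y m = ∅) (hyD : ∑ p ∈ optSupp y, lg p ≤ D / 2) :
    (∏ i ∈ Finset.univ.erase m, g (fiberSet y i)) *
        ((∑ S, (∏ q ∈ S, (P q - 1)⁻¹) * g S) * (1 - ∑ p ∈ optSupp y, (P p - 1)⁻¹)) ≤
      ∑ l : ι → Option (Fin k), sieveCoeff lg D g l *
        ∏ p, (if l p = y p then 1 else if l p = some m ∧ y p = none then (P p - 1)⁻¹ else 0) := by
  have hr : ∀ p, 0 ≤ (P p - 1)⁻¹ := fun p ↦ inv_nonneg.2 (by linarith [hP p])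
  refine (mul_le_mul_of_nonneg_left (sum_disjoint_ge hr hg hanti (optSupp y))
    (Finset.prod_nonneg fun i _ ↦ hg _)).trans ?_
  rw [Finset.mul_sum]
  have hym : ∀ p, y p ≠ some m := fun p hp ↦ by
    have := mem_fiberSet.2 hp; rw [hy] at this; simp at this
  have hdis : ∀ {A : Finset ι}, Disjoint A (optSupp y) → ∀ p ∈ A, y p = none := by
    intro A hA p hp
    by_contra h
    exact (Finset.disjoint_left.1 hA) hp (mem_optSupp.2 h)
  refine sum_le_sum_of_injOn (fun A ↦ extend y m A) (fun l _ ↦ ?_) (fun _ _ ↦ Finset.mem_univ _)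
    ?_ fun A hA ↦ ?_
  · refine mul_nonneg (sieveCoeff_nonneg hg l) (Finset.prod_nonneg fun p _ ↦ ?_)
    split_ifs
    · exact zero_le_one
    · exact hr p
    · exact le_rfl
  · intro A _ A' _ h
    ext p
    have h' : extend y m A p = extend y m A' p := congrFun h p
    have : extend y m A p = some m ↔ extend y m A' p = some m := by rw [h']
    simpa [extend, hym] using this
  · have hA' : Disjoint A (optSupp y) := (Finset.mem_filter.1 hA).2
    have h1 : ∏ p, (if extend y m A p = y p then 1 else
        if extend y m A p = some m ∧ y p = none then (P p - 1)⁻¹ else 0) =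
        ∏ p ∈ A, (P p - 1)⁻¹ := by
      rw [← Finset.prod_subset (Finset.subset_univ A)]
      · refine Finset.prod_congr rfl fun p hp ↦ ?_
        simp [extend, hp, hdis hA' p hp]
      · intro p _ hp
        simp [extend, hp]
    rw [h1]
    by_cases hgA : g A = 0
    · rw [hgA, mul_zero, mul_zero]
      exact mul_nonneg (sieveCoeff_nonneg hg _) (Finset.prod_nonneg fun p _ ↦ hr p)
    · have h2 : optSupp (extend y m A) = A ∪ optSupp y := by
        ext p
        rw [Finset.mem_union, mem_optSupp, mem_optSupp, extend]
        split_ifs with h <;> simp [h]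
      have h3 : fiberSet (extend y m A) m = A := by
        ext p
        rw [mem_fiberSet, extend]
        split_ifs with h <;> simp [h, hym]
      have h4 : ∀ i ∈ Finset.univ.erase m, fiberSet (extend y m A) i = fiberSet y i := by
        intro i hi
        have hi' : m ≠ i := (Finset.ne_of_mem_erase hi).symm
        ext p
        rw [mem_fiberSet, mem_fiberSet, extend]
        split_ifs with h
        · simp [hi', hdis hA' p h]
        · rfl
      rw [sieveCoeff, h2, Finset.sum_union hA', if_pos (by linarith [hsupp A hgA]),
        ← Finset.mul_prod_erase _ _ (Finset.mem_univ m), h3,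
        Finset.prod_congr rfl fun i hi ↦ congrArg g (h4 i hi)]
      exact le_of_eq (by ring)

/-- The assignment attached to a tuple of sets. -/
noncomputable def ofTuple (x : Fin k → Finset ι) (p : ι) : Option (Fin k) :=
  open Classical in if h : ∃ i, p ∈ x i then some h.choose else none

theorem fiberSet_ofTuple {x : Fin k → Finset ι} (hx : ∀ i j, i ≠ j → Disjoint (x i) (x j))
    (i : Fin k) : fiberSet (ofTuple x) i = x i := by
  ext p
  rw [mem_fiberSet, ofTuple]
  split_ifs with h
  · rw [Option.some.injEq]
    constructor
    · intro hi; rw [← hi]; exact h.choose_spec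
    · intro hi
      by_contra hne
      exact Finset.disjoint_left.1 (hx _ _ hne) h.choose_spec hi
  · simp only [false_iff]
    exact fun hi ↦ h ⟨i, hi⟩

end Lower

section LowerForm

variable {k : ℕ} {ι : Type*}

/-- The weight of a set in the upper bound for the sieve. -/
noncomputable def setWeight (k : ℕ) (P : ι → ℝ) (g : Finset ι → ℝ) (S : Finset ι) : ℝ :=
  (∏ p ∈ S, ((P p)⁻¹ + 8 * k / P p ^ 2)) * g S ^ 2

theorem setWeight_nonneg {P : ι → ℝ} (hP : ∀ p, 0 ≤ P p) (g : Finset ι → ℝ) (S : Finset ι) :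
    0 ≤ setWeight k P g S :=
  mul_nonneg (Finset.prod_nonneg fun p _ ↦ by have := hP p; positivity) (sq_nonneg _)

variable [DecidableEq ι]

/-- The weight of the `i`-th set of a tuple whose `m`-th set is empty. -/
noncomputable def tupleWeight (P : ι → ℝ) (g : Finset ι → ℝ) (m i : Fin k) (S : Finset ι) : ℝ :=
  if i = m then (if S = ∅ then 1 else 0) else setWeight k P g S

theorem local_weight_le {P : ℝ} {k : ℝ} (hk : 1 ≤ k) (hP : 16 * k ≤ P) :
    (P⁻¹ + 8 * k / P ^ 2) * (1 - 10 * k / P) ≤ (P - 1)⁻¹ * (1 - k * (P - 1)⁻¹) := by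
  have hP0 : 0 < P := by linarith
  have hP1 : 0 < P - 1 := by linarith
  have h1 : (P⁻¹ + 8 * k / P ^ 2) * (1 - 10 * k / P) ≤ P⁻¹ * (1 - 2 * k / P) := by
    have : P⁻¹ * (1 - 2 * k / P) - (P⁻¹ + 8 * k / P ^ 2) * (1 - 10 * k / P) =
      80 * k ^ 2 / P ^ 3 := by field_simp; ring
    have h2 : 0 ≤ 80 * k ^ 2 / P ^ 3 := by positivity
    linarith
  have h2 : (P - 1)⁻¹ ≤ 2 / P := by
    rw [inv_le_comm₀ hP1 (by positivity), inv_div]; linarith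
  have h3 : k * (P - 1)⁻¹ ≤ 2 * k / P := by
    calc k * (P - 1)⁻¹ ≤ k * (2 / P) := mul_le_mul_of_nonneg_left h2 (by linarith)
      _ = _ := by ring
  have h4 : 2 * k / P ≤ 1 := by rw [div_le_one hP0]; linarith
  refine h1.trans (mul_le_mul ?_ (by linarith) (by linarith) (inv_nonneg.2 hP1.le))
  exact inv_anti₀ hP1 (by linarith)

theorem tupleWeight_nonneg {P : ι → ℝ} (hP : ∀ p, 0 ≤ P p) (g : Finset ι → ℝ) (m i : Fin k)
    (S : Finset ι) : 0 ≤ tupleWeight P g m i S := by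
  rw [tupleWeight]
  split_ifs
  · exact zero_le_one
  · exact le_rfl
  · exact setWeight_nonneg hP g S

variable [Fintype ι]

theorem lower_pointwise {P : ι → ℝ} (hk : 1 ≤ k) (hP : ∀ p, 16 * k ≤ P p) {lg : ι → ℝ}
    (hlg : ∀ p, 0 ≤ lg p) {D : ℝ} (hD : 0 < D) {g : Finset ι → ℝ}
    (hg : ∀ S, 0 ≤ g S) (hanti : Antitone g)
    (hsupp : ∀ S, g S ≠ 0 → ∑ p ∈ S, lg p ≤ D / 2) (m : Fin k) (y : ι → Option (Fin k))
    (hy : fiberSet y m = ∅) :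
    (∏ i, tupleWeight P g m i (fiberSet y i)) * ((∑ S, (∏ q ∈ S, (P q - 1)⁻¹) * g S) ^ 2 *
        (1 - ∑ p ∈ optSupp y, 14 * k / P p - 2 / D * ∑ p ∈ optSupp y, lg p)) ≤
      (∏ p, (y p).elim 1 (fun i ↦ if i = m then 0 else (P p - 1)⁻¹ * (1 - k * (P p - 1)⁻¹))) *
      (∑ l : ι → Option (Fin k), sieveCoeff lg D g l *
        ∏ p, (if l p = y p then 1 else if l p = some m ∧ y p = none then (P p - 1)⁻¹ else 0)) ^ 2 := by
  have hk' : (1 : ℝ) ≤ k := by exact_mod_cast hk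
  have hP16 : ∀ p, 16 ≤ P p := fun p ↦ by linarith [hP p]
  have hP0 : ∀ p, 0 < P p := fun p ↦ by linarith [hP16 p]
  have hke : ∀ p, k * (P p - 1)⁻¹ ≤ 1 := fun p ↦ by
    rw [← div_eq_mul_inv, div_le_one (by linarith [hP16 p])]; linarith [hP p]
  have hρ' : ∀ p, 0 ≤ (P p - 1)⁻¹ * (1 - k * (P p - 1)⁻¹) := fun p ↦
    mul_nonneg (inv_nonneg.2 (by linarith [hP16 p])) (by linarith [hke p])
  have hW0 : 0 ≤ ∏ i, tupleWeight P g m i (fiberSet y i) :=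
    Finset.prod_nonneg fun i _ ↦ tupleWeight_nonneg (fun p ↦ (hP0 p).le) g m i _
  set β := ∑ S, (∏ q ∈ S, (P q - 1)⁻¹) * g S with hβ
  have hβ0 : 0 ≤ β := Finset.sum_nonneg fun S _ ↦ mul_nonneg
    (Finset.prod_nonneg fun q _ ↦ inv_nonneg.2 (by linarith [hP16 q])) (hg S)
  have hell : 0 ≤ ∑ p ∈ optSupp y, lg p := Finset.sum_nonneg fun p _ ↦ hlg p
  have ht : 0 ≤ ∑ p ∈ optSupp y, 14 * k / P p := Finset.sum_nonneg fun p _ ↦ by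
    have := hP0 p; positivity
  have hL0 : 0 ≤ ∏ p, (y p).elim 1
      (fun i ↦ if i = m then 0 else (P p - 1)⁻¹ * (1 - k * (P p - 1)⁻¹)) := by
    refine Finset.prod_nonneg fun p _ ↦ ?_
    cases y p with
    | none => exact zero_le_one
    | some i => simp only [Option.elim]; split_ifs; exacts [le_rfl, hρ' p]
  rcases le_or_gt (1 - ∑ p ∈ optSupp y, 14 * k / P p - 2 / D * ∑ p ∈ optSupp y, lg p) 0 with hB | hB
  · exact (mul_nonpos_of_nonneg_of_nonpos hW0
      (mul_nonpos_of_nonneg_of_nonpos (sq_nonneg _) hB)).trans (mul_nonneg hL0 (sq_nonneg _))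
  have h2D : 0 ≤ 2 / D * ∑ p ∈ optSupp y, lg p := by positivity
  have hyD : ∑ p ∈ optSupp y, lg p ≤ D / 2 := by
    have : 2 / D * ∑ p ∈ optSupp y, lg p ≤ 1 := by linarith
    rw [div_mul_eq_mul_div, div_le_one hD] at this
    linarith
  have hinner := inner_sum_ge (P := P) (fun p ↦ by linarith [hP16 p]) lg hg hanti hsupp m y hy hyD
  rw [← hβ] at hinner
  set a := ∑ p ∈ optSupp y, 10 * k / P p with ha
  set b := ∑ p ∈ optSupp y, 2 * k / P p with hb
  have hab : ∑ p ∈ optSupp y, 14 * k / P p = a + 2 * b := by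
    rw [ha, hb, Finset.mul_sum, ← Finset.sum_add_distrib]
    exact Finset.sum_congr rfl fun p _ ↦ by ring
  have ha0 : 0 ≤ a := Finset.sum_nonneg fun p _ ↦ by have := hP0 p; positivity
  have hb0 : 0 ≤ b := Finset.sum_nonneg fun p _ ↦ by have := hP0 p; positivity
  have hb1 : ∑ p ∈ optSupp y, (P p - 1)⁻¹ ≤ b := by
    refine Finset.sum_le_sum fun p _ ↦ ?_
    rw [inv_le_comm₀ (by linarith [hP16 p]) (by have := hP0 p; positivity), inv_div,
      div_le_iff₀ (by positivity)]
    nlinarith [hP16 p]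
  set Γ := ∏ i ∈ Finset.univ.erase m, g (fiberSet y i) with hΓ
  have hΓ0 : 0 ≤ Γ := Finset.prod_nonneg fun i _ ↦ hg _
  have hin2 : Γ ^ 2 * (β ^ 2 * (1 - b) ^ 2) ≤ (∑ l : ι → Option (Fin k), sieveCoeff lg D g l *
        ∏ p, (if l p = y p then 1 else if l p = some m ∧ y p = none then (P p - 1)⁻¹ else 0)) ^ 2 := by
    rw [← mul_pow, ← mul_pow]
    refine pow_le_pow_left₀ (mul_nonneg hΓ0 (mul_nonneg hβ0 (by linarith))) (le_trans ?_ hinner) 2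
    exact mul_le_mul_of_nonneg_left (mul_le_mul_of_nonneg_left (by linarith) hβ0) hΓ0
  have hWeq : ∏ i, tupleWeight P g m i (fiberSet y i) =
      (∏ p ∈ optSupp y, ((P p)⁻¹ + 8 * k / P p ^ 2)) * Γ ^ 2 := by
    have e1 : ∏ p ∈ optSupp y, ((P p)⁻¹ + 8 * k / P p ^ 2) =
        ∏ p, (y p).elim 1 (fun _ ↦ (P p)⁻¹ + 8 * k / P p ^ 2) := by
      rw [optSupp, Finset.prod_filter]
      refine Finset.prod_congr rfl fun p _ ↦ ?_
      cases y p <;> simp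
    rw [e1, prod_elim_eq_prod_fiberSet, ← Finset.mul_prod_erase _ _ (Finset.mem_univ m),
      ← Finset.mul_prod_erase _ (fun i ↦ ∏ p ∈ fiberSet y i, ((P p)⁻¹ + 8 * k / P p ^ 2))
        (Finset.mem_univ m), hy, hΓ, ← Finset.prod_pow, mul_assoc, ← Finset.prod_mul_distrib]
    congr 1
    · simp [tupleWeight]
    · refine Finset.prod_congr rfl fun i hi ↦ ?_
      rw [tupleWeight, if_neg (Finset.ne_of_mem_erase hi), setWeight]
  have hprod : (∏ p ∈ optSupp y, ((P p)⁻¹ + 8 * k / P p ^ 2)) * (1 - a) ≤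
      ∏ p, (y p).elim 1 (fun i ↦ if i = m then 0 else (P p - 1)⁻¹ * (1 - k * (P p - 1)⁻¹)) := by
    have e1 : ∏ p, (y p).elim 1
        (fun i ↦ if i = m then 0 else (P p - 1)⁻¹ * (1 - k * (P p - 1)⁻¹)) =
        ∏ p ∈ optSupp y, ((P p - 1)⁻¹ * (1 - k * (P p - 1)⁻¹)) := by
      rw [optSupp, Finset.prod_filter]
      refine Finset.prod_congr rfl fun p _ ↦ ?_
      cases h : y p with
      | none => simp
      | some i =>
        have : i ≠ m := by
          rintro rfl
          have := mem_fiberSet.2 h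
          rw [hy] at this; simp at this
        simp [this]
    rw [e1]
    have e2 := one_sub_sum_le_prod_one_sub (r := fun p ↦ 10 * (k : ℝ) / P p) (optSupp y)
      (fun p _ ↦ by have := hP0 p; positivity) (fun p _ ↦ by
        rw [div_le_one (hP0 p)]; linarith [hP p])
    refine (mul_le_mul_of_nonneg_left e2 (Finset.prod_nonneg fun p _ ↦ by
      have := hP0 p; positivity)).trans ?_
    rw [← Finset.prod_mul_distrib]
    refine Finset.prod_le_prod (fun p _ ↦ mul_nonneg (by have := hP0 p; positivity) ?_)
      fun p _ ↦ local_weight_le hk' (hP p)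
    have : 10 * (k : ℝ) / P p ≤ 1 := by rw [div_le_one (hP0 p)]; linarith [hP p]
    linarith
  rw [hWeq, hab]
  set R := ∏ p ∈ optSupp y, ((P p)⁻¹ + 8 * k / P p ^ 2)
  have hR0 : 0 ≤ R := Finset.prod_nonneg fun p _ ↦ by have := hP0 p; positivity
  rw [hab] at hB
  calc R * Γ ^ 2 * (β ^ 2 * (1 - (a + 2 * b) - 2 / D * ∑ p ∈ optSupp y, lg p))
      ≤ R * Γ ^ 2 * (β ^ 2 * ((1 - a) * (1 - b) ^ 2)) := by
        refine mul_le_mul_of_nonneg_left (mul_le_mul_of_nonneg_left ?_ (sq_nonneg _)) (by positivity)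
        have h1 : 0 ≤ 1 - a := by linarith
        nlinarith [mul_nonneg h1 (sq_nonneg b), mul_nonneg ha0 hb0]
    _ = (R * (1 - a)) * (Γ ^ 2 * (β ^ 2 * (1 - b) ^ 2)) := by ring
    _ ≤ _ := mul_le_mul hprod hin2 (by positivity) hL0

theorem sum_tupleWeight_mul_le {P : ι → ℝ} (hP : ∀ p, 0 ≤ P p) {g : Finset ι → ℝ} (m i : Fin k)
    {h : Finset ι → ℝ} (h0 : h ∅ = 0) {ν : ℝ} (hν0 : 0 ≤ ν)
    (hν : ∑ S, setWeight k P g S * h S ≤ ν * ∑ S, setWeight k P g S) :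
    ∑ S, tupleWeight P g m i S * h S ≤ ν * ∑ S, tupleWeight P g m i S := by
  by_cases hi : i = m
  · have : ∑ S, tupleWeight P g m i S * h S = 0 :=
      Finset.sum_eq_zero fun S _ ↦ by
        rw [tupleWeight, if_pos hi]
        split_ifs with hS
        · rw [hS, h0, mul_zero]
        · rw [zero_mul]
    rw [this]
    exact mul_nonneg hν0 (Finset.sum_nonneg fun S _ ↦ tupleWeight_nonneg hP g m i S)
  · simpa only [tupleWeight, if_neg hi] using hν

theorem prod_sum_tupleWeight (P : ι → ℝ) (g : Finset ι → ℝ) (m : Fin k) :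
    ∏ i, ∑ S, tupleWeight P g m i S = (∑ S, setWeight k P g S) ^ (k - 1) := by
  rw [← Finset.mul_prod_erase _ _ (Finset.mem_univ m),
    Finset.prod_congr rfl (g := fun _ ↦ ∑ S, setWeight k P g S) fun i hi ↦
      Finset.sum_congr rfl fun S _ ↦ by rw [tupleWeight, if_neg (Finset.ne_of_mem_erase hi)],
    Finset.prod_const, Finset.card_erase_of_mem (Finset.mem_univ m)]
  simp [tupleWeight]

theorem gramForm_lower {P : ι → ℝ} (hk : 1 ≤ k) (hP : ∀ p, 16 * k ≤ P p) {lg : ι → ℝ}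
    (hlg : ∀ p, 0 ≤ lg p) {D : ℝ} (hD : 0 < D) {g : Finset ι → ℝ}
    (hg : ∀ S, 0 ≤ g S) (hanti : Antitone g)
    (hsupp : ∀ S, g S ≠ 0 → ∑ p ∈ S, lg p ≤ D / 2) {ν : ℝ} (hν0 : 0 ≤ ν)
    (hν : ∑ S, setWeight k P g S * ∑ p ∈ S, lg p ≤ ν * ∑ S, setWeight k P g S)
    (hνD : 2 / D * (k * ν) ≤ 1 / 4)
    (hA : (k : ℝ) * ∑ p, 14 * k / P p * ((P p)⁻¹ + 8 * k / P p ^ 2) ≤ 1 / 8)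
    (hC : (k : ℝ) ^ 2 * ∑ p, ((P p)⁻¹ + 8 * k / P p ^ 2) ^ 2 ≤ 1 / 8) (m : Fin k) :
    1 / 2 * (∑ S, (∏ q ∈ S, (P q - 1)⁻¹) * g S) ^ 2 * (∑ S, setWeight k P g S) ^ (k - 1) ≤
      gramForm (fun p ↦ pointMass (fun i ↦ if i = m then 0 else (P p - 1)⁻¹))
        (fun p ↦ sieveFn (P p - 1)⁻¹) (sieveCoeff lg D g) := by
  have hk' : (1 : ℝ) ≤ k := by exact_mod_cast hk
  have hP16 : ∀ p, 16 ≤ P p := fun p ↦ by linarith [hP p]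
  have hP0 : ∀ p, 0 ≤ P p := fun p ↦ by linarith [hP16 p]
  have he0 : ∀ p, 0 ≤ (P p - 1)⁻¹ := fun p ↦ inv_nonneg.2 (by linarith [hP16 p])
  have hke : ∀ p, k * (P p - 1)⁻¹ ≤ 1 := fun p ↦ by
    rw [← div_eq_mul_inv, div_le_one (by linarith [hP16 p])]; linarith [hP p]
  have hρ' : ∀ p, 0 ≤ (P p - 1)⁻¹ * (1 - k * (P p - 1)⁻¹) := fun p ↦
    mul_nonneg (he0 p) (by linarith [hke p])
  set t : ι → Option (Fin k) → ℝ := fun p y ↦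
    y.elim 1 (fun i ↦ if i = m then 0 else (P p - 1)⁻¹ * (1 - k * (P p - 1)⁻¹)) with ht
  have ht0 : ∀ p y, 0 ≤ t p y := by
    intro p y
    cases y with
    | none => exact zero_le_one
    | some i => simp only [ht, Option.elim]; split_ifs; exacts [le_rfl, hρ' p]
  refine le_trans ?_ (gramForm_mono (u := t) (φ := fun p a y ↦ if a = y then 1 else
    if a = some m ∧ y = none then (P p - 1)⁻¹ else 0) ht0 ?_
    (fun p v ↦ local_lower (by linarith [hP16 p]) m v) _)
  swap
  · intro p x
    cases x with
    | none =>
      simp only [pointMass, Option.elim, sub_nonneg]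
      refine (Finset.sum_le_sum (g := fun _ ↦ (P p - 1)⁻¹) fun i _ ↦ ?_).trans ?_
      · split_ifs; exacts [he0 p, le_rfl]
      · simpa using hke p
    | some i => simp only [pointMass, Option.elim]; split_ifs; exacts [le_rfl, he0 p]
  set β := ∑ S, (∏ q ∈ S, (P q - 1)⁻¹) * g S with hβ
  set w := tupleWeight P g m with hw
  have hw0 : ∀ i S, 0 ≤ w i S := fun i S ↦ tupleWeight_nonneg hP0 g m i S
  set A : (Fin k → Finset ι) → ℝ := fun x ↦ ∑ i, ∑ p ∈ x i, 14 * k / P p with hAdef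
  set B : (Fin k → Finset ι) → ℝ := fun x ↦ ∑ i, ∑ p ∈ x i, lg p with hBdef
  set F : (Fin k → Finset ι) → ℝ := fun x ↦ ∑ p, ∑ i, ∑ j ∈ Finset.univ.erase i,
    (if p ∈ x i then (1 : ℝ) else 0) * (if p ∈ x j then 1 else 0) with hFdef
  have hF0 : ∀ x, 0 ≤ F x := fun x ↦ Finset.sum_nonneg fun p _ ↦ Finset.sum_nonneg fun i _ ↦
    Finset.sum_nonneg fun j _ ↦ by positivity
  have hA0 : ∀ x, 0 ≤ A x := fun x ↦ Finset.sum_nonneg fun i _ ↦ Finset.sum_nonneg fun p _ ↦ by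
    have := hP0 p; positivity
  have hB0 : ∀ x, 0 ≤ B x := fun x ↦ Finset.sum_nonneg fun i _ ↦ Finset.sum_nonneg fun p _ ↦ hlg p
  have hF1 : ∀ x : Fin k → Finset ι, ¬ (∀ i j, i ≠ j → Disjoint (x i) (x j)) → 1 ≤ F x := by
    intro x hx
    push Not at hx
    obtain ⟨i, j, hij, hd⟩ := hx
    obtain ⟨p, hpi, hpj⟩ := Finset.not_disjoint_iff.1 hd
    have hnn : ∀ p i j, 0 ≤ (if p ∈ x i then (1 : ℝ) else 0) * (if p ∈ x j then 1 else 0) :=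
      fun p i j ↦ by positivity
    calc (1 : ℝ) = (if p ∈ x i then (1 : ℝ) else 0) * (if p ∈ x j then 1 else 0) := by
          rw [if_pos hpi, if_pos hpj, one_mul]
      _ ≤ ∑ j ∈ Finset.univ.erase i, (if p ∈ x i then (1 : ℝ) else 0) * (if p ∈ x j then 1 else 0) :=
          Finset.single_le_sum (f := fun j ↦ (if p ∈ x i then (1 : ℝ) else 0) *
            (if p ∈ x j then 1 else 0)) (fun j _ ↦ hnn p i j)
            (Finset.mem_erase.2 ⟨hij.symm, Finset.mem_univ j⟩)
      _ ≤ ∑ i, ∑ j ∈ Finset.univ.erase i,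
          (if p ∈ x i then (1 : ℝ) else 0) * (if p ∈ x j then 1 else 0) :=
          Finset.single_le_sum (f := fun i ↦ ∑ j ∈ Finset.univ.erase i,
            (if p ∈ x i then (1 : ℝ) else 0) * (if p ∈ x j then 1 else 0))
            (fun i _ ↦ Finset.sum_nonneg fun j _ ↦ hnn p i j) (Finset.mem_univ i)
      _ ≤ F x := Finset.single_le_sum (f := fun p ↦ ∑ i, ∑ j ∈ Finset.univ.erase i,
            (if p ∈ x i then (1 : ℝ) else 0) * (if p ∈ x j then 1 else 0))
            (fun p _ ↦ Finset.sum_nonneg fun i _ ↦ Finset.sum_nonneg fun j _ ↦ hnn p i j)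
            (Finset.mem_univ p)
  have hmain : ∑ x : Fin k → Finset ι, (∏ i, w i (x i)) * (β ^ 2 * (1 - A x - 2 / D * B x - F x)) ≤
      gramForm t (fun p a y ↦ if a = y then 1 else
        if a = some m ∧ y = none then (P p - 1)⁻¹ else 0) (sieveCoeff lg D g) := by
    classical
    have hle : ∑ x : Fin k → Finset ι, (∏ i, w i (x i)) * (β ^ 2 * (1 - A x - 2 / D * B x - F x)) ≤
        ∑ x : Fin k → Finset ι with (∀ i j, i ≠ j → Disjoint (x i) (x j)) ∧ x m = ∅,
          (∏ i, w i (x i)) * (β ^ 2 * (1 - A x - 2 / D * B x - F x)) := by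
      rw [Finset.sum_filter]
      refine Finset.sum_le_sum fun x _ ↦ ?_
      split_ifs with hx
      · exact le_rfl
      · by_cases hm : x m = ∅
        · have h1 := hF1 x fun h ↦ hx ⟨h, hm⟩
          have h2 : 0 ≤ 2 / D * B x := mul_nonneg (by positivity) (hB0 x)
          exact mul_nonpos_of_nonneg_of_nonpos (Finset.prod_nonneg fun i _ ↦ hw0 i _)
            (mul_nonpos_of_nonneg_of_nonpos (sq_nonneg _) (by linarith [hA0 x]))
        · rw [Finset.prod_eq_zero (Finset.mem_univ m) (by simp [hw, tupleWeight, hm]), zero_mul]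
    refine hle.trans (sum_le_sum_of_injOn (fun x ↦ ofTuple x) (fun y _ ↦ ?_)
      (fun _ _ ↦ Finset.mem_univ _) ?_ fun x hx ↦ ?_)
    · exact mul_nonneg (Finset.prod_nonneg fun p _ ↦ ht0 p _) (sq_nonneg _)
    · intro x hx x' hx' h
      simp only [Finset.coe_filter, Finset.mem_univ, true_and, Set.mem_ofPred_eq] at hx hx'
      have h' : ofTuple x = ofTuple x' := h
      funext i
      rw [← fiberSet_ofTuple hx.1 i, ← fiberSet_ofTuple hx'.1 i, h']
    · obtain ⟨hd, hm⟩ := (Finset.mem_filter.1 hx).2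
      have h1 := lower_pointwise hk hP hlg hD hg hanti hsupp m (ofTuple x)
        (by rw [fiberSet_ofTuple hd, hm])
      simp only [sum_optSupp_eq_sum_fiberSet, fiberSet_ofTuple hd] at h1
      refine le_trans ?_ h1
      refine mul_le_mul_of_nonneg_left (mul_le_mul_of_nonneg_left ?_ (sq_nonneg _))
        (Finset.prod_nonneg fun i _ ↦ hw0 i _)
      simp only [hAdef, hBdef]
      linarith [hF0 x]
  refine le_trans ?_ hmain
  have hρ : ∀ p, 0 ≤ (P p)⁻¹ + 8 * k / P p ^ 2 := fun p ↦ by have := hP0 p; positivity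
  have hmem : ∀ p, ∑ S, setWeight k P g S * (if p ∈ S then 1 else 0) ≤
      ((P p)⁻¹ + 8 * k / P p ^ 2) * ∑ S, setWeight k P g S := by
    intro p
    exact sum_mem_le hρ (fun S ↦ sq_nonneg (g S))
      (fun S S' h ↦ pow_le_pow_left₀ (hg _) (hanti h) 2) p
  set T := ∏ i, ∑ S, w i S with hT
  have hT0 : 0 ≤ T := Finset.prod_nonneg fun i _ ↦ Finset.sum_nonneg fun S _ ↦ hw0 i S
  have hone : ∑ x : Fin k → Finset ι, ∏ i, w i (x i) = T := by
    have h1 := Finset.prod_univ_sum (fun _ : Fin k ↦ (Finset.univ : Finset (Finset ι)))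
      fun i S ↦ w i S
    rw [Fintype.piFinset_univ] at h1
    exact h1.symm
  have hsA : ∑ x : Fin k → Finset ι, (∏ i, w i (x i)) * A x ≤ 1 / 8 * T := by
    simp only [hAdef, Finset.mul_sum (s := (Finset.univ : Finset (Fin k)))]
    rw [Finset.sum_comm]
    set a := ∑ p, 14 * k / P p * ((P p)⁻¹ + 8 * k / P p ^ 2)
    have : ∀ i ∈ (Finset.univ : Finset (Fin k)), ∑ x : Fin k → Finset ι,
        (∏ i, w i (x i)) * ∑ p ∈ x i, 14 * k / P p ≤ a * T := by
      intro i _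
      refine sum_prod_mul_le hw0 i (h := fun S ↦ ∑ p ∈ S, 14 * k / P p) (fun S ↦
        Finset.sum_nonneg fun p _ ↦ by have := hP0 p; positivity) ?_
      refine sum_tupleWeight_mul_le hP0 m i Finset.sum_empty (Finset.sum_nonneg fun p _ ↦ by
        have := hP0 p; positivity) ?_
      have e1 : ∀ S : Finset ι, ∑ p ∈ S, 14 * (k : ℝ) / P p =
          ∑ p, 14 * k / P p * (if p ∈ S then 1 else 0) := by
        intro S; simp
      simp only [e1, Finset.mul_sum (s := (Finset.univ : Finset ι)),
        Finset.sum_mul (s := (Finset.univ : Finset ι)), a]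
      rw [Finset.sum_comm]
      refine Finset.sum_le_sum fun p _ ↦ ?_
      have := mul_le_mul_of_nonneg_left (hmem p) (show (0 : ℝ) ≤ 14 * k / P p by
        have := hP0 p; positivity)
      rw [Finset.mul_sum] at this
      refine le_trans (le_of_eq (Finset.sum_congr rfl fun S _ ↦ by ring))
        (this.trans (le_of_eq (by ring)))
    refine (Finset.sum_le_sum this).trans ?_
    rw [Finset.sum_const, Finset.card_univ, Fintype.card_fin, nsmul_eq_mul, ← mul_assoc]
    exact mul_le_mul_of_nonneg_right hA hT0
  have hsB : ∑ x : Fin k → Finset ι, (∏ i, w i (x i)) * B x ≤ k * ν * T := by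
    simp only [hBdef, Finset.mul_sum (s := (Finset.univ : Finset (Fin k)))]
    rw [Finset.sum_comm]
    have : ∀ i ∈ (Finset.univ : Finset (Fin k)), ∑ x : Fin k → Finset ι,
        (∏ i, w i (x i)) * ∑ p ∈ x i, lg p ≤ ν * T := fun i _ ↦
      sum_prod_mul_le hw0 i (h := fun S ↦ ∑ p ∈ S, lg p) (fun S ↦
        Finset.sum_nonneg fun p _ ↦ hlg p)
        (sum_tupleWeight_mul_le hP0 m i Finset.sum_empty hν0 hν)
    refine (Finset.sum_le_sum this).trans (le_of_eq ?_)
    rw [Finset.sum_const, Finset.card_univ, Fintype.card_fin, nsmul_eq_mul, ← mul_assoc]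
  have hsF : ∑ x : Fin k → Finset ι, (∏ i, w i (x i)) * F x ≤ 1 / 8 * T := by
    simp only [hFdef, Finset.mul_sum (s := (Finset.univ : Finset ι))]
    rw [Finset.sum_comm]
    have : ∀ p ∈ (Finset.univ : Finset ι), ∑ x : Fin k → Finset ι, (∏ i, w i (x i)) *
        ∑ i, ∑ j ∈ Finset.univ.erase i, (if p ∈ x i then (1 : ℝ) else 0) *
          (if p ∈ x j then 1 else 0) ≤ k ^ 2 * (((P p)⁻¹ + 8 * k / P p ^ 2) ^ 2 * T) := by
      intro p _
      simp only [Finset.mul_sum]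
      rw [Finset.sum_comm]
      have h2 : ∀ i ∈ (Finset.univ : Finset (Fin k)), ∑ x : Fin k → Finset ι,
          ∑ j ∈ Finset.univ.erase i, (∏ i, w i (x i)) * ((if p ∈ x i then (1 : ℝ) else 0) *
          (if p ∈ x j then 1 else 0)) ≤ k * (((P p)⁻¹ + 8 * k / P p ^ 2) ^ 2 * T) := by
        intro i _
        rw [Finset.sum_comm]
        refine (Finset.sum_le_sum (g := fun _ ↦ ((P p)⁻¹ + 8 * k / P p ^ 2) ^ 2 * T)
          fun j hj ↦ ?_).trans ?_
        · exact sum_prod_mul_mul_le hw0 (Finset.ne_of_mem_erase hj).symm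
            (h := fun S ↦ if p ∈ S then (1 : ℝ) else 0) (fun S ↦ by split_ifs <;> norm_num)
            fun i ↦ sum_tupleWeight_mul_le hP0 m i (by simp) (hρ p) (hmem p)
        · rw [Finset.sum_const, nsmul_eq_mul]
          refine mul_le_mul_of_nonneg_right ?_ (by positivity)
          exact_mod_cast (Finset.card_le_univ _).trans_eq (Fintype.card_fin k)
      refine (Finset.sum_le_sum h2).trans (le_of_eq ?_)
      rw [Finset.sum_const, Finset.card_univ, Fintype.card_fin, nsmul_eq_mul]
      ring
    refine (Finset.sum_le_sum this).trans ?_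
    rw [← Finset.mul_sum, ← Finset.sum_mul, ← mul_assoc]
    exact mul_le_mul_of_nonneg_right hC hT0
  have hsum : ∑ x : Fin k → Finset ι, (∏ i, w i (x i)) * (β ^ 2 * (1 - A x - 2 / D * B x - F x)) =
      β ^ 2 * (T - ∑ x : Fin k → Finset ι, (∏ i, w i (x i)) * A x -
        2 / D * ∑ x : Fin k → Finset ι, (∏ i, w i (x i)) * B x -
        ∑ x : Fin k → Finset ι, (∏ i, w i (x i)) * F x) := by
    rw [← hone, Finset.mul_sum (a := 2 / D), ← Finset.sum_sub_distrib, ← Finset.sum_sub_distrib,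
      ← Finset.sum_sub_distrib, Finset.mul_sum]
    exact Finset.sum_congr rfl fun x _ ↦ by ring
  rw [hsum, ← prod_sum_tupleWeight P g m, ← hw, ← hT, mul_comm (1 / 2 : ℝ), mul_assoc]
  refine mul_le_mul_of_nonneg_left ?_ (sq_nonneg β)
  have h1 : 2 / D * ∑ x : Fin k → Finset ι, (∏ i, w i (x i)) * B x ≤ 1 / 4 * T := by
    calc _ ≤ 2 / D * (k * ν * T) := mul_le_mul_of_nonneg_left hsB (by positivity)
      _ = 2 / D * (k * ν) * T := by ring
      _ ≤ _ := mul_le_mul_of_nonneg_right hνD hT0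
  linarith

end LowerForm

/-- The total weight of the primes exceeding `Q`. -/
noncomputable def primeTotal (L : ℝ) (Q : ℕ) : ℝ :=
  ∑ n ∈ Finset.Icc 1 (cut L), primeWeight Q n * om L n

/-- The contribution of the nonprincipal characters to the primes in a residue class. -/
noncomputable def residueError (L : ℝ) (Q q : ℕ) : ℝ :=
  (q.totient : ℝ)⁻¹ * ∑ χ ∈ nonprincipal q, ‖primeSum L Q χ‖

theorem residueError_nonneg (L : ℝ) (Q q : ℕ) : 0 ≤ residueError L Q q := by
  unfold residueError; positivity

theorem coprime_of_primeWeight_ne_zero {Q q n : ℕ} (hq0 : 0 < q) (hq : q ≤ Q)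
    (h : primeWeight Q n ≠ 0) : n.Coprime q := by
  unfold primeWeight at h
  split_ifs at h with h'
  · rw [h'.1.coprime_iff_not_dvd]
    intro hd
    have := Nat.le_of_dvd hq0 hd
    omega
  · exact absurd rfl h

theorem primeSum_one {L : ℝ} {Q q : ℕ} [NeZero q] (hq : q ≤ Q) :
    primeSum L Q (1 : DirichletCharacter ℂ q) = (primeTotal L Q : ℂ) := by
  unfold primeSum primeTotal
  push_cast
  refine Finset.sum_congr rfl fun n _ ↦ ?_
  by_cases h : primeWeight Q n = 0
  · simp [h]
  · have hu : IsUnit (n : ZMod q) :=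
      (ZMod.isUnit_iff_coprime n q).2 (coprime_of_primeWeight_ne_zero (NeZero.pos q) hq h)
    rw [MulChar.one_apply hu, mul_one]

theorem primeSum_changeLevel {L : ℝ} {Q d q : ℕ} [NeZero q] (hq : q ≤ Q) (h : d ∣ q)
    (χ : DirichletCharacter ℂ d) :
    primeSum L Q (DirichletCharacter.changeLevel h χ) = primeSum L Q χ := by
  refine Finset.sum_congr rfl fun n _ ↦ ?_
  by_cases hn : primeWeight Q n = 0
  · simp [hn]
  · rw [changeLevel_apply_natCast h χ (coprime_of_primeWeight_ne_zero (NeZero.pos q) hq hn)]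

theorem abs_sum_primeWeight_modEq_sub_le {L : ℝ} {Q q c : ℕ} (hq0 : 0 < q) (hq : q ≤ Q)
    (hc : c.Coprime q) :
    |∑ n ∈ Finset.Icc 1 (cut L) with n ≡ c [MOD q], primeWeight Q n * om L n -
      primeTotal L Q / q.totient| ≤ residueError L Q q := by
  classical
  have : NeZero q := ⟨hq0.ne'⟩
  have hφ : (0 : ℝ) < q.totient := by exact_mod_cast Nat.totient_pos.2 hq0
  have hu : IsUnit (c : ZMod q) := (ZMod.isUnit_iff_coprime c q).2 hc
  set A : ℝ := ∑ n ∈ Finset.Icc 1 (cut L) with n ≡ c [MOD q], primeWeight Q n * om L n with hA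
  have key : ((q.totient : ℝ) * A : ℂ) =
      ∑ χ : DirichletCharacter ℂ q, χ (c : ZMod q)⁻¹ * primeSum L Q χ := by
    have h1 : ∀ n : ℕ, ∑ χ : DirichletCharacter ℂ q, χ (c : ZMod q)⁻¹ * χ n =
        if n ≡ c [MOD q] then (q.totient : ℂ) else 0 := by
      intro n
      rw [DirichletCharacter.sum_char_inv_mul_char_eq ℂ hu]
      refine if_congr ?_ rfl rfl
      rw [← ZMod.natCast_eq_natCast_iff, eq_comm]
    calc ((q.totient : ℝ) * A : ℂ) = ∑ n ∈ Finset.Icc 1 (cut L), (primeWeight Q n * om L n : ℂ) *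
          ∑ χ : DirichletCharacter ℂ q, χ (c : ZMod q)⁻¹ * χ n := by
          rw [hA, Finset.sum_filter]
          push_cast
          rw [Finset.mul_sum]
          refine Finset.sum_congr rfl fun n _ ↦ ?_
          rw [h1]
          split_ifs <;> push_cast <;> ring
      _ = ∑ χ : DirichletCharacter ℂ q, χ (c : ZMod q)⁻¹ * primeSum L Q χ := by
          simp only [primeSum, Finset.mul_sum]
          rw [Finset.sum_comm]
          refine Finset.sum_congr rfl fun χ _ ↦ Finset.sum_congr rfl fun n _ ↦ ?_
          ring
  have key2 : ((q.totient : ℝ) * A - primeTotal L Q : ℂ) =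
      ∑ χ ∈ nonprincipal q, χ (c : ZMod q)⁻¹ * primeSum L Q χ := by
    rw [key, ← Finset.sum_filter_add_sum_filter_not Finset.univ (fun χ : DirichletCharacter ℂ q ↦ χ = 1)]
    have e1 : Finset.univ.filter (fun χ : DirichletCharacter ℂ q ↦ χ = 1) = {1} := by
      ext; simp
    have e2 : Finset.univ.filter (fun χ : DirichletCharacter ℂ q ↦ ¬ χ = 1) = nonprincipal q := by
      ext; simp [mem_nonprincipal]
    have e3 : IsUnit ((c : ZMod q)⁻¹) :=
      IsUnit.of_mul_eq_one (c : ZMod q) (by rw [mul_comm, ZMod.mul_inv_of_unit _ hu])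
    rw [e1, e2, Finset.sum_singleton, primeSum_one hq, MulChar.one_apply e3]
    ring
  have key3 : |q.totient * A - primeTotal L Q| ≤ ∑ χ ∈ nonprincipal q, ‖primeSum L Q χ‖ := by
    rw [← Real.norm_eq_abs, ← Complex.norm_real]
    push_cast
    push_cast at key2
    rw [key2]
    refine (norm_sum_le _ _).trans (Finset.sum_le_sum fun χ _ ↦ ?_)
    rw [norm_mul]
    exact mul_le_of_le_one_left (norm_nonneg _) (DirichletCharacter.norm_le_one χ _)
  have e : A - primeTotal L Q / q.totient =
      (q.totient : ℝ)⁻¹ * (q.totient * A - primeTotal L Q) := by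
    field_simp
  rw [e, abs_mul, abs_of_pos (inv_pos.2 hφ)]
  exact mul_le_mul_of_nonneg_left key3 (inv_pos.2 hφ).le

theorem residueError_le {L : ℝ} {Q d q : ℕ} (hd0 : 0 < d) (hq0 : 0 < q) (hq : q ≤ Q) (h : d ∣ q) :
    residueError L Q d ≤ q.totient / d.totient * residueError L Q q := by
  classical
  have : NeZero q := ⟨hq0.ne'⟩
  have : NeZero d := ⟨hd0.ne'⟩
  have hφ : (0 : ℝ) < q.totient := by exact_mod_cast Nat.totient_pos.2 hq0
  have hφ' : (0 : ℝ) < d.totient := by exact_mod_cast Nat.totient_pos.2 hd0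
  have e : (q.totient : ℝ) / d.totient * residueError L Q q =
      (d.totient : ℝ)⁻¹ * ∑ χ ∈ nonprincipal q, ‖primeSum L Q χ‖ := by
    unfold residueError; field_simp
  rw [e]
  refine mul_le_mul_of_nonneg_left ?_ (inv_pos.2 hφ').le
  refine sum_le_sum_of_injOn (DirichletCharacter.changeLevel h) (fun _ _ ↦ norm_nonneg _) ?_ ?_ ?_
  · intro χ hχ
    rw [mem_nonprincipal] at hχ ⊢
    rwa [Ne, DirichletCharacter.changeLevel_eq_one_iff]
  · exact (DirichletCharacter.changeLevel_injective h).injOn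
  · intro χ _
    rw [primeSum_changeLevel hq]

/-! ### Residue cells modulo primes -/

section Cells

variable {k : ℕ} {ι : Type*}

open Classical in
/-- The index `i` with `q ∣ n + i * W`, if there is one. -/
noncomputable def cell (k W q n : ℕ) : Option (Fin k) :=
  if h : ∃ i : Fin k, q ∣ n + i * W then some h.choose else none

theorem eq_of_prime_dvd_add_mul {W q n i j : ℕ} (hq : q.Prime) (hW : ¬ q ∣ W) (hi : i < q) (hj : j < q)
    (h1 : q ∣ n + i * W) (h2 : q ∣ n + j * W) : i = j := by
  have h3 : i * W ≡ j * W [MOD q] := by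
    refine Nat.ModEq.add_left_cancel' n ?_
    exact ((Nat.modEq_zero_iff_dvd.2 h1).trans (Nat.modEq_zero_iff_dvd.2 h2).symm)
  have h4 := Nat.ModEq.cancel_right_of_coprime ((hq.coprime_iff_not_dvd.2 hW)) h3
  exact h4.eq_of_lt_of_lt hi hj

theorem cell_eq_some_iff {W q n : ℕ} (hq : q.Prime) (hW : ¬ q ∣ W) (hk : k ≤ q) {i : Fin k} :
    cell k W q n = some i ↔ q ∣ n + i * W := by
  unfold cell
  split_ifs with h
  · have h1 := h.choose_spec
    rw [Option.some_inj]
    constructor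
    · rintro rfl; exact h1
    · intro h2
      exact Fin.ext (eq_of_prime_dvd_add_mul hq hW (h.choose.2.trans_le hk) (i.2.trans_le hk) h1 h2)
  · simp only [false_iff]
    exact fun h2 ↦ h ⟨i, h2⟩

theorem exists_modEq_iff_forall_dvd [DecidableEq ι] {pr : ι → ℕ} (hpr : ∀ p, (pr p).Prime)
    (hinj : Function.Injective pr) {W : ℕ} (hW : ∀ p, ¬ pr p ∣ W) (w : ℕ) (a : ι → ℕ)
    (T : Finset ι) :
    ∃ b, ∀ n, (n ≡ w [MOD W] ∧ ∀ p ∈ T, pr p ∣ n + a p) ↔ n ≡ b [MOD W * ∏ p ∈ T, pr p] := by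
  induction T using Finset.induction_on with
  | empty => exact ⟨w, fun n ↦ by simp⟩
  | insert p T hp ih =>
    obtain ⟨b, hb⟩ := ih
    have hco : (W * ∏ p ∈ T, pr p).Coprime (pr p) := by
      refine Nat.Coprime.mul_left (((hpr p).coprime_iff_not_dvd.2 (hW p)).symm) ?_
      refine Nat.Coprime.prod_left fun r hr ↦ (Nat.coprime_primes (hpr r) (hpr p)).2 fun h ↦ ?_
      exact hp (hinj h ▸ hr)
    obtain ⟨c, hc⟩ : ∃ c, ∀ n, pr p ∣ n + a p ↔ n ≡ c [MOD pr p] := by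
      have h1 : a p ≤ pr p * a p := Nat.le_mul_of_pos_left _ (hpr p).pos
      refine ⟨pr p * a p - a p, fun n ↦ ?_⟩
      have h2 : pr p ∣ n + a p ↔ n + a p ≡ (pr p * a p - a p) + a p [MOD pr p] := by
        rw [Nat.sub_add_cancel h1, ← Nat.modEq_zero_iff_dvd]
        have h3 : pr p * a p ≡ 0 [MOD pr p] := Nat.modEq_zero_iff_dvd.2 (dvd_mul_right _ _)
        exact ⟨fun h ↦ h.trans h3.symm, fun h ↦ h.trans h3⟩
      rw [h2]
      exact ⟨fun h ↦ Nat.ModEq.add_right_cancel' _ h, fun h ↦ h.add_right _⟩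
    obtain ⟨d, hd1, hd2⟩ := Nat.chineseRemainder hco b c
    refine ⟨d, fun n ↦ ?_⟩
    rw [Finset.prod_insert hp, mul_comm (pr p), ← mul_assoc, ← Nat.modEq_and_modEq_iff_modEq_mul hco]
    rw [Finset.forall_mem_insert, and_left_comm, hb, hc, and_comm]
    exact and_congr ⟨fun h ↦ h.trans hd1.symm, fun h ↦ h.trans hd1⟩
      ⟨fun h ↦ h.trans hd2.symm, fun h ↦ h.trans hd2⟩

variable [Fintype ι]

theorem exists_prod_pointFn_eq [DecidableEq ι] {pr : ι → ℕ} (hpr : ∀ p, (pr p).Prime)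
    (hinj : Function.Injective pr) {W : ℕ} (hW : ∀ p, ¬ pr p ∣ W) (hk : ∀ p, k ≤ pr p)
    (τ : ι → Option (Fin k)) :
    ∃ b, b ≡ 1 [MOD W] ∧ (∀ p i, τ p = some i → pr p ∣ b + i * W) ∧
      ∀ n, (if n ≡ 1 [MOD W] then (1 : ℝ) else 0) * ∏ p, pointFn (τ p) (cell k W (pr p) n) =
        if n ≡ b [MOD W * ∏ p ∈ optSupp τ, pr p] then 1 else 0 := by
  obtain ⟨b, hb⟩ := exists_modEq_iff_forall_dvd hpr hinj hW 1
    (fun p ↦ (τ p).elim 0 fun i ↦ i * W) (optSupp τ)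
  have hiff : ∀ n, (∀ p ∈ optSupp τ, pr p ∣ n + (τ p).elim 0 fun i ↦ i * W) ↔
      ∀ p i, τ p = some i → pr p ∣ n + i * W := by
    intro n
    constructor
    · intro h p i hi
      have := h p (mem_optSupp.2 (by simp [hi]))
      simpa [hi] using this
    · intro h p hp
      obtain ⟨i, hi⟩ := Option.ne_none_iff_exists'.1 (mem_optSupp.1 hp)
      simpa [hi] using h p i hi
  have hb1 := (hb b).2 rfl
  refine ⟨b, hb1.1, (hiff b).1 hb1.2, fun n ↦ ?_⟩
  rw [if_congr (hb n).symm rfl rfl]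
  have hpt : ∀ p, pointFn (τ p) (cell k W (pr p) n) =
      if pr p ∣ n + (τ p).elim 0 (fun i ↦ i * W) ∨ τ p = none then 1 else 0 := by
    intro p
    cases h : τ p with
    | none => simp [pointFn]
    | some i => simp [pointFn, cell_eq_some_iff (hpr p) (hW p) (hk p)]
  simp only [hpt]
  by_cases h1 : n ≡ 1 [MOD W]
  · by_cases h2 : ∀ p ∈ optSupp τ, pr p ∣ n + (τ p).elim 0 fun i ↦ i * W
    · rw [if_pos h1, if_pos ⟨h1, h2⟩, one_mul]
      refine Finset.prod_eq_one fun p _ ↦ if_pos ?_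
      by_cases h3 : τ p = none
      · exact Or.inr h3
      · exact Or.inl (h2 p (mem_optSupp.2 h3))
    · have h3 := h2
      push Not at h3
      obtain ⟨p, hp, hp2⟩ := h3
      rw [Finset.prod_eq_zero (Finset.mem_univ p) (if_neg (not_or.2 ⟨hp2, mem_optSupp.1 hp⟩)),
        mul_zero]
      exact (if_neg fun h ↦ h2 h.2).symm
  · rw [if_neg h1, zero_mul]
    exact (if_neg fun h ↦ h1 h.1).symm

theorem prod_elim_eq_prod_optSupp (τ : ι → Option (Fin k)) (f : ι → ℝ) :
    ∏ p, (τ p).elim 1 (fun _ ↦ f p) = ∏ p ∈ optSupp τ, f p := by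
  rw [optSupp, Finset.prod_filter]
  refine Finset.prod_congr rfl fun p _ ↦ ?_
  cases h : τ p <;> simp

end Cells

/-- The total mass of the smooth weight. -/
noncomputable def omTotal (L : ℝ) : ℝ := ∑ n ∈ Finset.range (cut L + 1), om L n

/-- The weight of the primes in `(Q, cut L]`. -/
noncomputable def cutPrimeWeight (L : ℝ) (Q n : ℕ) : ℝ :=
  if n ≤ cut L then primeWeight Q n * om L n else 0

theorem lt_of_primeWeight_ne_zero {Q n : ℕ} (h : primeWeight Q n ≠ 0) : Q < n := by
  unfold primeWeight at h
  split_ifs at h with h'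
  · exact h'.2
  · exact absurd rfl h

theorem primeWeight_ne_zero_of_cutPrimeWeight_ne_zero {L : ℝ} {Q n : ℕ}
    (h : cutPrimeWeight L Q n ≠ 0) : primeWeight Q n ≠ 0 := by
  unfold cutPrimeWeight at h
  split_ifs at h
  · exact left_ne_zero_of_mul h
  · exact absurd rfl h

section Instances

variable {k : ℕ} {ι : Type*} [Fintype ι] {pr : ι → ℕ} {W : ℕ} {L : ℝ}

theorem abs_sum_om_modEq_sub_le (hL : 0 < L) {q : ℕ} (hq : 0 < q) (b : ℕ) :
    |∑ n ∈ Finset.range (cut L + 1) with n ≡ b [MOD q], om L n - omTotal L / q| ≤ 1 := by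
  set f : ℕ → ℝ := fun n ↦ if n < cut L + 1 then om L n else 0 with hf
  have hanti : Antitone f := by
    intro m n hmn
    simp only [hf]
    split_ifs with h1 h2
    · exact om_antitone hL hmn
    · omega
    · exact (om_pos _ _).le
    · exact le_rfl
  have h0 : ∀ n, 0 ≤ f n := fun n ↦ by
    simp only [hf]; split_ifs
    · exact (om_pos _ _).le
    · exact le_rfl
  have key := abs_sum_modEq_sub_le hanti h0 (N := cut L + 1) (fun n hn ↦ if_neg (by omega)) hq b
  have e0 : f 0 = 1 := by simp [hf, om_zero]
  have e1 : ∑ n ∈ Finset.range (cut L + 1) with n ≡ b [MOD q], f n =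
      ∑ n ∈ Finset.range (cut L + 1) with n ≡ b [MOD q], om L n :=
    Finset.sum_congr rfl fun n hn ↦ if_pos (Finset.mem_range.1 (Finset.mem_filter.1 hn).1)
  have e2 : ∑ n ∈ Finset.range (cut L + 1), f n = omTotal L :=
    Finset.sum_congr rfl fun n hn ↦ if_pos (Finset.mem_range.1 hn)
  rwa [e0, e1, e2] at key

theorem abs_sum_om_cell_sub_le [DecidableEq ι] (hL : 0 < L) (hpr : ∀ p, (pr p).Prime)
    (hinj : Function.Injective pr) (hW0 : 0 < W) (hW : ∀ p, ¬ pr p ∣ W) (hk : ∀ p, k ≤ pr p)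
    (τ : ι → Option (Fin k)) :
    |∑ n ∈ Finset.range (cut L + 1), (if n ≡ 1 [MOD W] then om L n else 0) *
        ∏ p, pointFn (τ p) (cell k W (pr p) n) -
      omTotal L / W * ∏ p, (τ p).elim 1 (fun _ ↦ (pr p : ℝ)⁻¹)| ≤ 1 := by
  obtain ⟨b, -, -, hb⟩ := exists_prod_pointFn_eq hpr hinj hW hk τ
  have hq : 0 < W * ∏ p ∈ optSupp τ, pr p :=
    Nat.mul_pos hW0 (Finset.prod_pos fun p _ ↦ (hpr p).pos)
  convert abs_sum_om_modEq_sub_le hL hq b using 3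
  · rw [Finset.sum_filter]
    refine Finset.sum_congr rfl fun n _ ↦ ?_
    have := congrArg (om L n * ·) (hb n)
    rw [← mul_assoc] at this
    convert this using 2
    · split_ifs <;> simp
    · split_ifs <;> simp
  · rw [prod_elim_eq_prod_optSupp, Finset.prod_inv_distrib]
    push_cast
    rw [div_eq_mul_inv, div_eq_mul_inv, mul_inv]
    ring

theorem sum_cutPrimeWeight_shift {Q t : ℕ} (ht : t ≤ Q) (b q : ℕ) :
    ∑ n ∈ Finset.range (cut L + 1) with n ≡ b [MOD q], cutPrimeWeight L Q (n + t) =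
      ∑ n ∈ Finset.Icc 1 (cut L) with n ≡ b + t [MOD q], primeWeight Q n * om L n := by
  have h1 : ∀ n, cutPrimeWeight L Q n ≠ 0 → Q < n ∧ n ≤ cut L := by
    intro n hn
    refine ⟨lt_of_primeWeight_ne_zero (primeWeight_ne_zero_of_cutPrimeWeight_ne_zero hn), ?_⟩
    by_contra h
    exact hn (if_neg h)
  have e : ∑ n ∈ Finset.Icc 1 (cut L) with n ≡ b + t [MOD q], primeWeight Q n * om L n =
      ∑ n ∈ Finset.Icc 1 (cut L) with n ≡ b + t [MOD q], cutPrimeWeight L Q n :=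
    Finset.sum_congr rfl fun n hn ↦
      (if_pos (Finset.mem_Icc.1 (Finset.mem_filter.1 hn).1).2).symm
  rw [e]
  refine Finset.sum_bij_ne_zero (fun n _ _ ↦ n + t) ?_ ?_ ?_ ?_
  · intro n hn hne
    have := h1 _ hne
    rw [Finset.mem_filter] at hn ⊢
    exact ⟨Finset.mem_Icc.2 ⟨by omega, this.2⟩, hn.2.add_right t⟩
  · intro m _ _ n _ _ h
    omega
  · intro n hn hne
    have := h1 _ hne
    rw [Finset.mem_filter] at hn
    refine ⟨n - t, Finset.mem_filter.2 ⟨Finset.mem_range.2 (by omega), ?_⟩, ?_, by omega⟩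
    · refine Nat.ModEq.add_right_cancel' t ?_
      rw [Nat.sub_add_cancel (by omega)]
      exact hn.2
    · rwa [Nat.sub_add_cancel (by omega)]
  · intro n _ _
    rfl

theorem totient_mul_prod {ι : Type*} {pr : ι → ℕ} (hpr : ∀ p, (pr p).Prime)
    (hinj : Function.Injective pr) (hW : ∀ p, ¬ pr p ∣ W) (T : Finset ι) :
    ((W * ∏ p ∈ T, pr p).totient : ℝ) = W.totient * ∏ p ∈ T, ((pr p : ℝ) - 1) := by
  classical
  induction T using Finset.induction_on with
  | empty => simp
  | insert p T hp ih =>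
    have hco : (pr p).Coprime (W * ∏ p ∈ T, pr p) := by
      refine Nat.Coprime.mul_right ((hpr p).coprime_iff_not_dvd.2 (hW p)) ?_
      refine Nat.Coprime.prod_right fun r hr ↦ (Nat.coprime_primes (hpr p) (hpr r)).2 fun h ↦ ?_
      exact hp (hinj h ▸ hr)
    rw [Finset.prod_insert hp, Finset.prod_insert hp, mul_left_comm, Nat.totient_mul hco,
      Nat.totient_prime (hpr p)]
    push_cast [(hpr p).one_le]
    rw [ih]
    ring

theorem abs_sum_cutPrimeWeight_cell_sub_le [DecidableEq ι] (hpr : ∀ p, (pr p).Prime)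
    (hinj : Function.Injective pr) (hW0 : 0 < W) (hW : ∀ p, ¬ pr p ∣ W) (hk : ∀ p, k ≤ pr p)
    {Q : ℕ} (m : Fin k) (hkW : k * W ≤ Q) {S : Finset ι} (hS : W * ∏ p ∈ S, pr p ≤ Q)
    (τ : ι → Option (Fin k)) (hτ : optSupp τ ⊆ S) :
    |∑ n ∈ Finset.range (cut L + 1), (if n ≡ 1 [MOD W] then cutPrimeWeight L Q (n + m * W) else 0) *
        ∏ p, pointFn (τ p) (cell k W (pr p) n) -
      primeTotal L Q / W.totient *
        ∏ p, (τ p).elim 1 (fun i ↦ if i = m then 0 else ((pr p : ℝ) - 1)⁻¹)| ≤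
      (∏ p ∈ S \ optSupp τ, (((pr p : ℝ) - 1)⁻¹)⁻¹) * residueError L Q (W * ∏ p ∈ S, pr p) := by
  have hpos : ∀ T : Finset ι, 0 < W * ∏ p ∈ T, pr p := fun T ↦
    Nat.mul_pos hW0 (Finset.prod_pos fun p _ ↦ (hpr p).pos)
  have hp1 : ∀ p, (0 : ℝ) < (pr p : ℝ) - 1 := fun p ↦ by
    have : (1 : ℝ) < pr p := by exact_mod_cast (hpr p).one_lt
    linarith
  have hmW : (m : ℕ) * W ≤ Q := (Nat.mul_le_mul_right W m.2.le).trans hkW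
  have hdvd : W * ∏ p ∈ optSupp τ, pr p ∣ W * ∏ p ∈ S, pr p :=
    Nat.mul_dvd_mul_left W (Finset.prod_dvd_prod_of_subset _ _ _ hτ)
  have hR : 0 ≤ (∏ p ∈ S \ optSupp τ, (((pr p : ℝ) - 1)⁻¹)⁻¹) *
      residueError L Q (W * ∏ p ∈ S, pr p) :=
    mul_nonneg (Finset.prod_nonneg fun p _ ↦ by have := (hp1 p).le; positivity)
      (residueError_nonneg _ _ _)
  by_cases hm : ∃ p, τ p = some m
  · obtain ⟨p, hp⟩ := hm
    rw [Finset.prod_eq_zero (Finset.mem_univ p) (by simp [hp]), mul_zero, sub_zero,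
      Finset.sum_eq_zero, abs_zero]
    · exact hR
    · intro n _
      by_cases h0 : cutPrimeWeight L Q (n + m * W) = 0
      · simp [h0]
      · have hprQ : pr p ≤ Q := by
          refine le_trans (Nat.le_of_dvd (hpos S) ?_) hS
          exact (Finset.dvd_prod_of_mem pr (hτ (mem_optSupp.2 (by simp [hp])))).mul_left W
        have hco := coprime_of_primeWeight_ne_zero (hpr p).pos hprQ
          (primeWeight_ne_zero_of_cutPrimeWeight_ne_zero h0)
        rw [Finset.prod_eq_zero (Finset.mem_univ p), mul_zero]
        rw [hp]
        refine if_neg fun hc ↦ ?_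
        rw [cell_eq_some_iff (hpr p) (hW p) (hk p)] at hc
        exact ((hpr p).coprime_iff_not_dvd.1 hco.symm) hc
  · push Not at hm
    obtain ⟨b, hb1, hb2, hb⟩ := exists_prod_pointFn_eq hpr hinj hW hk τ
    have hco : (b + m * W).Coprime (W * ∏ p ∈ optSupp τ, pr p) := by
      refine Nat.Coprime.mul_right ?_ (Nat.Coprime.prod_right fun p hp ↦ ?_)
      · rw [Nat.coprime_add_mul_right_left, Nat.Coprime, hb1.gcd_eq, Nat.gcd_one_left]
      · obtain ⟨i, hi⟩ := Option.ne_none_iff_exists'.1 (mem_optSupp.1 hp)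
        refine ((hpr p).coprime_iff_not_dvd.2 fun hd ↦ hm p ?_).symm
        rw [hi, Option.some_inj]
        exact Fin.ext (eq_of_prime_dvd_add_mul (hpr p) (hW p) (i.2.trans_le (hk p))
          (m.2.trans_le (hk p)) (hb2 p i hi) hd)
    have h1 := abs_sum_primeWeight_modEq_sub_le (L := L) (hpos (optSupp τ))
      ((Nat.le_of_dvd (hpos S) hdvd).trans hS) hco
    have h2 := residueError_le (L := L) (hpos (optSupp τ)) (hpos S) hS hdvd
    have h3 : ((W * ∏ p ∈ S, pr p).totient : ℝ) / (W * ∏ p ∈ optSupp τ, pr p).totient =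
        ∏ p ∈ S \ optSupp τ, (((pr p : ℝ) - 1)⁻¹)⁻¹ := by
      have hφ : (0 : ℝ) < W.totient := by exact_mod_cast Nat.totient_pos.2 hW0
      rw [totient_mul_prod hpr hinj hW, totient_mul_prod hpr hinj hW, mul_div_mul_left _ _ hφ.ne',
        ← Finset.prod_sdiff hτ, mul_div_assoc, div_self, mul_one]
      · simp only [inv_inv]
      · exact (Finset.prod_pos fun p _ ↦ hp1 p).ne'
    rw [h3] at h2
    refine le_trans (le_of_eq ?_) (h1.trans h2)
    congr 2
    · rw [← sum_cutPrimeWeight_shift hmW, Finset.sum_filter]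
      refine Finset.sum_congr rfl fun n _ ↦ ?_
      have := congrArg (cutPrimeWeight L Q (n + m * W) * ·) (hb n)
      rw [← mul_assoc] at this
      convert this using 2
      · split_ifs <;> simp
      · split_ifs <;> simp
    · have : ∀ p, (τ p).elim 1 (fun i ↦ if i = m then 0 else ((pr p : ℝ) - 1)⁻¹) =
          (τ p).elim 1 (fun _ ↦ ((pr p : ℝ) - 1)⁻¹) := by
        intro p
        cases h : τ p with
        | none => rfl
        | some i =>
          refine if_neg ?_
          rintro rfl
          exact hm p h
      rw [Finset.prod_congr rfl fun p _ ↦ this p, prod_elim_eq_prod_optSupp,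
        totient_mul_prod hpr hinj hW, Finset.prod_inv_distrib, div_eq_mul_inv, div_eq_mul_inv, mul_inv]
      ring

end Instances

/-! ### The two weighted sums -/

section SieveSums

variable {k : ℕ} {ι : Type*} [Fintype ι] [DecidableEq ι] {pr : ι → ℕ} {W : ℕ} {L : ℝ}

/-- The square of the sieve weight at `n`. -/
noncomputable def sieveSq (k W : ℕ) (pr : ι → ℕ) (D : ℝ) (g : Finset ι → ℝ) (n : ℕ) : ℝ :=
  (∑ l : ι → Option (Fin k), sieveCoeff (fun p ↦ Real.log (pr p)) D g l *
    ∏ p, sieveFn ((pr p : ℝ) - 1)⁻¹ (l p) (cell k W (pr p) n)) ^ 2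

theorem sieveSq_nonneg (D : ℝ) (g : Finset ι → ℝ) (n : ℕ) : 0 ≤ sieveSq k W pr D g n :=
  sq_nonneg _

theorem prod_union_le_of_sieveCoeff_ne_zero (hpr : ∀ p, (pr p).Prime) {D : ℝ} {g : Finset ι → ℝ}
    {Y : ℕ} (hY : Real.exp (2 * D) ≤ Y) {l l' : ι → Option (Fin k)}
    (hl : sieveCoeff (fun p ↦ Real.log (pr p)) D g l ≠ 0)
    (hl' : sieveCoeff (fun p ↦ Real.log (pr p)) D g l' ≠ 0) :
    ∏ p ∈ optSupp l ∪ optSupp l', pr p ≤ Y := by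
  have h : ∀ l : ι → Option (Fin k), sieveCoeff (fun p ↦ Real.log (pr p)) D g l ≠ 0 →
      ∑ p ∈ optSupp l, Real.log (pr p) ≤ D := by
    intro l hl
    unfold sieveCoeff at hl
    split_ifs at hl with h
    · exact h
    · exact absurd rfl hl
  have h1 : ∑ p ∈ optSupp l ∪ optSupp l', Real.log (pr p) ≤ 2 * D := by
    have hs := Finset.sum_union_inter (s₁ := optSupp l) (s₂ := optSupp l') (f := fun p ↦ Real.log (pr p))
    have hi : 0 ≤ ∑ p ∈ optSupp l ∩ optSupp l', Real.log (pr p) :=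
      Finset.sum_nonneg fun p _ ↦ Real.log_natCast_nonneg _
    linarith [h l hl, h l' hl']
  have h2 : ((∏ p ∈ optSupp l ∪ optSupp l', pr p : ℕ) : ℝ) ≤ Y := by
    refine le_trans ?_ ((Real.exp_le_exp.2 h1).trans hY)
    rw [Real.exp_sum]
    push_cast
    refine le_of_eq (Finset.prod_congr rfl fun p _ ↦ ?_)
    rw [Real.exp_log]
    exact_mod_cast (hpr p).pos
  exact_mod_cast h2

theorem squarefree_mul_prod {ι : Type*} [DecidableEq ι] {pr : ι → ℕ}
    (hpr : ∀ p, (pr p).Prime) (hinj : Function.Injective pr)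
    (hWs : Squarefree W) (hW : ∀ p, ¬ pr p ∣ W) (S : Finset ι) :
    Squarefree (W * ∏ p ∈ S, pr p) ∧
      (W * ∏ p ∈ S, pr p).primeFactors.card = W.primeFactors.card + S.card := by
  induction S using Finset.induction_on with
  | empty => simpa using hWs
  | insert p T hp ih =>
    have hco : (pr p).Coprime (W * ∏ p ∈ T, pr p) := by
      refine Nat.Coprime.mul_right ((hpr p).coprime_iff_not_dvd.2 (hW p)) ?_
      refine Nat.Coprime.prod_right fun r hr ↦ (Nat.coprime_primes (hpr p) (hpr r)).2 fun h ↦ ?_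
      exact hp (hinj h ▸ hr)
    rw [Finset.prod_insert hp, mul_left_comm, Nat.squarefree_mul hco, hco.primeFactors_mul,
      Finset.card_union_of_disjoint hco.disjoint_primeFactors, ih.2, (hpr p).primeFactors,
      Finset.card_insert_of_notMem hp, Finset.card_singleton]
    exact ⟨⟨(hpr p).squarefree, ih.1⟩, by ring⟩

theorem mul_prod_injective {ι : Type*} {pr : ι → ℕ}
    (hpr : ∀ p, (pr p).Prime) (hinj : Function.Injective pr)
    (hW : ∀ p, ¬ pr p ∣ W) : Function.Injective fun S : Finset ι ↦ W * ∏ p ∈ S, pr p := by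
  have h : ∀ (S : Finset ι) p, p ∈ S ↔ pr p ∣ W * ∏ p ∈ S, pr p := by
    intro S p
    rw [(hpr p).dvd_mul, or_iff_right (hW p), (hpr p).prime.dvd_finsetProd_iff]
    constructor
    · exact fun hp ↦ ⟨p, hp, dvd_rfl⟩
    · rintro ⟨r, hr, hd⟩
      rwa [hinj ((Nat.prime_dvd_prime_iff_eq (hpr p) (hpr r)).1 hd)]
  intro S T hST
  ext p
  rw [h S, h T]
  exact iff_of_eq (congrArg (pr p ∣ ·) hST)

theorem sum_pow_card_le (hpr : ∀ p, (pr p).Prime) (hinj : Function.Injective pr) (K Y : ℕ) :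
    ∑ S : Finset ι with ∏ p ∈ S, pr p ≤ Y, (K : ℝ) ^ S.card ≤ Y * (1 + Real.log Y) ^ K := by
  have h1 : ∀ p, ¬ pr p ∣ 1 := fun p h ↦ (hpr p).one_lt.ne' (Nat.dvd_one.1 h)
  calc ∑ S : Finset ι with ∏ p ∈ S, pr p ≤ Y, (K : ℝ) ^ S.card
      ≤ ∑ n ∈ Finset.Icc 1 Y, (Y : ℝ) * (sqfreePow K n * (n : ℝ)⁻¹) := by
        refine sum_le_sum_of_injOn (fun S ↦ 1 * ∏ p ∈ S, pr p) ?_ ?_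
          (mul_prod_injective hpr hinj h1).injOn ?_
        · exact fun n _ ↦ mul_nonneg (by positivity) (mul_nonneg (sqfreePow_nonneg _ _) (by positivity))
        · intro S hS
          rw [one_mul]
          exact Finset.mem_Icc.2 ⟨Finset.prod_pos fun p _ ↦ (hpr p).pos, (Finset.mem_filter.1 hS).2⟩
        · intro S hS
          obtain ⟨h2, h3⟩ := squarefree_mul_prod hpr hinj squarefree_one h1 S
          have h4 : (0 : ℝ) < ((1 * ∏ p ∈ S, pr p : ℕ) : ℝ) := by
            rw [one_mul]; exact_mod_cast Finset.prod_pos fun p _ ↦ (hpr p).pos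
          have h5 : ((1 * ∏ p ∈ S, pr p : ℕ) : ℝ) ≤ Y := by
            rw [one_mul]; exact_mod_cast (Finset.mem_filter.1 hS).2
          simp only [sqfreePow_apply, if_pos h2, h3, Nat.primeFactors_one, Finset.card_empty, zero_add]
          rw [mul_left_comm, ← div_eq_mul_inv]
          exact le_mul_of_one_le_right (by positivity) ((one_le_div h4).2 h5)
    _ = Y * ∑ n ∈ Finset.Icc 1 Y, sqfreePow K n * (n : ℝ)⁻¹ := by rw [Finset.mul_sum]
    _ ≤ Y * (1 + Real.log Y) ^ K := by
        refine mul_le_mul_of_nonneg_left ((sum_sqfreePow_div_le K Y).trans ?_) (by positivity)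
        refine pow_le_pow_left₀ (Finset.sum_nonneg fun _ _ ↦ by positivity) ?_ _
        have h := harmonic_le_one_add_log Y
        rw [harmonic_eq_sum_Icc] at h
        push_cast at h
        exact h

theorem sum_pow_card_mul_residueError_le (hpr : ∀ p, (pr p).Prime) (hinj : Function.Injective pr)
    (hWs : Squarefree W) (hW : ∀ p, ¬ pr p ∣ W) {K Y Q : ℕ} (hK : 1 ≤ K) (hYQ : W * Y ≤ Q) :
    ∑ S : Finset ι with ∏ p ∈ S, pr p ≤ Y,
      (K : ℝ) ^ S.card * residueError L Q (W * ∏ p ∈ S, pr p) ≤ bvSum K L Q := by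
  have hW0 : 0 < W := Nat.pos_of_ne_zero hWs.ne_zero
  refine sum_le_sum_of_injOn (fun S ↦ W * ∏ p ∈ S, pr p) ?_ ?_
    (mul_prod_injective hpr hinj hW).injOn ?_
  · exact fun n _ ↦ mul_nonneg (modWeight_nonneg _ _) (Finset.sum_nonneg fun _ _ ↦ norm_nonneg _)
  · intro S hS
    exact Finset.mem_Icc.2 ⟨Nat.mul_pos hW0 (Finset.prod_pos fun p _ ↦ (hpr p).pos),
      (Nat.mul_le_mul_left W (Finset.mem_filter.1 hS).2).trans hYQ⟩
  · intro S hS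
    obtain ⟨h2, h3⟩ := squarefree_mul_prod hpr hinj hWs hW S
    rw [residueError, modWeight, sqfreePow_apply, if_pos h2, h3, mul_assoc]
    refine mul_le_mul_of_nonneg_right ?_
      (mul_nonneg (by positivity) (Finset.sum_nonneg fun _ _ ↦ norm_nonneg _))
    exact pow_le_pow_right₀ (by exact_mod_cast hK) (by omega)

theorem sum_om_mul_sieveSq_le (hL : 0 < L) (hpr : ∀ p, (pr p).Prime)
    (hinj : Function.Injective pr) (hW0 : 0 < W) (hW : ∀ p, ¬ pr p ∣ W) (hk : ∀ p, k ≤ pr p)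
    {D b : ℝ} {g : Finset ι → ℝ} (hg : ∀ S, 0 ≤ g S) (hgb : ∀ S, g S ≤ b)
    {Y : ℕ} (hY : Real.exp (2 * D) ≤ Y) :
    ∑ n ∈ Finset.range (cut L + 1), (if n ≡ 1 [MOD W] then om L n else 0) * sieveSq k W pr D g n ≤
      omTotal L / W * gramForm (fun p ↦ pointMass (fun _ : Fin k ↦ (pr p : ℝ)⁻¹))
        (fun p ↦ sieveFn ((pr p : ℝ) - 1)⁻¹) (sieveCoeff (fun p ↦ Real.log (pr p)) D g) +
      (b ^ k) ^ 2 * (Y * (1 + Real.log Y) ^ (4 * (k + 1) ^ 2)) := by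
  have hp1 : ∀ p, (1 : ℝ) ≤ (pr p : ℝ) - 1 := fun p ↦ by
    have : (2 : ℝ) ≤ pr p := by exact_mod_cast (hpr p).two_le
    linarith
  have key := abs_sum_sieve_sub_gramForm_le (e := fun p ↦ ((pr p : ℝ) - 1)⁻¹)
    (fun p ↦ inv_pos.2 (zero_lt_one.trans_le (hp1 p))) (fun p ↦ inv_le_one_of_one_le₀ (hp1 p))
    (Finset.range (cut L + 1)) (fun n ↦ if n ≡ 1 [MOD W] then om L n else 0)
    (fun n p ↦ cell k W (pr p) n) (omTotal L / W) (fun p _ ↦ (pr p : ℝ)⁻¹)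
    (sieveCoeff (fun p ↦ Real.log (pr p)) D g) (b := b ^ k)
    (fun l ↦ by
      rw [abs_of_nonneg (sieveCoeff_nonneg hg l)]
      exact sieveCoeff_le hg hgb l)
    (Finset.univ.filter fun S ↦ ∏ p ∈ S, pr p ≤ Y)
    (fun l l' hl hl' ↦ Finset.mem_filter.2 ⟨Finset.mem_univ _,
      prod_union_le_of_sieveCoeff_ne_zero hpr hY hl hl'⟩)
    (fun _ ↦ 1) (fun _ _ ↦ zero_le_one)
    (fun S _ τ _ ↦ by
      refine (abs_sum_om_cell_sub_le hL hpr hinj hW0 hW hk τ).trans ?_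
      rw [mul_one]
      refine Finset.one_le_prod fun p _ ↦ ?_
      rw [inv_inv]
      exact hp1 p)
  have h2 := sum_pow_card_le hpr hinj (4 * (k + 1) ^ 2) Y
  have h3 : (0 : ℝ) ≤ (b ^ k) ^ 2 := sq_nonneg _
  have h4 := mul_le_mul_of_nonneg_left h2 h3
  have h5 := (abs_le.1 key).2
  simp only [mul_one] at h5
  push_cast at h4
  unfold sieveSq
  linarith

theorem le_sum_cutPrimeWeight_mul_sieveSq (hpr : ∀ p, (pr p).Prime)
    (hinj : Function.Injective pr) (hWs : Squarefree W) (hW : ∀ p, ¬ pr p ∣ W)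
    (hk : ∀ p, k ≤ pr p) {D b : ℝ} {g : Finset ι → ℝ} (hg : ∀ S, 0 ≤ g S) (hgb : ∀ S, g S ≤ b)
    {Y Q : ℕ} (hY : Real.exp (2 * D) ≤ Y) (hYQ : W * Y ≤ Q) (hkW : k * W ≤ Q) (m : Fin k) :
    primeTotal L Q / W.totient *
        gramForm (fun p ↦ pointMass (fun i : Fin k ↦ if i = m then 0 else ((pr p : ℝ) - 1)⁻¹))
        (fun p ↦ sieveFn ((pr p : ℝ) - 1)⁻¹) (sieveCoeff (fun p ↦ Real.log (pr p)) D g) -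
      (b ^ k) ^ 2 * bvSum (4 * (k + 1) ^ 2) L Q ≤
    ∑ n ∈ Finset.range (cut L + 1),
      (if n ≡ 1 [MOD W] then cutPrimeWeight L Q (n + m * W) else 0) * sieveSq k W pr D g n := by
  have hW0 : 0 < W := Nat.pos_of_ne_zero hWs.ne_zero
  have hp1 : ∀ p, (1 : ℝ) ≤ (pr p : ℝ) - 1 := fun p ↦ by
    have : (2 : ℝ) ≤ pr p := by exact_mod_cast (hpr p).two_le
    linarith
  have key := abs_sum_sieve_sub_gramForm_le (e := fun p ↦ ((pr p : ℝ) - 1)⁻¹)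
    (fun p ↦ inv_pos.2 (zero_lt_one.trans_le (hp1 p))) (fun p ↦ inv_le_one_of_one_le₀ (hp1 p))
    (Finset.range (cut L + 1)) (fun n ↦ if n ≡ 1 [MOD W] then cutPrimeWeight L Q (n + m * W) else 0)
    (fun n p ↦ cell k W (pr p) n) (primeTotal L Q / W.totient)
    (fun p i ↦ if i = m then 0 else ((pr p : ℝ) - 1)⁻¹)
    (sieveCoeff (fun p ↦ Real.log (pr p)) D g) (b := b ^ k)
    (fun l ↦ by
      rw [abs_of_nonneg (sieveCoeff_nonneg hg l)]
      exact sieveCoeff_le hg hgb l)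
    (Finset.univ.filter fun S ↦ ∏ p ∈ S, pr p ≤ Y)
    (fun l l' hl hl' ↦ Finset.mem_filter.2 ⟨Finset.mem_univ _,
      prod_union_le_of_sieveCoeff_ne_zero hpr hY hl hl'⟩)
    (fun S ↦ residueError L Q (W * ∏ p ∈ S, pr p)) (fun _ _ ↦ residueError_nonneg _ _ _)
    (fun S hS τ hτ ↦ abs_sum_cutPrimeWeight_cell_sub_le hpr hinj hW0 hW hk m hkW
      ((Nat.mul_le_mul_left W (Finset.mem_filter.1 hS).2).trans hYQ) τ hτ)
  have h2 := sum_pow_card_mul_residueError_le (L := L) hpr hinj hWs hW (K := 4 * (k + 1) ^ 2)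
    (Nat.mul_pos (by norm_num) (by positivity)) hYQ
  have h3 : (0 : ℝ) ≤ (b ^ k) ^ 2 := sq_nonneg _
  have h4 := mul_le_mul_of_nonneg_left h2 h3
  have h5 := (abs_le.1 key).1
  push_cast at h4
  unfold sieveSq
  linarith

end SieveSums

/-- The proportion of integers coprime to `W`. -/
noncomputable def density (W : ℕ) : ℝ := W.totient / W

theorem density_pos {W : ℕ} (hW : 0 < W) : 0 < density W :=
  div_pos (by exact_mod_cast Nat.totient_pos.2 hW) (by exact_mod_cast hW)

theorem inv_le_density {W : ℕ} (hW : 0 < W) : (W : ℝ)⁻¹ ≤ density W := by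
  unfold density
  rw [inv_eq_one_div]
  have : (1 : ℝ) ≤ W.totient := by exact_mod_cast Nat.totient_pos.2 hW
  gcongr

/-- The harmonic sum over integers coprime to `W`. -/
noncomputable def coprimeHarmonic (W N : ℕ) : ℝ :=
  ∑ n ∈ Finset.Icc 1 N with n.Coprime W, (n : ℝ)⁻¹

theorem abs_sum_coprime_sub_le {f : ℕ → ℝ} (hf : Antitone f) (h0 : ∀ n, 0 ≤ f n) {N : ℕ}
    (hN : ∀ n, N ≤ n → f n = 0) {q : ℕ} (hq : 0 < q) :
    |∑ n ∈ Finset.range N with n.Coprime q, f n - density q * ∑ n ∈ Finset.range N, f n| ≤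
      q.totient * f 0 := by
  set A := (Finset.range q).filter fun a ↦ a.Coprime q with hA
  have hcard : (A.card : ℝ) = q.totient := by
    rw [Nat.totient_eq_card_coprime]
    congr 2
    exact Finset.filter_congr fun a _ ↦ Nat.coprime_comm
  have h1 : ∑ n ∈ Finset.range N with n.Coprime q, f n =
      ∑ a ∈ A, ∑ n ∈ Finset.range N with n ≡ a [MOD q], f n := by
    rw [← Finset.sum_fiberwise_of_maps_to (t := A) (g := fun n ↦ n % q)]
    · refine Finset.sum_congr rfl fun a ha ↦ Finset.sum_congr ?_ fun _ _ ↦ rfl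
      rw [Finset.mem_filter, Finset.mem_range] at ha
      rw [Finset.filter_filter]
      refine Finset.filter_congr fun n _ ↦ ?_
      constructor
      · rintro ⟨-, h⟩
        rw [Nat.ModEq, h, Nat.mod_eq_of_lt ha.1]
      · intro h
        refine ⟨?_, ?_⟩
        · rw [Nat.Coprime, h.gcd_eq]; exact ha.2
        · rw [h, Nat.mod_eq_of_lt ha.1]
    · intro n hn
      rw [Finset.mem_filter, Finset.mem_range]
      refine ⟨Nat.mod_lt _ hq, ?_⟩
      have := (Finset.mem_filter.1 hn).2
      rwa [Nat.Coprime, (Nat.mod_modEq n q).gcd_eq]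
  have h2 : density q * ∑ n ∈ Finset.range N, f n = ∑ a ∈ A, (∑ n ∈ Finset.range N, f n) / q := by
    rw [Finset.sum_const, nsmul_eq_mul, hcard, density]; ring
  rw [h1, h2, ← Finset.sum_sub_distrib, ← hcard]
  refine (Finset.abs_sum_le_sum_abs _ _).trans ?_
  refine (Finset.sum_le_sum fun a _ ↦ abs_sum_modEq_sub_le hf h0 hN hq a).trans ?_
  rw [Finset.sum_const, nsmul_eq_mul]

theorem abs_coprimeHarmonic_sub_le {W : ℕ} (hW : 0 < W) (N : ℕ) :
    |coprimeHarmonic W N - density W * ∑ n ∈ Finset.Icc 1 N, (n : ℝ)⁻¹| ≤ W + 1 := by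
  set f : ℕ → ℝ := fun n ↦ if n < N + 1 then (max (n : ℝ) 1)⁻¹ else 0 with hf
  have hanti : Antitone f := by
    intro m n hmn
    simp only [hf]
    have : (m : ℝ) ≤ n := by exact_mod_cast hmn
    split_ifs with h1 h2
    · gcongr
    · omega
    · positivity
    · exact le_rfl
  have h0 : ∀ n, 0 ≤ f n := fun n ↦ by simp only [hf]; split_ifs <;> positivity
  have key := abs_sum_coprime_sub_le hanti h0 (N := N + 1) (fun n hn ↦ if_neg (by omega)) hW
  have e0 : f 0 = 1 := by simp [hf]
  have e1 : ∀ n ∈ Finset.Icc 1 N, f n = (n : ℝ)⁻¹ := by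
    intro n hn
    obtain ⟨h1, h2⟩ := Finset.mem_Icc.1 hn
    have : (1 : ℝ) ≤ n := by exact_mod_cast h1
    simp only [hf]
    rw [if_pos (by omega), max_eq_left this]
  have e2 : Finset.range (N + 1) = insert 0 (Finset.Icc 1 N) := by
    ext n; simp only [Finset.mem_range, Finset.mem_insert, Finset.mem_Icc]; omega
  have hnot : 0 ∉ Finset.Icc 1 N := by simp
  rw [e2, Finset.sum_insert hnot, Finset.filter_insert, e0, Finset.sum_congr rfl e1] at key
  have hφ : (W.totient : ℝ) ≤ W := by exact_mod_cast Nat.totient_le W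
  have hd : density W ≤ 1 := by
    unfold density
    rw [div_le_one (by exact_mod_cast hW)]
    exact hφ
  have hd0 := (density_pos hW).le
  have e3 : ∑ n ∈ Finset.Icc 1 N with n.Coprime W, f n = coprimeHarmonic W N :=
    Finset.sum_congr rfl fun n hn ↦ e1 n (Finset.mem_filter.1 hn).1
  by_cases h : Nat.Coprime 0 W
  · have hW1 : W = 1 := by simpa using h
    subst hW1
    have : density 1 = 1 := by simp [density]
    rw [if_pos h, Finset.sum_insert (by simp), e0, e3, this] at key
    rw [this]
    rw [abs_le] at key ⊢
    simp at key ⊢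
    constructor <;> linarith
  · rw [if_neg h, e3, abs_le] at key
    rw [abs_le]
    constructor <;> nlinarith

theorem coprimeHarmonic_bounds {W : ℕ} (hW : 0 < W) {u : ℝ} (hu : 2 * W * (W + 2) ≤ u) :
    1 / 2 * (density W * u) ≤ coprimeHarmonic W ⌊Real.exp u⌋₊ ∧
      coprimeHarmonic W ⌊Real.exp u⌋₊ ≤ 2 * (density W * u) := by
  have hW' : (1 : ℝ) ≤ W := by exact_mod_cast hW
  have hu0 : 0 ≤ u := by nlinarith
  have hdu : 2 * ((W : ℝ) + 2) ≤ density W * u := by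
    calc 2 * ((W : ℝ) + 2) = (W : ℝ)⁻¹ * (2 * W * (W + 2)) := by field_simp
      _ ≤ density W * u := mul_le_mul (inv_le_density hW) hu (by positivity) (density_pos hW).le
  have hd : density W ≤ 1 := by
    unfold density
    rw [div_le_one (by exact_mod_cast hW)]
    exact_mod_cast Nat.totient_le W
  have hd0 := density_pos hW
  set N := ⌊Real.exp u⌋₊ with hN
  have hharm : ((harmonic N : ℚ) : ℝ) = ∑ n ∈ Finset.Icc 1 N, (n : ℝ)⁻¹ := by
    rw [harmonic_eq_sum_Icc]; push_cast; rfl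
  have hup : ∑ n ∈ Finset.Icc 1 N, (n : ℝ)⁻¹ ≤ 1 + u := by
    rw [← hharm]
    refine (harmonic_le_one_add_log N).trans ?_
    have hN1 : 1 ≤ N := Nat.le_floor (by simpa using Real.one_le_exp hu0)
    have : Real.log N ≤ u := by
      rw [Real.log_le_iff_le_exp (by exact_mod_cast hN1)]
      exact Nat.floor_le (Real.exp_pos u).le
    linarith
  have hlo : u ≤ ∑ n ∈ Finset.Icc 1 N, (n : ℝ)⁻¹ := by
    rw [← hharm]
    refine le_trans ?_ (log_add_one_le_harmonic N)
    rw [Real.le_log_iff_exp_le (by positivity)]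
    push_cast
    exact (Nat.lt_floor_add_one _).le
  have key := abs_le.1 (abs_coprimeHarmonic_sub_le hW N)
  have h1 := mul_le_mul_of_nonneg_left hup hd0.le
  have h2 := mul_le_mul_of_nonneg_left hlo hd0.le
  constructor <;> nlinarith

/-! ### Sums over sets of primes -/

section SubsetSums

variable {ι : Type*} {pr : ι → ℕ} {W R : ℕ}

theorem prod_le_floor_exp_iff (hpr : ∀ p, (pr p).Prime) (S : Finset ι) (u : ℝ) :
    ∏ p ∈ S, pr p ≤ ⌊Real.exp u⌋₊ ↔ ∑ p ∈ S, Real.log (pr p) ≤ u := by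
  rw [Nat.le_floor_iff (Real.exp_pos u).le, ← Real.exp_le_exp (x := ∑ p ∈ S, Real.log (pr p)),
    Real.exp_sum]
  push_cast
  rw [Finset.prod_congr rfl fun p _ ↦ Real.exp_log (by exact_mod_cast (hpr p).pos)]

theorem sum_prod_inv_le_coprimeHarmonic [Fintype ι]
    (hpr : ∀ p, (pr p).Prime) (hinj : Function.Injective pr)
    (hW : ∀ p, ¬ pr p ∣ W) (u : ℝ) :
    ∑ S : Finset ι with ∑ p ∈ S, Real.log (pr p) ≤ u, ∏ p ∈ S, (pr p : ℝ)⁻¹ ≤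
      coprimeHarmonic W ⌊Real.exp u⌋₊ := by
  classical
  have h1 : ∀ p, ¬ pr p ∣ 1 := fun p h ↦ (hpr p).one_lt.ne' (Nat.dvd_one.1 h)
  refine sum_le_sum_of_injOn (fun S ↦ 1 * ∏ p ∈ S, pr p) (fun _ _ ↦ by positivity) ?_
    (mul_prod_injective hpr hinj h1).injOn ?_
  · intro S hS
    rw [one_mul, Finset.mem_filter, Finset.mem_Icc, prod_le_floor_exp_iff hpr]
    exact ⟨⟨Finset.prod_pos fun p _ ↦ (hpr p).pos, (Finset.mem_filter.1 hS).2⟩,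
      Nat.Coprime.prod_left fun p _ ↦ (hpr p).coprime_iff_not_dvd.2 (hW p)⟩
  · intro S _
    rw [one_mul]
    push_cast
    rw [Finset.prod_inv_distrib]

theorem sum_inv_sq_le_two (N : ℕ) : ∑ n ∈ Finset.Icc 1 N, ((n : ℝ) ^ 2)⁻¹ ≤ 2 := by
  have h := sum_Ioo_inv_sq_le (α := ℝ) 0 (N + 1)
  have e : Finset.Ioo 0 (N + 1) = Finset.Icc 1 N := by
    ext n; simp only [Finset.mem_Ioo, Finset.mem_Icc]; omega
  rw [e] at h
  simpa using h

theorem coprimeHarmonic_le_two_mul_sum [Fintype ι]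
    (hpr : ∀ p, (pr p).Prime) (hinj : Function.Injective pr)
    (hsurj : ∀ q : ℕ, q.Prime → ¬ q ∣ W → q ≤ R → ∃ p, pr p = q) {u : ℝ}
    (hu : ⌊Real.exp u⌋₊ ≤ R) :
    coprimeHarmonic W ⌊Real.exp u⌋₊ ≤
      2 * ∑ S : Finset ι with ∑ p ∈ S, Real.log (pr p) ≤ u, ∏ p ∈ S, (pr p : ℝ)⁻¹ := by
  classical
  set N := ⌊Real.exp u⌋₊ with hN
  have key : ∀ n : ℕ, n ∈ (Finset.Icc 1 N).filter (fun n ↦ n.Coprime W) →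
      ∃ x : ℕ × Finset ι, x.1 ^ 2 * ∏ p ∈ x.2, pr p = n := by
    intro n hn
    rw [Finset.mem_filter, Finset.mem_Icc] at hn
    obtain ⟨a, b, hab, ha⟩ := Nat.sq_mul_squarefree n
    refine ⟨(b, Finset.univ.filter fun p ↦ pr p ∣ a), ?_⟩
    rw [← hab]
    congr 1
    have h2 : a.primeFactors = (Finset.univ.filter fun p ↦ pr p ∣ a).image pr := by
      ext q
      simp only [Nat.mem_primeFactors, Finset.mem_image, Finset.mem_filter, Finset.mem_univ,
        true_and]
      constructor
      · rintro ⟨hq, hqa, -⟩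
        have hqn : q ∣ n := hab ▸ hqa.mul_left _
        obtain ⟨p, hp⟩ := hsurj q hq
          (fun h ↦ (hq.coprime_iff_not_dvd.1 (hn.2.coprime_dvd_left hqn)) h)
          ((Nat.le_of_dvd (by omega) hqn).trans (hn.1.2.trans hu))
        exact ⟨p, hp ▸ hqa, hp⟩
      · rintro ⟨p, hp, rfl⟩
        exact ⟨hpr p, hp, ha.ne_zero⟩
    have h3 := Nat.prod_primeFactors_of_squarefree ha
    rwa [h2, Finset.prod_image hinj.injOn] at h3
  choose! e he using key
  calc coprimeHarmonic W N ≤ ∑ x ∈ Finset.Icc 1 N ×ˢ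
        Finset.univ.filter (fun S : Finset ι ↦ ∑ p ∈ S, Real.log (pr p) ≤ u),
        ((x.1 : ℝ) ^ 2)⁻¹ * ∏ p ∈ x.2, (pr p : ℝ)⁻¹ := by
        refine sum_le_sum_of_injOn e (fun _ _ ↦ by positivity) ?_ ?_ ?_
        · intro n hn
          have h1 := he n hn
          rw [Finset.mem_filter, Finset.mem_Icc] at hn
          have hpos : 0 < (e n).1 ^ 2 * ∏ p ∈ (e n).2, pr p := by omega
          have hp1 : 0 < (e n).1 ^ 2 := Nat.pos_of_mul_pos_right hpos
          have hp2 : 0 < ∏ p ∈ (e n).2, pr p := Nat.pos_of_mul_pos_left hpos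
          have hp3 : 0 < (e n).1 := by
            by_contra h0
            simp [Nat.eq_zero_of_not_pos h0] at hp1
          rw [Finset.mem_product, Finset.mem_Icc, Finset.mem_filter, ← prod_le_floor_exp_iff hpr]
          refine ⟨⟨hp3, ?_⟩, Finset.mem_univ _, ?_⟩
          · calc (e n).1 ≤ (e n).1 ^ 2 := Nat.le_self_pow two_ne_zero _
              _ ≤ (e n).1 ^ 2 * ∏ p ∈ (e n).2, pr p := Nat.le_mul_of_pos_right _ hp2
              _ ≤ N := by rw [h1]; exact hn.1.2
          · calc ∏ p ∈ (e n).2, pr p ≤ (e n).1 ^ 2 * ∏ p ∈ (e n).2, pr p :=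
                  Nat.le_mul_of_pos_left _ hp1
              _ ≤ N := by rw [h1]; exact hn.1.2
        · intro m hm n hn hmn
          rw [← he m hm, ← he n hn, hmn]
        · intro n hn
          conv_lhs => rw [← he n hn]
          push_cast
          rw [mul_inv, Finset.prod_inv_distrib]
    _ = (∑ n ∈ Finset.Icc 1 N, ((n : ℝ) ^ 2)⁻¹) *
        ∑ S : Finset ι with ∑ p ∈ S, Real.log (pr p) ≤ u, ∏ p ∈ S, (pr p : ℝ)⁻¹ := by
        rw [Finset.sum_mul_sum, Finset.sum_product]
    _ ≤ _ := mul_le_mul_of_nonneg_right (sum_inv_sq_le_two N)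
        (Finset.sum_nonneg fun _ _ ↦ Finset.prod_nonneg fun _ _ ↦ by positivity)

theorem sum_filter_prod_add_le [Fintype ι] [DecidableEq ι] {lg a b : ι → ℝ} (hlg : ∀ p, 0 ≤ lg p) (ha : ∀ p, 0 ≤ a p)
    (hb : ∀ p, 0 ≤ b p) (u : ℝ) :
    ∑ S : Finset ι with ∑ p ∈ S, lg p ≤ u, ∏ p ∈ S, (a p + b p) ≤
      (∏ p, (1 + b p)) * ∑ S : Finset ι with ∑ p ∈ S, lg p ≤ u, ∏ p ∈ S, a p := by
  have hprod : ∏ p, (1 + b p) = ∑ T : Finset ι, ∏ p ∈ T, b p := by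
    rw [Finset.prod_one_add, Finset.powerset_univ]
  rw [hprod, Finset.sum_mul_sum, ← Finset.sum_product']
  simp only [add_comm (a _), Finset.prod_add]
  rw [Finset.sum_sigma']
  refine sum_le_sum_of_injOn (fun x ↦ (x.2, x.1 \ x.2))
    (fun x _ ↦ mul_nonneg (Finset.prod_nonneg fun p _ ↦ hb p) (Finset.prod_nonneg fun p _ ↦ ha p))
    ?_ ?_ (fun x _ ↦ le_rfl)
  · rintro ⟨S, T⟩ hx
    rw [Finset.mem_sigma, Finset.mem_filter] at hx
    refine Finset.mem_product.2 ⟨Finset.mem_univ _, Finset.mem_filter.2 ⟨Finset.mem_univ _, ?_⟩⟩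
    exact (Finset.sum_le_sum_of_subset_of_nonneg Finset.sdiff_subset fun p _ _ ↦ hlg p).trans hx.1.2
  · rintro ⟨S, T⟩ hx ⟨S', T'⟩ hx' h
    simp only [Finset.coe_sigma, Set.mem_sigma_iff, Finset.mem_coe, Finset.mem_powerset] at hx hx'
    simp only [Prod.mk.injEq] at h
    obtain ⟨rfl, h2⟩ := h
    have : S = S' := by
      rw [← Finset.sdiff_union_of_subset hx.2, h2, Finset.sdiff_union_of_subset hx'.2]
    subst this
    rfl

end SubsetSums

/-! ### The staircase function -/

section Stairs

variable {ι : Type*} {lg : ι → ℝ} {t : ℝ} {J : ℕ}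

open Classical in
/-- A step function of `∑ p ∈ S, lg p`, of size about `1 / max (1, ∑ lg / t)` up to `2 ^ J * t`. -/
noncomputable def stairs (lg : ι → ℝ) (J : ℕ) (t : ℝ) (S : Finset ι) : ℝ :=
  ∑ j ∈ Finset.range (J + 1), (1 / 2) ^ j * if ∑ p ∈ S, lg p ≤ 2 ^ j * t then 1 else 0

theorem stairs_nonneg (lg : ι → ℝ) (J : ℕ) (t : ℝ) (S : Finset ι) : 0 ≤ stairs lg J t S :=
  Finset.sum_nonneg fun j _ ↦ mul_nonneg (by positivity) (by split_ifs <;> norm_num)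

theorem stairs_le_two (lg : ι → ℝ) (J : ℕ) (t : ℝ) (S : Finset ι) : stairs lg J t S ≤ 2 := by
  refine le_trans (Finset.sum_le_sum fun j _ ↦ ?_) (sum_geometric_two_le (J + 1))
  exact mul_le_of_le_one_right (by positivity) (by split_ifs <;> norm_num)

theorem stairs_antitone (hlg : ∀ p, 0 ≤ lg p) : Antitone (stairs lg J t) := by
  intro S T hST
  have h := Finset.sum_le_sum_of_subset_of_nonneg hST fun p _ _ ↦ hlg p
  refine Finset.sum_le_sum fun j _ ↦ mul_le_mul_of_nonneg_left ?_ (by positivity)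
  split_ifs with h1 h2
  · exact le_rfl
  · exact absurd (h.trans h1) h2
  · norm_num
  · exact le_rfl

theorem sum_le_of_stairs_ne_zero (ht : 0 ≤ t) {S : Finset ι} (h : stairs lg J t S ≠ 0) :
    ∑ p ∈ S, lg p ≤ 2 ^ J * t := by
  obtain ⟨j, hj, hne⟩ := Finset.exists_ne_zero_of_sum_ne_zero h
  have h1 : ∑ p ∈ S, lg p ≤ 2 ^ j * t := by
    by_contra hc
    exact hne (by rw [if_neg hc, mul_zero])
  refine h1.trans (mul_le_mul_of_nonneg_right ?_ ht)
  exact pow_le_pow_right₀ (by norm_num) (Nat.lt_succ_iff.1 (Finset.mem_range.1 hj))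

theorem stairs_succ (lg : ι → ℝ) (J : ℕ) (t : ℝ) (S : Finset ι) [Decidable (∑ p ∈ S, lg p ≤ t)] :
    stairs lg (J + 1) t S =
      1 / 2 * stairs lg J (2 * t) S + if ∑ p ∈ S, lg p ≤ t then 1 else 0 := by
  classical
  unfold stairs
  rw [Finset.sum_range_succ', Finset.mul_sum]
  congr 1
  · refine Finset.sum_congr rfl fun j _ ↦ ?_
    rw [pow_succ, pow_succ, mul_assoc (2 ^ j : ℝ) 2 t]
    ring
  · simp

open Classical in
theorem stairs_sq_le (lg : ι → ℝ) (J : ℕ) (t : ℝ) (S : Finset ι) :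
    stairs lg J t S ^ 2 ≤
      4 * ∑ j ∈ Finset.range (J + 1), (1 / 4) ^ j * if ∑ p ∈ S, lg p ≤ 2 ^ j * t then 1 else 0 := by
  induction J generalizing t with
  | zero =>
    simp only [stairs, zero_add, Finset.sum_range_one, pow_zero, one_mul]
    split_ifs <;> norm_num
  | succ J ih =>
    have e : ∑ j ∈ Finset.range (J + 1 + 1),
        (1 / 4 : ℝ) ^ j * (if ∑ p ∈ S, lg p ≤ 2 ^ j * t then (1 : ℝ) else 0) =
        1 / 4 * ∑ j ∈ Finset.range (J + 1),
          (1 / 4) ^ j * (if ∑ p ∈ S, lg p ≤ 2 ^ j * (2 * t) then (1 : ℝ) else 0) +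
        if ∑ p ∈ S, lg p ≤ t then 1 else 0 := by
      rw [Finset.sum_range_succ', Finset.mul_sum]
      congr 1
      · refine Finset.sum_congr rfl fun j _ ↦ ?_
        rw [pow_succ, pow_succ, mul_assoc (2 ^ j : ℝ) 2 t]
        ring
      · simp
    rw [e]
    have hnn : 0 ≤ ∑ j ∈ Finset.range (J + 1),
        (1 / 4 : ℝ) ^ j * (if ∑ p ∈ S, lg p ≤ 2 ^ j * (2 * t) then (1 : ℝ) else 0) :=
      Finset.sum_nonneg fun j _ ↦ mul_nonneg (by positivity) (by split_ifs <;> norm_num)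
    by_cases h : ∑ p ∈ S, lg p ≤ t
    · have h1 := stairs_le_two lg (J + 1) t S
      have h2 := stairs_nonneg lg (J + 1) t S
      rw [if_pos h]
      nlinarith
    · rw [if_neg h, stairs_succ, if_neg h]
      have := ih (2 * t)
      linarith

variable [Fintype ι]

open Classical in
theorem sum_mul_stairs_sq_le {w : Finset ι → ℝ} (hw : ∀ S, 0 ≤ w S) {c : ℝ} (hc : 0 ≤ c) (ht : 0 ≤ t)
    (h : ∀ j ∈ Finset.range (J + 1), ∑ S with ∑ p ∈ S, lg p ≤ 2 ^ j * t, w S ≤ c * (2 ^ j * t)) :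
    ∑ S, w S * stairs lg J t S ^ 2 ≤ 8 * c * t ∧
      ∑ S, w S * stairs lg J t S ^ 2 * ∑ p ∈ S, lg p ≤ 4 * c * (J + 1) * t ^ 2 := by
  constructor
  · calc ∑ S, w S * stairs lg J t S ^ 2
        ≤ ∑ S, w S * (4 * ∑ j ∈ Finset.range (J + 1),
            (1 / 4) ^ j * if ∑ p ∈ S, lg p ≤ 2 ^ j * t then 1 else 0) :=
          Finset.sum_le_sum fun S _ ↦ mul_le_mul_of_nonneg_left (stairs_sq_le lg J t S) (hw S)
      _ = 4 * ∑ j ∈ Finset.range (J + 1), (1 / 4) ^ j *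
            ∑ S with ∑ p ∈ S, lg p ≤ 2 ^ j * t, w S := by
          simp only [Finset.mul_sum, Finset.sum_filter]
          rw [Finset.sum_comm]
          refine Finset.sum_congr rfl fun j _ ↦ Finset.sum_congr rfl fun S _ ↦ ?_
          split_ifs <;> ring
      _ ≤ 4 * ∑ j ∈ Finset.range (J + 1), (1 / 4) ^ j * (c * (2 ^ j * t)) := by
          refine mul_le_mul_of_nonneg_left (Finset.sum_le_sum fun j hj ↦ ?_) (by norm_num)
          exact mul_le_mul_of_nonneg_left (h j hj) (by positivity)
      _ = 4 * c * t * ∑ j ∈ Finset.range (J + 1), (1 / 2 : ℝ) ^ j := by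
          rw [Finset.mul_sum, Finset.mul_sum]
          refine Finset.sum_congr rfl fun j _ ↦ ?_
          have : (1 / 4 : ℝ) ^ j * 2 ^ j = (1 / 2) ^ j := by rw [← mul_pow]; norm_num
          rw [← this]; ring
      _ ≤ 4 * c * t * 2 := mul_le_mul_of_nonneg_left (sum_geometric_two_le (J + 1)) (by positivity)
      _ = 8 * c * t := by ring
  · calc ∑ S, w S * stairs lg J t S ^ 2 * ∑ p ∈ S, lg p
        ≤ ∑ S, 4 * ∑ j ∈ Finset.range (J + 1), (1 / 4) ^ j *
            if ∑ p ∈ S, lg p ≤ 2 ^ j * t then w S * (2 ^ j * t) else 0 := by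
          refine Finset.sum_le_sum fun S _ ↦ ?_
          have hsq := stairs_sq_le lg J t S
          generalize ∑ p ∈ S, lg p = s at hsq ⊢
          rcases le_or_gt s 0 with h0 | h0
          · refine (mul_nonpos_of_nonneg_of_nonpos
              (mul_nonneg (hw S) (sq_nonneg _)) h0).trans ?_
            refine mul_nonneg (by norm_num) (Finset.sum_nonneg fun j _ ↦ ?_)
            have := hw S
            split_ifs <;> positivity
          · refine (mul_le_mul_of_nonneg_right
              (mul_le_mul_of_nonneg_left hsq (hw S)) h0.le).trans ?_
            rw [mul_left_comm, mul_assoc, Finset.mul_sum, Finset.sum_mul]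
            refine mul_le_mul_of_nonneg_left (Finset.sum_le_sum fun j _ ↦ ?_) (by norm_num)
            split_ifs with h1
            · have := mul_le_mul_of_nonneg_left h1 (hw S)
              have h4 : (0 : ℝ) ≤ (1 / 4) ^ j := by positivity
              nlinarith [mul_le_mul_of_nonneg_left this h4]
            · simp
      _ = 4 * ∑ j ∈ Finset.range (J + 1), (1 / 4) ^ j *
            ((∑ S with ∑ p ∈ S, lg p ≤ 2 ^ j * t, w S) * (2 ^ j * t)) := by
          simp only [Finset.mul_sum, Finset.sum_mul, Finset.sum_filter]
          rw [Finset.sum_comm]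
          refine Finset.sum_congr rfl fun j _ ↦ Finset.sum_congr rfl fun S _ ↦ ?_
          split_ifs <;> ring
      _ ≤ 4 * ∑ j ∈ Finset.range (J + 1), c * t ^ 2 := by
          refine mul_le_mul_of_nonneg_left (Finset.sum_le_sum fun j hj ↦ ?_) (by norm_num)
          have h4 : (1 / 4 : ℝ) ^ j * (2 ^ j * 2 ^ j) = 1 := by
            rw [← mul_pow, ← mul_pow]; norm_num
          calc (1 / 4 : ℝ) ^ j * ((∑ S with ∑ p ∈ S, lg p ≤ 2 ^ j * t, w S) * (2 ^ j * t))
              ≤ (1 / 4 : ℝ) ^ j * (c * (2 ^ j * t) * (2 ^ j * t)) :=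
                mul_le_mul_of_nonneg_left
                  (mul_le_mul_of_nonneg_right (h j hj) (by positivity)) (by positivity)
            _ = (1 / 4 : ℝ) ^ j * (2 ^ j * 2 ^ j) * (c * t ^ 2) := by ring
            _ = c * t ^ 2 := by rw [h4, one_mul]
      _ = 4 * c * (J + 1) * t ^ 2 := by
          rw [Finset.sum_const, Finset.card_range, nsmul_eq_mul]; push_cast; ring

open Classical in
theorem le_sum_mul_stairs {w : Finset ι → ℝ} {c : ℝ}
    (h : ∀ j ∈ Finset.range (J + 1), c * (2 ^ j * t) ≤ ∑ S with ∑ p ∈ S, lg p ≤ 2 ^ j * t, w S) :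
    c * (J + 1) * t ≤ ∑ S, w S * stairs lg J t S := by
  calc c * (J + 1) * t = ∑ j ∈ Finset.range (J + 1), (1 / 2 : ℝ) ^ j * (c * (2 ^ j * t)) := by
        have : ∀ j ∈ Finset.range (J + 1), (1 / 2 : ℝ) ^ j * (c * (2 ^ j * t)) = c * t := by
          intro j _
          have h4 : (1 / 2 : ℝ) ^ j * 2 ^ j = 1 := by rw [← mul_pow]; norm_num
          calc (1 / 2 : ℝ) ^ j * (c * (2 ^ j * t)) = (1 / 2 : ℝ) ^ j * 2 ^ j * (c * t) := by ring
            _ = c * t := by rw [h4, one_mul]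
        rw [Finset.sum_congr rfl this, Finset.sum_const, Finset.card_range, nsmul_eq_mul]
        push_cast; ring
    _ ≤ ∑ j ∈ Finset.range (J + 1), (1 / 2 : ℝ) ^ j * ∑ S with ∑ p ∈ S, lg p ≤ 2 ^ j * t, w S :=
        Finset.sum_le_sum fun j hj ↦ mul_le_mul_of_nonneg_left (h j hj) (by positivity)
    _ = ∑ S, w S * stairs lg J t S := by
        simp only [stairs, Finset.mul_sum, Finset.sum_filter]
        rw [Finset.sum_comm]
        refine Finset.sum_congr rfl fun j _ ↦ Finset.sum_congr rfl fun S _ ↦ ?_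
        split_ifs <;> ring

open Classical in
theorem le_sum_mul_stairs_sq {w : Finset ι → ℝ} (hw : ∀ S, 0 ≤ w S) :
    ∑ S with ∑ p ∈ S, lg p ≤ t, w S ≤ ∑ S, w S * stairs lg J t S ^ 2 := by
  rw [Finset.sum_filter]
  refine Finset.sum_le_sum fun S _ ↦ ?_
  split_ifs with h
  · refine le_mul_of_one_le_right (hw S) (one_le_pow₀ ?_)
    have h1 : (1 / 2 : ℝ) ^ 0 * (if ∑ p ∈ S, lg p ≤ 2 ^ 0 * t then (1 : ℝ) else 0) ≤
        stairs lg J t S :=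
      Finset.single_le_sum (f := fun j : ℕ ↦ (1 / 2 : ℝ) ^ j *
        if ∑ p ∈ S, lg p ≤ 2 ^ j * t then (1 : ℝ) else 0)
        (fun j _ ↦ mul_nonneg (by positivity) (by split_ifs <;> norm_num))
        (Finset.mem_range.2 (Nat.succ_pos J))
    simpa [h] using h1
  · exact mul_nonneg (hw S) (sq_nonneg _)

end Stairs

/-! ### Size of the sieve forms -/

section GramBounds

variable {ι : Type*} [Fintype ι] {pr : ι → ℕ} {W R k : ℕ}

theorem sum_inv_sq_le_of_large (hinj : Function.Injective pr) (hk : 1 ≤ k)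
    (hlarge : ∀ p, 448 * k ^ 2 ≤ pr p) :
    ∑ p, ((pr p : ℝ) ^ 2)⁻¹ ≤ 1 / (224 * (k : ℝ) ^ 2) := by
  classical
  obtain ⟨M, hM⟩ : ∃ M, ∀ p, pr p < M :=
    ⟨∑ p, pr p + 1, fun p ↦ Nat.lt_succ_of_le (Finset.single_le_sum (f := pr) (fun _ _ ↦ Nat.zero_le _)
      (Finset.mem_univ p))⟩
  have hk2 : 1 ≤ k ^ 2 := Nat.one_le_pow _ _ hk
  calc ∑ p, ((pr p : ℝ) ^ 2)⁻¹
      ≤ ∑ n ∈ Finset.Ioo (448 * k ^ 2 - 1) M, ((n : ℝ) ^ 2)⁻¹ := by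
        refine sum_le_sum_of_injOn pr (fun _ _ ↦ by positivity) ?_ hinj.injOn fun _ _ ↦ le_rfl
        intro p _
        have := hlarge p
        exact Finset.mem_Ioo.2 ⟨by omega, hM p⟩
    _ ≤ 2 / (((448 * k ^ 2 - 1 : ℕ) : ℝ) + 1) := sum_Ioo_inv_sq_le _ _
    _ = 1 / (224 * (k : ℝ) ^ 2) := by
        have : (0 : ℝ) < k := by exact_mod_cast hk
        push_cast [show 1 ≤ 448 * k ^ 2 by omega]
        field_simp
        ring

theorem prod_one_add_le_exp_sum (f : ι → ℝ) (hf : ∀ p, 0 ≤ f p) :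
    ∏ p, (1 + f p) ≤ Real.exp (∑ p, f p) := by
  rw [Real.exp_sum]
  exact Finset.prod_le_prod (fun p _ ↦ by have := hf p; positivity)
    fun p _ ↦ by rw [add_comm]; exact Real.add_one_le_exp _

theorem exists_gramForm_bounds [DecidableEq ι] (hpr : ∀ p, (pr p).Prime)
    (hinj : Function.Injective pr) (hW0 : 0 < W) (hW : ∀ p, ¬ pr p ∣ W)
    (hsurj : ∀ q : ℕ, q.Prime → ¬ q ∣ W → q ≤ R → ∃ p, pr p = q) {J : ℕ} (hkJ : k = 2 ^ J)
    (hlarge : ∀ p, 448 * k ^ 2 ≤ pr p) {D t : ℝ} (hDR : Real.exp D ≤ R)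
    (hD : D = 768 * k * (J + 1) * t) (ht : 2 * W * (W + 2) ≤ t) :
    ∃ α : ℝ, 1 / 4 * density W * t ≤ α ∧ α ≤ 144 * density W * t ∧
      gramForm (fun p ↦ pointMass (fun _ : Fin k ↦ (pr p : ℝ)⁻¹))
        (fun p ↦ sieveFn ((pr p : ℝ) - 1)⁻¹)
        (sieveCoeff (fun p ↦ Real.log (pr p)) D (stairs (fun p ↦ Real.log (pr p)) J t)) ≤ 2 * α ^ k ∧
      ∀ m : Fin k, 1 / 2 * (1 / 4 * density W * (J + 1) * t) ^ 2 * α ^ (k - 1) ≤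
        gramForm (fun p ↦ pointMass (fun i : Fin k ↦ if i = m then 0 else ((pr p : ℝ) - 1)⁻¹))
        (fun p ↦ sieveFn ((pr p : ℝ) - 1)⁻¹)
        (sieveCoeff (fun p ↦ Real.log (pr p)) D (stairs (fun p ↦ Real.log (pr p)) J t)) := by
  have hk : 1 ≤ k := hkJ ▸ Nat.one_le_two_pow
  have hkr : (1 : ℝ) ≤ k := by exact_mod_cast hk
  have hkJr : (k : ℝ) = 2 ^ J := by rw [hkJ]; push_cast; rfl
  have hWr : (1 : ℝ) ≤ W := by exact_mod_cast hW0
  have ht0 : 0 < t := by nlinarith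
  have hd0 := density_pos hW0
  set κ := density W with hκ
  set lg : ι → ℝ := fun p ↦ Real.log (pr p) with hlgdef
  set g := stairs lg J t with hg
  set P : ι → ℝ := fun p ↦ (pr p : ℝ) with hPdef
  have hlg : ∀ p, 0 ≤ lg p := fun p ↦ Real.log_natCast_nonneg _
  have hPl : ∀ p, 448 * (k : ℝ) ^ 2 ≤ P p := fun p ↦ by
    have h : ((448 * k ^ 2 : ℕ) : ℝ) ≤ (pr p : ℝ) := by exact_mod_cast hlarge p
    push_cast at h
    exact h
  have hP16 : ∀ p, 16 * (k : ℝ) ≤ P p := fun p ↦ by nlinarith [hPl p]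
  have hP0 : ∀ p, 0 < P p := fun p ↦ by nlinarith [hP16 p]
  have hT := sum_inv_sq_le_of_large hinj hk hlarge
  have h8 : ∀ p, (P p)⁻¹ + 8 * k / P p ^ 2 ≤ 2 / P p := fun p ↦ by
    have h0 := hP0 p
    have : 8 * (k : ℝ) / P p ^ 2 ≤ (P p)⁻¹ := by
      rw [div_le_iff₀ (by positivity), pow_two, inv_mul_cancel_left₀ h0.ne']
      nlinarith [hP16 p]
    calc (P p)⁻¹ + 8 * k / P p ^ 2 ≤ (P p)⁻¹ + (P p)⁻¹ := by linarith
      _ = 2 / P p := by ring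
  have hw0 : ∀ p, 0 ≤ (P p)⁻¹ + 8 * k / P p ^ 2 := fun p ↦ by have := hP0 p; positivity
  have hD0 : 0 < D := by rw [hD]; positivity
  have hj : ∀ j ∈ Finset.range (J + 1), 2 * W * (W + 2) ≤ 2 ^ j * t ∧ ⌊Real.exp (2 ^ j * t)⌋₊ ≤ R := by
    intro j hj
    have hjJ : j ≤ J := Nat.lt_succ_iff.1 (Finset.mem_range.1 hj)
    have h1 : (1 : ℝ) ≤ 2 ^ j := one_le_pow₀ (by norm_num)
    have h2 : (2 : ℝ) ^ j ≤ k := by rw [hkJr]; exact pow_le_pow_right₀ (by norm_num) hjJ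
    refine ⟨ht.trans (le_mul_of_one_le_left ht0.le h1), ?_⟩
    have h3 : (2 : ℝ) ^ j * t ≤ D := by
      rw [hD]
      refine mul_le_mul_of_nonneg_right ?_ ht0.le
      have hJ : (0 : ℝ) ≤ J := by positivity
      nlinarith [mul_nonneg (by positivity : (0 : ℝ) ≤ k) hJ]
    have h4 := (Nat.floor_le (Real.exp_pos (2 ^ j * t)).le).trans ((Real.exp_le_exp.2 h3).trans hDR)
    exact_mod_cast h4
  have hlow : ∀ u : ℝ, 2 * W * (W + 2) ≤ u → ⌊Real.exp u⌋₊ ≤ R →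
      1 / 4 * κ * u ≤ ∑ S with ∑ p ∈ S, lg p ≤ u, ∏ p ∈ S, (P p)⁻¹ := by
    intro u hu huR
    have h1 := (coprimeHarmonic_bounds hW0 hu).1
    have h2 := coprimeHarmonic_le_two_mul_sum hpr hinj hsurj huR
    linarith
  have hup : ∀ u : ℝ, 2 * W * (W + 2) ≤ u →
      ∑ S with ∑ p ∈ S, lg p ≤ u, ∏ p ∈ S, ((P p)⁻¹ + 8 * k / P p ^ 2) ≤ 6 * κ * u := by
    intro u hu
    have h1 := (coprimeHarmonic_bounds hW0 hu).2
    have h2 := sum_prod_inv_le_coprimeHarmonic hpr hinj hW u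
    have hu0 : 0 < u := by nlinarith
    refine (sum_filter_prod_add_le hlg (fun p ↦ (inv_pos.2 (hP0 p)).le)
      (fun p ↦ by have := hP0 p; positivity) u).trans ?_
    have h3 : ∏ p, (1 + 8 * k / P p ^ 2) ≤ 3 := by
      refine (prod_one_add_le_exp_sum _ fun p ↦ by have := hP0 p; positivity).trans ?_
      refine (Real.exp_le_exp.2 (show ∑ p, 8 * k / P p ^ 2 ≤ (1 : ℝ) from ?_)).trans (Real.exp_one_lt_d9.le.trans (by norm_num))
      calc ∑ p, 8 * k / P p ^ 2 = 8 * k * ∑ p, ((P p) ^ 2)⁻¹ := by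
            rw [Finset.mul_sum]; rfl
        _ ≤ 8 * k * (1 / (224 * (k : ℝ) ^ 2)) := mul_le_mul_of_nonneg_left hT (by positivity)
        _ ≤ 1 := by
            rw [mul_one_div, div_le_one (by positivity)]
            nlinarith
    calc (∏ p, (1 + 8 * k / P p ^ 2)) * ∑ S with ∑ p ∈ S, lg p ≤ u, ∏ p ∈ S, (P p)⁻¹
        ≤ 3 * (2 * (κ * u)) := mul_le_mul h3 (h2.trans h1)
          (Finset.sum_nonneg fun S _ ↦ Finset.prod_nonneg fun p _ ↦ (inv_pos.2 (hP0 p)).le) (by norm_num)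
      _ = 6 * κ * u := by ring
  have hw : ∀ S : Finset ι, 0 ≤ ∏ p ∈ S, ((P p)⁻¹ + 8 * k / P p ^ 2) :=
    fun S ↦ Finset.prod_nonneg fun p _ ↦ hw0 p
  obtain ⟨hα, hαlg⟩ := sum_mul_stairs_sq_le hw (by positivity : 0 ≤ 6 * κ) ht0.le
    (fun j hjm ↦ hup _ (hj j hjm).1)
  have hα0 := le_sum_mul_stairs_sq (J := J) (lg := lg) (t := t) hw
  have hα1 : 1 / 4 * κ * t ≤ ∑ S, setWeight k P g S := by
    have h0 := hj 0 (Finset.mem_range.2 (Nat.succ_pos J))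
    rw [pow_zero, one_mul] at h0
    refine (hlow t h0.1 h0.2).trans (le_trans (Finset.sum_le_sum fun S _ ↦ ?_) hα0)
    refine Finset.prod_le_prod (fun p _ ↦ (inv_pos.2 (hP0 p)).le) fun p _ ↦ ?_
    have := hP0 p
    exact le_add_of_nonneg_right (by positivity)
  have hβ : 1 / 4 * κ * (J + 1) * t ≤ ∑ S, (∏ q ∈ S, (P q - 1)⁻¹) * g S := by
    refine le_sum_mul_stairs (lg := lg) fun j hjm ↦ ?_
    refine (hlow _ (hj j hjm).1 (hj j hjm).2).trans (Finset.sum_le_sum fun S _ ↦ ?_)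
    refine Finset.prod_le_prod (fun p _ ↦ (inv_pos.2 (hP0 p)).le) fun p _ ↦ ?_
    exact inv_anti₀ (by nlinarith [hP16 p]) (by linarith)
  refine ⟨∑ S, setWeight k P g S, hα1, ?_, ?_, fun m ↦ ?_⟩
  · refine hα.trans ?_
    have : 0 ≤ κ * t := by positivity
    nlinarith
  · refine (gramForm_upper (P := P) (fun p ↦ by nlinarith [hP16 p])
      (fun p ↦ by nlinarith [hP16 p]) lg D g).trans ?_
    refine mul_le_mul_of_nonneg_right ?_ (pow_nonneg (Finset.sum_nonneg fun S _ ↦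
      mul_nonneg (hw S) (sq_nonneg _)) _)
    refine (prod_one_add_le_exp_sum _ fun p ↦ by have := hP0 p; positivity).trans ?_
    have h1 : ∑ p, (P p ^ 2)⁻¹ ≤ 1 / 2 := hT.trans (by
      rw [div_le_div_iff₀ (by positivity) (by norm_num)]
      nlinarith)
    refine (Real.exp_le_exp.2 h1).trans ?_
    have h2 : Real.exp (1 / 2) ^ 2 = Real.exp 1 := by rw [← Real.exp_nat_mul]; norm_num
    have h3 := Real.exp_one_lt_d9
    nlinarith [Real.exp_pos (1 / 2)]
  · have hlower := gramForm_lower (P := P) (lg := lg) (D := D) (g := g) (ν := 96 * (J + 1) * t)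
      hk hP16 hlg hD0
      (fun S ↦ stairs_nonneg lg J t S) (stairs_antitone hlg)
      (fun S hS ↦ (sum_le_of_stairs_ne_zero ht0.le hS).trans ?_)
      (by positivity) ?_ ?_ ?_ ?_ m
    · refine le_trans ?_ hlower
      refine mul_le_mul_of_nonneg_right ?_
        (pow_nonneg (Finset.sum_nonneg fun S _ ↦ mul_nonneg (hw S) (sq_nonneg _)) _)
      have : 0 ≤ 1 / 4 * κ * (J + 1) * t := by positivity
      gcongr
    · rw [← hkJr, hD]
      have hJ : (0 : ℝ) ≤ J := by positivity
      nlinarith [mul_nonneg (by positivity : (0 : ℝ) ≤ k * t) hJ, mul_pos (by positivity : (0 : ℝ) < k) ht0]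
    · refine hαlg.trans ?_
      calc 4 * (6 * κ) * (J + 1) * t ^ 2 = 96 * (J + 1) * t * (1 / 4 * κ * t) := by ring
        _ ≤ _ := mul_le_mul_of_nonneg_left hα1 (by positivity)
    · rw [hD]
      apply le_of_eq
      field_simp
      norm_num
    · calc (k : ℝ) * ∑ p, 14 * k / P p * ((P p)⁻¹ + 8 * k / P p ^ 2)
          ≤ k * ∑ p, 14 * k / P p * (2 / P p) := by
            refine mul_le_mul_of_nonneg_left (Finset.sum_le_sum fun p _ ↦ ?_) (by positivity)
            exact mul_le_mul_of_nonneg_left (h8 p) (by have := hP0 p; positivity)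
        _ = 28 * k ^ 2 * ∑ p, (P p ^ 2)⁻¹ := by
            rw [Finset.mul_sum, Finset.mul_sum]
            refine Finset.sum_congr rfl fun p _ ↦ ?_
            have := hP0 p
            field_simp
            ring
        _ ≤ 28 * k ^ 2 * (1 / (224 * (k : ℝ) ^ 2)) := mul_le_mul_of_nonneg_left hT (by positivity)
        _ = 1 / 8 := by field_simp; norm_num
    · calc (k : ℝ) ^ 2 * ∑ p, ((P p)⁻¹ + 8 * k / P p ^ 2) ^ 2
          ≤ k ^ 2 * ∑ p, (2 / P p) ^ 2 := by
            refine mul_le_mul_of_nonneg_left (Finset.sum_le_sum fun p _ ↦ ?_) (by positivity)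
            exact pow_le_pow_left₀ (hw0 p) (h8 p) 2
        _ = 4 * k ^ 2 * ∑ p, (P p ^ 2)⁻¹ := by
            rw [Finset.mul_sum, Finset.mul_sum]
            refine Finset.sum_congr rfl fun p _ ↦ ?_
            have := hP0 p
            field_simp
            ring
        _ ≤ 4 * k ^ 2 * (1 / (224 * (k : ℝ) ^ 2)) := mul_le_mul_of_nonneg_left hT (by positivity)
        _ ≤ 1 / 8 := by
            have : 4 * (k : ℝ) ^ 2 * (1 / (224 * (k : ℝ) ^ 2)) = 1 / 56 := by field_simp; norm_num
            rw [this]; norm_num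

end GramBounds

/-! ### The total masses of the weights -/

theorem sum_range_exp_neg_abs_le {L δ : ℝ} (hL : 0 ≤ L) (hδ : 0 < δ) (hδ1 : δ ≤ 1) (N : ℕ) :
    ∑ j ∈ Finset.range N, Real.exp (-(δ * |(j : ℝ) - L|)) ≤ 4 / δ := by
  set r := Real.exp (-δ) with hr
  have hr0 : 0 < r := Real.exp_pos _
  have hr1 : r < 1 := by rw [hr, Real.exp_lt_one_iff]; linarith
  have hr2 : δ / 2 ≤ 1 - r := by
    have h : r ≤ 1 / (1 + δ) := by
      rw [hr, Real.exp_neg, inv_eq_one_div]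
      exact one_div_le_one_div_of_le (by linarith) (by linarith [Real.add_one_le_exp δ])
    have h2 : 1 / (1 + δ) ≤ 1 - δ / 2 := by
      rw [div_le_iff₀ (by linarith)]; nlinarith
    linarith
  have hgeom : ∀ M : ℕ, ∑ i ∈ Finset.range M, r ^ i ≤ 2 / δ := by
    intro M
    calc ∑ i ∈ Finset.range M, r ^ i ≤ ∑' i, r ^ i :=
          (summable_geometric_of_lt_one hr0.le hr1).sum_le_tsum _ fun i _ ↦ by positivity
      _ = (1 - r)⁻¹ := tsum_geometric_of_lt_one hr0.le hr1
      _ ≤ 2 / δ := by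
        rw [inv_le_comm₀ (by linarith) (by positivity), inv_div]; exact hr2
  set m := ⌊L⌋₊ with hm
  have hmL : (m : ℝ) ≤ L := Nat.floor_le hL
  have hmL' : L < m + 1 := Nat.lt_floor_add_one L
  have hpow : ∀ {i : ℕ} {x : ℝ}, (i : ℝ) ≤ x → Real.exp (-(δ * x)) ≤ r ^ i := by
    intro i x hx
    rw [hr, ← Real.exp_nat_mul, Real.exp_le_exp]
    nlinarith
  calc ∑ j ∈ Finset.range N, Real.exp (-(δ * |(j : ℝ) - L|))
      ≤ ∑ j ∈ Finset.range (m + 1 + N), Real.exp (-(δ * |(j : ℝ) - L|)) :=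
        Finset.sum_le_sum_of_subset_of_nonneg (Finset.range_mono (by omega))
          fun _ _ _ ↦ (Real.exp_pos _).le
    _ = ∑ j ∈ Finset.range (m + 1), Real.exp (-(δ * |(j : ℝ) - L|)) +
        ∑ j ∈ Finset.range N, Real.exp (-(δ * |((m + 1 + j : ℕ) : ℝ) - L|)) := by
        rw [Finset.sum_range_add]
    _ ≤ ∑ j ∈ Finset.range (m + 1), r ^ (m - j) + ∑ j ∈ Finset.range N, r ^ j := by
        refine add_le_add (Finset.sum_le_sum fun j hj ↦ hpow ?_) (Finset.sum_le_sum fun j _ ↦ hpow ?_)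
        · have hjm : j ≤ m := Nat.lt_succ_iff.1 (Finset.mem_range.1 hj)
          rw [abs_sub_comm, Nat.cast_sub hjm]
          exact (by linarith : (m : ℝ) - j ≤ L - j).trans (le_abs_self _)
        · push_cast
          exact (by linarith : (j : ℝ) ≤ m + 1 + j - L).trans (le_abs_self _)
    _ ≤ 2 / δ + 2 / δ := by
        refine add_le_add ?_ (hgeom N)
        have h := Finset.sum_range_reflect (fun i ↦ r ^ i) (m + 1)
        simp only [Nat.add_sub_cancel] at h
        rw [h]
        exact hgeom _
    _ = 4 / δ := by ring

/-- On the block of `n` with `⌊log n⌋ = j` the weight has total mass at most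
`exp (j + 1 - j ^ 2 / (2 * L))`. -/
theorem sum_om_block_le {L : ℝ} (hL : 0 < L) (X j : ℕ) :
    ∑ n ∈ Finset.Icc 1 X with ⌊Real.log (n : ℕ)⌋₊ = j, om L n ≤
      Real.exp (j + 1) * Real.exp (-(j : ℝ) ^ 2 / (2 * L)) := by
  have hcard : (((Finset.Icc 1 X).filter fun n : ℕ ↦ ⌊Real.log n⌋₊ = j).card : ℝ) ≤
      Real.exp (j + 1) := by
    have hsub : ((Finset.Icc 1 X).filter fun n : ℕ ↦ ⌊Real.log n⌋₊ = j) ⊆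
        Finset.Icc 1 ⌊Real.exp (j + 1)⌋₊ := by
      intro n hn
      obtain ⟨hn, hj⟩ := Finset.mem_filter.1 hn
      have hn1 := (Finset.mem_Icc.1 hn).1
      have hlog := Nat.lt_floor_add_one (Real.log n)
      rw [hj] at hlog
      refine Finset.mem_Icc.2 ⟨hn1, Nat.le_floor ?_⟩
      exact ((Real.log_lt_iff_lt_exp (by exact_mod_cast hn1)).1 hlog).le
    have h := Finset.card_le_card hsub
    rw [Nat.card_Icc, Nat.add_sub_cancel] at h
    exact (Nat.cast_le.2 h).trans (Nat.floor_le (Real.exp_pos _).le)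
  calc _ ≤ ∑ n ∈ Finset.Icc 1 X with ⌊Real.log (n : ℕ)⌋₊ = j, Real.exp (-(j : ℝ) ^ 2 / (2 * L)) := by
        refine Finset.sum_le_sum fun n hn ↦ ?_
        obtain ⟨hn, hj⟩ := Finset.mem_filter.1 hn
        have h0 : 0 ≤ Real.log n := Real.log_natCast_nonneg n
        have h1 := Nat.floor_le h0
        rw [hj] at h1
        rw [om, Real.exp_le_exp, neg_div, neg_div, neg_le_neg_iff]
        gcongr
    _ ≤ _ := by
        rw [Finset.sum_const, nsmul_eq_mul]
        exact mul_le_mul_of_nonneg_right hcard (Real.exp_pos _).le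

theorem omTotal_le {L : ℝ} (hL : 1 ≤ L) : omTotal L ≤ 20 * (√L * Real.exp (L / 2)) := by
  have hL0 : 0 < L := by linarith
  set s := √L with hs
  have hs2 : s ^ 2 = L := Real.sq_sqrt hL0.le
  have hs1 : 1 ≤ s := Real.one_le_sqrt.2 hL
  have hs0 : 0 < s := by linarith
  set N := ⌊Real.log (cut L)⌋₊ + 1 with hN
  have hsplit : omTotal L = 1 + ∑ n ∈ Finset.Icc 1 (cut L), om L n := by
    rw [omTotal, Finset.range_eq_Ico, Finset.sum_eq_sum_Ico_succ_bot (Nat.succ_pos _), om_zero]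
    rfl
  have hexp : ∀ j : ℕ, Real.exp (j + 1) * Real.exp (-(j : ℝ) ^ 2 / (2 * L)) ≤
      Real.exp (3 / 2) * Real.exp (L / 2) * Real.exp (-(s⁻¹ * |(j : ℝ) - L|)) := by
    intro j
    rw [← Real.exp_add, ← Real.exp_add, ← Real.exp_add, Real.exp_le_exp]
    have h1 : (j : ℝ) - j ^ 2 / (2 * L) = L / 2 - (j - L) ^ 2 / (2 * L) := by
      field_simp
      ring
    have h2 : 0 ≤ (s⁻¹ * |(j : ℝ) - L| - 1) ^ 2 := sq_nonneg _
    have h3 : (s⁻¹ * |(j : ℝ) - L|) ^ 2 = (j - L) ^ 2 / L := by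
      rw [mul_pow, sq_abs, inv_pow, hs2]; ring
    have h4 : ((j : ℝ) - L) ^ 2 / (2 * L) = (j - L) ^ 2 / L / 2 := by field_simp
    rw [neg_div]
    nlinarith
  have hmain : ∑ n ∈ Finset.Icc 1 (cut L), om L n ≤
      Real.exp (3 / 2) * Real.exp (L / 2) * (4 * s) := by
    calc ∑ n ∈ Finset.Icc 1 (cut L), om L n
        = ∑ j ∈ Finset.range N, ∑ n ∈ Finset.Icc 1 (cut L) with ⌊Real.log (n : ℕ)⌋₊ = j, om L n := by
          refine (Finset.sum_fiberwise_of_maps_to (fun n hn ↦ ?_) _).symm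
          have hn' := Finset.mem_Icc.1 hn
          exact Finset.mem_range.2 (Nat.lt_succ_of_le
            (Nat.floor_le_floor (log_natCast_mono hn'.2)))
      _ ≤ ∑ j ∈ Finset.range N,
          Real.exp (3 / 2) * Real.exp (L / 2) * Real.exp (-(s⁻¹ * |(j : ℝ) - L|)) :=
          Finset.sum_le_sum fun j _ ↦ (sum_om_block_le hL0 _ j).trans (hexp j)
      _ ≤ Real.exp (3 / 2) * Real.exp (L / 2) * (4 / s⁻¹) := by
          rw [← Finset.mul_sum]
          exact mul_le_mul_of_nonneg_left
            (sum_range_exp_neg_abs_le hL0.le (by positivity) (inv_le_one_of_one_le₀ hs1) N)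
            (by positivity)
      _ = _ := by rw [div_inv_eq_mul]
  have h32 : Real.exp (3 / 2) ≤ 4.7 := by
    have h2 : Real.exp (3 / 2) ^ 2 = Real.exp 1 ^ 3 := by
      rw [← Real.exp_nat_mul, ← Real.exp_nat_mul]; norm_num
    have h3 := Real.exp_one_lt_d9
    have h4 : Real.exp 1 ^ 3 ≤ 2.75 ^ 3 :=
      pow_le_pow_left₀ (Real.exp_pos _).le (by linarith) 3
    nlinarith [Real.exp_pos (3 / 2)]
  have hone : 1 ≤ s * Real.exp (L / 2) := by
    nlinarith [Real.one_le_exp (by linarith : 0 ≤ L / 2)]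
  rw [hsplit]
  have : Real.exp (3 / 2) * Real.exp (L / 2) * (4 * s) ≤ 4.7 * (4 * (s * Real.exp (L / 2))) := by
    calc _ = Real.exp (3 / 2) * (4 * (s * Real.exp (L / 2))) := by ring
      _ ≤ _ := mul_le_mul_of_nonneg_right h32 (by positivity)
  linarith

theorem eventually_half_le_theta : ∀ᶠ x : ℝ in Filter.atTop, x / 2 ≤ Chebyshev.theta x := by
  have hlog := (isLittleO_log_rpow_atTop (by norm_num : (0 : ℝ) < 1 / 2)).bound
    (by norm_num : (0 : ℝ) < 1 / 100)
  filter_upwards [hlog, Filter.eventually_ge_atTop 100] with x hx h100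
  have h := Chebyshev.theta_ge' (by linarith : (1 : ℝ) ≤ x)
  rw [← Real.sqrt_eq_rpow, Real.norm_of_nonneg (Real.log_nonneg (by linarith)),
    Real.norm_of_nonneg (Real.sqrt_nonneg x)] at hx
  have hs : √x ^ 2 = x := Real.sq_sqrt (by linarith)
  have hs0 : 10 ≤ √x := Real.le_sqrt_of_sq_le (by linarith)
  have h2 : Real.log (x + 2) ≤ 2 * Real.log x := by
    rw [← Real.log_rpow (by linarith), Real.rpow_two]
    exact Real.log_le_log (by linarith) (by nlinarith)
  have hl2 := Real.log_two_gt_d9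
  have hl2' := Real.log_two_lt_d9
  have h4 : 0.69 * (x - 1) ≤ (x - 1) * Real.log 2 := by nlinarith
  nlinarith

theorem theta_block_ge : ∀ᶠ u : ℝ in Filter.atTop, Real.exp u ≤
    ∑ n ∈ Finset.Ioc ⌊Real.exp u⌋₊ ⌊Real.exp (u + 3)⌋₊ with n.Prime, Real.log n := by
  have hu : Filter.Tendsto (fun u : ℝ ↦ Real.exp (u + 3)) Filter.atTop Filter.atTop :=
    Real.tendsto_exp_atTop.comp (Filter.tendsto_atTop_add_const_right _ _ Filter.tendsto_id)
  filter_upwards [hu.eventually eventually_half_le_theta] with u h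
  have hle : ⌊Real.exp u⌋₊ ≤ ⌊Real.exp (u + 3)⌋₊ :=
    Nat.floor_le_floor (Real.exp_le_exp.2 (by linarith))
  have hsum : Chebyshev.theta (Real.exp u) +
      ∑ n ∈ Finset.Ioc ⌊Real.exp u⌋₊ ⌊Real.exp (u + 3)⌋₊ with n.Prime, Real.log n =
      Chebyshev.theta (Real.exp (u + 3)) := by
    simp only [Chebyshev.theta, Finset.sum_filter]
    exact Finset.sum_Ioc_consecutive _ (Nat.zero_le _) hle
  have hup := Chebyshev.theta_le_log4_mul_x (Real.exp_pos u).le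
  have hl4 : Real.log 4 ≤ 1.4 := by
    rw [show (4 : ℝ) = 2 ^ 2 by norm_num, Real.log_pow]
    push_cast
    linarith [Real.log_two_lt_d9]
  have he : 8 * Real.exp u ≤ Real.exp (u + 3) := by
    rw [Real.exp_add, mul_comm]
    refine mul_le_mul_of_nonneg_left ?_ (Real.exp_pos u).le
    have h2 : (2 : ℝ) ≤ Real.exp 1 := by linarith [Real.exp_one_gt_d9]
    calc (8 : ℝ) = 2 ^ 3 := by norm_num
      _ ≤ Real.exp 1 ^ 3 := pow_le_pow_left₀ (by norm_num) h2 3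
      _ = Real.exp 3 := by rw [← Real.exp_nat_mul]; norm_num
  nlinarith [Real.exp_pos u]

theorem eventually_le_primeTotal : ∀ᶠ L : ℝ in Filter.atTop, ∀ Q : ℕ, (Q : ℝ) ≤ Real.exp (L / 40) →
    1 / 120 * (√L * Real.exp (L / 2)) ≤ primeTotal L Q := by
  obtain ⟨u₀, hu₀⟩ := Filter.eventually_atTop.1 theta_block_ge
  filter_upwards [Filter.eventually_ge_atTop (u₀ + 3), Filter.eventually_ge_atTop 4] with L hLu hL4 Q hQ
  have hL0 : 0 < L := by linarith
  set s := √L with hs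
  have hs2 : s ^ 2 = L := Real.sq_sqrt hL0.le
  have hs1 : 1 ≤ s := Real.one_le_sqrt.2 (by linarith)
  set b : ℕ → ℕ := fun i ↦ ⌊Real.exp (L - 3 + 3 * i)⌋₊ with hb
  have hbmono : Monotone b := fun i j hij ↦ Nat.floor_le_floor (Real.exp_le_exp.2 (by
    have : (i : ℝ) ≤ j := by exact_mod_cast hij
    linarith))
  set F : ℕ → ℝ := fun n ↦ if n.Prime then Real.log n * om L n else 0 with hF
  have hF0 : ∀ n, 0 ≤ F n := fun n ↦ by
    simp only [hF]
    split_ifs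
    exacts [mul_nonneg (Real.log_natCast_nonneg n) (om_pos L n).le, le_rfl]
  have hblock : ∀ i : ℕ, 3 * (i : ℝ) ≤ s →
      1 / 40 * Real.exp (L / 2) ≤ ∑ n ∈ Finset.Ioc (b i) (b (i + 1)), F n := by
    intro i hi
    have hi0 : (0 : ℝ) ≤ 3 * i := by positivity
    have h1 := hu₀ (L - 3 + 3 * i) (by linarith)
    have hbs : ⌊Real.exp (L - 3 + 3 * i + 3)⌋₊ = b (i + 1) := by
      simp only [hb]; push_cast; ring_nf
    rw [hbs, Finset.sum_filter] at h1
    have hom : ∀ n ∈ Finset.Ioc (b i) (b (i + 1)),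
        Real.exp (-(L + 3 * i) ^ 2 / (2 * L)) * (if n.Prime then Real.log n else 0) ≤ F n := by
      intro n hn
      obtain ⟨hn1, hn2⟩ := Finset.mem_Ioc.1 hn
      simp only [hF]
      split_ifs
      · rw [mul_comm]
        refine mul_le_mul_of_nonneg_left ?_ (Real.log_natCast_nonneg n)
        have hn0 : (0 : ℝ) < n := by exact_mod_cast (Nat.zero_le _).trans_lt hn1
        have hlog : Real.log n ≤ L + 3 * i := by
          rw [Real.log_le_iff_le_exp hn0]
          have := (Nat.cast_le (α := ℝ)).2 hn2
          refine this.trans ((Nat.floor_le (Real.exp_pos _).le).trans_eq ?_)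
          push_cast; ring_nf
        have := Real.log_natCast_nonneg n
        rw [om, Real.exp_le_exp, neg_div, neg_div, neg_le_neg_iff]
        gcongr
      · simp
    calc 1 / 40 * Real.exp (L / 2)
        ≤ Real.exp (-(L + 3 * i) ^ 2 / (2 * L)) * Real.exp (L - 3 + 3 * i) := by
          have hx : -(L + 3 * i) ^ 2 / (2 * L) + (L - 3 + 3 * i) =
              L / 2 - 3 - (3 * (i : ℝ)) ^ 2 / (2 * L) := by
            field_simp
            ring
          have hy : (3 * (i : ℝ)) ^ 2 / (2 * L) ≤ 1 / 2 := by
            rw [div_le_div_iff₀ (by positivity) (by norm_num)]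
            nlinarith
          have hz : Real.exp (7 / 2) ≤ 40 := by
            have h2 : Real.exp (7 / 2) ^ 2 = Real.exp 1 ^ 7 := by
              rw [← Real.exp_nat_mul, ← Real.exp_nat_mul]; norm_num
            have h3 := Real.exp_one_lt_d9
            have h4 : Real.exp 1 ^ 7 ≤ 2.75 ^ 7 :=
              pow_le_pow_left₀ (Real.exp_pos _).le (by linarith) 7
            nlinarith [Real.exp_pos (7 / 2)]
          rw [← Real.exp_add, hx]
          calc 1 / 40 * Real.exp (L / 2) ≤ Real.exp (-(7 / 2)) * Real.exp (L / 2) := by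
                refine mul_le_mul_of_nonneg_right ?_ (Real.exp_pos _).le
                rw [Real.exp_neg, inv_eq_one_div]
                exact one_div_le_one_div_of_le (Real.exp_pos _) hz
            _ = Real.exp (L / 2 - 7 / 2) := by rw [← Real.exp_add]; ring_nf
            _ ≤ _ := Real.exp_le_exp.2 (by linarith)
      _ ≤ Real.exp (-(L + 3 * i) ^ 2 / (2 * L)) *
          ∑ n ∈ Finset.Ioc (b i) (b (i + 1)), (if n.Prime then Real.log n else 0) :=
          mul_le_mul_of_nonneg_left h1 (Real.exp_pos _).le
      _ ≤ _ := by
          rw [Finset.mul_sum]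
          exact Finset.sum_le_sum hom
  have hsum : ∀ M : ℕ, (∀ i < M, 3 * (i : ℝ) ≤ s) →
      M * (1 / 40 * Real.exp (L / 2)) ≤ ∑ n ∈ Finset.Ioc (b 0) (b M), F n := by
    intro M
    induction M with
    | zero => intro _; simp
    | succ M ih =>
      intro h
      rw [← Finset.sum_Ioc_consecutive F (hbmono (Nat.zero_le M)) (hbmono (Nat.le_succ M))]
      have h1 := ih fun i hi ↦ h i (by omega)
      have h2 := hblock M (h M (Nat.lt_succ_self M))
      push_cast
      linarith
  set M := ⌊s / 3⌋₊ + 1 with hM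
  have hMs : s / 3 ≤ M := by rw [hM]; push_cast; exact (Nat.lt_floor_add_one _).le
  have hMle : ((M : ℕ) : ℝ) ≤ s / 3 + 1 := by
    rw [hM]; push_cast; linarith [Nat.floor_le (by linarith : 0 ≤ s / 3)]
  have h := hsum M fun i hi ↦ by
    have : (i : ℝ) + 1 ≤ M := by exact_mod_cast hi
    linarith
  have hfin : ∑ n ∈ Finset.Ioc (b 0) (b M), F n ≤ primeTotal L Q := by
    have hbM : b M ≤ cut L := Nat.floor_le_floor (Real.exp_le_exp.2 (by nlinarith))
    refine (Finset.sum_le_sum (g := fun n ↦ primeWeight Q n * om L n) fun n hn ↦ ?_).trans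
      (Finset.sum_le_sum_of_subset_of_nonneg (fun n hn ↦ ?_) fun n _ _ ↦
        mul_nonneg (primeWeight_nonneg _ _) (om_pos L n).le)
    · have hn1 := (Finset.mem_Ioc.1 hn).1
      have hQn : Q < n := by
        have h1 : Real.exp (L - 3 + 3 * (0 : ℕ)) < n := (Nat.floor_lt (Real.exp_pos _).le).1 hn1
        have h2 : Real.exp (L / 40) ≤ Real.exp (L - 3 + 3 * (0 : ℕ)) :=
          Real.exp_le_exp.2 (by push_cast; linarith)
        exact_mod_cast (hQ.trans h2).trans_lt h1
      simp only [hF, primeWeight]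
      split_ifs with h1 h2 h2
      · exact le_rfl
      · exact absurd ⟨h1, hQn⟩ h2
      · exact absurd h2.1 h1
      · simp
    · have hn' := Finset.mem_Ioc.1 hn
      exact Finset.mem_Icc.2 ⟨by omega, hn'.2.trans hbM⟩
  refine le_trans ?_ (h.trans hfin)
  calc 1 / 120 * (s * Real.exp (L / 2)) = s / 3 * (1 / 40 * Real.exp (L / 2)) := by ring
    _ ≤ _ := mul_le_mul_of_nonneg_right hMs (by positivity)

end BoundedGaps

namespace BoundedGaps

open Filter

/-! ### Comparison of the two weighted sums -/

/-- If there are no two primes above `N` at distance at most `k * W`, then at most one of the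
integers `n + m * W` carries a weight. -/
theorem sum_cutPrimeWeight_le {k W N Q : ℕ} {L : ℝ}
    (hgap : ∀ p p' : ℕ, p.Prime → p'.Prime → N < p → p < p' → k * W < p' - p)
    (hW0 : 0 < W) (hQ : N + k * W ≤ Q) (hL : 0 ≤ L) (n : ℕ) :
    ∑ m : Fin k, cutPrimeWeight L Q (n + m * W) ≤ 5 * L * om L n := by
  have hprime : ∀ m : Fin k, cutPrimeWeight L Q (n + m * W) ≠ 0 →
      (n + m * W).Prime ∧ Q < n + m * W ∧ n + m * W ≤ cut L := fun m hm ↦ by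
    have h := primeWeight_ne_zero_of_cutPrimeWeight_ne_zero hm
    refine ⟨?_, lt_of_primeWeight_ne_zero h, ?_⟩
    · unfold primeWeight at h
      split_ifs at h with h'
      · exact h'.1
      · exact absurd rfl h
    · by_contra h'
      exact hm (if_neg h')
  have hmW : ∀ m : Fin k, (m : ℕ) * W ≤ k * W := fun m ↦ Nat.mul_le_mul_right _ m.2.le
  have hno : ∀ i j : Fin k, i < j → cutPrimeWeight L Q (n + i * W) ≠ 0 →
      cutPrimeWeight L Q (n + j * W) ≠ 0 → False := fun i j hij hi hj ↦ by
    have hlt : (i : ℕ) * W < j * W := Nat.mul_lt_mul_of_pos_right hij hW0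
    have h1 := hprime i hi
    have h2 := hprime j hj
    have h3 := hgap _ _ h1.1 h2.1 (by omega) (by omega)
    have := hmW j
    omega
  by_cases h : ∃ m : Fin k, cutPrimeWeight L Q (n + m * W) ≠ 0
  · obtain ⟨m, hm⟩ := h
    rw [Finset.sum_eq_single m ?_ (fun h ↦ absurd (Finset.mem_univ m) h)]
    · obtain ⟨-, hQn, hcut⟩ := hprime m hm
      have h0 : 0 < n + m * W := by omega
      have hlog : Real.log ((n + m * W : ℕ) : ℝ) ≤ 5 * L :=
        (log_natCast_mono hcut).trans (log_cut_le hL)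
      have hpw : primeWeight Q (n + m * W) ≤ 5 * L := by
        unfold primeWeight
        split_ifs
        · exact hlog
        · linarith
      rw [cutPrimeWeight, if_pos hcut]
      refine mul_le_mul hpw ?_ (om_pos L _).le (by linarith)
      rcases hL.eq_or_lt with rfl | hL'
      · simp [om]
      · exact om_antitone hL' (Nat.le_add_right _ _)
    · intro j _ hj
      by_contra hj0
      rcases lt_or_gt_of_ne hj with hlt | hlt
      · exact hno j m hlt hj0 hm
      · exact hno m j hlt hm hj0
  · push Not at h
    rw [Finset.sum_eq_zero fun m _ ↦ h m]
    exact mul_nonneg (by linarith) (om_pos L n).le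

/-- With sufficiently many steps in the staircase, the primes outweigh all integers. -/
theorem prime_mass_gt {k W J : ℕ} {L t α Ψ Ω E V c : ℝ} (hk : 1 ≤ k) (hW : 0 < W)
    (hJ : 10 ^ 14 ≤ J) (hL : 1 ≤ L) (hkt : L / 100 = 768 * k * (J + 1) * t)
    (ht : 4 ≤ density W * t) (hα : 1 / 4 * density W * t ≤ α) (hα' : α ≤ 144 * density W * t)
    (hΨ : 1 / 120 * (√L * Real.exp (L / 2)) ≤ Ψ) (hΩ : Ω ≤ 20 * (√L * Real.exp (L / 2)))
    (hE : c * E * (5 * W) ≤ Real.exp (L / 2)) (hV : V ≤ Real.exp (L / 2))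
    (hc0 : 0 ≤ c) (hc : k * c * W ≤ L) :
    5 * L * (Ω / W * (2 * α ^ k) + c * E) <
      k * (Ψ / W.totient * (1 / 2 * (1 / 4 * density W * (J + 1) * t) ^ 2 * α ^ (k - 1)) - c * V) := by
  set κ := density W with hκdef
  have hκ : 0 < κ := density_pos hW
  have hW0 : (0 : ℝ) < W := by exact_mod_cast hW
  have hk0 : (1 : ℝ) ≤ k := by exact_mod_cast hk
  have hJ0 : (10 : ℝ) ^ 14 ≤ J := by exact_mod_cast hJ
  have hφ : (W.totient : ℝ) = κ * W := by rw [hκdef, density]; field_simp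
  set G := √L * Real.exp (L / 2) with hG
  have hexp := Real.exp_pos (L / 2)
  have hs : 1 ≤ √L := Real.one_le_sqrt.2 hL
  have hGe : Real.exp (L / 2) ≤ G := le_mul_of_one_le_left hexp.le hs
  have hG0 : 0 < G := hexp.trans_le hGe
  have ht0 : 0 < t := pos_of_mul_pos_right (by linarith : 0 < κ * t) hκ.le
  have hα1 : 1 ≤ α := by nlinarith
  set a := α ^ (k - 1) with ha
  have ha1 : 1 ≤ a := one_le_pow₀ hα1
  have hαk : α ^ k = α * a := by
    rw [ha, ← pow_succ', Nat.sub_add_cancel hk]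
  set A := G * (κ * t) * a / W with hA
  have hA1 : 4 * Real.exp (L / 2) / W ≤ A := by
    refine div_le_div_of_nonneg_right ?_ hW0.le
    calc 4 * Real.exp (L / 2) ≤ G * (κ * t) * 1 := by nlinarith
      _ ≤ _ := mul_le_mul_of_nonneg_left ha1 (by positivity)
  have hup : 5 * L * (Ω / W * (2 * α ^ k)) ≤ 28800 * L * A := by
    calc 5 * L * (Ω / W * (2 * α ^ k)) ≤ 5 * L * (20 * G / W * (2 * (144 * κ * t * a))) := by
          rw [hαk]; gcongr
      _ = 28800 * L * A := by rw [hA]; ring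
  have hlow : 57600 * L * A ≤
      k * (Ψ / W.totient * (1 / 2 * (1 / 4 * κ * (J + 1) * t) ^ 2 * a)) := by
    have h1 : k * (1 / 120 * G / (κ * W) * (1 / 2 * (1 / 4 * κ * (J + 1) * t) ^ 2 * a)) =
        A * (J + 1) * (768 * k * (J + 1) * t) / 2949120 := by
      rw [hA]; field_simp; norm_num
    rw [← hkt] at h1
    have h2 : 57600 * L * A ≤ A * (J + 1) * (L / 100) / 2949120 := by
      have : 0 ≤ A * L := by positivity
      nlinarith
    rw [hφ]
    refine (h2.trans h1.ge).trans ?_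
    gcongr
  have herr1 : 5 * L * (c * E) ≤ L * (Real.exp (L / 2) / W) := by
    have : c * E * 5 ≤ Real.exp (L / 2) / W := by rw [le_div_iff₀ hW0]; linarith
    nlinarith
  have herr2 : k * (c * V) ≤ L * (Real.exp (L / 2) / W) := by
    calc k * (c * V) ≤ k * (c * Real.exp (L / 2)) := by gcongr
      _ = k * c * W * (Real.exp (L / 2) / W) := by field_simp
      _ ≤ _ := by gcongr
  have hpos : 0 < L * (Real.exp (L / 2) / W) := by positivity
  have hA2 : 4 * (L * (Real.exp (L / 2) / W)) ≤ L * A := by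
    calc _ = L * (4 * Real.exp (L / 2) / W) := by ring
      _ ≤ _ := by gcongr
  have hexpand : k * (Ψ / W.totient * (1 / 2 * (1 / 4 * κ * (J + 1) * t) ^ 2 * a) - c * V) =
      k * (Ψ / W.totient * (1 / 2 * (1 / 4 * κ * (J + 1) * t) ^ 2 * a)) - k * (c * V) := by ring
  rw [hexpand]
  linarith

theorem eventually_sieveError_le (c w : ℝ) (hc : 0 ≤ c) (hw : 0 ≤ w) (K : ℕ) :
    ∀ᶠ L : ℝ in atTop, c * ((⌈Real.exp (L / 50)⌉₊ : ℝ) *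
      (1 + Real.log ⌈Real.exp (L / 50)⌉₊) ^ K) * w ≤ Real.exp (L / 2) := by
  filter_upwards [eventually_const_mul_rpow_mul_exp_le (c * w * (2 * 2 ^ K)) K
    (b := 12 / 25) (ε := 1) (by norm_num) one_pos, eventually_ge_atTop 2] with L h hL
  have hY : (⌈Real.exp (L / 50)⌉₊ : ℝ) ≤ 2 * Real.exp (L / 50) := by
    have := Nat.ceil_lt_add_one (Real.exp_pos (L / 50)).le
    linarith [Real.one_le_exp (by linarith : 0 ≤ L / 50)]
  have hY0 : (0 : ℝ) < ⌈Real.exp (L / 50)⌉₊ := by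
    exact_mod_cast Nat.ceil_pos.2 (Real.exp_pos _)
  have hlog0 : 0 ≤ Real.log ⌈Real.exp (L / 50)⌉₊ := Real.log_natCast_nonneg _
  have hlog : 1 + Real.log ⌈Real.exp (L / 50)⌉₊ ≤ 2 * L := by
    have h1 := Real.log_le_log hY0 hY
    rw [Real.log_mul two_ne_zero (Real.exp_ne_zero _), Real.log_exp] at h1
    linarith [Real.log_two_lt_d9]
  calc c * ((⌈Real.exp (L / 50)⌉₊ : ℝ) * (1 + Real.log ⌈Real.exp (L / 50)⌉₊) ^ K) * w
      ≤ c * (2 * Real.exp (L / 50) * (2 * L) ^ K) * w := by gcongr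
    _ = c * w * (2 * 2 ^ K) * (L ^ (K : ℝ) * Real.exp (-(12 / 25) * L)) * Real.exp (L / 2) := by
        rw [Real.rpow_natCast, mul_pow,
          show L / 50 = -(12 / 25) * L + L / 2 by ring, Real.exp_add]
        ring
    _ ≤ 1 * Real.exp (L / 2) := by gcongr
    _ = _ := one_mul _

theorem eventually_scale_le (W M : ℕ) : ∀ᶠ L : ℝ in atTop,
    W * ⌈Real.exp (L / 50)⌉₊ ≤ ⌊Real.exp (L / 40)⌋₊ ∧ M ≤ ⌊Real.exp (L / 40)⌋₊ := by
  have htend : Tendsto (fun L : ℝ ↦ Real.exp (L / 40)) atTop atTop :=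
    Real.tendsto_exp_atTop.comp (tendsto_id.atTop_div_const (by norm_num))
  filter_upwards [eventually_const_mul_rpow_mul_exp_le (2 * W) 0 (b := 1 / 200) (ε := 1)
    (by norm_num) one_pos, eventually_ge_atTop 0, htend.eventually_ge_atTop (M : ℝ)] with L h hL hM
  refine ⟨Nat.le_floor ?_, Nat.le_floor hM⟩
  have hY : (⌈Real.exp (L / 50)⌉₊ : ℝ) ≤ 2 * Real.exp (L / 50) := by
    have := Nat.ceil_lt_add_one (Real.exp_pos (L / 50)).le
    linarith [Real.one_le_exp (by linarith : 0 ≤ L / 50)]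
  rw [Real.rpow_zero, one_mul] at h
  push_cast
  calc (W : ℝ) * ⌈Real.exp (L / 50)⌉₊ ≤ W * (2 * Real.exp (L / 50)) := by gcongr
    _ = 2 * W * Real.exp (-(1 / 200) * L) * Real.exp (L / 40) := by
        rw [show L / 50 = -(1 / 200) * L + L / 40 by ring, Real.exp_add]
        ring
    _ ≤ 1 * Real.exp (L / 40) := by gcongr
    _ = _ := one_mul _

theorem exists_primes_of_staircase {J k W : ℕ} (hJ : 10 ^ 14 ≤ J) (hk : k = 2 ^ J)
    (hW : W = primorial (448 * k ^ 2)) (N : ℕ) :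
    ∃ p p' : ℕ, p.Prime ∧ p'.Prime ∧ N < p ∧ p < p' ∧ p' - p ≤ k * W := by
  by_contra hcon
  have hgap : ∀ p p' : ℕ, p.Prime → p'.Prime → N < p → p < p' → k * W < p' - p := by
    intro p p' hp hp' hN hlt
    by_contra hle
    exact hcon ⟨p, p', hp, hp', hN, hlt, not_lt.1 hle⟩
  have hk1 : 1 ≤ k := hk ▸ Nat.one_le_two_pow
  have hWs : Squarefree W := hW ▸ squarefree_primorial _
  have hW0 : 0 < W := Nat.pos_of_ne_zero hWs.ne_zero
  have hκ := density_pos hW0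
  set c : ℝ := ((2 : ℝ) ^ k) ^ 2 with hc
  set K := 4 * (k + 1) ^ 2 with hK
  set T : ℝ := 76800 * k * (J + 1) with hT
  have hk0 : (0 : ℝ) < k := by exact_mod_cast hk1
  have hT0 : 0 < T := by positivity
  obtain ⟨B, hB, hbv⟩ := exists_eventually_bvSum_le (K := K) (Nat.one_le_iff_ne_zero.2 (by positivity))
  obtain ⟨L₀, hL₀⟩ := eventually_atTop.1 <| hbv.and <| eventually_le_primeTotal.and <|
    (eventually_sieveError_le c (5 * W) (by positivity) (by positivity) K).and <|
    (eventually_scale_le W (N + k * W)).and <|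
    (eventually_ge_atTop (T * (2 * W * (W + 2)))).and <|
    (eventually_ge_atTop (T * (4 / density W))).and <|
    (eventually_ge_atTop (k * c * W)).and (eventually_ge_atTop 1)
  obtain ⟨L, hLL, hgood⟩ := exists_goodScale hB L₀
  obtain ⟨hV, hΨ, hE, ⟨hYQ, hNQ⟩, ht1, ht2, hkc, hL1⟩ := hL₀ L hLL
  have hL0 : 0 < L := by linarith
  set Q := ⌊Real.exp (L / 40)⌋₊ with hQ
  set Y := ⌈Real.exp (L / 50)⌉₊ with hY
  set D := L / 100 with hD
  set R := ⌈Real.exp D⌉₊ with hR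
  set t := L / T with ht
  have hQL : (Q : ℝ) ≤ Real.exp (L / 40) := Nat.floor_le (Real.exp_pos _).le
  have hDY : Real.exp (2 * D) ≤ Y := by
    rw [show 2 * D = L / 50 by rw [hD]; ring]
    exact Nat.le_ceil _
  let P : Finset ℕ := (Finset.range (R + 1)).filter fun q ↦ q.Prime ∧ ¬ q ∣ W
  let pr : P → ℕ := Subtype.val
  have hmem : ∀ p : P, (pr p).Prime ∧ ¬ pr p ∣ W := fun p ↦ (Finset.mem_filter.1 p.2).2
  have hpr : ∀ p, (pr p).Prime := fun p ↦ (hmem p).1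
  have hprW : ∀ p, ¬ pr p ∣ W := fun p ↦ (hmem p).2
  have hinj : Function.Injective pr := Subtype.val_injective
  have hlarge : ∀ p, 448 * k ^ 2 ≤ pr p := fun p ↦ by
    by_contra h
    exact hprW p (hW ▸ (hpr p).dvd_primorial_iff.2 (by omega))
  have hkp : ∀ p, k ≤ pr p := fun p ↦ le_trans (by nlinarith) (hlarge p)
  have hsurj : ∀ q : ℕ, q.Prime → ¬ q ∣ W → q ≤ R → ∃ p, pr p = q := fun q hq hqW hqR ↦
    ⟨⟨q, Finset.mem_filter.2 ⟨Finset.mem_range.2 (by omega), hq, hqW⟩⟩, rfl⟩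
  have hDt : D = 768 * k * (J + 1) * t := by
    rw [ht, hT, hD]
    field_simp
    norm_num
  have htW : 2 * W * (W + 2) ≤ t := by rw [ht, le_div_iff₀ hT0]; linarith
  have htκ : 4 ≤ density W * t := by
    rw [← div_le_iff₀' hκ, ht, le_div_iff₀ hT0]
    linarith
  obtain ⟨α, hα, hα', hupper, hlower⟩ := exists_gramForm_bounds hpr hinj hW0 hprW hsurj hk hlarge
    (Nat.le_ceil (Real.exp D)) hDt htW
  set g := stairs (fun p ↦ Real.log (pr p)) J t with hg
  have hg0 : ∀ S, 0 ≤ g S := stairs_nonneg _ J t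
  have hg2 : ∀ S, g S ≤ 2 := stairs_le_two _ J t
  have hS1 := sum_om_mul_sieveSq_le hL0 hpr hinj hW0 hprW hkp hg0 hg2 hDY
  have hS2 := le_sum_cutPrimeWeight_mul_sieveSq (L := L) hpr hinj hWs hprW hkp hg0 hg2 hDY hYQ
    (le_trans (Nat.le_add_left _ _) hNQ)
  have hΨQ := hΨ Q hQL
  have hΨ0 : 0 ≤ primeTotal L Q := le_trans (by positivity) hΨQ
  have hΩ0 : 0 ≤ omTotal L := Finset.sum_nonneg fun n _ ↦ (om_pos L n).le
  have hlt := prime_mass_gt hk1 hW0 hJ hL1 hDt htκ hα hα' hΨQ (omTotal_le hL1) hE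
    (hV hgood Q hQL) (by positivity) hkc
  refine hlt.not_ge ?_
  calc (k : ℝ) * (primeTotal L Q / W.totient *
          (1 / 2 * (1 / 4 * density W * (J + 1) * t) ^ 2 * α ^ (k - 1)) - c * bvSum K L Q)
      = ∑ _m : Fin k, (primeTotal L Q / W.totient *
          (1 / 2 * (1 / 4 * density W * (J + 1) * t) ^ 2 * α ^ (k - 1)) - c * bvSum K L Q) := by
        rw [Finset.sum_const, Finset.card_univ, Fintype.card_fin, nsmul_eq_mul]
    _ ≤ ∑ m : Fin k, ∑ n ∈ Finset.range (cut L + 1),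
          (if n ≡ 1 [MOD W] then cutPrimeWeight L Q (n + m * W) else 0) * sieveSq k W pr D g n := by
        refine Finset.sum_le_sum fun m _ ↦ le_trans ?_ (hS2 m)
        exact sub_le_sub_right (mul_le_mul_of_nonneg_left (hlower m) (by positivity)) _
    _ = ∑ n ∈ Finset.range (cut L + 1), (if n ≡ 1 [MOD W] then
          ∑ m : Fin k, cutPrimeWeight L Q (n + m * W) else 0) * sieveSq k W pr D g n := by
        rw [Finset.sum_comm]
        refine Finset.sum_congr rfl fun n _ ↦ ?_
        rw [← Finset.sum_mul]
        split_ifs <;> simp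
    _ ≤ ∑ n ∈ Finset.range (cut L + 1),
          5 * L * ((if n ≡ 1 [MOD W] then om L n else 0) * sieveSq k W pr D g n) := by
        refine Finset.sum_le_sum fun n _ ↦ ?_
        rw [← mul_assoc]
        refine mul_le_mul_of_nonneg_right ?_ (sieveSq_nonneg D g n)
        split_ifs
        · exact sum_cutPrimeWeight_le hgap hW0 hNQ hL0.le n
        · simp
    _ ≤ 5 * L * (omTotal L / W * (2 * α ^ k) + c * (Y * (1 + Real.log Y) ^ K)) := by
        rw [← Finset.mul_sum]
        refine mul_le_mul_of_nonneg_left (hS1.trans ?_) (by positivity)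
        exact add_le_add_left (mul_le_mul_of_nonneg_left hupper (by positivity)) _

end BoundedGaps

/-- Zhang's theorem: there exists a constant `C` such that there are infinitely many
pairs of primes `p < p'` with `p' − p ≤ C` (bounded gaps between primes). -/
theorem stmt_12 :
    ∃ C : ℕ, ∀ N : ℕ, ∃ p p' : ℕ, p.Prime ∧ p'.Prime ∧ N < p ∧ p < p' ∧ p' - p ≤ C := by
  obtain ⟨J, hJ⟩ : ∃ J : ℕ, 10 ^ 14 ≤ J := ⟨_, le_rfl⟩
  obtain ⟨k, hk⟩ : ∃ k : ℕ, k = 2 ^ J := ⟨_, rfl⟩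
  exact ⟨k * primorial (448 * k ^ 2), BoundedGaps.exists_primes_of_staircase hJ hk rfl⟩
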